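/- Let n = 2 and let Ω = B₁(0) ⊂ ℝ² be the open unit disk. Let η : closure(Ω) → ℝ be continuous and positive, and smooth on Ω, and let φ : ∂Ω → ℝ be Lipschitz continuous. Then there exists exactly one function v : closure(Ω) → ℝ such that: v is continuous on closure(Ω); v is smooth and strictly convex on Ω; det D²v(y) = 1/(η(y)·(1 − |y|²)²) for all y ∈ Ω; v = φ on ∂Ω; and the gradient image ∇v(Ω) equals all of ℝ². -/

import Mathlib

open Real Filter

/-- `IsMinkowskiSolution2 Ω η φ v` : `v` is continuous on `closure Ω`, smooth and
strictly convex on `Ω`, solves the Monge–Ampère equation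
`det D²v = 1/(η (1 - |y|²)²)` in `Ω ⊆ ℝ²` (here `det D²v` is the determinant of
the derivative of the gradient map), equals `φ` on `∂Ω`, and its gradient image
`∇v(Ω)` is all of `ℝ²`. -/
def IsMinkowskiSolution2 (Ω : Set (EuclideanSpace ℝ (Fin 2)))
    (η φ v : EuclideanSpace ℝ (Fin 2) → ℝ) : Prop :=
  ContinuousOn v (closure Ω) ∧
  ContDiffOn ℝ (⊤ : ℕ∞) v Ω ∧
  StrictConvexOn ℝ Ω v ∧
  (∀ y ∈ Ω, (fderiv ℝ (gradient v) y).det = 1 / (η y * (1 - ‖y‖ ^ 2) ^ 2)) ∧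
  (∀ y ∈ frontier Ω, v y = φ y) ∧
  gradient v '' Ω = Set.univ

namespace MA
open MeasureTheory Metric Set Topology
open scoped ContDiff Convolution

section

/-- The operator `∂ₚ + i ∂_y` in the coordinates `z = p + i y`. -/
noncomputable def dbar (f : ℂ → ℂ) (z : ℂ) : ℂ :=
  fderiv ℝ f z 1 + Complex.I * fderiv ℝ f z Complex.I

/-- The Cauchy transform, normalised to invert `dbar`. -/
noncomputable def cauchyT (k : ℂ → ℂ) (z : ℂ) : ℂ :=
  (2 * π : ℂ)⁻¹ * ∫ w : ℂ, w⁻¹ * k (z - w)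

lemma integrableOn_norm_inv (R : ℝ) :
    IntegrableOn (fun w : ℂ => ‖w‖⁻¹) (ball 0 R) := by
  refine (integrableOn_fun_norm_addHaar (μ := (volume : Measure ℂ)) (f := fun t : ℝ => t⁻¹)).2 ?_
  have : IntegrableOn (fun _ : ℝ => (1 : ℝ)) (Ioo 0 R) := by simp
  refine this.congr_fun (fun x hx => ?_) measurableSet_Ioo
  have := hx.1.ne'
  simp [Complex.finrank_real_complex, this]

lemma setIntegral_norm_inv {R : ℝ} (hR : 0 ≤ R) :
    ∫ w in ball (0 : ℂ) R, ‖w‖⁻¹ = 2 * π * R := by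
  have h1 : ∫ w in ball (0 : ℂ) R, ‖w‖⁻¹ =
      ∫ w : ℂ, (Iio R).indicator (fun t : ℝ => t⁻¹) ‖w‖ := by
    rw [← integral_indicator measurableSet_ball]
    refine integral_congr_ae (Eventually.of_forall fun x => ?_)
    simp [indicator]
  rw [h1, integral_fun_norm_addHaar]
  have h2 : ∫ y in Ioi (0 : ℝ), y ^ (Module.finrank ℝ ℂ - 1) •
      (Iio R).indicator (fun t : ℝ => t⁻¹) y = ∫ y in Ioi (0 : ℝ), (Ioo 0 R).indicator 1 y := by
    refine setIntegral_congr_fun measurableSet_Ioi fun x hx => ?_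
    have hx' : 0 < x := hx
    by_cases h : x < R <;> simp [indicator, h, hx', hx'.ne', Complex.finrank_real_complex]
  rw [h2, setIntegral_indicator measurableSet_Ioo]
  have h3 : Ioi (0 : ℝ) ∩ Ioo 0 R = Ioo 0 R := by
    ext x; simp +contextual
  rw [h3]
  simp [Complex.finrank_real_complex, Measure.real, Complex.volume_ball, hR]
  ring

lemma locallyIntegrable_inv : LocallyIntegrable (fun w : ℂ => w⁻¹) := by
  intro x
  refine ⟨ball 0 (‖x‖ + 1), isOpen_ball.mem_nhds (by simp), ?_⟩
  refine (integrableOn_norm_inv (‖x‖ + 1)).mono' ?_ ?_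
  · exact (measurable_inv.aestronglyMeasurable)
  · exact Eventually.of_forall fun w => by simp

lemma cauchyT_eq_convolution (k : ℂ → ℂ) :
    cauchyT k = fun z => (2 * π : ℂ)⁻¹ *
      ((fun w : ℂ => w⁻¹) ⋆[ContinuousLinearMap.mul ℝ ℂ, volume] k) z := rfl

lemma hasFDerivAt_cauchyT {k : ℂ → ℂ} (hk : ContDiff ℝ 1 k) (hc : HasCompactSupport k) (z : ℂ) :
    HasFDerivAt (cauchyT k) ((2 * π : ℂ)⁻¹ •
      ((fun w : ℂ => w⁻¹) ⋆[(ContinuousLinearMap.mul ℝ ℂ).precompR ℂ, volume] fderiv ℝ k) z) z := by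
  rw [cauchyT_eq_convolution]
  exact (hc.hasFDerivAt_convolution_right (ContinuousLinearMap.mul ℝ ℂ)
    locallyIntegrable_inv hk z).const_mul _

lemma contDiff_cauchyT {k : ℂ → ℂ} (hk : ContDiff ℝ 1 k) (hc : HasCompactSupport k) :
    ContDiff ℝ 1 (cauchyT k) := by
  rw [cauchyT_eq_convolution]
  exact contDiff_const.mul (hc.contDiff_convolution_right (ContinuousLinearMap.mul ℝ ℂ)
    locallyIntegrable_inv hk)

lemma fderiv_cauchyT_apply {k : ℂ → ℂ} (hk : ContDiff ℝ 1 k) (hc : HasCompactSupport k) (z v : ℂ) :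
    fderiv ℝ (cauchyT k) z v = cauchyT (fun w => fderiv ℝ k w v) z := by
  rw [(hasFDerivAt_cauchyT hk hc z).fderiv]
  simp only [FunLike.coe_smul, Pi.smul_apply, smul_eq_mul, cauchyT]
  rw [convolution_precompR_apply _ locallyIntegrable_inv (hc.fderiv ℝ)
    (hk.continuous_fderiv one_ne_zero)]
  rfl

lemma integrable_cauchy_kernel {k : ℂ → ℂ} (hk : Continuous k) (hc : HasCompactSupport k) (z : ℂ) :
    Integrable (fun w : ℂ => w⁻¹ * k (z - w)) :=
  (hc.convolutionExists_right (ContinuousLinearMap.mul ℝ ℂ) locallyIntegrable_inv hk z)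

lemma dbar_cauchyT {k : ℂ → ℂ} (hk : ContDiff ℝ 1 k) (hc : HasCompactSupport k) (z : ℂ) :
    dbar (cauchyT k) z = cauchyT (dbar k) z := by
  have hcont : ∀ v : ℂ, Continuous fun w => fderiv ℝ k w v := fun v =>
    (hk.continuous_fderiv one_ne_zero).clm_apply continuous_const
  have hcs : ∀ v : ℂ, HasCompactSupport fun w => fderiv ℝ k w v := fun v => hc.fderiv_apply ℝ v
  simp only [dbar, fderiv_cauchyT_apply hk hc]
  have i1 := integrable_cauchy_kernel (hcont 1) (hcs 1) z
  have i2 := (integrable_cauchy_kernel (hcont Complex.I) (hcs Complex.I) z).const_mul Complex.I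
  simp only [cauchyT]
  rw [mul_left_comm, ← mul_add, ← integral_const_mul Complex.I, ← integral_add i1 i2]
  congr 2
  ext w
  simp only [dbar]; ring

lemma pompeiu_polar_zero {ψ : ℂ → ℂ} (hψ : ContDiff ℝ 1 ψ) (z : ℂ) {r : ℝ} (hr : r ≠ 0) :
    ∫ θ in Ioo (-π) π, fderiv ℝ ψ (z - r * Complex.exp (θ * Complex.I))
      (Complex.I * Complex.exp (θ * Complex.I)) = 0 := by
  have hd : ∀ θ : ℝ, HasDerivAt (fun θ : ℝ => ψ (z - r * Complex.exp (θ * Complex.I)))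
      (-(r : ℂ) * fderiv ℝ ψ (z - r * Complex.exp (θ * Complex.I))
      (Complex.I * Complex.exp (θ * Complex.I))) θ := by
    intro θ
    have h1 : HasDerivAt (fun θ : ℝ => z - r * Complex.exp (θ * Complex.I))
        (-(r * (Complex.exp (θ * Complex.I) * Complex.I))) θ := by
      have := (((Complex.hasDerivAt_exp (θ * Complex.I)).comp (θ : ℂ)
        ((hasDerivAt_id (θ : ℂ)).mul_const Complex.I)).comp_ofReal).const_mul (r : ℂ)
      simpa using this.const_sub z
    have h2 := ((hψ.differentiable one_ne_zero _).hasFDerivAt (x := z - r * Complex.exp (θ * Complex.I))).comp_hasDerivAt θ h1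
    refine HasDerivAt.congr_deriv h2 ?_
    have : -(↑r * (Complex.exp (↑θ * Complex.I) * Complex.I)) =
      (-r : ℝ) • (Complex.I * Complex.exp (θ * Complex.I)) := by
      rw [Complex.real_smul]; push_cast; ring
    rw [this, map_smul]
    simp
  have hcont : Continuous fun θ : ℝ => fderiv ℝ ψ (z - r * Complex.exp (θ * Complex.I))
      (Complex.I * Complex.exp (θ * Complex.I)) := by
    have := hψ.continuous_fderiv one_ne_zero
    fun_prop
  have hint : ∫ θ in (-π)..π, -(r : ℂ) * fderiv ℝ ψ (z - r * Complex.exp (θ * Complex.I))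
      (Complex.I * Complex.exp (θ * Complex.I)) = 0 := by
    rw [intervalIntegral.integral_eq_sub_of_hasDerivAt (fun θ _ => hd θ)
      ((continuous_const.mul hcont).intervalIntegrable _ _)]
    simp [Complex.exp_neg, Complex.exp_pi_mul_I]
  rw [← integral_Ioc_eq_integral_Ioo, ← intervalIntegral.integral_of_le (by linarith [pi_pos])]
  rw [intervalIntegral.integral_const_mul] at hint
  rcases mul_eq_zero.1 hint with h | h
  · exact absurd h (by simpa using hr)
  · exact h

lemma pompeiu_polar_radial {ψ : ℂ → ℂ} (hψ : ContDiff ℝ 1 ψ) (hc : HasCompactSupport ψ)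
    (z : ℂ) (θ : ℝ) :
    ∫ r in Ioi (0 : ℝ), fderiv ℝ ψ (z - r * Complex.exp (θ * Complex.I))
      (Complex.exp (θ * Complex.I)) = ψ z := by
  have hd : ∀ r : ℝ, HasDerivAt (fun r : ℝ => -ψ (z - r * Complex.exp (θ * Complex.I)))
      (fderiv ℝ ψ (z - r * Complex.exp (θ * Complex.I)) (Complex.exp (θ * Complex.I))) r := by
    intro r
    have h1 : HasDerivAt (fun r : ℝ => z - r * Complex.exp (θ * Complex.I))
        (-(Complex.exp (θ * Complex.I))) r := by
      have := ((hasDerivAt_id (r : ℂ)).comp_ofReal).mul_const (Complex.exp (θ * Complex.I))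
      simpa using this.const_sub z
    have h2 := (((hψ.differentiable one_ne_zero _).hasFDerivAt
      (x := z - r * Complex.exp (θ * Complex.I))).comp_hasDerivAt r h1).neg
    exact HasDerivAt.congr_deriv h2 (by simp)
  obtain ⟨R, hR⟩ := hc.isCompact.isBounded.subset_closedBall 0
  have hz : ∀ w : ℂ, R < ‖w‖ → ψ w = 0 := fun w hw => by
    by_contra h
    have := hR (subset_tsupport _ h)
    simp at this; linarith
  have htail : ∀ r : ℝ, R + ‖z‖ < r → R < ‖z - r * Complex.exp (θ * Complex.I)‖ := by
    intro r hr
    have h1 : ‖(r : ℂ) * Complex.exp (θ * Complex.I)‖ = |r| := by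
      simp [Complex.norm_exp_ofReal_mul_I]
    have h2 := norm_sub_norm_le ((r : ℂ) * Complex.exp (θ * Complex.I)) z
    rw [norm_sub_rev] at h2
    have := le_abs_self r
    linarith
  have hcont : Continuous fun r : ℝ => fderiv ℝ ψ (z - r * Complex.exp (θ * Complex.I))
      (Complex.exp (θ * Complex.I)) := by
    have := hψ.continuous_fderiv one_ne_zero
    fun_prop
  have hlim : Tendsto (fun r : ℝ => -ψ (z - r * Complex.exp (θ * Complex.I))) atTop (𝓝 0) := by
    refine tendsto_const_nhds.congr' ?_
    filter_upwards [eventually_gt_atTop (R + ‖z‖)] with r hr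
    rw [hz _ (htail r hr), neg_zero]
  have hint : IntegrableOn (fun r : ℝ => fderiv ℝ ψ (z - r * Complex.exp (θ * Complex.I))
      (Complex.exp (θ * Complex.I))) (Ioi 0) := by
    have h0 : ∀ r ∈ Ioi (R + ‖z‖), fderiv ℝ ψ (z - r * Complex.exp (θ * Complex.I))
      (Complex.exp (θ * Complex.I)) = 0 := by
      intro r hr
      refine (hd r).unique ?_
      have : (fun r : ℝ => -ψ (z - r * Complex.exp (θ * Complex.I))) =ᶠ[𝓝 r] fun _ => 0 := by
        filter_upwards [isOpen_Ioi.mem_nhds hr] with s hs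
        rw [hz _ (htail s hs), neg_zero]
      exact (hasDerivAt_const r (0 : ℂ)).congr_of_eventuallyEq this
    have h1 : Ioi (0 : ℝ) ⊆ Icc 0 (R + ‖z‖) ∪ Ioi (R + ‖z‖) := by
      intro x hx
      rcases le_or_gt x (R + ‖z‖) with h | h
      · exact Or.inl ⟨le_of_lt hx, h⟩
      · exact Or.inr h
    refine IntegrableOn.mono_set (IntegrableOn.union (hcont.integrableOn_Icc) ?_) h1
    exact (integrableOn_zero).congr_fun (fun r hr => (h0 r hr).symm) measurableSet_Ioi
  rw [integral_Ioi_of_hasDerivAt_of_tendsto' (fun r _ => hd r) hint hlim]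
  simp

lemma cauchyT_dbar {ψ : ℂ → ℂ} (hψ : ContDiff ℝ 1 ψ) (hc : HasCompactSupport ψ) (z : ℂ) :
    cauchyT (dbar ψ) z = ψ z := by
  have hcf := hψ.continuous_fderiv one_ne_zero
  obtain ⟨R, hR⟩ := (hc.fderiv ℝ).isCompact.isBounded.subset_closedBall 0
  have hz : ∀ w : ℂ, R < ‖w‖ → fderiv ℝ ψ w = 0 := fun w hw => by
    by_contra h
    have := hR (subset_tsupport _ h)
    simp at this; linarith
  let F : (ℂ → ℂ) → ℝ × ℝ → ℂ := fun e p =>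
    fderiv ℝ ψ (z - p.1 * Complex.exp (p.2 * Complex.I)) (e (Complex.exp (p.2 * Complex.I)))
  have hF : ∀ e : ℂ → ℂ, Continuous e → IntegrableOn (F e) (Ioi (0 : ℝ) ×ˢ Ioo (-π) π) := by
    intro e he
    have hFc : Continuous (F e) := by
      simp only [F]; fun_prop
    have : Ioi (0 : ℝ) ×ˢ Ioo (-π) π ⊆ (Icc 0 (R + ‖z‖) ×ˢ Icc (-π) π) ∪
        (Ioi (R + ‖z‖) ×ˢ univ) := by
      rintro ⟨a, b⟩ ⟨ha, hb⟩
      rcases le_or_gt a (R + ‖z‖) with h | h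
      · exact Or.inl ⟨⟨le_of_lt ha, h⟩, ⟨hb.1.le, hb.2.le⟩⟩
      · exact Or.inr ⟨h, trivial⟩
    refine IntegrableOn.mono_set (IntegrableOn.union
      (hFc.continuousOn.integrableOn_compact (isCompact_Icc.prod isCompact_Icc)) ?_) this
    refine (integrableOn_zero).congr_fun (fun p hp => ?_) (measurableSet_Ioi.prod MeasurableSet.univ)
    have hp1 : R + ‖z‖ < p.1 := hp.1
    have h1 : ‖(p.1 : ℂ) * Complex.exp (p.2 * Complex.I)‖ = |p.1| := by
      simp [Complex.norm_exp_ofReal_mul_I]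
    have h2 := norm_sub_norm_le ((p.1 : ℂ) * Complex.exp (p.2 * Complex.I)) z
    rw [norm_sub_rev] at h2
    have := le_abs_self p.1
    simp only [F]
    rw [hz _ (by linarith)]
    simp
  have key : ∫ w : ℂ, w⁻¹ * dbar ψ (z - w) = 2 * π * ψ z := by
    rw [← Complex.integral_comp_polarCoord_symm]
    have : ∀ p ∈ polarCoord.target, p.1 • ((Complex.polarCoord.symm p)⁻¹ *
        dbar ψ (z - Complex.polarCoord.symm p)) =
        F id p + Complex.I * F (fun e => Complex.I * e) p := by
      rintro ⟨r, θ⟩ hp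
      have hr : (0 : ℝ) < r := hp.1
      have hs : Complex.polarCoord.symm (r, θ) = r * Complex.exp (θ * Complex.I) := by
        rw [Complex.polarCoord_symm_apply, Complex.exp_mul_I]; simp
      rw [hs]
      simp only [F, dbar, id]
      set L := fderiv ℝ ψ (z - r * Complex.exp (θ * Complex.I))
      have e1 : Complex.exp (θ * Complex.I) =
        (Real.cos θ) • (1 : ℂ) + Real.sin θ • Complex.I := by
        rw [Complex.exp_mul_I]; simp
      have e2 : Complex.I * Complex.exp (θ * Complex.I) =
        (-Real.sin θ) • (1 : ℂ) + Real.cos θ • Complex.I := by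
        rw [Complex.exp_mul_I]; simp [mul_add]; ring_nf; simp; ring
      have e3 : L (Complex.exp (θ * Complex.I)) = Real.cos θ * L 1 + Real.sin θ * L Complex.I := by
        rw [e1, map_add, map_smul, map_smul]; simp
      have e4 : L (Complex.I * Complex.exp (θ * Complex.I)) =
          -Real.sin θ * L 1 + Real.cos θ * L Complex.I := by
        rw [e2, map_add, map_smul, map_smul]; simp
      rw [e3, e4]
      have e5 : (Complex.exp (θ * Complex.I))⁻¹ = Real.cos θ - Real.sin θ * Complex.I := by
        rw [← Complex.exp_neg, ← neg_mul, Complex.exp_mul_I]; simp; ring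
      rw [mul_inv, e5]
      have hr' : (r : ℂ) ≠ 0 := by exact_mod_cast hr.ne'
      simp only [Complex.real_smul]
      field_simp
      ring_nf
      simp only [Complex.I_sq]
      ring
    rw [setIntegral_congr_fun (by rw [polarCoord_target]; exact measurableSet_Ioi.prod measurableSet_Ioo) this]
    rw [polarCoord_target]
    have i1 := hF id continuous_id
    have i2 := (hF (fun e => Complex.I * e) (by fun_prop))
    rw [integral_add i1 (i2.const_mul _), integral_const_mul]
    have z2 : ∫ p in Ioi (0 : ℝ) ×ˢ Ioo (-π) π, F (fun e => Complex.I * e) p = 0 := by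
      rw [Measure.volume_eq_prod, setIntegral_prod _ i2]
      refine (setIntegral_congr_fun measurableSet_Ioi fun r hr => ?_).trans (integral_zero _ _)
      exact pompeiu_polar_zero hψ z (ne_of_gt hr)
    have z1 : ∫ p in Ioi (0 : ℝ) ×ˢ Ioo (-π) π, F id p = 2 * π * ψ z := by
      rw [Measure.volume_eq_prod, ← Measure.prod_restrict, integral_prod_symm]
      · have : ∀ θ : ℝ, ∫ r in Ioi (0 : ℝ), F id (r, θ) = ψ z := fun θ =>
          pompeiu_polar_radial hψ hc z θ
        simp only [this]
        have : π + π = 2 * π := by ring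
        simp [pi_pos.le, this]
      · rw [Measure.prod_restrict]; exact i1
    rw [z1, z2]; simp
  rw [cauchyT, key]
  have : (π : ℂ) ≠ 0 := by exact_mod_cast pi_ne_zero
  field_simp

lemma dbar_cauchyT_eq {k : ℂ → ℂ} (hk : ContDiff ℝ 1 k) (hc : HasCompactSupport k) (z : ℂ) :
    dbar (cauchyT k) z = k z := by
  rw [dbar_cauchyT hk hc, cauchyT_dbar hk hc]

end

section

lemma norm_cauchyT_le {k : ℂ → ℂ} {z₀ : ℂ} {r M : ℝ} (hr : 0 ≤ r)
    (hk : ∀ z, ‖k z‖ ≤ M) (hs : ∀ z, z ∉ ball z₀ r → k z = 0) {z : ℂ} (hz : z ∈ ball z₀ r) :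
    ‖cauchyT k z‖ ≤ 2 * r * M := by
  have hM : 0 ≤ M := (norm_nonneg _).trans (hk 0)
  have h1 : ‖∫ w : ℂ, w⁻¹ * k (z - w)‖ ≤
      ∫ w : ℂ, (ball (0 : ℂ) (2 * r)).indicator (fun w => M * ‖w‖⁻¹) w := by
    refine norm_integral_le_of_norm_le
      (IntegrableOn.integrable_indicator ((integrableOn_norm_inv (2 * r)).const_mul M)
        measurableSet_ball) ?_
    refine Eventually.of_forall fun w => ?_
    by_cases hw : w ∈ ball (0 : ℂ) (2 * r)
    · rw [indicator_of_mem hw, norm_mul, norm_inv, mul_comm]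
      exact mul_le_mul_of_nonneg_right (hk _) (by positivity)
    · rw [indicator_of_notMem hw, hs, mul_zero, norm_zero]
      intro h
      apply hw
      rw [mem_ball_zero_iff]
      rw [mem_ball, dist_eq_norm] at h hz
      calc ‖w‖ = ‖(z - z₀) - (z - w - z₀)‖ := by congr 1; ring
        _ ≤ ‖z - z₀‖ + ‖z - w - z₀‖ := norm_sub_le _ _
        _ < 2 * r := by linarith
  rw [integral_indicator measurableSet_ball, integral_const_mul,
    setIntegral_norm_inv (by positivity)] at h1
  rw [cauchyT, norm_mul]
  have h2 : ‖(2 * π : ℂ)⁻¹‖ = (2 * π)⁻¹ := by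
    rw [norm_inv, norm_mul]; simp [abs_of_pos pi_pos]
  rw [h2]
  calc (2 * π)⁻¹ * ‖∫ w : ℂ, w⁻¹ * k (z - w)‖ ≤ (2 * π)⁻¹ * (M * (2 * π * (2 * r))) := by gcongr
    _ = 2 * r * M := by field_simp

lemma norm_cauchyT_le_of_far {k : ℂ → ℂ} {z₀ : ℂ} {r M : ℝ} (hr : 0 < r)
    (hk : ∀ z, ‖k z‖ ≤ M) (hs : ∀ z, z ∉ ball z₀ r → k z = 0) {z : ℂ} (hz : 2 * r ≤ ‖z - z₀‖) :
    ‖cauchyT k z‖ ≤ r ^ 2 * M / ‖z - z₀‖ := by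
  have hM : 0 ≤ M := (norm_nonneg _).trans (hk 0)
  have hpos : 0 < ‖z - z₀‖ := by linarith
  have h1 : ‖∫ w : ℂ, w⁻¹ * k (z - w)‖ ≤
      ∫ w : ℂ, (ball (z - z₀) r).indicator (fun _ => M * (2 / ‖z - z₀‖)) w := by
    refine norm_integral_le_of_norm_le ?_ ?_
    · refine IntegrableOn.integrable_indicator ?_ measurableSet_ball
      exact integrableOn_const measure_ball_lt_top.ne
    refine Eventually.of_forall fun w => ?_
    by_cases hw : w ∈ ball (z - z₀) r
    · rw [indicator_of_mem hw, norm_mul, norm_inv, mul_comm]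
      have h3 : ‖z - z₀‖ / 2 ≤ ‖w‖ := by
        rw [mem_ball, dist_eq_norm] at hw
        have := norm_sub_norm_le (z - z₀) w
        rw [norm_sub_rev] at hw
        linarith
      have h4 : ‖w‖⁻¹ ≤ 2 / ‖z - z₀‖ := by
        rw [← inv_div]
        exact inv_anti₀ (by positivity) h3
      exact mul_le_mul (hk _) h4 (by positivity) hM
    · rw [indicator_of_notMem hw, hs, mul_zero, norm_zero]
      intro h
      apply hw
      rw [mem_ball, dist_eq_norm] at h ⊢
      have e : z - z₀ - w = z - w - z₀ := by ring
      rwa [norm_sub_rev, e]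
  rw [integral_indicator measurableSet_ball, setIntegral_const] at h1
  rw [cauchyT, norm_mul]
  have h2 : ‖(2 * π : ℂ)⁻¹‖ = (2 * π)⁻¹ := by
    rw [norm_inv, norm_mul]; simp [abs_of_pos pi_pos]
  have h5 : volume.real (ball (z - z₀) r) = r ^ 2 * π := by
    simp [Measure.real, Complex.volume_ball, hr.le]
  rw [h5, smul_eq_mul] at h1
  rw [h2]
  calc (2 * π)⁻¹ * ‖∫ w : ℂ, w⁻¹ * k (z - w)‖ ≤
      (2 * π)⁻¹ * (r ^ 2 * π * (M * (2 / ‖z - z₀‖))) := by gcongr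
    _ = r ^ 2 * M / ‖z - z₀‖ := by field_simp

lemma tendsto_integral_slope {a : ℂ → ℝ} {b : ℂ → ℝ} (ha : Continuous a)
    (hac : HasCompactSupport a) (hb : ContDiff ℝ 1 b) (hbc : HasCompactSupport b) (v : ℂ) :
    Tendsto (fun h : ℝ => ∫ z, a z * (h⁻¹ • (b (z + h • v) - b z))) (𝓝[≠] 0)
      (𝓝 (∫ z, a z * fderiv ℝ b z v)) := by
  obtain ⟨C, hC⟩ := hb.lipschitzWith_of_hasCompactSupport hbc one_ne_zero
  refine tendsto_integral_filter_of_dominated_convergence (fun z => ‖a z‖ * (C * ‖v‖)) ?_ ?_ ?_ ?_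
  · refine Eventually.of_forall fun h => Continuous.aestronglyMeasurable ?_
    have := hb.continuous
    fun_prop
  · refine eventually_nhdsWithin_of_forall fun h hh => Eventually.of_forall fun z => ?_
    rw [norm_mul]
    gcongr
    have h1 := hC.dist_le_mul (z + h • v) z
    rw [dist_eq_norm, dist_eq_norm, add_sub_cancel_left, norm_smul] at h1
    rw [norm_smul, norm_inv, inv_mul_le_iff₀ (by simpa using hh)]
    linarith
  · exact ((ha.integrable_of_hasCompactSupport hac).norm).mul_const _
  · refine Eventually.of_forall fun z => Tendsto.const_mul _ ?_
    exact ((hb.differentiable one_ne_zero z).hasFDerivAt.hasLineDerivAt v).tendsto_slope_zero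

lemma integral_null_lagrangian {a b : ℂ → ℝ} (ha : ContDiff ℝ 1 a)
    (hac : HasCompactSupport a) (hb : ContDiff ℝ 1 b) (hbc : HasCompactSupport b) (u v : ℂ) :
    ∫ z, fderiv ℝ a z u * fderiv ℝ b z v = ∫ z, fderiv ℝ a z v * fderiv ℝ b z u := by
  have hda : ∀ u, Continuous fun z => fderiv ℝ a z u := fun u =>
    (ha.continuous_fderiv one_ne_zero).clm_apply continuous_const
  have hdb : ∀ u, Continuous fun z => fderiv ℝ b z u := fun u =>
    (hb.continuous_fderiv one_ne_zero).clm_apply continuous_const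
  have L1 := tendsto_integral_slope (hda u) (hac.fderiv_apply ℝ u) hb hbc v
  have L2 := tendsto_integral_slope (hdb u) (hbc.fderiv_apply ℝ u) ha hac (-v)
  have L3 := L2.neg
  have e1 : -∫ z, fderiv ℝ b z u * fderiv ℝ a z (-v) = ∫ z, fderiv ℝ a z v * fderiv ℝ b z u := by
    rw [← integral_neg]
    congr 1; ext z; simp [mul_comm]
  rw [e1] at L3
  refine tendsto_nhds_unique L1 (L3.congr' ?_)
  refine eventually_nhdsWithin_of_forall fun h hh => ?_
  have hac' : Continuous a := ha.continuous
  have hbc' : Continuous b := hb.continuous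
  have hbt : ContDiff ℝ 1 fun z => b (z + h • v) := hb.comp (contDiff_id.add contDiff_const)
  have hbtc : HasCompactSupport fun z => b (z + h • v) :=
    hbc.comp_homeomorph (Homeomorph.addRight (h • v))
  have hD : ContDiff ℝ 1 fun z => h⁻¹ • (b (z + h • v) - b z) := (hbt.sub hb).const_smul _
  have hDc : HasCompactSupport fun z => h⁻¹ • (b (z + h • v) - b z) :=
    (hbtc.sub hbc).smul_left (f := fun _ => h⁻¹)
  have hfd : ∀ z, fderiv ℝ (fun z => h⁻¹ • (b (z + h • v) - b z)) z u =
      h⁻¹ • (fderiv ℝ b (z + h • v) u - fderiv ℝ b z u) := by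
    intro z
    have h1 : HasFDerivAt (fun z => b (z + h • v)) (fderiv ℝ b (z + h • v)) z := by
      have := (hb.differentiable one_ne_zero (z + h • v)).hasFDerivAt.comp z
        ((hasFDerivAt_id z).add_const (h • v))
      exact this.congr_fderiv (by ext; simp)
    have h2 := ((h1.sub (hb.differentiable one_ne_zero z).hasFDerivAt).const_smul h⁻¹).fderiv
    rw [show (fun z => h⁻¹ • (b (z + h • v) - b z)) =
      h⁻¹ • ((fun z => b (z + h • v)) - b) from rfl, h2]
    simp
  have hcc : ∀ {f g : ℂ → ℝ}, Continuous f → HasCompactSupport f → Continuous g →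
      Integrable fun z => f z * g z := fun hf hfc hg =>
    (hf.mul hg).integrable_of_hasCompactSupport hfc.mul_right
  have ibp := integral_mul_fderiv_eq_neg_fderiv_mul_of_integrable (μ := (volume : Measure ℂ))
    (𝕜 := ℝ) (f := a) (g := fun z => h⁻¹ • (b (z + h • v) - b z)) (v := u)
    (hcc (hda u) (hac.fderiv_apply ℝ u) hD.continuous)
    (hcc hac' hac ((hD.continuous_fderiv one_ne_zero).clm_apply continuous_const))
    (hcc hac' hac hD.continuous) (fun x _ => ha.differentiable one_ne_zero x)
    (fun x _ => hD.differentiable one_ne_zero x)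
  rw [eq_neg_iff_add_eq_zero, add_comm, ← eq_neg_iff_add_eq_zero] at ibp
  beta_reduce
  rw [ibp, neg_inj]
  simp only [hfd]
  have t1 : ∫ z, a (z + h • (-v)) * fderiv ℝ b z u = ∫ z, a z * fderiv ℝ b (z + h • v) u := by
    rw [← integral_add_right_eq_self _ (h • v)]
    congr 1; ext z; congr 2; simp
  have i1 : Integrable fun z => a (z + h • (-v)) * fderiv ℝ b z u := by
    refine (Continuous.mul (by fun_prop) (hdb u)).integrable_of_hasCompactSupport ?_
    exact (hbc.fderiv_apply ℝ u).mul_left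
  have i2 := hcc hac' hac (hdb u)
  have i3 : Integrable fun z => a z * fderiv ℝ b (z + h • v) u :=
    hcc hac' hac ((hdb u).comp (continuous_id.add continuous_const))
  have e2 : (fun z => fderiv ℝ b z u * h⁻¹ • (a (z + h • -v) - a z)) =
      fun z => h⁻¹ * (a (z + h • (-v)) * fderiv ℝ b z u - a z * fderiv ℝ b z u) := by
    ext z; simp only [smul_eq_mul]; ring
  have e3 : (fun z => a z * h⁻¹ • (fderiv ℝ b (z + h • v) u - fderiv ℝ b z u)) =
      fun z => h⁻¹ * (a z * fderiv ℝ b (z + h • v) u - a z * fderiv ℝ b z u) := by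
    ext z; simp only [smul_eq_mul]; ring
  rw [e2, e3, integral_const_mul, integral_const_mul, integral_sub i1 i2, integral_sub i3 i2, t1]

end

section

lemma dbar_mul {χ Z : ℂ → ℂ} {z : ℂ} (hχ : DifferentiableAt ℝ χ z) (hZ : DifferentiableAt ℝ Z z) :
    dbar (fun w => χ w * Z w) z = χ z * dbar Z z + Z z * dbar χ z := by
  simp only [dbar]
  rw [(hχ.hasFDerivAt.fun_mul hZ.hasFDerivAt).fderiv]
  simp
  ring

lemma dbar_sub {f g : ℂ → ℂ} {z : ℂ} (hf : DifferentiableAt ℝ f z) (hg : DifferentiableAt ℝ g z) :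
    dbar (fun w => f w - g w) z = dbar f z - dbar g z := by
  simp only [dbar]
  rw [fderiv_fun_sub hf hg]
  simp; ring

lemma differentiableAt_of_dbar_eq_zero {f : ℂ → ℂ} {z : ℂ} (hf : DifferentiableAt ℝ f z)
    (h : dbar f z = 0) : DifferentiableAt ℂ f z := by
  refine differentiableAt_complex_iff_differentiableAt_real.2 ⟨hf, ?_⟩
  rw [dbar] at h
  rw [smul_eq_mul]
  linear_combination (-Complex.I) * h + fderiv ℝ f z Complex.I * Complex.I_sq

lemma norm_dbar_le (f : ℂ → ℂ) (z : ℂ) : ‖dbar f z‖ ≤ 2 * ‖fderiv ℝ f z‖ := by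
  have h1 := (fderiv ℝ f z).le_opNorm 1
  have h2 := (fderiv ℝ f z).le_opNorm Complex.I
  simp only [norm_one, Complex.norm_I, mul_one] at h1 h2
  calc ‖dbar f z‖ ≤ ‖fderiv ℝ f z 1‖ + ‖Complex.I * fderiv ℝ f z Complex.I‖ := norm_add_le _ _
    _ ≤ 2 * ‖fderiv ℝ f z‖ := by rw [norm_mul, Complex.norm_I]; linarith

lemma continuous_dbar {f : ℂ → ℂ} (hf : ContDiff ℝ 1 f) : Continuous (dbar f) := by
  have := hf.continuous_fderiv one_ne_zero
  unfold dbar; fun_prop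

lemma hasCompactSupport_dbar {f : ℂ → ℂ} (hf : HasCompactSupport f) :
    HasCompactSupport (dbar f) := by
  refine (hf.fderiv_apply ℝ 1).add ?_
  exact (hf.fderiv_apply ℝ Complex.I).mul_left (f := fun _ => Complex.I)

lemma integral_norm_sq_le_dbar {ψ : ℂ → ℂ} (hψ : ContDiff ℝ 1 ψ) (hc : HasCompactSupport ψ) :
    ∫ z, ‖fderiv ℝ ψ z 1‖ ^ 2 ≤ ∫ z, ‖dbar ψ z‖ ^ 2 := by
  have hda : ∀ u, Continuous fun z => fderiv ℝ ψ z u := fun u =>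
    (hψ.continuous_fderiv one_ne_zero).clm_apply continuous_const
  have ha : ContDiff ℝ 1 fun z => (ψ z).re := Complex.reCLM.contDiff.comp hψ
  have hb : ContDiff ℝ 1 fun z => (ψ z).im := Complex.imCLM.contDiff.comp hψ
  have hac : HasCompactSupport fun z => (ψ z).re := hc.comp_left (g := Complex.re) rfl
  have hbc : HasCompactSupport fun z => (ψ z).im := hc.comp_left (g := Complex.im) rfl
  have fa : ∀ z u, fderiv ℝ (fun z => (ψ z).re) z u = (fderiv ℝ ψ z u).re := fun z u => by
    have := (Complex.reCLM.hasFDerivAt.comp z (hψ.differentiable one_ne_zero z).hasFDerivAt).fderiv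
    have h2 : fderiv ℝ (fun z => (ψ z).re) z = Complex.reCLM.comp (fderiv ℝ ψ z) := this
    rw [h2]; rfl
  have fb : ∀ z u, fderiv ℝ (fun z => (ψ z).im) z u = (fderiv ℝ ψ z u).im := fun z u => by
    have := (Complex.imCLM.hasFDerivAt.comp z (hψ.differentiable one_ne_zero z).hasFDerivAt).fderiv
    have h2 : fderiv ℝ (fun z => (ψ z).im) z = Complex.imCLM.comp (fderiv ℝ ψ z) := this
    rw [h2]; rfl
  have null := integral_null_lagrangian ha hac hb hbc 1 Complex.I
  simp only [fa, fb] at null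
  have hcc : ∀ {f g : ℂ → ℝ}, Continuous f → HasCompactSupport f → Continuous g →
      Integrable fun z => f z * g z := fun hf hfc hg =>
    (hf.mul hg).integrable_of_hasCompactSupport hfc.mul_right
  have hre : ∀ u, Continuous fun z => (fderiv ℝ ψ z u).re := fun u =>
    Complex.continuous_re.comp (hda u)
  have him : ∀ u, Continuous fun z => (fderiv ℝ ψ z u).im := fun u =>
    Complex.continuous_im.comp (hda u)
  have hrec : ∀ u, HasCompactSupport fun z => (fderiv ℝ ψ z u).re := fun u =>
    (hc.fderiv_apply ℝ u).comp_left (g := Complex.re) rfl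
  have i1 := hcc (hre 1) (hrec 1) (him Complex.I)
  have i2 := hcc (hre Complex.I) (hrec Complex.I) (him 1)
  have hsq : ∀ u, Integrable fun z => ‖fderiv ℝ ψ z u‖ ^ 2 := fun u => by
    refine Continuous.integrable_of_hasCompactSupport (by have := hda u; fun_prop) ?_
    exact (hc.fderiv_apply ℝ u).comp_left (g := fun z => ‖z‖ ^ 2) (by simp)
  have key : ∀ z, ‖dbar ψ z‖ ^ 2 = (‖fderiv ℝ ψ z 1‖ ^ 2 + ‖fderiv ℝ ψ z Complex.I‖ ^ 2) +
      2 * ((fderiv ℝ ψ z Complex.I).re * (fderiv ℝ ψ z 1).im -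
        (fderiv ℝ ψ z 1).re * (fderiv ℝ ψ z Complex.I).im) := by
    intro z
    simp only [dbar, Complex.sq_norm, Complex.normSq_apply]
    simp
    ring
  simp only [key]
  have i3 : Integrable fun z => (fderiv ℝ ψ z Complex.I).re * (fderiv ℝ ψ z 1).im -
        (fderiv ℝ ψ z 1).re * (fderiv ℝ ψ z Complex.I).im := i2.sub i1
  rw [integral_add ((hsq 1).fun_add (hsq _)) (i3.const_mul 2), integral_const_mul,
    integral_sub i2 i1, null, sub_self, mul_zero, add_zero, integral_add (hsq 1) (hsq _)]
  have : 0 ≤ ∫ z, ‖fderiv ℝ ψ z Complex.I‖ ^ 2 := integral_nonneg fun z => by positivity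
  linarith

lemma setIntegral_norm_sq_le_of_decay {T : ℂ → ℂ} (hT : ContDiff ℝ 1 T) {z₀ : ℂ} {r K : ℝ}
    (hr : 0 < r) (hK : 0 ≤ K) (hdec : ∀ z, r ≤ ‖z - z₀‖ → ‖T z‖ ≤ K / ‖z - z₀‖)
    (hc : HasCompactSupport (dbar T)) (ρ : ℝ) :
    ∫ z in ball z₀ ρ, ‖fderiv ℝ T z 1‖ ^ 2 ≤ 2 * ∫ z, ‖dbar T z‖ ^ 2 := by
  let χ : ContDiffBump (0 : ℂ) := ⟨1, 2, one_pos, one_lt_two⟩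
  let χ' : ℂ → ℂ := fun z => ((χ z : ℝ) : ℂ)
  have hχ : ContDiff ℝ 1 χ' := Complex.ofRealCLM.contDiff.comp χ.contDiff
  have hχc : HasCompactSupport χ' := χ.hasCompactSupport.comp_left (g := Complex.ofReal) rfl
  obtain ⟨C, hC⟩ := (hχ.continuous_fderiv one_ne_zero).bounded_above_of_compact_support
    (hχc.fderiv ℝ)
  have hC0 : 0 ≤ C := (norm_nonneg _).trans (hC 0)
  have iT : Integrable fun z => ‖dbar T z‖ ^ 2 := by
    refine Continuous.integrable_of_hasCompactSupport
      ((continuous_dbar hT).norm.pow 2) ?_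
    exact hc.comp_left (g := fun z => ‖z‖ ^ 2) (by simp)
  have main : ∀ R : ℝ, r < R → ρ < R → ∫ z in ball z₀ ρ, ‖fderiv ℝ T z 1‖ ^ 2 ≤
      2 * (∫ z, ‖dbar T z‖ ^ 2) + 72 * K ^ 2 * C ^ 2 * π / R ^ 2 := by
    intro R hrR hρR
    have hR : 0 < R := hr.trans hrR
    let X : ℂ → ℂ := fun z => χ' (R⁻¹ • (z - z₀))
    have hX : ContDiff ℝ 1 X := hχ.comp ((contDiff_id.sub contDiff_const).const_smul R⁻¹)
    have hX1 : ∀ z ∈ ball z₀ R, X z = 1 := by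
      intro z hz
      rw [mem_ball, dist_eq_norm] at hz
      simp only [X, χ']
      rw [χ.one_of_mem_closedBall]
      · simp
      · rw [mem_closedBall_zero_iff, norm_smul, norm_inv, Real.norm_of_nonneg hR.le,
          inv_mul_le_iff₀ hR]
        show _ ≤ R * 1
        linarith
    have hX0 : ∀ z, z ∉ ball z₀ (2 * R) → X z = 0 := by
      intro z hz
      rw [mem_ball, dist_eq_norm, not_lt] at hz
      simp only [X, χ']
      rw [χ.zero_of_le_dist]
      · simp
      · rw [dist_zero_right, norm_smul, norm_inv, Real.norm_of_nonneg hR.le,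
          le_inv_mul_iff₀ hR]
        show R * 2 ≤ _
        linarith
    have hXle : ∀ z, ‖X z‖ ≤ 1 := fun z => by
      simp only [X, χ', Complex.norm_real, Real.norm_of_nonneg χ.nonneg]; exact χ.le_one
    have hXd : ∀ z, ‖fderiv ℝ X z‖ ≤ C / R := by
      intro z
      have h1 : HasFDerivAt (fun z : ℂ => R⁻¹ • (z - z₀)) (R⁻¹ • ContinuousLinearMap.id ℝ ℂ) z :=
        ((hasFDerivAt_id z).sub_const z₀).const_smul R⁻¹
      have h2 := ((hχ.differentiable one_ne_zero (R⁻¹ • (z - z₀))).hasFDerivAt.comp z h1).fderiv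
      have h3 : fderiv ℝ X z = _ := h2
      rw [h3]
      refine (ContinuousLinearMap.opNorm_comp_le _ _).trans ?_
      rw [div_eq_mul_inv]
      gcongr
      · exact hC _
      · rw [norm_smul, norm_inv, Real.norm_of_nonneg hR.le]
        exact mul_le_of_le_one_right (by positivity) ContinuousLinearMap.norm_id_le
    have hXd0 : ∀ z, z ∉ ball z₀ (3 * R) → fderiv ℝ X z = 0 := by
      intro z hz
      have : X =ᶠ[𝓝 z] fun _ => 0 := by
        have ho : IsOpen (closedBall z₀ (2 * R))ᶜ := isClosed_closedBall.isOpen_compl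
        have hz' : z ∈ (closedBall z₀ (2 * R))ᶜ := fun h =>
          hz (closedBall_subset_ball (by linarith) h)
        filter_upwards [ho.mem_nhds hz'] with w hw
        exact hX0 w (fun h => hw (ball_subset_closedBall h))
      rw [this.fderiv_eq]; simp
    have hXd1 : ∀ z ∈ ball z₀ R, fderiv ℝ X z = 0 := by
      intro z hz
      have : X =ᶠ[𝓝 z] fun _ => 1 := by
        filter_upwards [isOpen_ball.mem_nhds hz] with w hw using hX1 w hw
      rw [this.fderiv_eq]; simp
    have hψ : ContDiff ℝ 1 fun z => X z * T z := hX.mul hT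
    have hψc : HasCompactSupport fun z => X z * T z := by
      refine HasCompactSupport.intro (isCompact_closedBall z₀ (2 * R)) fun z hz => ?_
      rw [hX0 z (fun h => hz (ball_subset_closedBall h)), zero_mul]
    have e := integral_norm_sq_le_dbar hψ hψc
    have hpt : ∀ z, ‖dbar (fun z => X z * T z) z‖ ^ 2 ≤ 2 * ‖dbar T z‖ ^ 2 +
        (ball z₀ (3 * R)).indicator (fun _ => 8 * K ^ 2 * C ^ 2 / R ^ 4) z := by
      intro z
      rw [dbar_mul (hX.differentiable one_ne_zero z) (hT.differentiable one_ne_zero z)]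
      have h1 : ‖X z * dbar T z + T z * dbar X z‖ ≤ ‖dbar T z‖ + ‖T z‖ * ‖dbar X z‖ := by
        refine (norm_add_le _ _).trans ?_
        rw [norm_mul, norm_mul]
        gcongr
        exact mul_le_of_le_one_left (norm_nonneg _) (hXle z)
      have h2 : ‖T z‖ * ‖dbar X z‖ ≤
          (ball z₀ (3 * R)).indicator (fun _ => 2 * K * C / R ^ 2) z := by
        have hd := norm_dbar_le X z
        by_cases hz3 : z ∈ ball z₀ (3 * R)
        · rw [indicator_of_mem hz3]
          by_cases hzR : z ∈ ball z₀ R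
          · rw [hXd1 z hzR, norm_zero, mul_zero] at hd
            rw [le_antisymm hd (norm_nonneg _), mul_zero]
            positivity
          · rw [mem_ball, dist_eq_norm, not_lt] at hzR
            have h3 : ‖T z‖ ≤ K / R := (hdec z (by linarith)).trans (by gcongr)
            have h4 : ‖dbar X z‖ ≤ 2 * (C / R) := hd.trans (by have := hXd z; linarith)
            calc ‖T z‖ * ‖dbar X z‖ ≤ (K / R) * (2 * (C / R)) := by gcongr
              _ = 2 * K * C / R ^ 2 := by field_simp
        · rw [indicator_of_notMem hz3]
          rw [hXd0 z hz3, norm_zero, mul_zero] at hd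
          rw [le_antisymm hd (norm_nonneg _), mul_zero]
      set b := (ball z₀ (3 * R)).indicator (fun _ => 2 * K * C / R ^ 2) z with hb
      have h5 : ‖X z * dbar T z + T z * dbar X z‖ ^ 2 ≤ (‖dbar T z‖ + b) ^ 2 := by
        gcongr; linarith
      have h6 : (ball z₀ (3 * R)).indicator (fun _ => 8 * K ^ 2 * C ^ 2 / R ^ 4) z = 2 * b ^ 2 := by
        rw [hb]
        by_cases hz3 : z ∈ ball z₀ (3 * R)
        · rw [indicator_of_mem hz3, indicator_of_mem hz3]; field_simp; ring
        · rw [indicator_of_notMem hz3, indicator_of_notMem hz3]; simp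
      rw [h6]
      nlinarith [sq_nonneg (‖dbar T z‖ - b)]
    have iψ : Integrable fun z => ‖fderiv ℝ (fun z => X z * T z) z 1‖ ^ 2 := by
      have hc1 : Continuous fun z => fderiv ℝ (fun z => X z * T z) z 1 :=
        (hψ.continuous_fderiv one_ne_zero).clm_apply continuous_const
      refine Continuous.integrable_of_hasCompactSupport (by fun_prop) ?_
      exact (hψc.fderiv_apply ℝ 1).comp_left (g := fun z => ‖z‖ ^ 2) (by simp)
    have iind : Integrable ((ball z₀ (3 * R)).indicator
        (fun _ => 8 * K ^ 2 * C ^ 2 / R ^ 4)) := by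
      refine IntegrableOn.integrable_indicator ?_ measurableSet_ball
      exact integrableOn_const measure_ball_lt_top.ne
    have idb : Integrable fun z => ‖dbar (fun z => X z * T z) z‖ ^ 2 := by
      refine Continuous.integrable_of_hasCompactSupport
        ((continuous_dbar hψ).norm.pow 2) ?_
      exact (hasCompactSupport_dbar hψc).comp_left (g := fun z => ‖z‖ ^ 2) (by simp)
    have s1 : ∫ z in ball z₀ ρ, ‖fderiv ℝ T z 1‖ ^ 2 ≤
        ∫ z, ‖fderiv ℝ (fun z => X z * T z) z 1‖ ^ 2 := by
      have : ∫ z in ball z₀ ρ, ‖fderiv ℝ T z 1‖ ^ 2 =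
          ∫ z in ball z₀ ρ, ‖fderiv ℝ (fun z => X z * T z) z 1‖ ^ 2 := by
        refine setIntegral_congr_fun measurableSet_ball fun z hz => ?_
        have : (fun z => X z * T z) =ᶠ[𝓝 z] T := by
          filter_upwards [isOpen_ball.mem_nhds (ball_subset_ball hρR.le hz)] with w hw
          rw [hX1 w hw, one_mul]
        simp only [this.fderiv_eq]
      rw [this]
      exact setIntegral_le_integral iψ (Eventually.of_forall fun z => by positivity)
    have s2 : ∫ z, ‖dbar (fun z => X z * T z) z‖ ^ 2 ≤ 2 * (∫ z, ‖dbar T z‖ ^ 2) +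
        9 * R ^ 2 * π * (8 * K ^ 2 * C ^ 2 / R ^ 4) := by
      refine (integral_mono idb ((iT.const_mul 2).add iind) hpt).trans (le_of_eq ?_)
      have hv : volume.real (ball z₀ (3 * R)) = 9 * R ^ 2 * π := by
        simp [Measure.real, Complex.volume_ball, hR.le]; ring
      simp only [Pi.add_apply]
      rw [integral_add (iT.const_mul 2) iind, integral_const_mul, integral_indicator
        measurableSet_ball, setIntegral_const, hv, smul_eq_mul]
    refine s1.trans (e.trans (s2.trans ?_))
    have : 9 * R ^ 2 * π * (8 * K ^ 2 * C ^ 2 / R ^ 4) = (72 * K ^ 2 * C ^ 2 * π) / R ^ 2 := by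
      field_simp; ring
    rw [this]
  have hlim : Tendsto (fun R : ℝ => 2 * (∫ z, ‖dbar T z‖ ^ 2) +
      72 * K ^ 2 * C ^ 2 * π / R ^ 2) atTop (𝓝 (2 * (∫ z, ‖dbar T z‖ ^ 2) + 0)) := by
    refine tendsto_const_nhds.add ?_
    exact tendsto_const_nhds.div_atTop (tendsto_pow_atTop two_ne_zero)
  rw [add_zero] at hlim
  refine ge_of_tendsto hlim ?_
  filter_upwards [eventually_gt_atTop r, eventually_gt_atTop ρ] with R h1 h2 using main R h1 h2

/-- Splitting of a `C¹` function into a holomorphic part and a part controlled by `dbar`. -/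
lemma exists_holomorphic_add {Z : ℂ → ℂ} {z₀ : ℂ} {r : ℝ} (hr : 0 < r)
    (hZ : ContDiffOn ℝ 1 Z (ball z₀ r)) :
    ∃ H T : ℂ → ℂ, (∀ z ∈ ball z₀ (r / 2), Z z = H z + T z) ∧
      DifferentiableOn ℂ H (ball z₀ (r / 2)) ∧ ContDiff ℝ 1 T ∧
      (∀ M, (∀ z ∈ ball z₀ r, ‖dbar Z z‖ ≤ M) → ∀ z ∈ ball z₀ (r / 2), ‖T z‖ ≤ 2 * r * M) ∧
      ∫ z in ball z₀ (r / 2), ‖fderiv ℝ T z 1‖ ^ 2 ≤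
        2 * ∫ z in closedBall z₀ (3 * r / 4), ‖dbar Z z‖ ^ 2 := by
  let χ : ContDiffBump z₀ := ⟨r / 2, 3 * r / 4, by positivity, by linarith⟩
  let X : ℂ → ℂ := fun z => ((χ z : ℝ) : ℂ)
  have hX : ContDiff ℝ 2 X := Complex.ofRealCLM.contDiff.comp χ.contDiff
  have hX1' : ContDiff ℝ 1 X := hX.of_le (by norm_num)
  have hX1 : ∀ z ∈ ball z₀ (r / 2), X z = 1 := fun z hz => by
    simp only [X]; rw [χ.one_of_mem_closedBall (ball_subset_closedBall hz)]; simp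
  have hX0 : ∀ z, z ∉ ball z₀ (3 * r / 4) → X z = 0 := fun z hz => by
    simp only [X]; rw [χ.zero_of_le_dist (by simpa using hz)]; simp
  have hXle : ∀ z, ‖X z‖ ≤ 1 := fun z => by
    simp only [X, Complex.norm_real, Real.norm_of_nonneg χ.nonneg]; exact χ.le_one
  have hfar : ∀ z, z ∉ closedBall z₀ (3 * r / 4) → X =ᶠ[𝓝 z] fun _ => 0 := fun z hz => by
    filter_upwards [isClosed_closedBall.isOpen_compl.mem_nhds hz] with w hw
    exact hX0 w (fun h => hw (ball_subset_closedBall h))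
  have hsub : closedBall z₀ (3 * r / 4) ⊆ ball z₀ r := closedBall_subset_ball (by linarith)
  have hZd : ∀ z ∈ ball z₀ r, ContDiffAt ℝ 1 Z z := fun z hz =>
    hZ.contDiffAt (isOpen_ball.mem_nhds hz)
  -- products with functions vanishing off the closed ball are globally smooth
  have glob : ∀ Y : ℂ → ℂ, ContDiff ℝ 1 Y → (∀ z, z ∉ closedBall z₀ (3 * r / 4) →
      Y =ᶠ[𝓝 z] fun _ => 0) → ContDiff ℝ 1 (fun z => Y z * Z z) ∧
      HasCompactSupport (fun z => Y z * Z z) := by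
    intro Y hY hY0
    refine ⟨contDiff_iff_contDiffAt.2 fun z => ?_,
      HasCompactSupport.intro (isCompact_closedBall z₀ (3 * r / 4)) fun z hz => ?_⟩
    · by_cases hz : z ∈ closedBall z₀ (3 * r / 4)
      · exact hY.contDiffAt.mul (hZd z (hsub hz))
      · refine (contDiffAt_const (c := (0 : ℂ))).congr_of_eventuallyEq ?_
        filter_upwards [hY0 z hz] with w hw
        rw [hw, zero_mul]
    · rw [(hY0 z hz).self_of_nhds, zero_mul]
  obtain ⟨hP, hPc⟩ := glob X hX1' hfar
  have hdX : ContDiff ℝ 1 (dbar X) := by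
    have h1 : ContDiff ℝ 1 (fderiv ℝ X) := hX.fderiv_right (by norm_num)
    exact (h1.clm_apply contDiff_const).add (contDiff_const.mul (h1.clm_apply contDiff_const))
  have hdX0 : ∀ z, z ∉ closedBall z₀ (3 * r / 4) → dbar X =ᶠ[𝓝 z] fun _ => 0 := by
    intro z hz
    filter_upwards [isClosed_closedBall.isOpen_compl.mem_nhds hz] with w hw
    simp only [dbar]
    rw [(hfar w hw).fderiv_eq]; simp
  obtain ⟨hQ, hQc⟩ := glob (dbar X) hdX hdX0
  have hH := contDiff_cauchyT hQ hQc
  have hTd : ContDiff ℝ 1 fun z => X z * Z z - cauchyT (fun z => dbar X z * Z z) z := hP.sub hH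
  have hdP : ∀ z, dbar (fun z => X z * Z z) z = X z * dbar Z z + dbar X z * Z z := by
    intro z
    by_cases hz : z ∈ closedBall z₀ (3 * r / 4)
    · rw [dbar_mul (hX1'.differentiable one_ne_zero z)
        ((hZd z (hsub hz)).differentiableAt one_ne_zero), mul_comm (Z z)]
    · rw [(hdX0 z hz).self_of_nhds, (hfar z hz).self_of_nhds]
      have : (fun z => X z * Z z) =ᶠ[𝓝 z] fun _ => 0 := by
        filter_upwards [hfar z hz] with w hw
        rw [hw, zero_mul]
      simp only [dbar]
      rw [this.fderiv_eq]; simp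
  have hdT : ∀ z, dbar (fun z => X z * Z z - cauchyT (fun z => dbar X z * Z z) z) z =
      X z * dbar Z z := by
    intro z
    rw [dbar_sub (hP.differentiable one_ne_zero z) (hH.differentiable one_ne_zero z),
      dbar_cauchyT_eq hQ hQc, hdP]; ring
  have hTc : ∀ z, X z * Z z - cauchyT (fun z => dbar X z * Z z) z =
      cauchyT (fun z => X z * dbar Z z) z := by
    intro z
    have e : (fun z => X z * dbar Z z) =
        fun z => dbar (fun z => X z * Z z) z - dbar X z * Z z := by
      ext w; rw [hdP]; ring
    have i1 := integrable_cauchy_kernel (continuous_dbar hP) (hasCompactSupport_dbar hPc) z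
    have i2 := integrable_cauchy_kernel hQ.continuous hQc z
    rw [e, ← cauchyT_dbar hP hPc z]
    simp only [cauchyT]
    rw [← mul_sub, ← integral_sub i1 i2]
    congr 2; ext w; ring
  have hk0 : ∀ z, z ∉ ball z₀ r → X z * dbar Z z = 0 := fun z hz => by
    rw [hX0 z (fun h => hz (ball_subset_ball (by linarith) h)), zero_mul]
  have hdTc : HasCompactSupport
      (dbar fun z => X z * Z z - cauchyT (fun z => dbar X z * Z z) z) := by
    refine HasCompactSupport.intro (isCompact_closedBall z₀ r) fun z hz => ?_
    rw [hdT, hk0 z (fun h => hz (ball_subset_closedBall h))]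
  refine ⟨cauchyT (fun z => dbar X z * Z z), fun z => X z * Z z -
    cauchyT (fun z => dbar X z * Z z) z, ?_, ?_, hTd, ?_, ?_⟩
  · intro z hz
    simp only [hX1 z hz]; ring
  · intro z hz
    refine DifferentiableAt.differentiableWithinAt ?_
    refine differentiableAt_of_dbar_eq_zero (hH.differentiable one_ne_zero z) ?_
    rw [dbar_cauchyT_eq hQ hQc]
    have : X =ᶠ[𝓝 z] fun _ => 1 := by
      filter_upwards [isOpen_ball.mem_nhds hz] with w hw using hX1 w hw
    simp only [dbar]
    rw [this.fderiv_eq]; simp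
  · intro M hM z hz
    have hM0 : 0 ≤ M := (norm_nonneg _).trans (hM z₀ (by simpa using hr))
    beta_reduce
    rw [hTc]
    refine norm_cauchyT_le hr.le (z₀ := z₀) (fun w => ?_) hk0 (ball_subset_ball (by linarith) hz)
    by_cases hw : w ∈ ball z₀ r
    · rw [norm_mul]
      exact (mul_le_of_le_one_left (norm_nonneg _) (hXle w)).trans (hM w hw)
    · rw [hk0 w hw, norm_zero]; exact hM0
  · have hkc : Continuous fun z => X z * dbar Z z := by
      have := continuous_dbar hTd
      rwa [funext hdT] at this
    obtain ⟨M, hM⟩ := hkc.bounded_above_of_compact_support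
      (by rwa [funext hdT] at hdTc)
    have hM0 : 0 ≤ M := (norm_nonneg _).trans (hM z₀)
    have := setIntegral_norm_sq_le_of_decay hTd (z₀ := z₀) (r := 2 * r) (K := r ^ 2 * M)
      (by positivity) (by positivity) (fun z hz => by
        rw [hTc]; exact norm_cauchyT_le_of_far hr hM hk0 hz) hdTc (r / 2)
    refine this.trans ?_
    gcongr
    simp only [hdT]
    have h1 : ∫ z, ‖X z * dbar Z z‖ ^ 2 = ∫ z in closedBall z₀ (3 * r / 4), ‖X z * dbar Z z‖ ^ 2 := by
      refine (setIntegral_eq_integral_of_forall_compl_eq_zero fun z hz => ?_).symm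
      rw [hX0 z (fun h => hz (ball_subset_closedBall h))]; simp
    rw [h1]
    have hdZc : ContinuousOn (dbar Z) (ball z₀ r) := by
      have hf := hZ.continuousOn_fderiv_of_isOpen isOpen_ball le_rfl
      unfold dbar; fun_prop
    refine setIntegral_mono_on ?_ ?_ measurableSet_closedBall fun z hz => ?_
    · exact (hkc.norm.pow 2).continuousOn.integrableOn_compact (isCompact_closedBall _ _)
    · exact ((hdZc.mono hsub).norm.pow 2).integrableOn_compact (isCompact_closedBall _ _)
    · gcongr
      rw [norm_mul]
      exact mul_le_of_le_one_left (norm_nonneg _) (hXle z)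

end

section

lemma setIntegral_ball_eq_of_differentiableOn {k : ℂ → ℂ} {z₀ : ℂ} {ρ R : ℝ} (hρ : 0 < ρ)
    (hR : ρ < R) (hk : DifferentiableOn ℂ k (ball z₀ R)) :
    ∫ z in ball z₀ ρ, k z = (ρ ^ 2 * π : ℝ) * k z₀ := by
  have hsub : closedBall z₀ ρ ⊆ ball z₀ R := closedBall_subset_ball hR
  have e1 : ∫ z in ball z₀ ρ, k z =
      ∫ p in polarCoord.target, p.1 • (ball (0 : ℂ) ρ).indicator (fun w => k (z₀ + w))
        (Complex.polarCoord.symm p) := by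
    rw [Complex.integral_comp_polarCoord_symm, ← integral_indicator measurableSet_ball,
      ← integral_add_left_eq_self _ z₀]
    congr 1; ext w
    simp [indicator, dist_eq_norm]
  have e2 : ∀ p ∈ polarCoord.target, p.1 • (ball (0 : ℂ) ρ).indicator (fun w => k (z₀ + w))
        (Complex.polarCoord.symm p) =
      (Ioo 0 ρ ×ˢ Ioo (-π) π).indicator (fun p : ℝ × ℝ => (p.1 : ℂ) * k (circleMap z₀ p.1 p.2)) p := by
    rintro ⟨r, θ⟩ hp
    have hr : (0 : ℝ) < r := hp.1
    have hθ : θ ∈ Ioo (-π) π := hp.2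
    have hs : Complex.polarCoord.symm (r, θ) = r * Complex.exp (θ * Complex.I) := by
      rw [Complex.polarCoord_symm_apply, Complex.exp_mul_I]; simp
    have hn : ‖(r : ℂ) * Complex.exp (θ * Complex.I)‖ = r := by
      simp [Complex.norm_exp_ofReal_mul_I, abs_of_pos hr]
    rw [hs]
    by_cases h : r < ρ
    · rw [indicator_of_mem (by rw [mem_ball_zero_iff, hn]; exact h),
        indicator_of_mem (show (r, θ) ∈ Ioo 0 ρ ×ˢ Ioo (-π) π from ⟨⟨hr, h⟩, hθ⟩)]
      simp [circleMap]
    · rw [indicator_of_notMem (by rw [mem_ball_zero_iff, hn]; exact h),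
        indicator_of_notMem (fun h' : (r, θ) ∈ Ioo 0 ρ ×ˢ Ioo (-π) π => h h'.1.2)]
      simp
  have hsm : MeasurableSet (Ioo 0 ρ ×ˢ Ioo (-π) π) := measurableSet_Ioo.prod measurableSet_Ioo
  rw [e1, setIntegral_congr_fun polarCoord.open_target.measurableSet e2,
    setIntegral_indicator hsm, polarCoord_target]
  have e3 : Ioi (0 : ℝ) ×ˢ Ioo (-π) π ∩ Ioo 0 ρ ×ˢ Ioo (-π) π = Ioo 0 ρ ×ˢ Ioo (-π) π := by
    ext ⟨a, b⟩; simp; tauto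
  have hmem : ∀ p : ℝ × ℝ, p ∈ Icc 0 ρ ×ˢ Icc (-π) π → circleMap z₀ p.1 p.2 ∈ ball z₀ R := by
    rintro ⟨a, b⟩ ⟨ha, hb⟩
    have := circleMap_mem_sphere z₀ ha.1 b
    simp only [mem_sphere, mem_ball] at *
    linarith [ha.2]
  have hint : IntegrableOn (fun p : ℝ × ℝ => (p.1 : ℂ) * k (circleMap z₀ p.1 p.2))
      (Ioo 0 ρ ×ˢ Ioo (-π) π) := by
    refine IntegrableOn.mono_set (ContinuousOn.integrableOn_compact
      (isCompact_Icc.prod isCompact_Icc) ?_) (prod_mono Ioo_subset_Icc_self Ioo_subset_Icc_self)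
    refine ContinuousOn.mul (by fun_prop) (hk.continuousOn.comp ?_ hmem)
    unfold circleMap; fun_prop
  rw [e3, Measure.volume_eq_prod, setIntegral_prod _ hint]
  have e4 : ∀ r ∈ Ioo 0 ρ, ∫ θ in Ioo (-π) π, (r : ℂ) * k (circleMap z₀ r θ) =
      (r : ℂ) * (2 * π * k z₀) := by
    intro r hr
    rw [integral_const_mul]
    congr 1
    have h1 : circleAverage k z₀ r = k z₀ := by
      apply DiffContOnCl.circleAverage
      rw [abs_of_pos hr.1]
      exact DifferentiableOn.diffContOnCl (hk.mono (by
        rw [closure_ball _ hr.1.ne']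
        exact (closedBall_subset_closedBall hr.2.le).trans hsub))
    rw [circleAverage_eq_integral_add (-π),
      intervalIntegral.integral_comp_add_right (fun θ ↦ k (circleMap z₀ r θ))] at h1
    rw [← h1, ← integral_Ioc_eq_integral_Ioo, ← intervalIntegral.integral_of_le (by linarith [pi_pos])]
    have : (π : ℂ) ≠ 0 := by exact_mod_cast pi_ne_zero
    have h2 : 2 * π + -π = π := by ring
    rw [h2, zero_add, Complex.real_smul]
    push_cast
    field_simp
  rw [setIntegral_congr_fun measurableSet_Ioo e4, integral_mul_const,
    ← integral_Ioc_eq_integral_Ioo, ← intervalIntegral.integral_of_le hρ.le,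
    intervalIntegral.integral_ofReal, integral_id]
  push_cast; ring

lemma norm_sq_le_setIntegral_of_differentiableOn {k : ℂ → ℂ} {z₀ : ℂ} {ρ R : ℝ} (hρ : 0 < ρ)
    (hR : ρ < R) (hk : DifferentiableOn ℂ k (ball z₀ R)) :
    ρ ^ 2 * π * ‖k z₀‖ ^ 2 ≤ ∫ z in ball z₀ ρ, ‖k z‖ ^ 2 := by
  have h := setIntegral_ball_eq_of_differentiableOn hρ hR (k := fun z => k z ^ 2) (hk.pow 2)
  have h2 := norm_integral_le_integral_norm (μ := volume.restrict (ball z₀ ρ)) (fun z => k z ^ 2)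
  rw [h, norm_mul, Complex.norm_real, norm_of_nonneg (by positivity)] at h2
  simpa only [norm_pow] using h2

lemma setIntegral_norm_sub_sq_le {f g : ℂ → ℂ} {s : Set ℂ} (hf : IntegrableOn (fun z => ‖f z‖ ^ 2) s)
    (hg : IntegrableOn (fun z => ‖g z‖ ^ 2) s) :
    ∫ z in s, ‖f z + g z‖ ^ 2 ≤ 2 * (∫ z in s, ‖f z‖ ^ 2) + 2 * ∫ z in s, ‖g z‖ ^ 2 := by
  rw [← integral_const_mul, ← integral_const_mul, ← integral_add (hf.const_mul 2) (hg.const_mul 2)]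
  refine integral_mono_of_nonneg (ae_of_all _ fun z => by positivity)
    ((hf.const_mul 2).add (hg.const_mul 2)) (ae_of_all _ fun z => ?_)
  have := norm_add_le (f z) (g z)
  have h2 := sq_nonneg (‖f z‖ - ‖g z‖)
  have : ‖f z + g z‖ ^ 2 ≤ (‖f z‖ + ‖g z‖) ^ 2 := by gcongr
  simp only
  linarith

lemma dbar_const_mul_id (a z : ℂ) : dbar (fun z => a * z) z = 0 := by
  have h : HasFDerivAt (𝕜 := ℝ) (fun z : ℂ => a * z) (a • ContinuousLinearMap.id ℝ ℂ) z :=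
    (hasFDerivAt_id z).const_mul a
  rw [dbar, h.fderiv]; simp; ring_nf; simp

lemma fderiv_const_mul_id (a z : ℂ) : fderiv ℝ (fun z => a * z) z 1 = a := by
  have h : HasFDerivAt (𝕜 := ℝ) (fun z : ℂ => a * z) (a • ContinuousLinearMap.id ℝ ℂ) z :=
    (hasFDerivAt_id z).const_mul a
  rw [h.fderiv]; simp

/-- One step of the `L²` Campanato iteration for the operator `dbar`. -/
lemma exists_const_setIntegral_le {Z : ℂ → ℂ} {U : Set ℂ} (hU : IsOpen U) {z₀ : ℂ} {r θ : ℝ}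
    (hr : 0 < r) (hsub : closedBall z₀ r ⊆ U) (hZ : ContDiffOn ℝ 1 Z U) (hθ : 0 < θ)
    (hθ' : θ ≤ 1 / 8) (a : ℂ) :
    ∃ c : ℂ, ∫ z in ball z₀ (θ * r), ‖fderiv ℝ Z z 1 - c‖ ^ 2 ≤
      16384 * (θ ^ 4 * (∫ z in ball z₀ r, ‖fderiv ℝ Z z 1 - a‖ ^ 2) +
        ∫ z in ball z₀ r, ‖dbar Z z‖ ^ 2) := by
  have hZd : ∀ z ∈ U, DifferentiableAt ℝ Z z := fun z hz =>
    (hZ.contDiffAt (hU.mem_nhds hz)).differentiableAt one_ne_zero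
  have hdc : ∀ e : ℂ, ContinuousOn (fun z => fderiv ℝ Z z e) U := fun e =>
    (hZ.continuousOn_fderiv_of_isOpen hU le_rfl).clm_apply continuousOn_const
  have hbU : ball z₀ r ⊆ U := ball_subset_closedBall.trans hsub
  have hlin : ∀ z : ℂ, DifferentiableAt ℝ (fun z => a * z) z := fun z => by fun_prop
  obtain ⟨H, T, hHT, hH, hT, -, hTi⟩ := exists_holomorphic_add (Z := fun z => Z z - a * z)
    (z₀ := z₀) hr ((hZ.mono hbU).sub (by fun_prop))
  have hball : ∀ {s : ℝ}, s ≤ r → ball z₀ s ⊆ U := fun h => (ball_subset_ball h).trans hbU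
  have hTc : Continuous fun z => fderiv ℝ T z 1 :=
    (hT.continuous_fderiv one_ne_zero).clm_apply continuous_const
  have hint : ∀ {f : ℂ → ℂ}, ContinuousOn f U → ∀ {s : ℝ} {z₁ : ℂ}, ball z₁ s ⊆ closedBall z₀ r →
      IntegrableOn (fun z => ‖f z‖ ^ 2) (ball z₁ s) := by
    intro f hf s z₁ hs
    refine IntegrableOn.mono_set (ContinuousOn.integrableOn_compact (isCompact_closedBall z₀ r) ?_) hs
    exact ((hf.mono hsub).norm.pow 2)
  set w : ℂ → ℂ := fun z => fderiv ℝ Z z 1 - a with hw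
  set t : ℂ → ℂ := fun z => fderiv ℝ T z 1 with ht
  have hwc : ContinuousOn w U := (hdc 1).sub continuousOn_const
  have hdbc : ContinuousOn (dbar Z) U := (hdc 1).add ((hdc Complex.I).const_smul Complex.I)
  set h : ℂ → ℂ := fun z => w z - t z with hh
  have hhc : ContinuousOn h U := hwc.sub hTc.continuousOn
  -- on the half ball `h` is the complex derivative of `H`
  have hder : ∀ z ∈ ball z₀ (r / 2), deriv H z = h z := by
    intro z hz
    have hzU := hball (by linarith) hz
    have hHd : DifferentiableAt ℂ H z := (hH z hz).differentiableAt (isOpen_ball.mem_nhds hz)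
    have e1 : fderiv ℝ H z 1 = deriv H z := by
      rw [hHd.hasDerivAt.hasFDerivAt.restrictScalars ℝ |>.fderiv]; simp
    have e2 : H =ᶠ[𝓝 z] fun z => (Z z - a * z) - T z := by
      filter_upwards [isOpen_ball.mem_nhds hz] with y hy
      rw [hHT y hy]; ring
    rw [← e1, e2.fderiv_eq, fderiv_fun_sub ((hZd z hzU).fun_sub (hlin z))
      (hT.differentiable one_ne_zero z), fderiv_fun_sub (hZd z hzU) (hlin z)]
    simp only [sub_apply, fderiv_const_mul_id]
    rfl
  have hhol : DifferentiableOn ℂ h (ball z₀ (r / 2)) :=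
    (hH.deriv isOpen_ball).congr fun z hz => (hder z hz).symm
  set E := ∫ z in ball z₀ r, ‖w z‖ ^ 2 with hE
  set G := ∫ z in ball z₀ r, ‖dbar Z z‖ ^ 2 with hG
  have hE0 : 0 ≤ E := integral_nonneg fun z => by positivity
  have hG0 : 0 ≤ G := integral_nonneg fun z => by positivity
  have hTG : ∫ z in ball z₀ (r / 2), ‖t z‖ ^ 2 ≤ 2 * G := by
    refine hTi.trans (mul_le_mul_of_nonneg_left ?_ zero_le_two)
    have : ∫ z in closedBall z₀ (3 * r / 4), ‖dbar (fun z => Z z - a * z) z‖ ^ 2 =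
        ∫ z in closedBall z₀ (3 * r / 4), ‖dbar Z z‖ ^ 2 := by
      refine setIntegral_congr_fun isClosed_closedBall.measurableSet fun z hz => ?_
      have hzU : z ∈ U := hsub (closedBall_subset_closedBall (by linarith) hz)
      rw [dbar_sub (hZd z hzU) (hlin z), dbar_const_mul_id, sub_zero]
    rw [this]
    exact setIntegral_mono_set (hint hdbc ball_subset_closedBall)
      (ae_of_all _ fun z => by positivity)
      (closedBall_subset_ball (by linarith)).eventuallyLE
  have hEH : ∫ z in ball z₀ (r / 2), ‖h z‖ ^ 2 ≤ 2 * E + 4 * G := by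
    have hs : ball z₀ (r / 2) ⊆ closedBall z₀ r :=
      ball_subset_closedBall.trans (closedBall_subset_closedBall (by linarith))
    have i1 := hint hwc hs
    have i2 := hint hTc.neg.continuousOn hs
    have := setIntegral_norm_sub_sq_le i1 i2
    have i3 : ∫ z in ball z₀ (r / 2), ‖w z‖ ^ 2 ≤ E :=
      setIntegral_mono_set (hint hwc ball_subset_closedBall)
        (ae_of_all _ fun z => by positivity) (ball_subset_ball (by linarith)).eventuallyLE
    have e : ∀ z, ‖-t z‖ ^ 2 = ‖t z‖ ^ 2 := fun z => by rw [norm_neg]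
    have e' : ∀ z, ‖w z + -t z‖ ^ 2 = ‖h z‖ ^ 2 := fun z => by rw [← sub_eq_add_neg]
    change ∫ z in ball z₀ (r / 2), ‖w z + -t z‖ ^ 2 ≤
      2 * _ + 2 * ∫ z in ball z₀ (r / 2), ‖-t z‖ ^ 2 at this
    simp only [e, e'] at this
    linarith
  set M := √(16 * (2 * E + 4 * G) / (π * r ^ 2)) with hM
  have hMsq : M ^ 2 = 16 * (2 * E + 4 * G) / (π * r ^ 2) := Real.sq_sqrt (by positivity)
  have hbd : ∀ z ∈ ball z₀ (r / 8), ‖h z‖ ≤ M := by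
    intro z hz
    have hs : ball z (3 * r / 8) ⊆ ball z₀ (r / 2) := by
      refine ball_subset_ball' ?_
      rw [mem_ball] at hz; linarith
    have h1 := norm_sq_le_setIntegral_of_differentiableOn (ρ := r / 4) (R := 3 * r / 8)
      (by linarith) (by linarith) (hhol.mono hs)
    have h2 : ∫ z in ball z (r / 4), ‖h z‖ ^ 2 ≤ ∫ z in ball z₀ (r / 2), ‖h z‖ ^ 2 :=
      setIntegral_mono_set (hint hhc (ball_subset_closedBall.trans
        (closedBall_subset_closedBall (by linarith))))
        (ae_of_all _ fun z => by positivity)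
        ((ball_subset_ball (by linarith)).trans hs).eventuallyLE
    refine Real.le_sqrt_of_sq_le ?_
    rw [le_div_iff₀ (by positivity)]
    nlinarith
  have hz0 : z₀ ∈ ball z₀ (r / 8) := mem_ball_self (by linarith)
  have hosc : ∀ z ∈ ball z₀ (θ * r), ‖h z - h z₀‖ ≤ 16 * M * θ := by
    intro z hz
    have hz8 : z ∈ ball z₀ (r / 8) := ball_subset_ball (by nlinarith) hz
    have := Complex.dist_le_div_mul_dist_of_mapsTo_ball (f := h) (c := z₀) (R₁ := r / 8)
      (R₂ := 2 * M) (hhol.mono (ball_subset_ball (by linarith))) (fun y hy => by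
        rw [mem_closedBall, dist_eq_norm]
        linarith [norm_sub_le (h y) (h z₀), hbd y hy, hbd z₀ hz0]) hz8
    rw [dist_eq_norm] at this
    refine this.trans ?_
    rw [mem_ball] at hz
    have hM0 : 0 ≤ M := Real.sqrt_nonneg _
    calc 2 * M / (r / 8) * dist z z₀ ≤ 2 * M / (r / 8) * (θ * r) := by gcongr
      _ = 16 * M * θ := by field_simp; ring
  have hsθ : ball z₀ (θ * r) ⊆ closedBall z₀ r :=
    ball_subset_closedBall.trans (closedBall_subset_closedBall (by nlinarith))
  refine ⟨a + h z₀, ?_⟩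
  have hdec := setIntegral_norm_sub_sq_le (hint (hhc.sub (continuousOn_const (c := h z₀))) hsθ)
    (hint hTc.continuousOn hsθ)
  have hl : ∀ z, ‖fderiv ℝ Z z 1 - (a + h z₀)‖ ^ 2 = ‖(h z - h z₀) + t z‖ ^ 2 := by
    intro z; congr 2; simp only [hh, hw]; ring
  simp only [hl]
  refine hdec.trans ?_
  have h1 : ∫ z in ball z₀ (θ * r), ‖h z - h z₀‖ ^ 2 ≤ 4096 * θ ^ 4 * (2 * E + 4 * G) := by
    calc ∫ z in ball z₀ (θ * r), ‖h z - h z₀‖ ^ 2 ≤ ∫ z in ball z₀ (θ * r), (16 * M * θ) ^ 2 := by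
          refine setIntegral_mono_on (hint (hhc.sub continuousOn_const) hsθ)
            (integrableOn_const measure_ball_lt_top.ne) measurableSet_ball fun z hz => ?_
          gcongr
          exact hosc z hz
      _ = (θ * r) ^ 2 * π * (16 * M * θ) ^ 2 := by
          simp [Measure.real, Complex.volume_ball, hr.le, hθ.le]
      _ = 256 * θ ^ 4 * r ^ 2 * π * M ^ 2 := by ring
      _ = _ := by rw [hMsq]; field_simp; ring
  have h2 : ∫ z in ball z₀ (θ * r), ‖t z‖ ^ 2 ≤ 2 * G := by
    refine le_trans (setIntegral_mono_set (hint hTc.continuousOn (ball_subset_closedBall.trans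
        (closedBall_subset_closedBall (by linarith))))
        (ae_of_all _ fun z => by positivity) ?_) hTG
    exact (ball_subset_ball (by nlinarith)).eventuallyLE
  have h3 : θ ^ 4 ≤ 1 / 4096 := by
    calc θ ^ 4 ≤ (1 / 8) ^ 4 := by gcongr
      _ = _ := by norm_num
  have h4 : θ ^ 4 * G ≤ 1 / 4096 * G := by gcongr
  change 2 * (∫ z in ball z₀ (θ * r), ‖h z - h z₀‖ ^ 2) + 2 * (∫ z in ball z₀ (θ * r), ‖t z‖ ^ 2) ≤ _
  nlinarith

end

section

lemma sq_norm_sub_le_setIntegral {W : ℂ → ℂ} {z : ℂ} {ρ : ℝ} (hρ : 0 < ρ) {B B' : Set ℂ}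
    (hB : ball z ρ ⊆ B) (hB' : ball z ρ ⊆ B') {c c' : ℂ}
    (hi : IntegrableOn (fun z => ‖W z - c‖ ^ 2) B) (hi' : IntegrableOn (fun z => ‖W z - c'‖ ^ 2) B') :
    ρ ^ 2 * π * ‖c - c'‖ ^ 2 ≤ 2 * (∫ z in B, ‖W z - c‖ ^ 2) + 2 * ∫ z in B', ‖W z - c'‖ ^ 2 := by
  have e : ∀ z, ‖c - W z‖ ^ 2 = ‖W z - c‖ ^ 2 := fun z => by rw [norm_sub_rev]
  have h1 := setIntegral_norm_sub_sq_le (s := ball z ρ) (f := fun z => c - W z)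
    (g := fun z => W z - c') (by simp only [e]; exact hi.mono_set hB) (hi'.mono_set hB')
  simp only [e, sub_add_sub_cancel] at h1
  have h2 : ∫ z in ball z ρ, ‖W z - c‖ ^ 2 ≤ ∫ z in B, ‖W z - c‖ ^ 2 :=
    setIntegral_mono_set hi (ae_of_all _ fun z => by positivity) hB.eventuallyLE
  have h3 : ∫ z in ball z ρ, ‖W z - c'‖ ^ 2 ≤ ∫ z in B', ‖W z - c'‖ ^ 2 :=
    setIntegral_mono_set hi' (ae_of_all _ fun z => by positivity) hB'.eventuallyLE
  have h4 : ∫ _ in ball z ρ, ‖c - c'‖ ^ 2 = ρ ^ 2 * π * ‖c - c'‖ ^ 2 := by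
    simp [Measure.real, Complex.volume_ball, hρ.le]
  linarith

/-- Campanato's characterisation of Hölder continuity (exponent `3/4`), along geometric radii. -/
lemma exists_holder_of_campanato {W : ℂ → ℂ} {U D : Set ℂ} {s r L : ℝ} (hs : 0 < s)
    (hs' : s ≤ 1 / 2) (hr : 0 < r) (hL : 0 ≤ L) (hW : ContinuousOn W U)
    (hD : ∀ z ∈ D, closedBall z r ⊆ U)
    (h : ∀ z ∈ D, ∀ k : ℕ, ∃ c : ℂ, ∫ w in ball z (s ^ (4 * k) * r), ‖W w - c‖ ^ 2 ≤ L * s ^ (14 * k)) :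
    ∃ C, 0 ≤ C ∧ ∀ z ∈ D, ∀ z' ∈ D, dist z z' ≤ r / 2 → ‖W z - W z'‖ ≤ C * dist z z' ^ (3 / 4 : ℝ) := by
  have hs1 : s < 1 := by linarith
  have hpow : ∀ k : ℕ, s ^ (4 * k) ≤ 1 := fun k => pow_le_one₀ hs.le hs1.le
  have hint : ∀ z ∈ D, ∀ (k : ℕ) (c : ℂ),
      IntegrableOn (fun w => ‖W w - c‖ ^ 2) (ball z (s ^ (4 * k) * r)) := by
    intro z hz k c
    refine IntegrableOn.mono_set (ContinuousOn.integrableOn_compact (isCompact_closedBall z r) ?_)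
      (ball_subset_closedBall.trans (closedBall_subset_closedBall (by nlinarith [hpow k])))
    exact (((hW.mono (hD z hz)).sub continuousOn_const).norm.pow 2)
  set C₁ := √(4 * L / (π * r ^ 2 * s ^ 8)) with hC₁
  have hC₁0 : 0 ≤ C₁ := Real.sqrt_nonneg _
  have key : ∀ (k : ℕ) (c c' : ℂ) (z : ℂ) (E E' : ℝ), E ≤ L * s ^ (14 * k) → E' ≤ L * s ^ (14 * k) →
      (s ^ (4 * (k + 1)) * r) ^ 2 * π * ‖c - c'‖ ^ 2 ≤ 2 * E + 2 * E' → ‖c - c'‖ ≤ C₁ * (s ^ 3) ^ k := by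
    intro k c c' z E E' hE hE' hle
    have h1 : ‖c - c'‖ ^ 2 ≤ (C₁ * (s ^ 3) ^ k) ^ 2 := by
      rw [mul_pow, hC₁, Real.sq_sqrt (by positivity), div_mul_eq_mul_div, le_div_iff₀ (by positivity)]
      have e1 : (s ^ (4 * (k + 1)) * r) ^ 2 = s ^ (8 * k) * (s ^ 8 * r ^ 2) := by ring
      have e2 : s ^ (14 * k) = s ^ (8 * k) * ((s ^ 3) ^ k) ^ 2 := by ring
      have : s ^ (8 * k) * (‖c - c'‖ ^ 2 * (π * r ^ 2 * s ^ 8)) ≤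
          s ^ (8 * k) * (4 * L * ((s ^ 3) ^ k) ^ 2) := by
        rw [e1] at hle
        rw [e2] at hE hE'
        nlinarith
      exact le_of_mul_le_mul_left this (by positivity)
    exact abs_le_of_sq_le_sq' h1 (by positivity) |>.2
  choose! c hc using h
  have hlim : ∀ z ∈ D, Tendsto (c z) atTop (𝓝 (W z)) := by
    intro z hz
    have hrad : Tendsto (fun k : ℕ => s ^ (4 * k) * r) atTop (𝓝 0) := by
      have : Tendsto (fun k : ℕ => (s ^ 4) ^ k * r) atTop (𝓝 (0 * r)) :=
        (tendsto_pow_atTop_nhds_zero_of_lt_one (by positivity) (pow_lt_one₀ hs.le hs1 (by norm_num))).mul_const r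
      simpa [pow_mul] using this
    have hbase : Tendsto (fun k : ℕ => C₁ * (s ^ 3) ^ k) atTop (𝓝 0) := by
      have := (tendsto_pow_atTop_nhds_zero_of_lt_one (r := s ^ 3) (by positivity)
        (pow_lt_one₀ hs.le hs1 (by norm_num))).const_mul C₁
      simpa using this
    rw [Metric.tendsto_atTop]
    intro ε hε
    have hcz : ContinuousAt W z := hW.continuousAt
      (mem_of_superset (closedBall_mem_nhds z hr) (hD z hz))
    obtain ⟨δ, hδ, hδε⟩ := Metric.continuousAt_iff.1 hcz (ε / 4) (by positivity)
    obtain ⟨N, hN⟩ := ((hrad.eventually (gt_mem_nhds hδ)).and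
      (hbase.eventually (gt_mem_nhds (show 0 < ε / 4 by positivity)))).exists_forall_of_atTop
    refine ⟨N, fun k hk => ?_⟩
    obtain ⟨hk1, hk2⟩ := hN k hk
    set ρ := s ^ (4 * k) * r with hρ
    have hρ0 : 0 < ρ := by positivity
    have h1 := sq_norm_sub_le_setIntegral hρ0 subset_rfl subset_rfl (hint z hz k (c z k))
      (hint z hz k (W z))
    have h2 : ∫ w in ball z ρ, ‖W w - W z‖ ^ 2 ≤ ρ ^ 2 * π * (ε / 4) ^ 2 := by
      calc ∫ w in ball z ρ, ‖W w - W z‖ ^ 2 ≤ ∫ w in ball z ρ, (ε / 4) ^ 2 := by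
            refine setIntegral_mono_on (hint z hz k (W z))
              (integrableOn_const measure_ball_lt_top.ne) measurableSet_ball fun w hw => ?_
            gcongr
            rw [← dist_eq_norm]
            exact (hδε (lt_trans hw hk1)).le
        _ = _ := by simp [Measure.real, Complex.volume_ball, hρ0.le]
    have h3 : L * s ^ (14 * k) ≤ ρ ^ 2 * π * (C₁ * (s ^ 3) ^ k) ^ 2 := by
      rw [mul_pow C₁, hC₁, Real.sq_sqrt (by positivity), hρ]
      have e : (s ^ (4 * k) * r) ^ 2 * π * (4 * L / (π * r ^ 2 * s ^ 8) * ((s ^ 3) ^ k) ^ 2) =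
        L * s ^ (14 * k) * (4 / s ^ 8) := by field_simp; ring
      rw [e]
      refine le_mul_of_one_le_right (by positivity) ?_
      rw [le_div_iff₀ (by positivity)]
      linarith [pow_le_one₀ hs.le hs1.le (n := 8)]
    have h4 : ρ ^ 2 * π * ‖c z k - W z‖ ^ 2 ≤ ρ ^ 2 * π * (4 * (ε / 4) ^ 2) := by
      have : (C₁ * (s ^ 3) ^ k) ^ 2 ≤ (ε / 4) ^ 2 := by gcongr
      have : ρ ^ 2 * π * (C₁ * (s ^ 3) ^ k) ^ 2 ≤ ρ ^ 2 * π * (ε / 4) ^ 2 := by gcongr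
      linarith [hc z hz k]
    have h5 := le_of_mul_le_mul_left h4 (by positivity)
    have h6 : ‖c z k - W z‖ ≤ ε / 2 :=
      (abs_le_of_sq_le_sq' (h5.trans (by ring_nf; rfl) : _ ≤ (ε / 2) ^ 2) (by positivity)).2
    rw [dist_eq_norm]; linarith
  have hstep : ∀ z ∈ D, ∀ k, dist (c z k) (W z) ≤ C₁ * (s ^ 3) ^ k / (1 - s ^ 3) := by
    intro z hz k
    refine dist_le_of_le_geometric_of_tendsto _ _ (pow_lt_one₀ hs.le hs1 (by norm_num))
      (fun n => ?_) (hlim z hz) k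
    rw [dist_eq_norm]
    have hdec : s ^ (14 * (n + 1)) ≤ s ^ (14 * n) := pow_le_pow_of_le_one hs.le hs1.le (by lia)
    have hdec' : s ^ (4 * (n + 1)) ≤ s ^ (4 * n) := pow_le_pow_of_le_one hs.le hs1.le (by lia)
    refine key n _ _ z _ _ (hc z hz n) ((hc z hz (n + 1)).trans (by gcongr)) ?_
    exact sq_norm_sub_le_setIntegral (z := z) (by positivity) (ball_subset_ball (by gcongr)) subset_rfl
      (hint z hz n _) (hint z hz (n + 1) _)
  set C₂ := C₁ + 2 * (C₁ / (1 - s ^ 3)) with hC₂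
  have hs31 : 0 < 1 - s ^ 3 := by linarith [pow_lt_one₀ hs.le hs1 (n := 3) (by norm_num)]
  have hC₂0 : 0 ≤ C₂ := by positivity
  have hcmp : ∀ z ∈ D, ∀ z' ∈ D, ∀ k : ℕ, dist z z' ≤ s ^ (4 * k) * r / 2 →
      ‖W z - W z'‖ ≤ C₂ * (s ^ 3) ^ k := by
    intro z hz z' hz' k hd
    have hdec : s ^ (14 * (k + 1)) ≤ s ^ (14 * k) := pow_le_pow_of_le_one hs.le hs1.le (by lia)
    have h1 := key k (c z k) (c z' (k + 1)) z _ _ (hc z hz k)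
      ((hc z' hz' (k + 1)).trans (by gcongr))
      (sq_norm_sub_le_setIntegral (z := z') (by positivity) (ball_subset_ball' (by
        rw [dist_comm z' z]
        have : s ^ (4 * (k + 1)) ≤ s ^ (4 * k) / 2 := by
          have e : s ^ (4 * (k + 1)) = s ^ (4 * k) * s ^ 4 := by ring
          have : s ^ 4 ≤ 1 / 2 := (pow_le_of_le_one hs.le hs1.le (by norm_num)).trans hs'
          rw [e]
          have h0 : 0 < s ^ (4 * k) := by positivity
          nlinarith
        nlinarith)) subset_rfl (hint z hz k _) (hint z' hz' (k + 1) _))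
    have h2 := hstep z hz k
    have h3 := hstep z' hz' (k + 1)
    have h4 : C₁ * (s ^ 3) ^ (k + 1) / (1 - s ^ 3) ≤ C₁ * (s ^ 3) ^ k / (1 - s ^ 3) := by
      gcongr ?_ / _
      exact mul_le_mul_of_nonneg_left (pow_le_pow_of_le_one (by positivity)
        (pow_le_one₀ hs.le hs1.le) (by lia)) hC₁0
    rw [← dist_eq_norm] at h1 ⊢
    have h5 := dist_triangle4 (W z) (c z k) (c z' (k + 1)) (W z')
    rw [dist_comm (W z) (c z k)] at h5
    have e : C₂ * (s ^ 3) ^ k = C₁ * (s ^ 3) ^ k + 2 * (C₁ * (s ^ 3) ^ k / (1 - s ^ 3)) := by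
      rw [hC₂]; ring
    linarith
  refine ⟨C₂ / s ^ 3 * (2 / r) ^ (3 / 4 : ℝ), by positivity, fun z hz z' hz' hd => ?_⟩
  rcases eq_or_lt_of_le (dist_nonneg (x := z) (y := z')) with h0 | h0
  · rw [dist_eq_zero.1 h0.symm]; simp only [sub_self, norm_zero]; positivity
  obtain ⟨k, hk1, hk2⟩ := exists_nat_pow_near_of_lt_one (x := 2 / r * dist z z') (y := s ^ 4)
    (by positivity) (by rw [div_mul_eq_mul_div, div_le_one hr]; linarith) (by positivity)
    (pow_lt_one₀ hs.le hs1 (by norm_num))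
  have h1 := hcmp z hz z' hz' k (by
    rw [pow_mul]
    rw [div_mul_eq_mul_div, div_le_iff₀ hr] at hk2; linarith)
  refine h1.trans ?_
  have h2 : (s ^ 3) ^ (k + 1) ≤ (2 / r * dist z z') ^ (3 / 4 : ℝ) := by
    have e : (s ^ 3) ^ (k + 1) = ((s ^ 4) ^ (k + 1)) ^ (3 / 4 : ℝ) := by
      rw [← pow_mul, ← pow_mul, ← Real.rpow_natCast, ← Real.rpow_natCast, ← Real.rpow_mul hs.le]
      congr 1; push_cast; ring
    rw [e]
    exact Real.rpow_le_rpow (by positivity) hk1.le (by norm_num)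
  rw [Real.mul_rpow (by positivity) dist_nonneg] at h2
  calc C₂ * (s ^ 3) ^ k = C₂ / s ^ 3 * (s ^ 3) ^ (k + 1) := by field_simp; ring
    _ ≤ C₂ / s ^ 3 * ((2 / r) ^ (3 / 4 : ℝ) * dist z z' ^ (3 / 4 : ℝ)) := by gcongr
    _ = _ := by ring

end

section

lemma hasFDerivAt_const_mul_conj (a z : ℂ) : HasFDerivAt (𝕜 := ℝ)
    (fun z : ℂ => a * (starRingEnd ℂ) z) (a • (Complex.conjCLE : ℂ →L[ℝ] ℂ)) z :=
  (Complex.conjCLE.hasFDerivAt (x := z)).const_mul a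

lemma exists_const_of_dbar_contraction {Z : ℂ → ℂ} {g : ℂ → ℝ} {U : Set ℂ} (hU : IsOpen U)
    {z₀ : ℂ} {r θ ε K : ℝ} (hr : 0 < r) (hsub : closedBall z₀ r ⊆ U) (hZ : ContDiffOn ℝ 1 Z U)
    (hg : ∀ z ∈ U, dbar Z z = g z) (hε : 0 ≤ ε)
    (hlip : ∀ z ∈ U, ∀ z' ∈ U, |g z - g z'| ≤
      ε * ‖fderiv ℝ Z z 1 - fderiv ℝ Z z' 1‖ + K * dist z z') (hK : 0 ≤ K)
    (hθ : 0 < θ) (hθ' : θ ≤ 1 / 8) (c : ℂ) :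
    ∃ c' : ℂ, ∫ z in ball z₀ (θ * r), ‖fderiv ℝ Z z 1 - c'‖ ^ 2 ≤
      16384 * ((θ ^ 4 + 2 * ε ^ 2) * (∫ z in ball z₀ r, ‖fderiv ℝ Z z 1 - c‖ ^ 2) +
        8 * π * K ^ 2 * r ^ 4) := by
  have hbU : ball z₀ r ⊆ U := ball_subset_closedBall.trans hsub
  set W : ℂ → ℂ := fun z => fderiv ℝ Z z 1 with hW
  have hWc : ContinuousOn W U :=
    (hZ.continuousOn_fderiv_of_isOpen hU le_rfl).clm_apply continuousOn_const
  have hZd : ∀ z ∈ U, DifferentiableAt ℝ Z z := fun z hz =>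
    (hZ.contDiffAt (hU.mem_nhds hz)).differentiableAt one_ne_zero
  have hpair : ∀ z ∈ ball z₀ r, ∀ z' ∈ ball z₀ r,
      g z - ε * ‖W z - c‖ ≤ g z' + ε * ‖W z' - c‖ + 2 * K * r := by
    intro z hz z' hz'
    have h1 := (abs_le.1 (hlip z (hbU hz) z' (hbU hz'))).2
    have h2 : ‖W z - W z'‖ ≤ ‖W z - c‖ + ‖W z' - c‖ := by
      rw [norm_sub_rev (W z') c]; exact norm_sub_le_norm_sub_add_norm_sub _ _ _
    have h3 : dist z z' ≤ 2 * r := by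
      rw [mem_ball] at hz hz'
      linarith [dist_triangle_right z z' z₀]
    have h4 : ε * ‖W z - W z'‖ ≤ ε * (‖W z - c‖ + ‖W z' - c‖) := by gcongr
    have h5 : K * dist z z' ≤ K * (2 * r) := by gcongr
    change g z - g z' ≤ ε * ‖W z - W z'‖ + _ at h1
    linarith
  have hne : (ball z₀ r).Nonempty := ⟨z₀, mem_ball_self hr⟩
  obtain ⟨b, hb⟩ : ∃ b : ℝ, ∀ z ∈ ball z₀ r, |g z - b| ≤ ε * ‖W z - c‖ + 2 * K * r := by
    refine ⟨sSup ((fun z => g z - ε * ‖W z - c‖) '' ball z₀ r), fun z hz => ?_⟩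
    have hbdd : BddAbove ((fun z => g z - ε * ‖W z - c‖) '' ball z₀ r) :=
      ⟨_, by rintro _ ⟨y, hy, rfl⟩; exact hpair y hy z hz⟩
    have h1 := le_csSup hbdd (mem_image_of_mem _ hz)
    have h2 : sSup ((fun z => g z - ε * ‖W z - c‖) '' ball z₀ r) ≤
        g z + ε * ‖W z - c‖ + 2 * K * r :=
      csSup_le (hne.image _) (by rintro _ ⟨y, hy, rfl⟩; exact hpair y hy z hz)
    have : 0 ≤ K * r := by positivity
    rw [abs_le]; constructor <;> linarith
  set Q : ℂ → ℂ := fun z => (b / 2 : ℂ) * (starRingEnd ℂ) z with hQ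
  have hQd : ∀ z, DifferentiableAt ℝ Q z := fun z => (hasFDerivAt_const_mul_conj _ z).differentiableAt
  have hQp : ∀ z, fderiv ℝ Q z 1 = b / 2 := fun z => by
    rw [hQ, (hasFDerivAt_const_mul_conj _ z).fderiv]; simp
  have hQb : ∀ z, dbar Q z = b := fun z => by
    rw [dbar, hQp, hQ, (hasFDerivAt_const_mul_conj _ z).fderiv]; simp
    ring_nf; simp; ring
  have hQs : ContDiff ℝ 1 Q := by
    have : ContDiff ℝ 1 (starRingEnd ℂ) := Complex.conjCLE.contDiff
    exact contDiff_const.mul this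
  obtain ⟨c', hc'⟩ := exists_const_setIntegral_le (Z := Z - Q) hU hr hsub (hZ.sub hQs.contDiffOn) hθ hθ'
    (c - b / 2)
  have eW : ∀ z ∈ U, fderiv ℝ (Z - Q) z 1 = W z - b / 2 := fun z hz => by
    rw [fderiv_sub (hZd z hz) (hQd z), sub_apply, hQp]
  have eb : ∀ z ∈ U, dbar (Z - Q) z = ((g z - b : ℝ) : ℂ) := fun z hz => by
    have := dbar_sub (hZd z hz) (hQd z)
    rw [hQb, hg z hz] at this
    push_cast
    exact this
  have hθr : ball z₀ (θ * r) ⊆ U := (ball_subset_ball (by nlinarith)).trans hbU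
  refine ⟨c' + b / 2, ?_⟩
  have i1 : ∫ z in ball z₀ (θ * r), ‖fderiv ℝ (Z - Q) z 1 - c'‖ ^ 2 =
      ∫ z in ball z₀ (θ * r), ‖W z - (c' + b / 2)‖ ^ 2 :=
    setIntegral_congr_fun measurableSet_ball fun z hz => by
      simp only [eW z (hθr hz)]; congr 2; ring
  have i2 : ∫ z in ball z₀ r, ‖fderiv ℝ (Z - Q) z 1 - (c - b / 2)‖ ^ 2 =
      ∫ z in ball z₀ r, ‖W z - c‖ ^ 2 :=
    setIntegral_congr_fun measurableSet_ball fun z hz => by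
      simp only [eW z (hbU hz)]; congr 2; ring
  have hint : IntegrableOn (fun z => ‖W z - c‖ ^ 2) (ball z₀ r) :=
    IntegrableOn.mono_set (ContinuousOn.integrableOn_compact (isCompact_closedBall z₀ r)
      (((hWc.mono hsub).sub continuousOn_const).norm.pow 2)) ball_subset_closedBall
  have i3 : ∫ z in ball z₀ r, ‖dbar (Z - Q) z‖ ^ 2 ≤
      2 * ε ^ 2 * (∫ z in ball z₀ r, ‖W z - c‖ ^ 2) + 8 * π * K ^ 2 * r ^ 4 := by
    have hconst : ∫ _ in ball z₀ r, 8 * K ^ 2 * r ^ 2 = 8 * π * K ^ 2 * r ^ 4 := by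
      simp [Measure.real, Complex.volume_ball, hr.le]; ring
    have hcI : IntegrableOn (fun _ : ℂ => 8 * K ^ 2 * r ^ 2) (ball z₀ r) :=
      integrableOn_const measure_ball_lt_top.ne
    rw [← hconst, ← integral_const_mul, ← integral_add (hint.const_mul _) hcI]
    refine integral_mono_of_nonneg (ae_of_all _ fun z => by positivity)
      ((hint.const_mul _).add hcI) ?_
    filter_upwards [ae_restrict_mem measurableSet_ball] with z hz
    have h1 := hb z hz
    rw [eb z (hbU hz), Complex.norm_real, norm_eq_abs]
    have h2 : |g z - b| ^ 2 ≤ (ε * ‖W z - c‖ + 2 * K * r) ^ 2 := by gcongr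
    nlinarith [sq_nonneg (ε * ‖W z - c‖ - 2 * K * r)]
  rw [i1, i2] at hc'
  refine hc'.trans ?_
  nlinarith

/-- Hölder continuity for a `dbar` equation whose right-hand side is a small multiple of the
unknown. -/
theorem exists_holder_of_dbar_contraction : ∃ ε : ℝ, 0 < ε ∧ ∀ {Z : ℂ → ℂ} {g : ℂ → ℝ} {U : Set ℂ}
    {z₀ : ℂ} {R K : ℝ}, IsOpen U → 0 < R → closedBall z₀ (2 * R) ⊆ U → ContDiffOn ℝ 1 Z U →
    (∀ z ∈ U, dbar Z z = g z) → 0 ≤ K → (∀ z ∈ U, ∀ z' ∈ U, |g z - g z'| ≤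
      ε * ‖fderiv ℝ Z z 1 - fderiv ℝ Z z' 1‖ + K * dist z z') →
    ∃ C, 0 ≤ C ∧ ∀ z ∈ closedBall z₀ (R / 4), ∀ z' ∈ closedBall z₀ (R / 4),
      ‖fderiv ℝ Z z 1 - fderiv ℝ Z z' 1‖ ≤ C * dist z z' ^ (3 / 4 : ℝ) := by
  obtain ⟨s, hs⟩ : ∃ s : ℝ, s = 1 / 256 := ⟨_, rfl⟩
  have hs0 : 0 < s := by rw [hs]; norm_num
  have hs1 : s < 1 := by rw [hs]; norm_num
  refine ⟨s ^ 9, by positivity, ?_⟩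
  intro Z g U z₀ R K hU hR hsub hZ hg hK hlip
  set W : ℂ → ℂ := fun z => fderiv ℝ Z z 1 with hW
  have hWc : ContinuousOn W U :=
    (hZ.continuousOn_fderiv_of_isOpen hU le_rfl).clm_apply continuousOn_const
  have hcen : ∀ z ∈ closedBall z₀ (R / 4), closedBall z R ⊆ closedBall z₀ (2 * R) := fun z hz => by
    refine closedBall_subset_closedBall' ?_
    rw [mem_closedBall] at hz; linarith
  have hint : IntegrableOn (fun z => ‖W z‖ ^ 2) (closedBall z₀ (2 * R)) :=
    ContinuousOn.integrableOn_compact (isCompact_closedBall _ _) ((hWc.mono hsub).norm.pow 2)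
  set L := (∫ z in closedBall z₀ (2 * R), ‖W z‖ ^ 2) + 16 * π * 16384 * K ^ 2 * R ^ 4 / s ^ 14
    with hL
  have hI0 : 0 ≤ ∫ z in closedBall z₀ (2 * R), ‖W z‖ ^ 2 := integral_nonneg fun z => by positivity
  have hL0 : 0 ≤ L := by positivity
  have main : ∀ z ∈ closedBall z₀ (R / 4), ∀ k : ℕ,
      ∃ c : ℂ, ∫ w in ball z (s ^ (4 * k) * R), ‖W w - c‖ ^ 2 ≤ L * s ^ (14 * k) := by
    intro z hz k
    induction k with
    | zero =>
      refine ⟨0, ?_⟩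
      simp only [mul_zero, pow_zero, one_mul, sub_zero, mul_one]
      have : ∫ w in ball z R, ‖W w‖ ^ 2 ≤ ∫ z in closedBall z₀ (2 * R), ‖W z‖ ^ 2 :=
        setIntegral_mono_set hint (ae_of_all _ fun z => by positivity)
          (ball_subset_closedBall.trans (hcen z hz)).eventuallyLE
      have h2 : 0 ≤ 16 * π * 16384 * K ^ 2 * R ^ 4 / s ^ 14 := by positivity
      linarith
    | succ k ih =>
      obtain ⟨c, hc⟩ := ih
      have hpk : s ^ (4 * k) ≤ 1 := pow_le_one₀ hs0.le hs1.le
      obtain ⟨c', hc'⟩ := exists_const_of_dbar_contraction hU (z₀ := z) (r := s ^ (4 * k) * R)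
        (θ := s ^ 4) (by positivity) ((closedBall_subset_closedBall (by nlinarith)).trans
          ((hcen z hz).trans hsub)) hZ hg (by positivity) hlip hK (by positivity)
        (by rw [hs]; norm_num) c
      refine ⟨c', ?_⟩
      have e1 : s ^ (4 * (k + 1)) * R = s ^ 4 * (s ^ (4 * k) * R) := by ring
      rw [e1]
      refine hc'.trans ?_
      have e2 : 16384 * (s ^ 4) ^ 4 + 16384 * (2 * (s ^ 9) ^ 2) ≤ s ^ 14 / 2 := by
        rw [hs]; norm_num
      have e3 : s ^ (14 * (k + 1)) = s ^ 14 * s ^ (14 * k) := by ring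
      have e4 : (s ^ (4 * k) * R) ^ 4 ≤ s ^ (14 * k) * R ^ 4 := by
        rw [mul_pow, ← pow_mul]
        gcongr ?_ * _
        exact pow_le_pow_of_le_one hs0.le hs1.le (by lia)
      have e5 : 16 * π * 16384 * K ^ 2 * R ^ 4 ≤ L * s ^ 14 := by
        rw [hL, add_mul, div_mul_cancel₀ _ (by positivity)]
        have : 0 ≤ (∫ z in closedBall z₀ (2 * R), ‖W z‖ ^ 2) * s ^ 14 := by positivity
        linarith
      rw [e3]
      have e6 : 16384 * ((s ^ 4) ^ 4 + 2 * (s ^ 9) ^ 2) *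
          (∫ z in ball z (s ^ (4 * k) * R), ‖W z - c‖ ^ 2) ≤ s ^ 14 / 2 * (L * s ^ (14 * k)) := by
        refine mul_le_mul (by linarith) hc (integral_nonneg fun z => by positivity) (by positivity)
      have e7 : 16384 * (8 * π * K ^ 2 * (s ^ (4 * k) * R) ^ 4) ≤ s ^ 14 / 2 * (L * s ^ (14 * k)) := by
        calc 16384 * (8 * π * K ^ 2 * (s ^ (4 * k) * R) ^ 4)
            ≤ 16384 * (8 * π * K ^ 2 * (s ^ (14 * k) * R ^ 4)) := by gcongr
          _ = 16 * π * 16384 * K ^ 2 * R ^ 4 * (s ^ (14 * k) / 2) := by ring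
          _ ≤ L * s ^ 14 * (s ^ (14 * k) / 2) := by gcongr
          _ = _ := by ring
      calc _ = 16384 * ((s ^ 4) ^ 4 + 2 * (s ^ 9) ^ 2) *
          (∫ z in ball z (s ^ (4 * k) * R), ‖W z - c‖ ^ 2) +
          16384 * (8 * π * K ^ 2 * (s ^ (4 * k) * R) ^ 4) := by ring
        _ ≤ _ := by linarith
  obtain ⟨C, hC, h⟩ := exists_holder_of_campanato hs0 (by rw [hs]; norm_num) hR hL0 hWc
    (fun z hz => (hcen z hz).trans hsub) main
  refine ⟨C, hC, fun z hz z' hz' => h z hz z' hz' ?_⟩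
  rw [mem_closedBall] at hz hz'
  linarith [dist_triangle_right z z' z₀]

end

section

lemma exists_taylor_two_of_norm_le {H : ℂ → ℂ} {z₀ : ℂ} {ρ m : ℝ} (hρ : 0 < ρ)
    (hH : DifferentiableOn ℂ H (ball z₀ ρ)) (hm : ∀ z ∈ ball z₀ ρ, ‖H z‖ ≤ m) :
    ∃ a b c : ℂ, ∀ z ∈ ball z₀ ρ, ‖H z - (a + b * (z - z₀) + c * (z - z₀) ^ 2)‖ ≤
      8 * m / ρ ^ 3 * ‖z - z₀‖ ^ 3 := by
  have hz₀ : z₀ ∈ ball z₀ ρ := mem_ball_self hρ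
  have step : ∀ (f : ℂ → ℂ) (N : ℝ), DifferentiableOn ℂ f (ball z₀ ρ) →
      (∀ z ∈ ball z₀ ρ, ‖f z‖ ≤ N) → DifferentiableOn ℂ (dslope f z₀) (ball z₀ ρ) ∧
      ∀ z ∈ ball z₀ ρ, ‖dslope f z₀ z‖ ≤ 2 * N / ρ := by
    intro f N hf hN
    refine ⟨(Complex.differentiableOn_dslope (isOpen_ball.mem_nhds hz₀)).2 hf, fun z hz => ?_⟩
    refine Complex.norm_dslope_le_div_of_mapsTo_ball hf (fun y hy => ?_) hz
    rw [mem_closedBall, dist_eq_norm]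
    linarith [norm_sub_le (f y) (f z₀), hN y hy, hN z₀ hz₀]
  obtain ⟨d1, b1⟩ := step H m hH hm
  obtain ⟨d2, b2⟩ := step _ _ d1 b1
  obtain ⟨d3, b3⟩ := step _ _ d2 b2
  refine ⟨H z₀, dslope H z₀ z₀, dslope (dslope H z₀) z₀ z₀, fun z hz => ?_⟩
  have e1 := sub_smul_dslope H z₀ z
  have e2 := sub_smul_dslope (dslope H z₀) z₀ z
  have e3 := sub_smul_dslope (dslope (dslope H z₀) z₀) z₀ z
  simp only [smul_eq_mul] at e1 e2 e3
  have e : H z - (H z₀ + dslope H z₀ z₀ * (z - z₀) + dslope (dslope H z₀) z₀ z₀ * (z - z₀) ^ 2) =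
      dslope (dslope (dslope H z₀) z₀) z₀ z * (z - z₀) ^ 3 := by
    linear_combination (-1 : ℂ) * e1 - (z - z₀) * e2 - (z - z₀) ^ 2 * e3
  rw [e, norm_mul, norm_pow]
  gcongr
  refine (b3 z hz).trans (le_of_eq ?_)
  field_simp; ring

lemma norm_coeff_le_of_quadratic {a b c z₀ : ℂ} {r m : ℝ} (hr : 0 < r)
    (h : ∀ z ∈ ball z₀ r, ‖a + b * (z - z₀) + c * (z - z₀) ^ 2‖ ≤ m) :
    ‖a‖ ≤ m ∧ ‖b‖ ≤ 2 * m / r ∧ ‖c‖ ≤ 8 * m / r ^ 2 := by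
  have h0 := h z₀ (mem_ball_self hr)
  have h1 := h (z₀ + (r / 2 : ℝ)) (by simp [abs_of_pos hr]; linarith)
  have h2 := h (z₀ - (r / 2 : ℝ)) (by simp [abs_of_pos hr]; linarith)
  simp only [sub_self, mul_zero, add_zero, ne_eq, OfNat.ofNat_ne_zero, not_false_eq_true,
    zero_pow] at h0
  simp only [add_sub_cancel_left, sub_sub_cancel_left] at h1 h2
  have hrn : ‖((r / 2 : ℝ) : ℂ)‖ = r / 2 := by rw [Complex.norm_real, norm_of_nonneg (by positivity)]
  have h22 : ‖(2 : ℂ)‖ = 2 := by norm_num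
  refine ⟨h0, ?_, ?_⟩
  · have e : (2 : ℂ) * (b * ((r / 2 : ℝ) : ℂ)) = (a + b * ((r / 2 : ℝ) : ℂ) + c * ((r / 2 : ℝ) : ℂ) ^ 2) -
        (a + b * (-((r / 2 : ℝ) : ℂ)) + c * (-((r / 2 : ℝ) : ℂ)) ^ 2) := by ring
    have := norm_sub_le (a + b * ((r / 2 : ℝ) : ℂ) + c * ((r / 2 : ℝ) : ℂ) ^ 2)
      (a + b * (-((r / 2 : ℝ) : ℂ)) + c * (-((r / 2 : ℝ) : ℂ)) ^ 2)
    rw [← e, norm_mul, norm_mul, hrn] at this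
    rw [h22] at this
    rw [le_div_iff₀ hr]
    linarith
  · have e : (2 : ℂ) * (c * ((r / 2 : ℝ) : ℂ) ^ 2) = (a + b * ((r / 2 : ℝ) : ℂ) + c * ((r / 2 : ℝ) : ℂ) ^ 2) +
        (a + b * (-((r / 2 : ℝ) : ℂ)) + c * (-((r / 2 : ℝ) : ℂ)) ^ 2) - 2 * a := by ring
    have h3 := norm_sub_le ((a + b * ((r / 2 : ℝ) : ℂ) + c * ((r / 2 : ℝ) : ℂ) ^ 2) +
      (a + b * (-((r / 2 : ℝ) : ℂ)) + c * (-((r / 2 : ℝ) : ℂ)) ^ 2)) (2 * a)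
    have h4 := norm_add_le (a + b * ((r / 2 : ℝ) : ℂ) + c * ((r / 2 : ℝ) : ℂ) ^ 2)
      (a + b * (-((r / 2 : ℝ) : ℂ)) + c * (-((r / 2 : ℝ) : ℂ)) ^ 2)
    rw [← e, norm_mul, norm_mul, norm_pow, hrn] at h3
    have h5 : ‖2 * a‖ ≤ 2 * m := by rw [norm_mul]; norm_num; linarith
    rw [le_div_iff₀ (by positivity)]
    rw [h22] at h3
    nlinarith

lemma dbar_quadratic (a b c z₀ z : ℂ) :
    dbar (fun z => a + b * (z - z₀) + c * (z - z₀) ^ 2) z = 0 := by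
  have h : HasFDerivAt (𝕜 := ℂ) (fun z : ℂ => a + b * (z - z₀) + c * (z - z₀) ^ 2)
      (fderiv ℂ (fun z : ℂ => a + b * (z - z₀) + c * (z - z₀) ^ 2) z) z :=
    DifferentiableAt.hasFDerivAt (by fun_prop)
  rw [dbar, (h.restrictScalars ℝ).fderiv]
  simp only [ContinuousLinearMap.coe_restrictScalars']
  set L := fderiv ℂ (fun z : ℂ => a + b * (z - z₀) + c * (z - z₀) ^ 2) z
  have : L Complex.I = Complex.I * L 1 := by
    rw [← smul_eq_mul, ← map_smul]; simp
  rw [this, ← mul_assoc, Complex.I_mul_I]; ring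

lemma exists_quadratic_step {Z : ℂ → ℂ} {z₀ a b c : ℂ} {r K N s : ℝ} (hr : 0 < r) (hs : 0 < s)
    (hs' : s ≤ 1 / 2) (hK : 0 ≤ K)
    (hZ : ContDiffOn ℝ 1 Z (ball z₀ r)) (hd : ∀ z ∈ ball z₀ r, ‖dbar Z z‖ ≤ K)
    (hN : ∀ z ∈ ball z₀ r, ‖Z z - (a + b * (z - z₀) + c * (z - z₀) ^ 2)‖ ≤ N) :
    ∃ a' b' c' : ℂ, ∀ z ∈ ball z₀ (s ^ 2 * r),
      ‖Z z - (a' + b' * (z - z₀) + c' * (z - z₀) ^ 2)‖ ≤ 64 * s ^ 6 * (N + 2 * r * K) + 2 * r * K := by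
  set P : ℂ → ℂ := fun z => a + b * (z - z₀) + c * (z - z₀) ^ 2 with hP
  have hPd : ContDiff ℝ 1 P := by
    have : ContDiff ℝ 1 (fun z : ℂ => z - z₀) := contDiff_id.sub contDiff_const
    exact (contDiff_const.add (contDiff_const.mul this)).add (contDiff_const.mul (this.pow 2))
  obtain ⟨H, T, hHT, hH, -, hTb, -⟩ := exists_holomorphic_add (Z := fun z => Z z - P z) hr
    (hZ.sub hPd.contDiffOn)
  have hT := hTb K (fun z hz => by
    rw [dbar_sub ((hZ.contDiffAt (isOpen_ball.mem_nhds hz)).differentiableAt one_ne_zero)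
      (hPd.differentiable one_ne_zero z), hP, dbar_quadratic, sub_zero]
    exact hd z hz)
  have hHb : ∀ z ∈ ball z₀ (r / 2), ‖H z‖ ≤ N + 2 * r * K := by
    intro z hz
    have e : H z = (Z z - P z) - T z := by rw [hHT z hz]; ring
    rw [e]
    exact (norm_sub_le _ _).trans (add_le_add (hN z (ball_subset_ball (by linarith) hz)) (hT z hz))
  obtain ⟨a', b', c', h⟩ := exists_taylor_two_of_norm_le (by positivity) hH hHb
  refine ⟨a + a', b + b', c + c', fun z hz => ?_⟩
  have hz2 : z ∈ ball z₀ (r / 2) := by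
    refine ball_subset_ball ?_ hz
    have : s ^ 2 ≤ 1 / 2 := by nlinarith
    nlinarith
  have e : Z z - (a + a' + (b + b') * (z - z₀) + (c + c') * (z - z₀) ^ 2) =
      (H z - (a' + b' * (z - z₀) + c' * (z - z₀) ^ 2)) + T z := by
    have := hHT z hz2
    simp only [hP] at this
    linear_combination this
  rw [e]
  refine (norm_add_le _ _).trans (add_le_add ((h z hz2).trans ?_) (hT z hz2))
  rw [mem_ball, dist_eq_norm] at hz
  have hN0 : 0 ≤ N := (norm_nonneg _).trans (hN z₀ (mem_ball_self hr))
  calc 8 * (N + 2 * r * K) / (r / 2) ^ 3 * ‖z - z₀‖ ^ 3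
      ≤ 8 * (N + 2 * r * K) / (r / 2) ^ 3 * (s ^ 2 * r) ^ 3 := by gcongr
    _ = _ := by field_simp; ring

/-- A `C¹` function whose `dbar` is `O(|z - z₀|^{3/2})` is a holomorphic quadratic polynomial up to
`O(|z - z₀|^{5/2})`. -/
theorem exists_quadratic_approx : ∃ C₀ : ℝ, 0 < C₀ ∧ ∀ {Z : ℂ → ℂ} {z₀ : ℂ} {r K M : ℝ}, 0 < r →
    0 ≤ K → 0 ≤ M → ContDiffOn ℝ 1 Z (ball z₀ r) → (∀ z ∈ ball z₀ r, ‖Z z‖ ≤ M) →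
    (∀ z ∈ ball z₀ r, ‖dbar Z z‖ ≤ K * ‖z - z₀‖ ^ (3 / 2 : ℝ)) →
    ∃ a b c : ℂ, ∀ z ∈ ball z₀ r, ‖Z z - (a + b * (z - z₀) + c * (z - z₀) ^ 2)‖ ≤
      C₀ * (K + M / r ^ (5 / 2 : ℝ)) * ‖z - z₀‖ ^ (5 / 2 : ℝ) := by
  obtain ⟨s, hs⟩ : ∃ s : ℝ, s = 1 / 128 := ⟨_, rfl⟩
  have hs0 : 0 < s := by rw [hs]; norm_num
  have hs2 : s ≤ 1 / 2 := by rw [hs]; norm_num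
  have hs1 : s < 1 := by linarith
  set C₁ := 1 + 4 + 8 / s ^ 2 + 32 / s ^ 4 with hC₁
  refine ⟨C₁ * (8 / s ^ 5) / s ^ 10, by positivity, ?_⟩
  intro Z z₀ r K M hr hK hM hZ hZM hd
  set ϱ := r ^ (5 / 2 : ℝ) with hϱ
  have hϱ0 : 0 < ϱ := Real.rpow_pos_of_pos hr _
  set L := M + 8 * K * ϱ / s ^ 5 with hL
  have hL0 : 0 ≤ L := by positivity
  have hpk : ∀ k : ℕ, s ^ (2 * k) ≤ 1 := fun k => pow_le_one₀ hs0.le hs1.le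
  have hsub : ∀ k : ℕ, ball z₀ (s ^ (2 * k) * r) ⊆ ball z₀ r := fun k =>
    ball_subset_ball (by nlinarith [hpk k])
  have h52 : ∀ k : ℕ, (s ^ (2 * k) * r) * (s ^ (2 * k) * r) ^ (3 / 2 : ℝ) = s ^ (5 * k) * ϱ := by
    intro k
    have e1 : (s ^ (2 * k) * r) * (s ^ (2 * k) * r) ^ (3 / 2 : ℝ) = (s ^ (2 * k) * r) ^ (5 / 2 : ℝ) := by
      rw [show (5 / 2 : ℝ) = 1 + 3 / 2 by norm_num, Real.rpow_add (by positivity), Real.rpow_one]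
    rw [e1, Real.mul_rpow (by positivity) hr.le, ← Real.rpow_natCast, ← Real.rpow_natCast,
      ← Real.rpow_mul hs0.le]
    congr 2; push_cast; ring
  have main : ∀ k : ℕ, ∃ P : ℂ × ℂ × ℂ, ∀ z ∈ ball z₀ (s ^ (2 * k) * r),
      ‖Z z - (P.1 + P.2.1 * (z - z₀) + P.2.2 * (z - z₀) ^ 2)‖ ≤ L * s ^ (5 * k) := by
    intro k
    induction k with
    | zero =>
      refine ⟨(0, 0, 0), fun z hz => ?_⟩
      simp only [mul_zero, pow_zero, one_mul, zero_mul, add_zero, sub_zero, mul_one] at hz ⊢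
      refine (hZM z hz).trans ?_
      have : 0 ≤ 8 * K * ϱ / s ^ 5 := by positivity
      linarith
    | succ k ih =>
      obtain ⟨⟨a, b, c⟩, h⟩ := ih
      obtain ⟨a', b', c', h'⟩ := exists_quadratic_step (K := K * (s ^ (2 * k) * r) ^ (3 / 2 : ℝ))
        (by positivity) hs0 hs2 (by positivity)
        (hZ.mono (hsub k)) (fun z hz => (hd z (hsub k hz)).trans (by
          rw [mem_ball, dist_eq_norm] at hz
          gcongr)) h
      refine ⟨(a', b', c'), fun z hz => ?_⟩
      have e1 : s ^ (2 * (k + 1)) * r = s ^ 2 * (s ^ (2 * k) * r) := by ring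
      rw [e1] at hz
      refine (h' z hz).trans ?_
      have e2 : 2 * (s ^ (2 * k) * r) * (K * (s ^ (2 * k) * r) ^ (3 / 2 : ℝ)) =
        2 * K * ϱ * s ^ (5 * k) := by
        linear_combination (2 * K) * h52 k
      have e3 : s ^ (5 * (k + 1)) = s ^ 5 * s ^ (5 * k) := by ring
      have e4 : 8 * K * ϱ ≤ L * s ^ 5 := by
        rw [hL, add_mul, div_mul_cancel₀ _ (by positivity)]
        have : 0 ≤ M * s ^ 5 := by positivity
        linarith
      rw [e2, e3]
      have e5 : 64 * s ^ 6 = s ^ 5 / 2 := by rw [hs]; norm_num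
      have e6 : s ^ 5 / 2 ≤ 1 := by rw [hs]; norm_num
      have e7 : 0 < s ^ (5 * k) := by positivity
      rw [e5]
      have h8 : 0 ≤ K * ϱ := by positivity
      have : (s ^ 5 / 2 * (L + 2 * K * ϱ) + 2 * K * ϱ) ≤ L * s ^ 5 := by nlinarith
      nlinarith
  choose P hP using main
  have hdiff : ∀ k, ‖(P (k + 1)).1 - (P k).1‖ ≤ 2 * L * s ^ (5 * k) ∧
      ‖(P (k + 1)).2.1 - (P k).2.1‖ ≤ 2 * (2 * L * s ^ (5 * k)) / (s ^ (2 * (k + 1)) * r) ∧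
      ‖(P (k + 1)).2.2 - (P k).2.2‖ ≤ 8 * (2 * L * s ^ (5 * k)) / (s ^ (2 * (k + 1)) * r) ^ 2 := by
    intro k
    refine norm_coeff_le_of_quadratic (z₀ := z₀) (by positivity) fun z hz => ?_
    have h1 := hP (k + 1) z hz
    have h2 := hP k z (ball_subset_ball (by
      gcongr ?_ * _
      exact pow_le_pow_of_le_one hs0.le hs1.le (by lia)) hz)
    have h3 : s ^ (5 * (k + 1)) ≤ s ^ (5 * k) := pow_le_pow_of_le_one hs0.le hs1.le (by lia)
    have h4 : L * s ^ (5 * (k + 1)) ≤ L * s ^ (5 * k) := by gcongr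
    have h5 := norm_sub_le (Z z - ((P k).1 + (P k).2.1 * (z - z₀) + (P k).2.2 * (z - z₀) ^ 2))
      (Z z - ((P (k + 1)).1 + (P (k + 1)).2.1 * (z - z₀) + (P (k + 1)).2.2 * (z - z₀) ^ 2))
    refine le_trans (le_of_eq ?_) (h5.trans (by linarith))
    congr 1; ring
  have lim : ∀ (u : ℕ → ℂ) (D : ℝ) (j : ℕ), j ≠ 0 → 0 ≤ D → (∀ k, ‖u (k + 1) - u k‖ ≤ D * (s ^ j) ^ k) →
      ∃ l, ∀ k, ‖u k - l‖ ≤ 2 * D * (s ^ j) ^ k := by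
    intro u D j hj hD hu
    have hsj : s ^ j ≤ 1 / 2 := (pow_le_of_le_one hs0.le hs1.le hj).trans hs2
    have hsj1 : s ^ j < 1 := by linarith
    have hu' : ∀ k, dist (u k) (u (k + 1)) ≤ D * (s ^ j) ^ k := fun k => by
      rw [dist_comm, dist_eq_norm]; exact hu k
    obtain ⟨l, hl⟩ := cauchySeq_tendsto_of_complete (cauchySeq_of_le_geometric _ _ hsj1 hu')
    refine ⟨l, fun k => ?_⟩
    have := dist_le_of_le_geometric_of_tendsto _ _ hsj1 hu' hl k
    rw [dist_eq_norm] at this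
    refine this.trans ?_
    rw [div_le_iff₀ (by linarith)]
    have : 0 ≤ D * (s ^ j) ^ k := by positivity
    nlinarith
  obtain ⟨a, ha⟩ := lim (fun k => (P k).1) (2 * L) 5 (by norm_num) (by positivity) (fun k =>
    (hdiff k).1.trans (le_of_eq (by ring)))
  obtain ⟨b, hb⟩ := lim (fun k => (P k).2.1) (4 * L / (s ^ 2 * r)) 3 (by norm_num) (by positivity)
    (fun k => (hdiff k).2.1.trans (le_of_eq (by field_simp; ring)))
  obtain ⟨c, hc⟩ := lim (fun k => (P k).2.2) (16 * L / (s ^ 4 * r ^ 2)) 1 (by norm_num)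
    (by positivity) (fun k => (hdiff k).2.2.trans (le_of_eq (by field_simp; ring)))
  have hfin : ∀ (k : ℕ), ∀ z ∈ ball z₀ (s ^ (2 * k) * r),
      ‖Z z - (a + b * (z - z₀) + c * (z - z₀) ^ 2)‖ ≤ C₁ * L * s ^ (5 * k) := by
    intro k z hz
    have h1 := hP k z hz
    have hw : ‖z - z₀‖ ≤ s ^ (2 * k) * r := by rw [mem_ball, dist_eq_norm] at hz; exact hz.le
    have e : Z z - (a + b * (z - z₀) + c * (z - z₀) ^ 2) =
      (Z z - ((P k).1 + (P k).2.1 * (z - z₀) + (P k).2.2 * (z - z₀) ^ 2)) +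
      (((P k).1 - a) + ((P k).2.1 - b) * (z - z₀) + ((P k).2.2 - c) * (z - z₀) ^ 2) := by ring
    rw [e]
    have hb' : ‖((P k).2.1 - b) * (z - z₀)‖ ≤ 8 * L / s ^ 2 * s ^ (5 * k) := by
      rw [norm_mul]
      calc _ ≤ 2 * (4 * L / (s ^ 2 * r)) * (s ^ 3) ^ k * (s ^ (2 * k) * r) :=
            mul_le_mul (hb k) hw (norm_nonneg _) (by positivity)
        _ = _ := by field_simp; ring
    have hc' : ‖((P k).2.2 - c) * (z - z₀) ^ 2‖ ≤ 32 * L / s ^ 4 * s ^ (5 * k) := by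
      rw [norm_mul, norm_pow]
      calc _ ≤ 2 * (16 * L / (s ^ 4 * r ^ 2)) * (s ^ 1) ^ k * (s ^ (2 * k) * r) ^ 2 :=
            mul_le_mul (hc k) (by gcongr) (by positivity) (by positivity)
        _ = _ := by field_simp; ring
    have ha' : ‖(P k).1 - a‖ ≤ 4 * L * s ^ (5 * k) := (ha k).trans (le_of_eq (by ring))
    have h3 := norm_add_le (((P k).1 - a) + ((P k).2.1 - b) * (z - z₀)) (((P k).2.2 - c) * (z - z₀) ^ 2)
    have h4 := norm_add_le ((P k).1 - a) (((P k).2.1 - b) * (z - z₀))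
    refine (norm_add_le _ _).trans ?_
    have : C₁ * L * s ^ (5 * k) = L * s ^ (5 * k) + (4 * L * s ^ (5 * k) + 8 * L / s ^ 2 * s ^ (5 * k) +
      32 * L / s ^ 4 * s ^ (5 * k)) := by rw [hC₁]; ring
    linarith
  refine ⟨a, b, c, fun z hz => ?_⟩
  rw [mem_ball, dist_eq_norm] at hz
  have hLb : L / ϱ ≤ 8 / s ^ 5 * (K + M / ϱ) := by
    have : L / ϱ = M / ϱ + 8 / s ^ 5 * K := by rw [hL]; field_simp
    rw [this]
    have h8 : 1 ≤ 8 / s ^ 5 := by rw [hs]; norm_num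
    have : 0 ≤ M / ϱ := by positivity
    nlinarith
  rcases eq_or_lt_of_le (norm_nonneg (z - z₀)) with h0 | h0
  · have hz0 : z = z₀ := by rw [← sub_eq_zero, ← norm_eq_zero, h0]
    rw [← h0, Real.zero_rpow (by norm_num), mul_zero]
    refine le_of_tendsto_of_tendsto' (f := fun _ : ℕ => ‖Z z - (a + b * (z - z₀) + c * (z - z₀) ^ 2)‖)
      tendsto_const_nhds (b := atTop) (g := fun k : ℕ => C₁ * L * (s ^ 5) ^ k) ?_ fun k => ?_
    · have := (tendsto_pow_atTop_nhds_zero_of_lt_one (r := s ^ 5) (by positivity)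
        (pow_lt_one₀ hs0.le hs1 (by norm_num))).const_mul (C₁ * L)
      simpa using this
    · rw [← pow_mul]
      exact hfin k z (by rw [hz0]; exact mem_ball_self (by positivity))
  obtain ⟨n, hn1, hn2⟩ := exists_nat_pow_near_of_lt_one (x := ‖z - z₀‖ / r) (y := s ^ 2)
    (by positivity) (by rw [div_le_one hr]; exact hz.le) (by positivity)
    (pow_lt_one₀ hs0.le hs1 (by norm_num))
  obtain ⟨k, hk1, hk2⟩ : ∃ k : ℕ, (s ^ 2) ^ (k + 2) ≤ ‖z - z₀‖ / r ∧ ‖z - z₀‖ / r < (s ^ 2) ^ k := by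
    have hsq : s ^ 2 < 1 := pow_lt_one₀ hs0.le hs1 (by norm_num)
    cases n with
    | zero =>
      refine ⟨0, le_trans ?_ hn1.le, by rw [pow_zero, div_lt_one hr]; exact hz⟩
      exact pow_le_pow_of_le_one (by positivity) hsq.le (by lia)
    | succ n =>
      exact ⟨n, hn1.le, hn2.trans_lt (pow_lt_pow_right_of_lt_one₀ (by positivity) hsq (by lia))⟩
  have h1 := hfin k z (by
    rw [mem_ball, dist_eq_norm, pow_mul]
    rwa [div_lt_iff₀ hr] at hk2)
  refine h1.trans ?_
  have h2 : s ^ 10 * s ^ (5 * k) ≤ ‖z - z₀‖ ^ (5 / 2 : ℝ) / ϱ := by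
    have e : s ^ 10 * s ^ (5 * k) = ((s ^ 2) ^ (k + 2)) ^ (5 / 2 : ℝ) := by
      rw [← pow_mul, ← pow_add, ← Real.rpow_natCast, ← Real.rpow_natCast, ← Real.rpow_mul hs0.le]
      congr 1; push_cast; ring
    rw [e, hϱ, ← Real.div_rpow (norm_nonneg _) hr.le]
    exact Real.rpow_le_rpow (by positivity) hk1 (by norm_num)
  calc C₁ * L * s ^ (5 * k) = C₁ / s ^ 10 * L * (s ^ 10 * s ^ (5 * k)) := by field_simp
    _ ≤ C₁ / s ^ 10 * L * (‖z - z₀‖ ^ (5 / 2 : ℝ) / ϱ) := by gcongr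
    _ = C₁ / s ^ 10 * (L / ϱ) * ‖z - z₀‖ ^ (5 / 2 : ℝ) := by ring
    _ ≤ C₁ / s ^ 10 * (8 / s ^ 5 * (K + M / ϱ)) * ‖z - z₀‖ ^ (5 / 2 : ℝ) := by gcongr
    _ = _ := by ring

end

section

/-- The real linear functional on `ℂ` with gradient `(a, b)`. -/
noncomputable def lin (a b : ℝ) : ℂ →L[ℝ] ℝ := a • Complex.reCLM + b • Complex.imCLM

@[simp] lemma lin_apply (a b : ℝ) (z : ℂ) : lin a b z = a * z.re + b * z.im := by simp [lin]

lemma lin_injective {a b a' b' : ℝ} (h : lin a b = lin a' b') : a = a' ∧ b = b' := by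
  have h1 := DFunLike.congr_fun h 1
  have h2 := DFunLike.congr_fun h Complex.I
  simp at h1 h2
  exact ⟨h1, h2⟩

lemma exists_eq_lin (L : ℂ →L[ℝ] ℝ) : L = lin (L 1) (L Complex.I) := by
  ext z
  conv_lhs => rw [← Complex.re_add_im z]
  have e1 : (z.re : ℂ) = z.re • (1 : ℂ) := by simp
  have e2 : (z.im : ℂ) * Complex.I = z.im • Complex.I := by simp
  rw [map_add, e1, e2, map_smul, map_smul]
  simp; ring

/-- The real quadratic polynomial with the given coefficients. -/
noncomputable def quad (α l m a b c : ℝ) (w : ℂ) : ℝ :=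
  α + l * w.re + m * w.im + a * w.re ^ 2 + b * (w.re * w.im) + c * w.im ^ 2

lemma hasFDerivAt_quad (α l m a b c : ℝ) (z₀ z : ℂ) :
    HasFDerivAt (fun z => quad α l m a b c (z - z₀))
      (lin (l + 2 * a * (z - z₀).re + b * (z - z₀).im) (m + b * (z - z₀).re + 2 * c * (z - z₀).im)) z := by
  have hre : HasFDerivAt (fun z : ℂ => (z - z₀).re) Complex.reCLM z :=
    Complex.reCLM.hasFDerivAt.comp z ((hasFDerivAt_id z).sub_const z₀)
  have him : HasFDerivAt (fun z : ℂ => (z - z₀).im) Complex.imCLM z :=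
    Complex.imCLM.hasFDerivAt.comp z ((hasFDerivAt_id z).sub_const z₀)
  unfold quad
  refine ((((((hasFDerivAt_const α z).add (hre.const_mul l)).add (him.const_mul m)).add
    ((hre.pow 2).const_mul a)).add ((hre.mul him).const_mul b)).add
    ((him.pow 2).const_mul c)).congr_fderiv ?_
  ext w
  simp [lin]
  ring

lemma hasFDerivAt_zero_of_le_rpow {e : ℂ → ℝ} {z₀ : ℂ} {ρ C p : ℝ} (hρ : 0 < ρ) (hp : 1 < p)
    (h : ∀ z ∈ ball z₀ ρ, |e z| ≤ C * ‖z - z₀‖ ^ p) : HasFDerivAt e (0 : ℂ →L[ℝ] ℝ) z₀ := by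
  have he0 : e z₀ = 0 := by
    have := h z₀ (mem_ball_self hρ)
    rw [sub_self, norm_zero, Real.zero_rpow (by linarith), mul_zero] at this
    exact abs_nonpos_iff.1 this
  rw [hasFDerivAt_iff_isLittleO]
  simp only [he0, sub_zero, zero_apply]
  have h1 : e =O[𝓝 z₀] fun z => ‖z - z₀‖ ^ p := by
    refine Asymptotics.IsBigO.of_bound C ?_
    filter_upwards [ball_mem_nhds z₀ hρ] with z hz
    rw [norm_eq_abs, norm_of_nonneg (by positivity)]
    exact h z hz
  refine h1.trans_isLittleO ?_
  have h2 : Tendsto (fun z : ℂ => ‖z - z₀‖ ^ (p - 1)) (𝓝 z₀) (𝓝 0) := by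
    have : ContinuousAt (fun z : ℂ => ‖z - z₀‖ ^ (p - 1)) z₀ :=
      ContinuousAt.rpow_const (by fun_prop) (Or.inr (by linarith))
    have h3 := this.tendsto
    rwa [sub_self, norm_zero, Real.zero_rpow (by linarith)] at h3
  rw [Asymptotics.isLittleO_iff]
  intro c hc
  filter_upwards [h2.eventually (gt_mem_nhds hc)] with z hz
  rw [norm_of_nonneg (by positivity)]
  rcases eq_or_ne z z₀ with rfl | hne
  · simp [Real.zero_rpow (by linarith : p ≠ 0)]
  have hpos : 0 < ‖z - z₀‖ := norm_pos_iff.2 (sub_ne_zero.2 hne)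
  have : ‖z - z₀‖ ^ p = ‖z - z₀‖ ^ (p - 1) * ‖z - z₀‖ := by
    rw [← Real.rpow_add_one hpos.ne']; congr 1; ring
  rw [this]
  gcongr

/-- `f` is approximated to order `5/2` by quadratic polynomials, uniformly at the points of `D`. -/
def QuadApprox (f : ℂ → ℝ) (D : Set ℂ) (ρ C : ℝ) : Prop :=
  ∀ z₀ ∈ D, ∃ α l m a b c : ℝ, ∀ z ∈ ball z₀ ρ,
    |f z - quad α l m a b c (z - z₀)| ≤ C * ‖z - z₀‖ ^ (5 / 2 : ℝ)

lemma abs_coeff_le_of_quad {α l m a b c d M : ℝ} (hd : 0 < d)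
    (h : ∀ w : ℂ, ‖w‖ ≤ 2 * d → |quad α l m a b c w| ≤ M) :
    |l| ≤ M / d ∧ |m| ≤ M / d ∧ |a| ≤ 4 * M / d ^ 2 ∧ |b| ≤ 4 * M / d ^ 2 ∧ |c| ≤ 4 * M / d ^ 2 := by
  have hn : ∀ s t : ℝ, |s| ≤ 1 → |t| ≤ 1 → |quad α l m a b c ⟨s * d, t * d⟩| ≤ M := by
    intro s t hs ht
    refine h _ ((Complex.norm_le_abs_re_add_abs_im _).trans ?_)
    simp only [abs_mul, abs_of_pos hd]
    nlinarith
  have h0 := abs_le.1 (hn 0 0 (by simp) (by simp))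
  have h1 := abs_le.1 (hn 1 0 (by simp) (by simp))
  have h2 := abs_le.1 (hn (-1) 0 (by simp) (by simp))
  have h3 := abs_le.1 (hn 0 1 (by simp) (by simp))
  have h4 := abs_le.1 (hn 0 (-1) (by simp) (by simp))
  have h5 := abs_le.1 (hn 1 1 (by simp) (by simp))
  simp only [quad] at h0 h1 h2 h3 h4 h5
  have hd2 : 0 < d ^ 2 := by positivity
  have hdiv : ∀ x y D : ℝ, 0 < D → |x * D| ≤ y → |x| ≤ y / D := fun x y D hD h => by
    rw [abs_mul, abs_of_pos hD] at h
    rwa [le_div_iff₀ hD]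
  refine ⟨hdiv _ _ _ hd (abs_le.2 ⟨?_, ?_⟩), hdiv _ _ _ hd (abs_le.2 ⟨?_, ?_⟩),
    hdiv _ _ _ hd2 (abs_le.2 ⟨?_, ?_⟩), hdiv _ _ _ hd2 (abs_le.2 ⟨?_, ?_⟩),
    hdiv _ _ _ hd2 (abs_le.2 ⟨?_, ?_⟩)⟩ <;> nlinarith

/-- Uniform quadratic approximation of order `5/2` gives a Hölder continuous second derivative. -/
theorem QuadApprox.exists_second_derivative {f f₁ f₂ : ℂ → ℝ} {D : Set ℂ} {ρ C : ℝ} (hρ : 0 < ρ)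
    (hC : 0 ≤ C) (hD : IsOpen D) (h : QuadApprox f D ρ C)
    (hf : ∀ z ∈ D, HasFDerivAt f (lin (f₁ z) (f₂ z)) z) :
    ∃ f₁₁ f₁₂ f₂₂ : ℂ → ℝ, (∀ z ∈ D, HasFDerivAt f₁ (lin (f₁₁ z) (f₁₂ z)) z) ∧
      (∀ z ∈ D, HasFDerivAt f₂ (lin (f₁₂ z) (f₂₂ z)) z) ∧
      ∀ z ∈ D, ∀ z' ∈ D, dist z z' < ρ / 3 →
        |f₁₁ z - f₁₁ z'| ≤ 256 * C * dist z z' ^ (1 / 2 : ℝ) ∧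
        |f₁₂ z - f₁₂ z'| ≤ 256 * C * dist z z' ^ (1 / 2 : ℝ) ∧
        |f₂₂ z - f₂₂ z'| ≤ 256 * C * dist z z' ^ (1 / 2 : ℝ) := by
  unfold QuadApprox at h
  choose! α l m a b c h using h
  have hlm : ∀ z ∈ D, f₁ z = l z ∧ f₂ z = m z := by
    intro z hz
    have h1 := hasFDerivAt_zero_of_le_rpow hρ (by norm_num) (h z hz)
    have h2 := h1.add (hasFDerivAt_quad (α z) (l z) (m z) (a z) (b z) (c z) z z)
    have h3 : HasFDerivAt f (lin (l z) (m z)) z := by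
      refine (h2.congr_fderiv ?_).congr_of_eventuallyEq (Eventually.of_forall fun y => ?_)
      · simp
      · simp
    exact lin_injective ((hf z hz).unique h3)
  have key : ∀ z₀ ∈ D, ∀ z₁ ∈ D, z₀ ≠ z₁ → dist z₀ z₁ < ρ / 3 →
      |l z₁ - (l z₀ + (2 * a z₀ * (z₁ - z₀).re + b z₀ * (z₁ - z₀).im))| ≤ 32 * C * dist z₀ z₁ ^ (3 / 2 : ℝ) ∧
      |m z₁ - (m z₀ + (b z₀ * (z₁ - z₀).re + 2 * c z₀ * (z₁ - z₀).im))| ≤ 32 * C * dist z₀ z₁ ^ (3 / 2 : ℝ) ∧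
      |a z₁ - a z₀| ≤ 128 * C * dist z₀ z₁ ^ (1 / 2 : ℝ) ∧
      |b z₁ - b z₀| ≤ 128 * C * dist z₀ z₁ ^ (1 / 2 : ℝ) ∧
      |c z₁ - c z₀| ≤ 128 * C * dist z₀ z₁ ^ (1 / 2 : ℝ) := by
    intro z₀ hz₀ z₁ hz₁ hne hd
    set d := dist z₀ z₁ with hdd
    have hd0 : 0 < d := dist_pos.2 hne
    set k := z₁ - z₀ with hk
    have hkn : ‖k‖ = d := by rw [hdd, dist_comm, dist_eq_norm]
    have hpw : ∀ w : ℂ, ‖w‖ ≤ 3 * d → C * ‖w‖ ^ (5 / 2 : ℝ) ≤ 16 * C * d ^ (5 / 2 : ℝ) := by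
      intro w hw
      have h1 : ‖w‖ ^ (5 / 2 : ℝ) ≤ (3 * d) ^ (5 / 2 : ℝ) :=
        Real.rpow_le_rpow (norm_nonneg _) hw (by norm_num)
      have h3 : (3 : ℝ) ^ (5 / 2 : ℝ) ≤ 16 := by
        have : (3 : ℝ) ^ (5 / 2 : ℝ) = 9 * √3 := by
          rw [show (5 / 2 : ℝ) = 2 + 1 / 2 by norm_num, Real.rpow_add (by norm_num),
            Real.sqrt_eq_rpow]
          norm_num
        rw [this]
        have : √3 ≤ 16 / 9 := Real.sqrt_le_iff.2 (by norm_num)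
        linarith
      rw [Real.mul_rpow (by norm_num) hd0.le] at h1
      have h4 : 0 ≤ d ^ (5 / 2 : ℝ) := by positivity
      nlinarith [mul_le_mul_of_nonneg_left (h1.trans (mul_le_mul_of_nonneg_right h3 h4)) hC]
    have hE : ∀ w : ℂ, ‖w‖ ≤ 2 * d → |quad
        (α z₁ - (α z₀ + l z₀ * k.re + m z₀ * k.im + a z₀ * k.re ^ 2 + b z₀ * (k.re * k.im) + c z₀ * k.im ^ 2))
        (l z₁ - (l z₀ + (2 * a z₀ * k.re + b z₀ * k.im))) (m z₁ - (m z₀ + (b z₀ * k.re + 2 * c z₀ * k.im)))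
        (a z₁ - a z₀) (b z₁ - b z₀) (c z₁ - c z₀) w| ≤ 32 * C * d ^ (5 / 2 : ℝ) := by
      intro w hw
      have n0 : ‖k + w‖ ≤ 3 * d := (norm_add_le _ _).trans (by linarith)
      have h1 := h z₁ hz₁ (z₁ + w) (by simp; linarith)
      have h0 := h z₀ hz₀ (z₁ + w) (by
        rw [mem_ball, dist_eq_norm, show z₁ + w - z₀ = k + w by rw [hk]; ring]; linarith)
      rw [show z₁ + w - z₀ = k + w by rw [hk]; ring] at h0
      rw [add_sub_cancel_left] at h1
      have h2 := abs_le.1 (h1.trans (hpw w (by linarith)))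
      have h3 := abs_le.1 (h0.trans (hpw _ n0))
      simp only [quad, Complex.add_re, Complex.add_im] at h2 h3 ⊢
      rw [abs_le]
      constructor <;> linarith
    have e1 : 32 * C * d ^ (5 / 2 : ℝ) / d = 32 * C * d ^ (3 / 2 : ℝ) := by
      rw [show (5 / 2 : ℝ) = 3 / 2 + 1 by norm_num, Real.rpow_add_one hd0.ne']; field_simp
    have e2 : 4 * (32 * C * d ^ (5 / 2 : ℝ)) / d ^ 2 = 128 * C * d ^ (1 / 2 : ℝ) := by
      rw [show (5 / 2 : ℝ) = 1 / 2 + 2 by norm_num, Real.rpow_add hd0, Real.rpow_two]; field_simp; ring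
    have := abs_coeff_le_of_quad hd0 hE
    rw [e1, e2] at this
    exact this
  have hder : ∀ (g u v : ℂ → ℝ), ∀ z₀ ∈ D, (∀ z₁ ∈ D, z₀ ≠ z₁ → dist z₀ z₁ < ρ / 3 →
      |g z₁ - (g z₀ + (u z₀ * (z₁ - z₀).re + v z₀ * (z₁ - z₀).im))| ≤ 32 * C * dist z₀ z₁ ^ (3 / 2 : ℝ)) →
      HasFDerivAt g (lin (u z₀) (v z₀)) z₀ := by
    intro g u v z₀ hz₀ hg
    obtain ⟨δ, hδ, hδD⟩ := Metric.isOpen_iff.1 hD z₀ hz₀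
    have h1 := hasFDerivAt_zero_of_le_rpow (e := fun z => g z - quad (g z₀) (u z₀) (v z₀) 0 0 0 (z - z₀))
      (z₀ := z₀) (ρ := min δ (ρ / 3)) (C := 32 * C) (p := 3 / 2) (by positivity) (by norm_num) (by
        intro z hz
        rcases eq_or_ne z₀ z with rfl | hne
        · simp [quad, Real.zero_rpow]
        have hz1 : dist z z₀ < min δ (ρ / 3) := hz
        rw [lt_min_iff] at hz1
        have := hg z (hδD hz1.1) hne (by rw [dist_comm]; exact hz1.2)
        rw [← dist_eq_norm, dist_comm z z₀]
        refine le_trans (le_of_eq ?_) this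
        congr 1; simp only [quad]; ring)
    have h2 := h1.add (hasFDerivAt_quad (g z₀) (u z₀) (v z₀) 0 0 0 z₀ z₀)
    refine (h2.congr_fderiv ?_).congr_of_eventuallyEq (Eventually.of_forall fun y => ?_)
    · simp
    · simp
  have hcongr : ∀ (g g' : ℂ → ℝ) (L : ℂ →L[ℝ] ℝ), ∀ z ∈ D, (∀ z ∈ D, g z = g' z) →
      HasFDerivAt g' L z → HasFDerivAt g L z := fun g g' L z hz he h' =>
    h'.congr_of_eventuallyEq (by filter_upwards [hD.mem_nhds hz] with y hy using he y hy)
  refine ⟨fun z => 2 * a z, b, fun z => 2 * c z, fun z hz => ?_, fun z hz => ?_, fun z hz z' hz' hd => ?_⟩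
  · exact hcongr f₁ l _ z hz (fun z hz => (hlm z hz).1) (hder l (fun z => 2 * a z) b z hz
      fun z₁ hz₁ hne hd => (key z hz z₁ hz₁ hne hd).1)
  · exact hcongr f₂ m _ z hz (fun z hz => (hlm z hz).2) (hder m b (fun z => 2 * c z) z hz
      fun z₁ hz₁ hne hd => (key z hz z₁ hz₁ hne hd).2.1)
  · rcases eq_or_ne z' z with rfl | hne
    · simp
    rw [dist_comm] at hd ⊢
    obtain ⟨-, -, k1, k2, k3⟩ := key z' hz' z hz hne hd
    have h0 : 0 ≤ C * dist z' z ^ (1 / 2 : ℝ) := by positivity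
    refine ⟨?_, by linarith, ?_⟩ <;> rw [← mul_sub, abs_mul, abs_two] <;> linarith

end

section

lemma continuousOn_lin {f g : ℂ → ℝ} {U : Set ℂ} (hf : ContinuousOn f U) (hg : ContinuousOn g U) :
    ContinuousOn (fun z => lin (f z) (g z)) U := by
  unfold lin
  exact (hf.smul continuousOn_const).add (hg.smul continuousOn_const)

lemma contDiffOn_one_of_lin {f f₁ f₂ : ℂ → ℝ} {U : Set ℂ} (hU : IsOpen U)
    (h : ∀ z ∈ U, HasFDerivAt f (lin (f₁ z) (f₂ z)) z) (h1 : ContinuousOn f₁ U)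
    (h2 : ContinuousOn f₂ U) : ContDiffOn ℝ 1 f U := by
  rw [show (1 : WithTop ℕ∞) = 0 + 1 from rfl, contDiffOn_succ_iff_fderiv_of_isOpen hU]
  refine ⟨fun z hz => (h z hz).differentiableAt.differentiableWithinAt, by simp, ?_⟩
  rw [contDiffOn_zero]
  exact (continuousOn_lin h1 h2).congr fun z hz => (h z hz).fderiv

/-- The complex valued function with the given real and imaginary part. -/
noncomputable def cpx (f g : ℂ → ℝ) (z : ℂ) : ℂ := (f z : ℂ) + Complex.I * (g z : ℂ)

lemma hasFDerivAt_cpx {f g : ℂ → ℝ} {L M : ℂ →L[ℝ] ℝ} {z : ℂ} (hf : HasFDerivAt f L z)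
    (hg : HasFDerivAt g M z) : HasFDerivAt (cpx f g)
      (Complex.ofRealCLM.comp L + Complex.I • Complex.ofRealCLM.comp M) z := by
  have h1 := Complex.ofRealCLM.hasFDerivAt.comp z hf
  have h2 := (Complex.ofRealCLM.hasFDerivAt.comp z hg).const_mul Complex.I
  exact h1.add h2

lemma fderiv_cpx_one {f g : ℂ → ℝ} {a b c d : ℝ} {z : ℂ} (hf : HasFDerivAt f (lin a b) z)
    (hg : HasFDerivAt g (lin c d) z) : fderiv ℝ (cpx f g) z 1 = (a : ℂ) + Complex.I * c := by
  rw [(hasFDerivAt_cpx hf hg).fderiv]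
  simp

lemma dbar_cpx {f g : ℂ → ℝ} {a b c d : ℝ} {z : ℂ} (hf : HasFDerivAt f (lin a b) z)
    (hg : HasFDerivAt g (lin c d) z) :
    dbar (cpx f g) z = ((a - d : ℝ) : ℂ) + Complex.I * ((b + c : ℝ) : ℂ) := by
  rw [dbar, (hasFDerivAt_cpx hf hg).fderiv]
  simp
  linear_combination (d : ℂ) * Complex.I_mul_I

lemma contDiffOn_cpx {f g : ℂ → ℝ} {U : Set ℂ} (hf : ContDiffOn ℝ 1 f U)
    (hg : ContDiffOn ℝ 1 g U) : ContDiffOn ℝ 1 (cpx f g) U := by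
  have h1 := Complex.ofRealCLM.contDiff.comp_contDiffOn hf
  have h2 := contDiffOn_const (c := Complex.I).mul (Complex.ofRealCLM.contDiff.comp_contDiffOn hg)
  exact h1.add h2

/-- The affine stretch `ξ + i η ↦ z₀ + t ξ + i η`. -/
noncomputable def stretch (z₀ : ℂ) (t : ℝ) (ζ : ℂ) : ℂ := z₀ + ⟨t * ζ.re, ζ.im⟩

@[simp] lemma stretch_re (z₀ : ℂ) (t : ℝ) (ζ : ℂ) : (stretch z₀ t ζ).re = z₀.re + t * ζ.re := by
  simp [stretch]

@[simp] lemma stretch_im (z₀ : ℂ) (t : ℝ) (ζ : ℂ) : (stretch z₀ t ζ).im = z₀.im + ζ.im := by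
  simp [stretch]

lemma hasFDerivAt_stretch (z₀ : ℂ) (t : ℝ) (ζ : ℂ) : HasFDerivAt (stretch z₀ t)
    ((t • Complex.reCLM).smulRight (1 : ℂ) + Complex.imCLM.smulRight Complex.I) ζ := by
  have h := ((((t • Complex.reCLM).smulRight (1 : ℂ) +
    Complex.imCLM.smulRight Complex.I).hasFDerivAt (x := ζ)).const_add z₀)
  refine h.congr_of_eventuallyEq (Eventually.of_forall fun w => ?_)
  apply Complex.ext <;> simp

lemma hasFDerivAt_comp_stretch {f : ℂ → ℝ} {a b t : ℝ} {z₀ ζ : ℂ}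
    (h : HasFDerivAt f (lin a b) (stretch z₀ t ζ)) :
    HasFDerivAt (fun ζ => f (stretch z₀ t ζ)) (lin (t * a) b) ζ := by
  refine (h.comp ζ (hasFDerivAt_stretch z₀ t ζ)).congr_fderiv ?_
  ext w
  simp
  ring

lemma continuous_stretch (z₀ : ℂ) (t : ℝ) : Continuous (stretch z₀ t) :=
  continuous_iff_continuousAt.2 fun ζ => (hasFDerivAt_stretch z₀ t ζ).continuousAt

lemma norm_mk_mul_le {t a b Λ : ℝ} (h1 : 1 ≤ Λ) (ht : 0 ≤ t) (htΛ : t ≤ Λ) :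
    ‖(⟨t * a, b⟩ : ℂ)‖ ≤ Λ * ‖(⟨a, b⟩ : ℂ)‖ := by
  rw [Complex.norm_def, Complex.norm_def, Real.sqrt_le_left (by positivity), mul_pow,
    Real.sq_sqrt (Complex.normSq_nonneg _), Complex.normSq_mk, Complex.normSq_mk]
  have e1 : t ^ 2 ≤ Λ ^ 2 := pow_le_pow_left₀ ht htΛ 2
  have e2 : (1 : ℝ) ≤ Λ ^ 2 := one_le_pow₀ h1
  nlinarith [mul_le_mul_of_nonneg_right e1 (sq_nonneg a), mul_le_mul_of_nonneg_right e2 (sq_nonneg b)]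

lemma dist_stretch_le {t Λ : ℝ} (h1 : 1 ≤ Λ) (ht : 0 ≤ t) (htΛ : t ≤ Λ) (z₀ ζ : ℂ) :
    ‖stretch z₀ t ζ - z₀‖ ≤ Λ * ‖ζ‖ := by
  have : stretch z₀ t ζ - z₀ = ⟨t * ζ.re, ζ.im⟩ := by simp [stretch]
  rw [this]
  exact norm_mk_mul_le h1 ht htΛ

/-- `(X, -Q)` and `(Q, G)` are gradients on `U`, of `A` and `B`. -/
structure Sys (A B X Q G : ℂ → ℝ) (U : Set ℂ) : Prop where
  isOpen : IsOpen U
  left : ∀ z ∈ U, HasFDerivAt A (lin (X z) (-Q z)) z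
  right : ∀ z ∈ U, HasFDerivAt B (lin (Q z) (G z)) z
  contX : ContinuousOn X U
  contQ : ContinuousOn Q U
  contG : ContinuousOn G U

theorem Sys.quadApprox {A B X Q G : ℂ → ℝ} {U D : Set ℂ} (hS : Sys A B X Q G U) {ρ Λ K M : ℝ}
    (hρ : 0 < ρ) (hΛ : 1 ≤ Λ) (hK : 0 ≤ K) (hDU : ∀ z ∈ D, ball z ρ ⊆ U)
    (hAM : ∀ z ∈ U, |A z| ≤ M) (hBM : ∀ z ∈ U, |B z| ≤ M)
    (h : ∀ z₀ ∈ D, ∃ t l₀ l₁ l₂ : ℝ, 1 / Λ ≤ t ∧ t ≤ Λ ∧ |l₀| ≤ Λ ∧ |l₁| ≤ Λ ∧ |l₂| ≤ Λ ∧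
      ∀ z ∈ ball z₀ ρ, |G z - t ^ 2 * X z - (l₀ + l₁ * (z - z₀).re + l₂ * (z - z₀).im)| ≤
        K * ‖z - z₀‖ ^ (3 / 2 : ℝ)) :
    ∃ ρ' C, 0 < ρ' ∧ 0 ≤ C ∧ QuadApprox A D ρ' C ∧ QuadApprox B D ρ' C := by
  obtain ⟨C₀, hC₀, happ⟩ := exists_quadratic_approx
  have hΛ0 : 0 < Λ := by linarith
  set r := ρ / Λ with hr
  have hr0 : 0 < r := by positivity
  set N := |M| + Λ * r + Λ * r ^ 2 + Λ * |M| + Λ ^ 2 * r ^ 2 + Λ ^ 2 * r with hN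
  have hN0 : 0 ≤ N := by positivity
  set C₁ := C₀ * (Λ * (K * Λ ^ (3 / 2 : ℝ)) + N / r ^ (5 / 2 : ℝ)) with hC₁
  have hC₁0 : 0 ≤ C₁ := by positivity
  have main : ∀ z₀ ∈ D,
      (∃ α l m a b c : ℝ, ∀ z ∈ ball z₀ (r / Λ), |A z - quad α l m a b c (z - z₀)| ≤
        (Λ * C₁ * Λ ^ (5 / 2 : ℝ)) * ‖z - z₀‖ ^ (5 / 2 : ℝ)) ∧
      (∃ α l m a b c : ℝ, ∀ z ∈ ball z₀ (r / Λ), |B z - quad α l m a b c (z - z₀)| ≤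
        (Λ * C₁ * Λ ^ (5 / 2 : ℝ)) * ‖z - z₀‖ ^ (5 / 2 : ℝ)) := by
    intro z₀ hz₀
    obtain ⟨t, l₀, l₁, l₂, ht, htΛ, hl₀, hl₁, hl₂, hG⟩ := h z₀ hz₀
    have ht0 : 0 < t := lt_of_lt_of_le (by positivity) ht
    have hti : t⁻¹ ≤ Λ := by
      rw [inv_le_comm₀ ht0 hΛ0, ← one_div]; exact ht
    have hSm : ∀ ζ ∈ ball (0 : ℂ) r, stretch z₀ t ζ ∈ ball z₀ ρ := by
      intro ζ hζ
      rw [mem_ball_zero_iff] at hζ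
      rw [mem_ball, dist_eq_norm]
      refine (dist_stretch_le hΛ ht0.le htΛ z₀ ζ).trans_lt ?_
      calc Λ * ‖ζ‖ < Λ * r := by gcongr
        _ = ρ := by rw [hr]; field_simp
    have hSU : ∀ ζ ∈ ball (0 : ℂ) r, stretch z₀ t ζ ∈ U := fun ζ hζ => hDU z₀ hz₀ (hSm ζ hζ)
    set f : ℂ → ℝ := fun ζ => A (stretch z₀ t ζ) + quad 0 (t⁻¹ * l₀) 0 (l₁ / 2) 0 0 (ζ - 0) with hf
    set g : ℂ → ℝ := fun ζ => t⁻¹ * B (stretch z₀ t ζ) + quad 0 0 0 0 0 (-(t⁻¹ * l₂ / 2)) (ζ - 0) with hg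
    have hfd : ∀ ζ ∈ ball (0 : ℂ) r, HasFDerivAt f
        (lin (t * X (stretch z₀ t ζ) + (t⁻¹ * l₀ + l₁ * ζ.re)) (-Q (stretch z₀ t ζ))) ζ := by
      intro ζ hζ
      refine ((hasFDerivAt_comp_stretch (hS.left _ (hSU ζ hζ))).add
        (hasFDerivAt_quad 0 (t⁻¹ * l₀) 0 (l₁ / 2) 0 0 0 ζ)).congr_fderiv ?_
      ext w; simp; ring
    have hgd : ∀ ζ ∈ ball (0 : ℂ) r, HasFDerivAt g
        (lin (Q (stretch z₀ t ζ)) (t⁻¹ * G (stretch z₀ t ζ) - t⁻¹ * l₂ * ζ.im)) ζ := by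
      intro ζ hζ
      refine (((hasFDerivAt_comp_stretch (hS.right _ (hSU ζ hζ))).const_mul t⁻¹).add
        (hasFDerivAt_quad 0 0 0 0 0 (-(t⁻¹ * l₂ / 2)) 0 ζ)).congr_fderiv ?_
      ext w; simp; field_simp; ring
    have hcomp : ∀ {k : ℂ → ℝ}, ContinuousOn k U →
        ContinuousOn (fun ζ => k (stretch z₀ t ζ)) (ball 0 r) := fun hk =>
      hk.comp (continuous_stretch z₀ t).continuousOn hSU
    have hX := hcomp hS.contX
    have hQ := hcomp hS.contQ
    have hGc := hcomp hS.contG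
    have hre : ContinuousOn (fun ζ : ℂ => ζ.re) (ball 0 r) := Complex.continuous_re.continuousOn
    have him : ContinuousOn (fun ζ : ℂ => ζ.im) (ball 0 r) := Complex.continuous_im.continuousOn
    have hCD : ContDiffOn ℝ 1 (cpx f g) (ball 0 r) := by
      refine contDiffOn_cpx (contDiffOn_one_of_lin isOpen_ball hfd
          ((continuousOn_const.mul hX).add (continuousOn_const.add (continuousOn_const.mul hre))) hQ.neg)
        (contDiffOn_one_of_lin isOpen_ball hgd hQ
          ((continuousOn_const.mul hGc).sub (continuousOn_const.mul him)))
    have hbd : ∀ ζ ∈ ball (0 : ℂ) r, ‖cpx f g ζ‖ ≤ N := by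
      intro ζ hζ
      have hζr : ‖ζ‖ < r := mem_ball_zero_iff.1 hζ
      have c1 : |ζ.re| ≤ r := (Complex.abs_re_le_norm ζ).trans hζr.le
      have c2 : |ζ.im| ≤ r := (Complex.abs_im_le_norm ζ).trans hζr.le
      have hA' := (hAM _ (hSU ζ hζ)).trans (le_abs_self M)
      have hB' := (hBM _ (hSU ζ hζ)).trans (le_abs_self M)
      have q1 : ζ.re ^ 2 ≤ r ^ 2 := sq_le_sq' (abs_le.1 c1).1 (abs_le.1 c1).2
      have q2 : ζ.im ^ 2 ≤ r ^ 2 := sq_le_sq' (abs_le.1 c2).1 (abs_le.1 c2).2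
      have n1 : ‖cpx f g ζ‖ ≤ |f ζ| + |g ζ| := by
        refine (norm_add_le _ _).trans ?_
        simp
      have n2 : |f ζ| ≤ |M| + Λ ^ 2 * r + Λ * r ^ 2 := by
        have e : f ζ = A (stretch z₀ t ζ) + t⁻¹ * l₀ * ζ.re + l₁ / 2 * ζ.re ^ 2 := by
          simp only [hf, quad, sub_zero]; ring
        rw [e]
        refine (abs_add_three _ _ _).trans ?_
        have b1 : |t⁻¹ * l₀ * ζ.re| ≤ Λ ^ 2 * r := by
          rw [abs_mul, abs_mul, abs_of_pos (inv_pos.2 ht0), sq]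
          gcongr
        have b2 : |l₁ / 2 * ζ.re ^ 2| ≤ Λ * r ^ 2 := by
          rw [abs_mul, abs_div, abs_two, abs_of_nonneg (sq_nonneg ζ.re)]
          have : |l₁| / 2 ≤ Λ := by linarith [abs_nonneg l₁]
          gcongr
        linarith
      have n3 : |g ζ| ≤ Λ * |M| + Λ ^ 2 * r ^ 2 := by
        have e : g ζ = t⁻¹ * B (stretch z₀ t ζ) + -(t⁻¹ * l₂ / 2 * ζ.im ^ 2) := by
          simp only [hg, quad, sub_zero]; ring
        rw [e]
        refine (abs_add_le _ _).trans ?_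
        have b1 : |t⁻¹ * B (stretch z₀ t ζ)| ≤ Λ * |M| := by
          rw [abs_mul, abs_of_pos (inv_pos.2 ht0)]
          gcongr
        have b2 : |-(t⁻¹ * l₂ / 2 * ζ.im ^ 2)| ≤ Λ ^ 2 * r ^ 2 := by
          rw [abs_neg, abs_mul, abs_div, abs_mul, abs_two, abs_of_nonneg (sq_nonneg ζ.im),
            abs_of_pos (inv_pos.2 ht0)]
          have h3 : t⁻¹ * |l₂| ≤ Λ ^ 2 := by rw [sq]; gcongr
          have : t⁻¹ * |l₂| / 2 ≤ Λ ^ 2 := by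
            have : 0 ≤ t⁻¹ * |l₂| := by positivity
            linarith
          gcongr
        linarith
      have : 0 ≤ Λ * r := by positivity
      rw [hN]; linarith
    have hdb : ∀ ζ ∈ ball (0 : ℂ) r, ‖dbar (cpx f g) ζ‖ ≤
        (Λ * (K * Λ ^ (3 / 2 : ℝ))) * ‖ζ - 0‖ ^ (3 / 2 : ℝ) := by
      intro ζ hζ
      rw [dbar_cpx (hfd ζ hζ) (hgd ζ hζ)]
      have e2 : (-Q (stretch z₀ t ζ) + Q (stretch z₀ t ζ) : ℝ) = 0 := by ring
      rw [e2]
      simp only [Complex.ofReal_zero, mul_zero, add_zero, sub_zero, Complex.norm_real, norm_eq_abs]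
      have e3 : t * X (stretch z₀ t ζ) + (t⁻¹ * l₀ + l₁ * ζ.re) -
          (t⁻¹ * G (stretch z₀ t ζ) - t⁻¹ * l₂ * ζ.im) =
          -(t⁻¹ * (G (stretch z₀ t ζ) - t ^ 2 * X (stretch z₀ t ζ) -
            (l₀ + l₁ * (stretch z₀ t ζ - z₀).re + l₂ * (stretch z₀ t ζ - z₀).im))) := by
        simp only [Complex.sub_re, Complex.sub_im, stretch_re, stretch_im]
        field_simp
        ring
      rw [e3, abs_neg, abs_mul, abs_of_pos (inv_pos.2 ht0), mul_assoc Λ, mul_assoc K,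
        ← Real.mul_rpow hΛ0.le (norm_nonneg _)]
      refine mul_le_mul hti ((hG _ (hSm ζ hζ)).trans ?_) (abs_nonneg _) hΛ0.le
      gcongr
      exact dist_stretch_le hΛ ht0.le htΛ z₀ ζ
    obtain ⟨a, b, c, habc⟩ := happ hr0 (by positivity) hN0 hCD hbd hdb
    have hinv : ∀ z ∈ ball z₀ (r / Λ), ∃ ζ ∈ ball (0 : ℂ) r, stretch z₀ t ζ = z ∧
        ‖ζ‖ ≤ Λ * ‖z - z₀‖ ∧ ζ.re = t⁻¹ * (z - z₀).re ∧ ζ.im = (z - z₀).im := by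
      intro z hz
      rw [mem_ball, dist_eq_norm] at hz
      have hle : ‖(⟨t⁻¹ * (z - z₀).re, (z - z₀).im⟩ : ℂ)‖ ≤ Λ * ‖z - z₀‖ :=
        norm_mk_mul_le hΛ (inv_pos.2 ht0).le hti
      refine ⟨⟨t⁻¹ * (z - z₀).re, (z - z₀).im⟩, ?_, ?_, hle, rfl, rfl⟩
      · rw [mem_ball_zero_iff]
        refine hle.trans_lt ?_
        rwa [lt_div_iff₀ hΛ0, mul_comm] at hz
      · apply Complex.ext
        · simp [← mul_assoc, mul_inv_cancel₀ ht0.ne']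
        · simp
    have hfin : ∀ ζ ∈ ball (0 : ℂ) r, ∀ z, ‖ζ‖ ≤ Λ * ‖z - z₀‖ →
        |f ζ - (a + b * ζ + c * ζ ^ 2).re| ≤ C₁ * Λ ^ (5 / 2 : ℝ) * ‖z - z₀‖ ^ (5 / 2 : ℝ) ∧
        |g ζ - (a + b * ζ + c * ζ ^ 2).im| ≤ C₁ * Λ ^ (5 / 2 : ℝ) * ‖z - z₀‖ ^ (5 / 2 : ℝ) := by
      intro ζ hζ z hz
      have h1 := habc ζ hζ
      rw [sub_zero] at h1
      have h2 : C₁ * ‖ζ‖ ^ (5 / 2 : ℝ) ≤ C₁ * Λ ^ (5 / 2 : ℝ) * ‖z - z₀‖ ^ (5 / 2 : ℝ) := by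
        rw [mul_assoc C₁, ← Real.mul_rpow hΛ0.le (norm_nonneg _)]
        gcongr
      have h3 := h1.trans h2
      refine ⟨le_trans (le_trans (le_of_eq ?_) (Complex.abs_re_le_norm _)) h3,
        le_trans (le_trans (le_of_eq ?_) (Complex.abs_im_le_norm _)) h3⟩
      · congr 1; rw [Complex.sub_re]; simp [cpx]
      · congr 1; rw [Complex.sub_im]; simp [cpx]
    constructor
    · refine ⟨a.re, t⁻¹ * b.re - t⁻¹ * (t⁻¹ * l₀), -b.im, t⁻¹ ^ 2 * (c.re - l₁ / 2),
        -2 * t⁻¹ * c.im, -c.re, fun z hz => ?_⟩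
      obtain ⟨ζ, hζ, rfl, hle, h1, h2⟩ := hinv z hz
      have h3 := (hfin ζ hζ _ hle).1
      have h4 : C₁ * Λ ^ (5 / 2 : ℝ) * ‖stretch z₀ t ζ - z₀‖ ^ (5 / 2 : ℝ) ≤
          Λ * C₁ * Λ ^ (5 / 2 : ℝ) * ‖stretch z₀ t ζ - z₀‖ ^ (5 / 2 : ℝ) := by
        gcongr
        nlinarith
      refine le_trans (le_of_eq ?_) (h3.trans h4)
      congr 1
      simp only [hf, quad, sub_zero, pow_two, Complex.add_re, Complex.mul_re, Complex.mul_im, ← h2]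
      rw [h1]
      ring
    · refine ⟨t * a.im, b.im, t * b.re, t⁻¹ * c.im,
        2 * c.re, t * (-c.im + t⁻¹ * l₂ / 2), fun z hz => ?_⟩
      obtain ⟨ζ, hζ, rfl, hle, h1, h2⟩ := hinv z hz
      have h3 := (hfin ζ hζ _ hle).2
      have h4 : t * |g ζ - (a + b * ζ + c * ζ ^ 2).im| ≤
          Λ * (C₁ * Λ ^ (5 / 2 : ℝ) * ‖stretch z₀ t ζ - z₀‖ ^ (5 / 2 : ℝ)) := by
        gcongr
      refine le_trans (le_of_eq ?_) (h4.trans (le_of_eq (by ring)))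
      rw [← abs_of_pos ht0, ← abs_mul, abs_of_pos ht0]
      congr 1
      simp only [hg, quad, sub_zero, pow_two, Complex.add_im, Complex.mul_re, Complex.mul_im, ← h2]
      rw [h1]
      field_simp
      ring
  exact ⟨r / Λ, Λ * C₁ * Λ ^ (5 / 2 : ℝ), by positivity, by positivity, fun z hz => (main z hz).1,
    fun z hz => (main z hz).2⟩

end

section

/-- Hölder continuity of exponent `s` near the point `z`. -/
def HolderNear {E : Type*} [NormedAddCommGroup E] (s : ℝ) (f : ℂ → E) (z : ℂ) : Prop :=
  (fun p : ℂ × ℂ => f p.2 - f p.1) =O[𝓝 (z, z)] fun p => ‖p.2 - p.1‖ ^ s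

lemma tendsto_norm_sub_diag (z : ℂ) :
    Tendsto (fun p : ℂ × ℂ => ‖p.2 - p.1‖) (𝓝 (z, z)) (𝓝 0) := by
  have : Continuous fun p : ℂ × ℂ => ‖p.2 - p.1‖ := by fun_prop
  simpa using this.tendsto (z, z)

lemma isBigO_norm_rpow_of_le {s t : ℝ} (hs : 0 ≤ s) (hst : s ≤ t) (z : ℂ) :
    (fun p : ℂ × ℂ => ‖p.2 - p.1‖ ^ t) =O[𝓝 (z, z)] fun p => ‖p.2 - p.1‖ ^ s := by
  refine Asymptotics.IsBigO.of_bound 1 ?_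
  filter_upwards [(tendsto_norm_sub_diag z).eventually (gt_mem_nhds one_pos)] with p hp
  rw [one_mul, norm_of_nonneg (by positivity), norm_of_nonneg (by positivity)]
  rcases (norm_nonneg (p.2 - p.1)).eq_or_lt with h0 | h0
  · rw [← h0]
    rcases hs.eq_or_lt with rfl | hs'
    · rw [Real.rpow_zero]
      exact Real.zero_rpow_le_one t
    · rw [Real.zero_rpow hs'.ne', Real.zero_rpow (by linarith)]
  · exact Real.rpow_le_rpow_of_exponent_ge h0 hp.le hst

section
variable {E : Type*} [NormedAddCommGroup E]

lemma HolderNear.mono {s t : ℝ} (hs : 0 ≤ s) (hst : s ≤ t) {f : ℂ → E} {z : ℂ}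
    (h : HolderNear t f z) : HolderNear s f z := h.trans (isBigO_norm_rpow_of_le hs hst z)

lemma HolderNear.continuousAt {s : ℝ} (hs : 0 < s) {f : ℂ → E} {z : ℂ} (h : HolderNear s f z) :
    ContinuousAt f z := by
  have h1 : Tendsto (fun w : ℂ => ((z, w) : ℂ × ℂ)) (𝓝 z) (𝓝 (z, z)) :=
    (Continuous.prodMk_right z).tendsto z
  have h2 := Asymptotics.IsBigO.comp_tendsto h h1
  have h3 : Tendsto (fun w : ℂ => ‖w - z‖ ^ s) (𝓝 z) (𝓝 0) := by
    have : ContinuousAt (fun w : ℂ => ‖w - z‖ ^ s) z :=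
      ContinuousAt.rpow_const (by fun_prop) (Or.inr hs.le)
    simpa [Real.zero_rpow hs.ne'] using this.tendsto
  have h4 := h2.trans_tendsto h3
  rw [ContinuousAt, tendsto_iff_norm_sub_tendsto_zero]
  simpa using h4.norm

lemma HolderNear.congr {s : ℝ} {f g : ℂ → E} {z : ℂ} (h : HolderNear s f z) (hfg : f =ᶠ[𝓝 z] g) :
    HolderNear s g z := by
  refine Asymptotics.IsBigO.congr' h ?_ EventuallyEq.rfl
  rw [nhds_prod_eq]
  filter_upwards [hfg.prod_mk hfg] with p hp
  rw [hp.1, hp.2]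

lemma HolderNear.add {s : ℝ} {f g : ℂ → E} {z : ℂ} (hf : HolderNear s f z) (hg : HolderNear s g z) :
    HolderNear s (fun w => f w + g w) z := by
  refine (Asymptotics.IsBigO.add hf hg).congr_left fun p => ?_
  exact (add_sub_add_comm _ _ _ _).symm

end

lemma isBigO_one_of_continuousAt {f : ℂ × ℂ → ℝ} {p : ℂ × ℂ} (h : ContinuousAt f p) :
    f =O[𝓝 p] fun _ => (1 : ℝ) := h.tendsto.isBigO_one ℝ

lemma HolderNear.mul {s : ℝ} (hs : 0 < s) {f g : ℂ → ℝ} {z : ℂ} (hf : HolderNear s f z)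
    (hg : HolderNear s g z) : HolderNear s (fun w => f w * g w) z := by
  have h1 : (fun p : ℂ × ℂ => f p.1) =O[𝓝 (z, z)] fun _ => (1 : ℝ) :=
    isBigO_one_of_continuousAt (ContinuousAt.comp (g := f) (f := Prod.fst) (hf.continuousAt hs) continuousAt_fst)
  have h2 : (fun p : ℂ × ℂ => g p.2) =O[𝓝 (z, z)] fun _ => (1 : ℝ) :=
    isBigO_one_of_continuousAt (ContinuousAt.comp (g := g) (f := Prod.snd) (hg.continuousAt hs) continuousAt_snd)
  refine ((Asymptotics.IsBigO.mul h2 hf).add (Asymptotics.IsBigO.mul h1 hg)).congr (fun p => ?_) (fun p => one_mul _)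
  ring

lemma holderNear_one_of_contDiffAt {E : Type*} [NormedAddCommGroup E] [NormedSpace ℝ E] {f : ℂ → E}
    {z : ℂ} (h : ContDiffAt ℝ 1 f z) : HolderNear 1 f z := by
  obtain ⟨K, t, ht, hL⟩ := h.exists_lipschitzOnWith
  refine Asymptotics.IsBigO.of_bound K ?_
  filter_upwards [prod_mem_nhds ht ht] with p hp
  rw [Real.rpow_one, norm_norm, ← dist_eq_norm, ← dist_eq_norm]
  exact hL.dist_le_mul _ hp.2 _ hp.1

/-- Composition of a Hölder map with a Hölder map. -/
lemma HolderNear.comp {E : Type*} [NormedAddCommGroup E] {s : ℝ} (hs : 0 < s) {F : ℂ → E}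
    {m : ℂ → ℂ} {z : ℂ} (hm : HolderNear s m z) (hF : HolderNear 1 F (m z)) :
    HolderNear s (fun w => F (m w)) z := by
  have hc := hm.continuousAt hs
  have h1 : Tendsto (fun p : ℂ × ℂ => (m p.1, m p.2)) (𝓝 (z, z)) (𝓝 (m z, m z)) :=
    (ContinuousAt.comp (g := m) (f := Prod.fst) hc continuousAt_fst).prodMk_nhds
      (ContinuousAt.comp (g := m) (f := Prod.snd) hc continuousAt_snd)
  have h2 := Asymptotics.IsBigO.comp_tendsto hF h1
  refine h2.trans ?_
  simp only [Function.comp_def, Real.rpow_one]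
  exact Asymptotics.IsBigO.norm_left hm

/-- First order Taylor expansion with Hölder derivative. -/
lemma taylor_one_isBigO {f : ℂ → ℝ} {f' : ℂ → ℂ →L[ℝ] ℝ} {z : ℂ} {s : ℝ} (hs : 0 < s)
    (hf : ∀ᶠ w in 𝓝 z, HasFDerivAt f (f' w) w) (h : HolderNear s f' z) :
    (fun p : ℂ × ℂ => f p.2 - f p.1 - f' p.1 (p.2 - p.1)) =O[𝓝 (z, z)]
      fun p => ‖p.2 - p.1‖ ^ (1 + s) := by
  obtain ⟨C, hC⟩ := Asymptotics.IsBigO.bound h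
  rw [nhds_prod_eq, eventually_prod_iff] at hC
  obtain ⟨P, hP, P', hP', hPP⟩ := hC
  obtain ⟨δ, hδ, hb⟩ := Metric.eventually_nhds_iff_ball.1 (hf.and (hP.and hP'))
  refine Asymptotics.IsBigO.of_bound C ?_
  filter_upwards [prod_mem_nhds (ball_mem_nhds z hδ) (ball_mem_nhds z hδ)] with p hp
  obtain ⟨hp1, hp2⟩ := hp
  have hpos : (0 : ℝ) ≤ ‖p.2 - p.1‖ := norm_nonneg _
  have hC0 : ∀ w ∈ segment ℝ p.1 p.2, ‖f' w - f' p.1‖ ≤ C * ‖p.2 - p.1‖ ^ s := by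
    intro w hw
    have hwb : w ∈ ball z δ := (convex_ball z δ).segment_subset hp1 hp2 hw
    have h1 := hPP (hb _ hp1).2.1 (hb _ hwb).2.2
    have h2 : ‖w - p.1‖ ≤ ‖p.2 - p.1‖ := by
      obtain ⟨a, b, ha, hb', hab, rfl⟩ := hw
      have : a • p.1 + b • p.2 - p.1 = b • (p.2 - p.1) := by
        have : a = 1 - b := by linarith
        subst this; module
      rw [this, norm_smul, norm_of_nonneg hb']
      exact mul_le_of_le_one_left hpos (by linarith)
    rcases eq_or_ne w p.1 with rfl | hne
    · simp only [sub_self, norm_zero]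
      have h3 := hPP (hb _ hp1).2.1 (hb _ hp2).2.2
      refine (norm_nonneg _).trans (h3.trans_eq ?_)
      simp only [norm_of_nonneg (Real.rpow_nonneg hpos s)]
    refine h1.trans ?_
    simp only
    rw [norm_of_nonneg (by positivity)]
    have hCnn : 0 ≤ C := by
      by_contra hneg
      push Not at hneg
      have h4 : 0 < ‖w - p.1‖ ^ s := Real.rpow_pos_of_pos (norm_pos_iff.2 (sub_ne_zero.2 hne)) _
      simp only at h1
      rw [norm_of_nonneg h4.le] at h1
      nlinarith [norm_nonneg (f' w - f' p.1)]
    gcongr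
  have h5 := (convex_segment p.1 p.2).norm_image_sub_le_of_norm_hasFDerivWithin_le'
    (f := f) (f' := f') (φ := f' p.1) (C := C * ‖p.2 - p.1‖ ^ s)
    (fun w hw => (hb w ((convex_ball z δ).segment_subset hp1 hp2 hw)).1.hasFDerivWithinAt) hC0
    (left_mem_segment ℝ _ _) (right_mem_segment ℝ _ _)
  rw [norm_of_nonneg (Real.rpow_nonneg hpos (1 + s))]
  refine h5.trans_eq ?_
  rcases hpos.eq_or_lt with h0 | h0
  · rw [← h0, Real.zero_rpow (by linarith : 1 + s ≠ 0)]; simp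
  · rw [Real.rpow_add h0, Real.rpow_one]; ring

/-- The class of functions with `k` derivatives that are locally `1/2`-Hölder. -/
def HC : ℕ → (ℂ → ℝ) → Set ℂ → Prop
  | 0, f, U => ∀ z ∈ U, HolderNear (1 / 2) f z
  | k + 1, f, U => ∃ f₁ f₂ : ℂ → ℝ, (∀ z ∈ U, HasFDerivAt f (lin (f₁ z) (f₂ z)) z) ∧
      HC k f₁ U ∧ HC k f₂ U

lemma hasFDerivAt_congr_on {f g : ℂ → ℝ} {L : ℂ →L[ℝ] ℝ} {U : Set ℂ} (hU : IsOpen U) {z : ℂ}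
    (hz : z ∈ U) (hfg : ∀ z ∈ U, f z = g z) (h : HasFDerivAt f L z) : HasFDerivAt g L z :=
  h.congr_of_eventuallyEq (by filter_upwards [hU.mem_nhds hz] with y hy using (hfg y hy).symm)

lemma HC.continuousOn {k : ℕ} {f : ℂ → ℝ} {U : Set ℂ} (h : HC k f U) : ContinuousOn f U := by
  cases k with
  | zero => exact fun z hz => ((h z hz).continuousAt (by norm_num)).continuousWithinAt
  | succ k =>
    obtain ⟨f₁, f₂, hd, -, -⟩ := h
    exact fun z hz => (hd z hz).continuousAt.continuousWithinAt

lemma HC.contDiffOn {k : ℕ} {f : ℂ → ℝ} {U : Set ℂ} (hU : IsOpen U) (h : HC k f U) :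
    ContDiffOn ℝ k f U := by
  induction k generalizing f with
  | zero => simpa using h.continuousOn
  | succ k ih =>
    obtain ⟨f₁, f₂, hd, h1, h2⟩ := h
    have e : ((k + 1 : ℕ) : WithTop ℕ∞) = (k : WithTop ℕ∞) + 1 := by push_cast; rfl
    rw [e, contDiffOn_succ_iff_fderiv_of_isOpen hU]
    refine ⟨fun z hz => (hd z hz).differentiableAt.differentiableWithinAt, by simp, ?_⟩
    have h3 : ContDiffOn ℝ k (fun z => lin (f₁ z) (f₂ z)) U := by
      unfold lin
      exact ((ih h1).smul contDiffOn_const).add ((ih h2).smul contDiffOn_const)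
    exact h3.congr fun z hz => (hd z hz).fderiv

lemma hc_zero_of_contDiffOn {f : ℂ → ℝ} {U : Set ℂ} (hU : IsOpen U) (h : ContDiffOn ℝ 1 f U) :
    HC 0 f U := fun z hz =>
  (holderNear_one_of_contDiffAt (h.contDiffAt (hU.mem_nhds hz))).mono (by norm_num) (by norm_num)

lemma HC.of_succ {k : ℕ} {f : ℂ → ℝ} {U : Set ℂ} (hU : IsOpen U) (h : HC (k + 1) f U) :
    HC k f U := by
  induction k generalizing f with
  | zero => exact hc_zero_of_contDiffOn hU (by simpa using h.contDiffOn hU)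
  | succ k ih =>
    obtain ⟨f₁, f₂, hd, h1, h2⟩ := h
    exact ⟨f₁, f₂, hd, ih h1, ih h2⟩

lemma HC.to_zero {k : ℕ} {f : ℂ → ℝ} {U : Set ℂ} (hU : IsOpen U) (h : HC k f U) : HC 0 f U := by
  induction k with
  | zero => exact h
  | succ k ih => exact ih (h.of_succ hU)

lemma HC.add {k : ℕ} {f g : ℂ → ℝ} {U : Set ℂ} (hf : HC k f U) (hg : HC k g U) :
    HC k (fun z => f z + g z) U := by
  induction k generalizing f g with
  | zero => exact fun z hz => (hf z hz).add (hg z hz)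
  | succ k ih =>
    obtain ⟨f₁, f₂, hd, h1, h2⟩ := hf
    obtain ⟨g₁, g₂, gd, k1, k2⟩ := hg
    refine ⟨_, _, fun z hz => ((hd z hz).add (gd z hz)).congr_fderiv ?_, ih h1 k1, ih h2 k2⟩
    ext w; simp; ring

lemma HC.mul {k : ℕ} {f g : ℂ → ℝ} {U : Set ℂ} (hU : IsOpen U) (hf : HC k f U) (hg : HC k g U) :
    HC k (fun z => f z * g z) U := by
  induction k generalizing f g with
  | zero => exact fun z hz => (hf z hz).mul (by norm_num) (hg z hz)
  | succ k ih =>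
    have hf' := hf.of_succ hU
    have hg' := hg.of_succ hU
    obtain ⟨f₁, f₂, hd, h1, h2⟩ := hf
    obtain ⟨g₁, g₂, gd, k1, k2⟩ := hg
    refine ⟨_, _, fun z hz => ((hd z hz).mul (gd z hz)).congr_fderiv ?_,
      (ih hf' k1).add (ih hg' h1), (ih hf' k2).add (ih hg' h2)⟩
    ext w; simp; ring

/-- The map `z ↦ X z + i Im z`. -/
noncomputable def graphMap (X : ℂ → ℝ) (z : ℂ) : ℂ := ⟨X z, z.im⟩

lemma hasFDerivAt_comp_graphMap {F X : ℂ → ℝ} {a b X₁ X₂ : ℝ} {z : ℂ}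
    (hF : HasFDerivAt F (lin a b) (graphMap X z)) (hX : HasFDerivAt X (lin X₁ X₂) z) :
    HasFDerivAt (fun z => F (graphMap X z)) (lin (a * X₁) (a * X₂ + b)) z := by
  have h1 : HasFDerivAt (graphMap X) ((lin X₁ X₂).smulRight (1 : ℂ) + Complex.imCLM.smulRight Complex.I) z := by
    have := (hX.smul_const (1 : ℂ)).add (Complex.imCLM.hasFDerivAt.smul_const Complex.I)
    refine this.congr_of_eventuallyEq (Eventually.of_forall fun w => ?_)
    apply Complex.ext <;> simp [graphMap]
  refine (hF.comp z h1).congr_fderiv ?_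
  ext w; simp; ring

lemma HolderNear.graphMap {s : ℝ} (hs : 0 ≤ s) (hs1 : s ≤ 1) {X : ℂ → ℝ} {z : ℂ}
    (h : HolderNear s X z) : HolderNear s (graphMap X) z := by
  have h1 : HolderNear s (fun z : ℂ => z.im) z :=
    (holderNear_one_of_contDiffAt (by exact Complex.imCLM.contDiff.contDiffAt)).mono hs hs1
  have h2 : HolderNear s (fun z => (X z : ℂ)) z := by
    refine Asymptotics.IsBigO.trans ?_ h
    refine Asymptotics.IsBigO.of_bound 1 (Eventually.of_forall fun p => ?_)
    rw [← Complex.ofReal_sub, Complex.norm_real, one_mul]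
  have h3 : HolderNear s (fun z : ℂ => (z.im : ℂ) * Complex.I) z := by
    refine Asymptotics.IsBigO.trans ?_ h1
    refine Asymptotics.IsBigO.of_bound 1 (Eventually.of_forall fun p => ?_)
    rw [← sub_mul, ← Complex.ofReal_sub, norm_mul, Complex.norm_real, Complex.norm_I, one_mul, mul_one]
  refine (h2.add h3).congr (Eventually.of_forall fun w => ?_)
  apply Complex.ext <;> simp [MA.graphMap]

lemma HC.comp_graphMap {k : ℕ} {F X : ℂ → ℝ} {U V : Set ℂ} (hU : IsOpen U) (hV : IsOpen V)
    (hF : ContDiffOn ℝ ∞ F V) (hX : HC k X U) (hm : ∀ z ∈ U, graphMap X z ∈ V) :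
    HC k (fun z => F (graphMap X z)) U := by
  induction k generalizing F with
  | zero =>
    exact fun z hz => ((hX z hz).graphMap (by norm_num) (by norm_num)).comp (by norm_num)
      (holderNear_one_of_contDiffAt ((hF.contDiffAt (hV.mem_nhds (hm z hz))).of_le (by simp)))
  | succ k ih =>
    have hX' := hX.of_succ hU
    obtain ⟨X₁, X₂, hd, h1, h2⟩ := hX
    have hF' : ∀ v, ContDiffOn ℝ ∞ (fun w => fderiv ℝ F w v) V := fun v =>
      (hF.fderiv_of_isOpen hV (by simp)).clm_apply contDiffOn_const
    refine ⟨_, _, fun z hz => hasFDerivAt_comp_graphMap ?_ (hd z hz),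
      (ih (hF' 1) hX').mul hU h1, ((ih (hF' 1) hX').mul hU h2).add (ih (hF' Complex.I) hX')⟩
    have := ((hF.contDiffAt (hV.mem_nhds (hm z hz))).differentiableAt (by simp)).hasFDerivAt
    rwa [exists_eq_lin (fderiv ℝ F (graphMap X z))] at this

lemma mixed_eq {A a₁ a₂ : ℂ → ℝ} {a₁₁ a₁₂ a₂₁ a₂₂ : ℝ} {U : Set ℂ} (hU : IsOpen U)
    (h : ∀ z ∈ U, HasFDerivAt A (lin (a₁ z) (a₂ z)) z) {z : ℂ} (hz : z ∈ U)
    (h1 : HasFDerivAt a₁ (lin a₁₁ a₁₂) z) (h2 : HasFDerivAt a₂ (lin a₂₁ a₂₂) z) : a₁₂ = a₂₁ := by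
  have h3 : HasFDerivAt (fun z => lin (a₁ z) (a₂ z))
      ((lin a₁₁ a₁₂).smulRight Complex.reCLM + (lin a₂₁ a₂₂).smulRight Complex.imCLM) z := by
    unfold lin
    exact (h1.smul_const Complex.reCLM).add (h2.smul_const Complex.imCLM)
  have := second_derivative_symmetric_of_eventually (by filter_upwards [hU.mem_nhds hz] with y hy using h y hy) h3
    Complex.I 1
  simpa using this

end

section

lemma holderNear_half_of_bound {f g : ℂ → ℝ} {D : Set ℂ} {z : ℂ} {C δ : ℝ} (hD : D ∈ 𝓝 z) (hδ : 0 < δ)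
    (hfg : ∀ w ∈ D, f w = g w)
    (h : ∀ w ∈ D, ∀ w' ∈ D, dist w w' < δ → |f w - f w'| ≤ C * dist w w' ^ (1 / 2 : ℝ)) :
    HolderNear (1 / 2) g z := by
  refine Asymptotics.IsBigO.of_bound C ?_
  filter_upwards [prod_mem_nhds hD hD,
    (tendsto_norm_sub_diag z).eventually (gt_mem_nhds hδ)] with p hp hd
  have := h _ hp.2 _ hp.1 (by rwa [dist_eq_norm])
  rw [hfg _ hp.1, hfg _ hp.2] at this
  rwa [norm_of_nonneg (Real.rpow_nonneg (norm_nonneg _) _), norm_eq_abs, ← dist_eq_norm p.2]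

theorem Sys.hc_one {A B X Q G : ℂ → ℝ} {U : Set ℂ} (hS : Sys A B X Q G U) {a l₀ l₁ l₂ : ℂ → ℝ}
    (ha : ContinuousOn a U) (ha0 : ∀ z ∈ U, 0 < a z) (hl₀ : ContinuousOn l₀ U)
    (hl₁ : ContinuousOn l₁ U) (hl₂ : ContinuousOn l₂ U)
    (h : ∀ z ∈ U, (fun p : ℂ × ℂ => G p.2 - a p.1 * X p.2 -
      (l₀ p.1 + l₁ p.1 * (p.2 - p.1).re + l₂ p.1 * (p.2 - p.1).im)) =O[𝓝 (z, z)]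
        fun p => ‖p.2 - p.1‖ ^ (3 / 2 : ℝ)) :
    HC 1 X U ∧ HC 1 Q U := by
  have hU := hS.isOpen
  have main : ∀ z ∈ U, ∃ D, IsOpen D ∧ z ∈ D ∧ ∃ δ C : ℝ, 0 < δ ∧
      ∃ X₁ X₂ Q₁ Q₂ : ℂ → ℝ, (∀ w ∈ D, HasFDerivAt X (lin (X₁ w) (X₂ w)) w) ∧
        (∀ w ∈ D, HasFDerivAt Q (lin (Q₁ w) (Q₂ w)) w) ∧
        ∀ f : ℂ → ℝ, f = X₁ ∨ f = X₂ ∨ f = Q₁ ∨ f = Q₂ → ∀ w ∈ D, ∀ w' ∈ D, dist w w' < δ →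
          |f w - f w'| ≤ C * dist w w' ^ (1 / 2 : ℝ) := by
    intro z hz
    have hUz := hU.mem_nhds hz
    obtain ⟨K, hK⟩ := (h z hz).bound
    rw [nhds_prod_eq] at hK
    obtain ⟨P, hP', hPP⟩ := eventually_prod_self_iff'.1 hK
    have hP : ∀ᶠ w in 𝓝 z, w ∈ P := hP'
    have hb : ∀ {f : ℂ → ℝ}, ContinuousAt f z → ∀ᶠ w in 𝓝 z, |f w| < |f z| + 1 := fun hf =>
      hf.abs.eventually (gt_mem_nhds (by simp))
    have hat : 0 < √(a z) := Real.sqrt_pos.2 (ha0 z hz)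
    have hsq : ContinuousAt (fun w => √(a w)) z := (ha.continuousAt hUz).sqrt
    have hall := ((((hb (hS.left z hz).continuousAt).and (hb (hS.right z hz).continuousAt)).and
      ((hb (hl₀.continuousAt hUz)).and (hb (hl₁.continuousAt hUz)))).and
      ((hb (hl₂.continuousAt hUz)).and (hb hsq))).and
      ((hP.and hUz).and (hsq.eventually (lt_mem_nhds (half_lt_self hat))))
    obtain ⟨δ, hδ, hball⟩ := Metric.eventually_nhds_iff_ball.1 hall
    set Λ := (|l₀ z| + 1) + (|l₁ z| + 1) + (|l₂ z| + 1) + (|√(a z)| + 1) + 2 / √(a z) with hΛ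
    have e0 : 0 < 2 / √(a z) := by positivity
    have n0 := abs_nonneg (l₀ z)
    have n1 := abs_nonneg (l₁ z)
    have n2 := abs_nonneg (l₂ z)
    have n3 := abs_nonneg (√(a z))
    have hsub : ball z δ ⊆ U := fun w hw => (hball w hw).2.1.2
    have hS' : Sys A B X Q G (ball z δ) := ⟨isOpen_ball, fun w hw => hS.left w (hsub hw),
      fun w hw => hS.right w (hsub hw), hS.contX.mono hsub, hS.contQ.mono hsub, hS.contG.mono hsub⟩
    have hbb : ∀ w ∈ ball z (δ / 2), ball w (δ / 2) ⊆ ball z δ := fun w hw =>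
      ball_subset_ball' (by rw [mem_ball] at hw; linarith)
    obtain ⟨ρ, C, hρ, hC, hqA, hqB⟩ := hS'.quadApprox (D := ball z (δ / 2)) (ρ := δ / 2) (Λ := Λ)
      (K := |K|) (M := max (|A z| + 1) (|B z| + 1)) (half_pos hδ) (by linarith) (abs_nonneg _) hbb
      (fun w hw => ((hball w hw).1.1.1.1.le).trans (le_max_left _ _))
      (fun w hw => ((hball w hw).1.1.1.2.le).trans (le_max_right _ _)) (by
        intro w hw
        have hw' : w ∈ ball z δ := ball_subset_ball (by linarith) hw
        obtain ⟨⟨⟨-, b0, b1⟩, b2, b3⟩, ⟨pw, uw⟩, sw⟩ := hball w hw'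
        refine ⟨√(a w), l₀ w, l₁ w, l₂ w, ?_, (le_abs_self _).trans (by linarith), by linarith,
          by linarith, by linarith, ?_⟩
        · rw [div_le_iff₀ (by linarith)]
          have : 2 / √(a z) ≤ Λ := by linarith
          rw [div_le_iff₀ hat] at this
          have hΛ0 : 0 < Λ := by linarith
          nlinarith
        · intro y hy
          have := hPP w pw y (hball y (hbb w hw hy)).2.1.1
          simp only [norm_of_nonneg (Real.rpow_nonneg (norm_nonneg (y - w)) (3 / 2))] at this
          rw [Real.sq_sqrt (ha0 w uw).le]
          refine this.trans ?_
          gcongr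
          exact le_abs_self K)
    obtain ⟨f₁₁, f₁₂, f₂₂, hf1, hf2, hf3⟩ := hqA.exists_second_derivative hρ hC isOpen_ball
      (fun w hw => hS.left w (hsub (ball_subset_ball (by linarith) hw)))
    obtain ⟨g₁₁, g₁₂, g₂₂, hg1, hg2, hg3⟩ := hqB.exists_second_derivative hρ hC isOpen_ball
      (fun w hw => hS.right w (hsub (ball_subset_ball (by linarith) hw)))
    refine ⟨ball z (δ / 2), isOpen_ball, mem_ball_self (half_pos hδ), ρ / 3, 256 * C, by positivity,
      f₁₁, f₁₂, g₁₁, g₁₂, hf1, hg1, ?_⟩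
    rintro f (rfl | rfl | rfl | rfl) w hw w' hw' hd
    · exact (hf3 w hw w' hw' hd).1
    · exact (hf3 w hw w' hw' hd).2.1
    · exact (hg3 w hw w' hw' hd).1
    · exact (hg3 w hw w' hw' hd).2.1
  have fin : ∀ Y : ℂ → ℝ, (∀ z ∈ U, ∃ D, IsOpen D ∧ z ∈ D ∧ ∃ δ C : ℝ, 0 < δ ∧
      ∃ Y₁ Y₂ : ℂ → ℝ, (∀ w ∈ D, HasFDerivAt Y (lin (Y₁ w) (Y₂ w)) w) ∧
        ∀ f : ℂ → ℝ, f = Y₁ ∨ f = Y₂ → ∀ w ∈ D, ∀ w' ∈ D, dist w w' < δ →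
          |f w - f w'| ≤ C * dist w w' ^ (1 / 2 : ℝ)) → HC 1 Y U := by
    intro Y hY
    refine ⟨fun z => fderiv ℝ Y z 1, fun z => fderiv ℝ Y z Complex.I, fun z hz => ?_, fun z hz => ?_,
      fun z hz => ?_⟩
    all_goals obtain ⟨D, hD, hzD, δ, C, hδ, Y₁, Y₂, hd, hh⟩ := hY z hz
    · rw [← exists_eq_lin]
      exact (hd z hzD).differentiableAt.hasFDerivAt
    · exact holderNear_half_of_bound (hD.mem_nhds hzD) hδ
        (fun w hw => by rw [(hd w hw).fderiv]; simp) (hh Y₁ (Or.inl rfl))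
    · exact holderNear_half_of_bound (hD.mem_nhds hzD) hδ
        (fun w hw => by rw [(hd w hw).fderiv]; simp) (hh Y₂ (Or.inr rfl))
  refine ⟨fin X fun z hz => ?_, fin Q fun z hz => ?_⟩
  all_goals obtain ⟨D, hD, hzD, δ, C, hδ, X₁, X₂, Q₁, Q₂, hd1, hd2, hh⟩ := main z hz
  · exact ⟨D, hD, hzD, δ, C, hδ, X₁, X₂, hd1,
      fun f hf => hh f (hf.imp_right Or.inl)⟩
  · exact ⟨D, hD, hzD, δ, C, hδ, Q₁, Q₂, hd2, fun f hf => hh f (Or.inr (Or.inr hf))⟩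

lemma holderNear_lin {s : ℝ} {f g : ℂ → ℝ} {z : ℂ} (hf : HolderNear s f z) (hg : HolderNear s g z) :
    HolderNear s (fun w => lin (f w) (g w)) z := by
  have h : ∀ {f : ℂ → ℝ} (L : ℂ →L[ℝ] ℝ), HolderNear s f z → HolderNear s (fun w => f w • L) z := by
    intro f L hf
    refine Asymptotics.IsBigO.trans ?_ hf
    refine Asymptotics.IsBigO.of_bound ‖L‖ (Eventually.of_forall fun p => ?_)
    have e : f p.2 • L - f p.1 • L = (f p.2 - f p.1) • L := (sub_smul _ _ _).symm
    beta_reduce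
    rw [e, norm_smul, mul_comm]
  exact (h _ hf).add (h _ hg)

/-- Linear systems: one derivative at a time. -/
theorem Sys.hc_one_of_linear {A B X Q G a b : ℂ → ℝ} {U : Set ℂ} (hS : Sys A B X Q G U)
    (hG : ∀ z ∈ U, G z = a z * X z + b z) (ha : HC 1 a U) (hb : HC 1 b U) (ha0 : ∀ z ∈ U, 0 < a z)
    (hX : HC 0 X U) : HC 1 X U ∧ HC 1 Q U := by
  have hU := hS.isOpen
  have hac := ha.continuousOn
  have hbc := hb.continuousOn
  have hah := ha.contDiffOn hU
  obtain ⟨a₁, a₂, had, ha₁, ha₂⟩ := ha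
  obtain ⟨b₁, b₂, hbd, hb₁, hb₂⟩ := hb
  refine hS.hc_one (a := a) (l₀ := b) (l₁ := fun z => b₁ z + X z * a₁ z)
    (l₂ := fun z => b₂ z + X z * a₂ z) hac ha0 hbc
    (hb₁.continuousOn.add (hX.continuousOn.mul ha₁.continuousOn))
    (hb₂.continuousOn.add (hX.continuousOn.mul ha₂.continuousOn)) fun z hz => ?_
  have hUz := hU.mem_nhds hz
  have e : (1 + 1 / 2 : ℝ) = 3 / 2 := by norm_num
  have t1 := taylor_one_isBigO (by norm_num) (by filter_upwards [hUz] with w hw using had w hw)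
    (holderNear_lin (ha₁ z hz) (ha₂ z hz))
  have t2 := taylor_one_isBigO (by norm_num) (by filter_upwards [hUz] with w hw using hbd w hw)
    (holderNear_lin (hb₁ z hz) (hb₂ z hz))
  rw [e] at t1 t2
  have h1 : (fun p : ℂ × ℂ => X p.1) =O[𝓝 (z, z)] fun _ => (1 : ℝ) :=
    isBigO_one_of_continuousAt (ContinuousAt.comp (g := X) (f := Prod.fst)
      (hX.continuousOn.continuousAt hUz) continuousAt_fst)
  have t3 : (fun p : ℂ × ℂ => (a p.2 - a p.1) * (X p.2 - X p.1)) =O[𝓝 (z, z)]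
      fun p => ‖p.2 - p.1‖ ^ (3 / 2 : ℝ) := by
    have hm := Asymptotics.IsBigO.mul
      (holderNear_one_of_contDiffAt ((hah.contDiffAt hUz).of_le (by simp))) (hX z hz)
    refine hm.congr_right fun p => ?_
    rw [← e, Real.rpow_add_of_nonneg (norm_nonneg _) (by norm_num) (by norm_num)]
  have t4 : (fun p : ℂ × ℂ => X p.1 * (a p.2 - a p.1 - lin (a₁ p.1) (a₂ p.1) (p.2 - p.1)))
      =O[𝓝 (z, z)] fun p => ‖p.2 - p.1‖ ^ (3 / 2 : ℝ) := by
    simpa using Asymptotics.IsBigO.mul h1 t1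
  refine ((t4.add t3).add t2).congr' ?_ EventuallyEq.rfl
  filter_upwards [prod_mem_nhds hUz hUz] with p hp
  rw [hG _ hp.2]
  simp only [lin_apply]
  ring

/-- Differentiating a system in both directions. -/
theorem Sys.exists_deriv {A B X Q G : ℂ → ℝ} {U : Set ℂ} (hS : Sys A B X Q G U) {k : ℕ}
    (hX : HC (k + 1) X U) (hQ : HC (k + 1) Q U) {G₁ G₂ : ℂ → ℝ}
    (hG : ∀ z ∈ U, HasFDerivAt G (lin (G₁ z) (G₂ z)) z) (hG₂ : ContinuousOn G₂ U) :
    ∃ X₁ X₂ Q₁ Q₂ : ℂ → ℝ, HC k X₁ U ∧ HC k X₂ U ∧ HC k Q₁ U ∧ HC k Q₂ U ∧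
      (∀ z ∈ U, HasFDerivAt X (lin (X₁ z) (X₂ z)) z) ∧
      (∀ z ∈ U, HasFDerivAt Q (lin (Q₁ z) (Q₂ z)) z) ∧
      Sys X Q X₁ Q₁ G₁ U ∧ Sys (fun z => -Q z) G X₂ Q₂ G₂ U := by
  have hU := hS.isOpen
  obtain ⟨X₁, X₂, hXd, hX₁, hX₂⟩ := hX
  obtain ⟨Q₁, Q₂, hQd, hQ₁, hQ₂⟩ := hQ
  have hnQ : ∀ z ∈ U, HasFDerivAt (fun z => -Q z) (lin (-Q₁ z) (-Q₂ z)) z := fun z hz =>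
    (hQd z hz).neg.congr_fderiv (by ext w; simp; ring)
  have e1 : ∀ z ∈ U, X₂ z = -Q₁ z := fun z hz =>
    mixed_eq hU hS.left hz (hXd z hz) (hnQ z hz)
  have e2 : ∀ z ∈ U, Q₂ z = G₁ z := fun z hz =>
    mixed_eq hU hS.right hz (hQd z hz) (hG z hz)
  have hG₁ : ContinuousOn G₁ U := hQ₂.continuousOn.congr fun z hz => (e2 z hz).symm
  refine ⟨X₁, X₂, Q₁, Q₂, hX₁, hX₂, hQ₁, hQ₂, hXd, hQd,
    ⟨hU, fun z hz => ?_, fun z hz => ?_, hX₁.continuousOn, hQ₁.continuousOn, hG₁⟩,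
    ⟨hU, fun z hz => ?_, fun z hz => ?_, hX₂.continuousOn, hQ₂.continuousOn, hG₂⟩⟩
  · rw [← e1 z hz]; exact hXd z hz
  · rw [← e2 z hz]; exact hQd z hz
  · rw [e1 z hz]; exact hnQ z hz
  · rw [e2 z hz]; exact hG z hz

theorem Sys.hc_of_linear {k : ℕ} {A B X Q G a b : ℂ → ℝ} {U : Set ℂ} (hS : Sys A B X Q G U)
    (hG : ∀ z ∈ U, G z = a z * X z + b z) (ha : HC (k + 1) a U) (hb : HC (k + 1) b U)
    (ha0 : ∀ z ∈ U, 0 < a z) (hX : HC 0 X U) : HC (k + 1) X U ∧ HC (k + 1) Q U := by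
  have hU := hS.isOpen
  induction k generalizing A B X Q G b with
  | zero => exact hS.hc_one_of_linear hG ha hb ha0 hX
  | succ k ih =>
    have ha' := ha.of_succ hU
    have hb' := hb.of_succ hU
    obtain ⟨hXk, hQk⟩ := ih hS hG ha' hb' hX
    obtain ⟨a₁, a₂, had, ha₁, ha₂⟩ := ha
    obtain ⟨b₁, b₂, hbd, hb₁, hb₂⟩ := hb
    have hXk' := hXk
    obtain ⟨Y₁, Y₂, hYd, hY₁, hY₂⟩ := hXk'
    have hGd : ∀ z ∈ U, HasFDerivAt G (lin (a z * Y₁ z + (a₁ z * X z + b₁ z))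
        (a z * Y₂ z + (a₂ z * X z + b₂ z))) z := by
      intro z hz
      refine hasFDerivAt_congr_on hU hz (fun w hw => (hG w hw).symm) ?_
      refine (((had z hz).mul (hYd z hz)).add (hbd z hz)).congr_fderiv ?_
      ext w; simp; ring
    have c1 := (ha₁.mul hU hXk).add hb₁
    have c2 := (ha₂.mul hU hXk).add hb₂
    obtain ⟨X₁, X₂, Q₁, Q₂, hX₁, hX₂, hQ₁, hQ₂, hXd, hQd, hS₁, hS₂⟩ := hS.exists_deriv hXk hQk hGd
      ((ha'.continuousOn.mul hY₂.continuousOn).add c2.continuousOn)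
    have eY : ∀ z ∈ U, Y₁ z = X₁ z ∧ Y₂ z = X₂ z := fun z hz =>
      lin_injective ((hYd z hz).unique (hXd z hz))
    obtain ⟨r1, r2⟩ := ih hS₁ (fun z hz => by rw [(eY z hz).1]) ha' c1 (hX₁.to_zero hU)
    obtain ⟨r3, r4⟩ := ih hS₂ (fun z hz => by rw [(eY z hz).2]) ha' c2 (hX₂.to_zero hU)
    exact ⟨⟨X₁, X₂, hXd, r1, r3⟩, ⟨Q₁, Q₂, hQd, r2, r4⟩⟩

end

section

lemma norm_stretch_sub_le {t : ℝ} (ht : 0 ≤ t) (z₀ a b : ℂ) :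
    ‖stretch z₀ t a - stretch z₀ t b‖ ≤ max 1 t * ‖a - b‖ := by
  have : stretch z₀ t a - stretch z₀ t b = ⟨t * (a - b).re, (a - b).im⟩ := by
    apply Complex.ext <;> simp [mul_sub]
  rw [this]
  exact norm_mk_mul_le (le_max_left _ _) ht (le_max_right _ _)

lemma graphMap_continuousAt {X : ℂ → ℝ} {z : ℂ} (h : ContinuousAt X z) :
    ContinuousAt (graphMap X) z := by
  have h1 : ContinuousAt (fun z => (X z : ℂ) + (z.im : ℂ) * Complex.I) z :=
    (Complex.continuous_ofReal.continuousAt.comp h).add (by fun_prop)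
  refine h1.congr (Eventually.of_forall fun w => ?_)
  apply Complex.ext <;> simp [graphMap]

theorem Sys.holderNear_of_nonlinear {A B X Q G F : ℂ → ℝ} {U V : Set ℂ} (hS : Sys A B X Q G U)
    (hV : IsOpen V) (hF : ContDiffOn ℝ ∞ F V) (hm : ∀ z ∈ U, graphMap X z ∈ V)
    (hG : ∀ z ∈ U, G z = F (graphMap X z)) (hFx : ∀ w ∈ V, 0 < fderiv ℝ F w 1) {z : ℂ} (hz : z ∈ U) :
    HolderNear (3 / 4) X z := by
  obtain ⟨ε, hε, hstep⟩ := exists_holder_of_dbar_contraction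
  have hUz := hS.isOpen.mem_nhds hz
  set m := graphMap X z with hmdef
  set t := √(fderiv ℝ F m 1) with htdef
  have ht : 0 < t := Real.sqrt_pos.2 (hFx m (hm z hz))
  have ht2 : fderiv ℝ F m 1 = t ^ 2 := (Real.sq_sqrt (hFx m (hm z hz)).le).symm
  set δ := ε * t ^ 2 with hδdef
  have hδ : 0 < δ := by positivity
  have hstr : HasStrictFDerivAt F (fderiv ℝ F m) m :=
    (hF.contDiffAt (hV.mem_nhds (hm z hz))).hasStrictFDerivAt (by simp)
  have h1 := hstr.isLittleO.bound hδ
  rw [nhds_prod_eq] at h1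
  obtain ⟨N, hN, hNN⟩ := eventually_prod_self_iff'.1 h1
  have h2 : ∀ᶠ w in 𝓝 z, graphMap X w ∈ N :=
    graphMap_continuousAt (hS.contX.continuousAt hUz) hN
  obtain ⟨r, hr, hball⟩ := Metric.eventually_nhds_iff_ball.1 (h2.and hUz)
  set R := r / (3 * max 1 t) with hR
  have hmax : 0 < max 1 t := by positivity
  have hR0 : 0 < R := by positivity
  have hSm : ∀ ζ ∈ ball (0 : ℂ) (3 * R), stretch z t ζ ∈ ball z r := by
    intro ζ hζ
    rw [mem_ball_zero_iff] at hζ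
    rw [mem_ball, dist_eq_norm]
    refine (dist_stretch_le (le_max_left 1 t) ht.le (le_max_right 1 t) z ζ).trans_lt ?_
    calc max 1 t * ‖ζ‖ < max 1 t * (3 * R) := by gcongr
      _ = r := by rw [hR]; field_simp
  have hSU : ∀ ζ ∈ ball (0 : ℂ) (3 * R), stretch z t ζ ∈ U := fun ζ hζ => (hball _ (hSm ζ hζ)).2
  have hcomp : ∀ {k : ℂ → ℝ}, ContinuousOn k U →
      ContinuousOn (fun ζ => k (stretch z t ζ)) (ball 0 (3 * R)) := fun hk =>
    hk.comp (continuous_stretch z t).continuousOn hSU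
  have hfd : ∀ ζ ∈ ball (0 : ℂ) (3 * R), HasFDerivAt (fun ζ => A (stretch z t ζ))
      (lin (t * X (stretch z t ζ)) (-Q (stretch z t ζ))) ζ := fun ζ hζ =>
    hasFDerivAt_comp_stretch (hS.left _ (hSU ζ hζ))
  have hgd : ∀ ζ ∈ ball (0 : ℂ) (3 * R), HasFDerivAt (fun ζ => t⁻¹ * B (stretch z t ζ))
      (lin (Q (stretch z t ζ)) (t⁻¹ * G (stretch z t ζ))) ζ := by
    intro ζ hζ
    refine ((hasFDerivAt_comp_stretch (hS.right _ (hSU ζ hζ))).const_mul t⁻¹).congr_fderiv ?_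
    ext w; simp; field_simp
  obtain ⟨C, hC0, hC⟩ := hstep (Z := cpx (fun ζ => A (stretch z t ζ)) (fun ζ => t⁻¹ * B (stretch z t ζ)))
    (g := fun ζ => t * X (stretch z t ζ) - t⁻¹ * G (stretch z t ζ)) (U := ball 0 (3 * R))
    (z₀ := 0) (R := R) (K := t⁻¹ * (|fderiv ℝ F m Complex.I| + δ)) isOpen_ball hR0
    (closedBall_subset_ball (by linarith))
    (contDiffOn_cpx
      (contDiffOn_one_of_lin isOpen_ball hfd (continuousOn_const.mul (hcomp hS.contX)) (hcomp hS.contQ).neg)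
      (contDiffOn_one_of_lin isOpen_ball hgd (hcomp hS.contQ) (continuousOn_const.mul (hcomp hS.contG))))
    (by
      intro ζ hζ
      rw [dbar_cpx (hfd ζ hζ) (hgd ζ hζ)]
      simp) (by positivity) (by
      intro ζ hζ ζ' hζ'
      rw [fderiv_cpx_one (hfd ζ hζ) (hgd ζ hζ), fderiv_cpx_one (hfd ζ' hζ') (hgd ζ' hζ'),
        hG _ (hSU ζ hζ), hG _ (hSU ζ' hζ')]
      have hk := hNN _ (hball _ (hSm ζ hζ)).1 _ (hball _ (hSm ζ' hζ')).1
      simp only at hk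
      set w := graphMap X (stretch z t ζ) with hw
      set w' := graphMap X (stretch z t ζ') with hw'
      have ew : w - w' = (⟨X (stretch z t ζ) - X (stretch z t ζ'), (ζ - ζ').im⟩ : ℂ) := by
        apply Complex.ext <;> simp [hw, hw', graphMap]
      have nw : ‖w - w'‖ ≤ |X (stretch z t ζ) - X (stretch z t ζ')| + |(ζ - ζ').im| := by
        rw [ew]; exact Complex.norm_le_abs_re_add_abs_im _
      rw [exists_eq_lin (fderiv ℝ F m), lin_apply, ht2, ew, ← ew] at hk
      have er : (w - w').re = X (stretch z t ζ) - X (stretch z t ζ') := by rw [ew]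
      have ei : (w - w').im = (ζ - ζ').im := by rw [ew]
      rw [er, ei, norm_eq_abs] at hk
      set Δ := X (stretch z t ζ) - X (stretch z t ζ') with hΔ
      set Fy := fderiv ℝ F m Complex.I
      have hk2 := hk.trans (mul_le_mul_of_nonneg_left nw hδ.le)
      have e1 : t * X (stretch z t ζ) - t⁻¹ * F w - (t * X (stretch z t ζ') - t⁻¹ * F w') =
          -(t⁻¹ * ((F w - F w' - (t ^ 2 * Δ + Fy * (ζ - ζ').im)) + Fy * (ζ - ζ').im)) := by
        rw [hΔ]; field_simp; ring
      have e2 : t * |Δ| ≤ ‖((t * X (stretch z t ζ) : ℝ) : ℂ) + Complex.I * (Q (stretch z t ζ) : ℂ) -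
          (((t * X (stretch z t ζ') : ℝ) : ℂ) + Complex.I * (Q (stretch z t ζ') : ℂ))‖ := by
        refine le_trans (le_of_eq ?_) (Complex.abs_re_le_norm _)
        rw [← abs_of_pos ht, ← abs_mul, abs_of_pos ht]
        congr 1
        simp [hΔ]; ring
      have e3 : |(ζ - ζ').im| ≤ dist ζ ζ' := by rw [dist_eq_norm]; exact Complex.abs_im_le_norm _
      rw [e1, abs_neg, abs_mul, abs_of_pos (inv_pos.2 ht)]
      have e4 := (abs_add_le (F w - F w' - (t ^ 2 * Δ + Fy * (ζ - ζ').im)) (Fy * (ζ - ζ').im)).trans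
        (add_le_add_left hk2 _)
      rw [abs_mul] at e4
      calc _ ≤ t⁻¹ * (δ * (|Δ| + |(ζ - ζ').im|) + |Fy| * |(ζ - ζ').im|) := by gcongr
        _ = ε * (t * |Δ|) + t⁻¹ * (|Fy| + δ) * |(ζ - ζ').im| := by
          rw [hδdef]; field_simp; ring
        _ ≤ _ := by gcongr)
  have htend : Tendsto (fun p : ℂ => stretch 0 t⁻¹ (p - z)) (𝓝 z) (𝓝 0) := by
    have : Continuous fun p : ℂ => stretch 0 t⁻¹ (p - z) :=
      (continuous_stretch 0 t⁻¹).comp (by fun_prop)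
    have h := this.tendsto z
    have e : stretch 0 t⁻¹ (z - z) = 0 := by apply Complex.ext <;> simp
    rwa [e] at h
  have hinv : ∀ p : ℂ, stretch z t (stretch 0 t⁻¹ (p - z)) = p := by
    intro p
    apply Complex.ext
    · simp [← mul_assoc, mul_inv_cancel₀ ht.ne']
    · simp
  have hev := htend.eventually (closedBall_mem_nhds (0 : ℂ) (show 0 < R / 4 by positivity))
  refine Asymptotics.IsBigO.of_bound (t⁻¹ * (C * (max 1 t⁻¹) ^ (3 / 4 : ℝ))) ?_
  filter_upwards [prod_mem_nhds hev hev] with p hp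
  have h1 := hC _ hp.2 _ hp.1
  have hb : ∀ q : ℂ, stretch 0 t⁻¹ (q - z) ∈ closedBall 0 (R / 4) →
      stretch 0 t⁻¹ (q - z) ∈ ball (0 : ℂ) (3 * R) :=
    fun q hq => closedBall_subset_ball (by linarith) hq
  rw [fderiv_cpx_one (hfd _ (hb _ hp.1)) (hgd _ (hb _ hp.1)),
    fderiv_cpx_one (hfd _ (hb _ hp.2)) (hgd _ (hb _ hp.2)), hinv, hinv] at h1
  have e2 : t * |X p.2 - X p.1| ≤ ‖((t * X p.2 : ℝ) : ℂ) + Complex.I * (Q p.2 : ℂ) -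
      (((t * X p.1 : ℝ) : ℂ) + Complex.I * (Q p.1 : ℂ))‖ := by
    refine le_trans (le_of_eq ?_) (Complex.abs_re_le_norm _)
    rw [← abs_of_pos ht, ← abs_mul, abs_of_pos ht]
    congr 1
    simp; ring
  have e3 : dist (stretch 0 t⁻¹ (p.2 - z)) (stretch 0 t⁻¹ (p.1 - z)) ≤ max 1 t⁻¹ * ‖p.2 - p.1‖ := by
    rw [dist_eq_norm]
    refine (norm_stretch_sub_le (inv_pos.2 ht).le 0 _ _).trans_eq ?_
    rw [sub_sub_sub_cancel_right]
  have e4 : t * |X p.2 - X p.1| ≤ C * (max 1 t⁻¹) ^ (3 / 4 : ℝ) * ‖p.2 - p.1‖ ^ (3 / 4 : ℝ) := by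
    refine (e2.trans h1).trans ?_
    rw [mul_assoc, ← Real.mul_rpow (by positivity) (norm_nonneg _)]
    gcongr
  rw [norm_eq_abs, norm_of_nonneg (Real.rpow_nonneg (norm_nonneg _) _), mul_assoc t⁻¹]
  rwa [inv_mul_eq_div, le_div_iff₀ ht, mul_comm]

theorem Sys.hc_of_nonlinear {A B X Q G F : ℂ → ℝ} {U V : Set ℂ} (hS : Sys A B X Q G U)
    (hV : IsOpen V) (hF : ContDiffOn ℝ ∞ F V) (hm : ∀ z ∈ U, graphMap X z ∈ V)
    (hG : ∀ z ∈ U, G z = F (graphMap X z)) (hFx : ∀ w ∈ V, 0 < fderiv ℝ F w 1) (k : ℕ) :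
    HC (k + 1) X U ∧ HC (k + 1) Q U := by
  have hU := hS.isOpen
  have hF' : ∀ v, ContDiffOn ℝ ∞ (fun w => fderiv ℝ F w v) V := fun v =>
    (hF.fderiv_of_isOpen hV (by simp)).clm_apply contDiffOn_const
  have hmc : ContinuousOn (graphMap X) U := fun z hz =>
    (graphMap_continuousAt (hS.contX.continuousAt (hU.mem_nhds hz))).continuousWithinAt
  have hcomp : ∀ {k : ℂ → ℝ}, ContinuousOn k V → ContinuousOn (fun z => k (graphMap X z)) U :=
    fun hk => hk.comp hmc hm
  induction k with
  | zero =>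
    refine hS.hc_one (a := fun z => fderiv ℝ F (graphMap X z) 1)
      (l₀ := fun z => F (graphMap X z) - fderiv ℝ F (graphMap X z) 1 * X z) (l₁ := fun _ => 0)
      (l₂ := fun z => fderiv ℝ F (graphMap X z) Complex.I) (hcomp (hF' 1).continuousOn)
      (fun z hz => hFx _ (hm z hz))
      ((hcomp hF.continuousOn).sub ((hcomp (hF' 1).continuousOn).mul hS.contX)) continuousOn_const
      (hcomp (hF' Complex.I).continuousOn) fun z hz => ?_
    have hUz := hU.mem_nhds hz
    have hh := (hS.holderNear_of_nonlinear hV hF hm hG hFx hz).graphMap (by norm_num) (by norm_num)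
    have hVm := hV.mem_nhds (hm z hz)
    have t1 := taylor_one_isBigO (f := F) (f' := fderiv ℝ F) (z := graphMap X z) (s := 1) one_pos
      (by
        filter_upwards [hVm] with w hw
        exact ((hF.contDiffAt (hV.mem_nhds hw)).differentiableAt (by simp)).hasFDerivAt)
      (holderNear_one_of_contDiffAt (((hF.fderiv_of_isOpen hV (by simp) :
        ContDiffOn ℝ ∞ _ V).contDiffAt hVm).of_le (by simp)))
    have hc := hmc.continuousAt hUz
    have h1 : Tendsto (fun p : ℂ × ℂ => (graphMap X p.1, graphMap X p.2)) (𝓝 (z, z))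
        (𝓝 (graphMap X z, graphMap X z)) :=
      (ContinuousAt.comp (g := graphMap X) (f := Prod.fst) hc continuousAt_fst).prodMk_nhds
        (ContinuousAt.comp (g := graphMap X) (f := Prod.snd) hc continuousAt_snd)
    have t2 := t1.comp_tendsto h1
    have t3 : (fun p : ℂ × ℂ => ‖graphMap X p.2 - graphMap X p.1‖ ^ (1 + 1 : ℝ)) =O[𝓝 (z, z)]
        fun p => ‖p.2 - p.1‖ ^ (3 / 2 : ℝ) := by
      have := Asymptotics.IsBigO.mul hh.norm_left hh.norm_left
      refine this.congr (fun p => ?_) fun p => ?_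
      · rw [one_add_one_eq_two, Real.rpow_two, sq]
      · rw [← Real.rpow_add_of_nonneg (norm_nonneg _) (by norm_num) (by norm_num)]; norm_num
    refine (t2.trans t3).congr' ?_ EventuallyEq.rfl
    filter_upwards [prod_mem_nhds hUz hUz] with p hp
    rw [hG _ hp.2]
    simp only [Function.comp_apply]
    have : fderiv ℝ F (graphMap X p.1) (graphMap X p.2 - graphMap X p.1) =
        fderiv ℝ F (graphMap X p.1) 1 * (X p.2 - X p.1) +
        fderiv ℝ F (graphMap X p.1) Complex.I * (p.2 - p.1).im := by
      conv_lhs => rw [exists_eq_lin (fderiv ℝ F (graphMap X p.1)), lin_apply]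
      simp [graphMap]
    rw [this]
    ring
  | succ k ih =>
    obtain ⟨hXk, hQk⟩ := ih
    have c1 := HC.comp_graphMap hU hV (hF' 1) hXk hm
    have c2 := HC.comp_graphMap hU hV (hF' Complex.I) hXk hm
    have hXk' := hXk
    obtain ⟨Y₁, Y₂, hYd, hY₁, hY₂⟩ := hXk'
    have hGd : ∀ z ∈ U, HasFDerivAt G (lin (fderiv ℝ F (graphMap X z) 1 * Y₁ z)
        (fderiv ℝ F (graphMap X z) 1 * Y₂ z + fderiv ℝ F (graphMap X z) Complex.I)) z := by
      intro z hz
      refine hasFDerivAt_congr_on hU hz (fun w hw => (hG w hw).symm) ?_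
      refine hasFDerivAt_comp_graphMap ?_ (hYd z hz)
      rw [← exists_eq_lin]
      exact ((hF.contDiffAt (hV.mem_nhds (hm z hz))).differentiableAt (by simp)).hasFDerivAt
    obtain ⟨X₁, X₂, Q₁, Q₂, hX₁, hX₂, hQ₁, hQ₂, hXd, hQd, hS₁, hS₂⟩ := hS.exists_deriv hXk hQk hGd
      ((c1.continuousOn.mul hY₂.continuousOn).add c2.continuousOn)
    have eY : ∀ z ∈ U, Y₁ z = X₁ z ∧ Y₂ z = X₂ z := fun z hz =>
      lin_injective ((hYd z hz).unique (hXd z hz))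
    have hzero : ∀ k : ℕ, HC k (fun _ => (0 : ℝ)) U := by
      intro k
      have : ∀ k : ℕ, HC k (fun _ => (0 : ℝ)) U := fun k => by
        induction k with
        | zero => exact hc_zero_of_contDiffOn hU contDiffOn_const
        | succ k ih =>
          refine ⟨_, _, fun z _ => (hasFDerivAt_const (0 : ℝ) z).congr_fderiv ?_, ih, ih⟩
          ext w; simp
      exact this k
    obtain ⟨r1, r2⟩ := hS₁.hc_of_linear (b := fun _ => 0)
      (fun z hz => by rw [(eY z hz).1, add_zero]) c1 (hzero _) (fun z hz => hFx _ (hm z hz)) (hX₁.to_zero hU)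
    obtain ⟨r3, r4⟩ := hS₂.hc_of_linear (fun z hz => by rw [(eY z hz).2]) c1 c2
      (fun z hz => hFx _ (hm z hz)) (hX₂.to_zero hU)
    exact ⟨⟨X₁, X₂, hXd, r1, r3⟩, ⟨Q₁, Q₂, hQd, r2, r4⟩⟩

/-- Regularity of continuous solutions of the quasilinear system. -/
theorem Sys.contDiffOn {A B X Q G F : ℂ → ℝ} {U V : Set ℂ} (hS : Sys A B X Q G U)
    (hV : IsOpen V) (hF : ContDiffOn ℝ ∞ F V) (hm : ∀ z ∈ U, graphMap X z ∈ V)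
    (hG : ∀ z ∈ U, G z = F (graphMap X z)) (hFx : ∀ w ∈ V, 0 < fderiv ℝ F w 1) :
    ContDiffOn ℝ ∞ X U ∧ ContDiffOn ℝ ∞ Q U := by
  constructor <;> rw [contDiffOn_infty] <;> intro n
  · exact ((hS.hc_of_nonlinear hV hF hm hG hFx n).1.of_succ hS.isOpen).contDiffOn hS.isOpen
  · exact ((hS.hc_of_nonlinear hV hF hm hG hFx n).2.of_succ hS.isOpen).contDiffOn hS.isOpen

end

section

lemma continuous_mk : Continuous fun p : ℝ × ℝ => (⟨p.1, p.2⟩ : ℂ) :=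
  Complex.equivRealProdCLM.symm.continuous

lemma hasDerivAt_mk_left (t y : ℝ) : HasDerivAt (fun s : ℝ => (⟨s, y⟩ : ℂ)) 1 t := by
  have h : HasDerivAt (fun s : ℝ => (s : ℂ) + y * Complex.I) 1 t :=
    (Complex.ofRealCLM.hasDerivAt.add_const _)
  refine h.congr_of_eventuallyEq (Eventually.of_forall fun s => ?_)
  apply Complex.ext <;> simp

lemma hasDerivAt_mk_right (x t : ℝ) : HasDerivAt (fun s : ℝ => (⟨x, s⟩ : ℂ)) Complex.I t := by
  have h : HasDerivAt (fun s : ℝ => (x : ℂ) + s * Complex.I) Complex.I t := by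
    have := ((Complex.ofRealCLM.hasDerivAt (x := t)).mul_const Complex.I).const_add (x : ℂ)
    simpa using this
  refine h.congr_of_eventuallyEq (Eventually.of_forall fun s => ?_)
  apply Complex.ext <;> simp

lemma HasFDerivAt.left_slice {f : ℂ → ℝ} {L : ℂ →L[ℝ] ℝ} {x y : ℝ}
    (h : HasFDerivAt f L ⟨x, y⟩) : HasDerivAt (fun t => f ⟨t, y⟩) (L 1) x :=
  h.comp_hasDerivAt x (hasDerivAt_mk_left x y)

lemma HasFDerivAt.right_slice {f : ℂ → ℝ} {L : ℂ →L[ℝ] ℝ} {x y : ℝ}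
    (h : HasFDerivAt f L ⟨x, y⟩) : HasDerivAt (fun t => f ⟨x, t⟩) (L Complex.I) y :=
  h.comp_hasDerivAt y (hasDerivAt_mk_right x y)

/-- A function of two real variables with continuous partial derivatives is differentiable. -/
lemma hasFDerivAt_of_partials {f f₁ f₂ : ℂ → ℝ} {U : Set ℂ} (hU : IsOpen U)
    (h1 : ∀ z ∈ U, HasDerivAt (fun t => f ⟨t, z.im⟩) (f₁ z) z.re)
    (h2 : ∀ z ∈ U, HasDerivAt (fun t => f ⟨z.re, t⟩) (f₂ z) z.im)
    (c1 : ContinuousOn f₁ U) (c2 : ContinuousOn f₂ U) {z : ℂ} (hz : z ∈ U) :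
    HasFDerivAt f (lin (f₁ z) (f₂ z)) z := by
  have hm : ContinuousAt (fun p : ℝ × ℝ => (⟨p.1, p.2⟩ : ℂ)) (z.re, z.im) :=
    continuous_mk.continuousAt
  have hev : ∀ᶠ p : ℝ × ℝ in 𝓝 (z.re, z.im), (⟨p.1, p.2⟩ : ℂ) ∈ U :=
    hm.eventually (hU.mem_nhds hz)
  have key := hasStrictFDerivAt_uncurry_coprod (𝕜 := ℝ) (u := (z.re, z.im))
    (f := fun x y => f ⟨x, y⟩)
    (f₁ := fun x y => ContinuousLinearMap.toSpanSingleton ℝ (f₁ ⟨x, y⟩))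
    (f₂ := fun x y => ContinuousLinearMap.toSpanSingleton ℝ (f₂ ⟨x, y⟩))
    (by filter_upwards [hev] with p hp using (h1 _ hp).hasFDerivAt)
    (by filter_upwards [hev] with p hp using (h2 _ hp).hasFDerivAt)
    (by
      have : ContinuousAt (fun p : ℝ × ℝ => f₁ ⟨p.1, p.2⟩) (z.re, z.im) :=
        ContinuousAt.comp (f := fun p : ℝ × ℝ => (⟨p.1, p.2⟩ : ℂ)) (g := f₁)
          (c1.continuousAt (hU.mem_nhds hz)) hm
      exact (ContinuousLinearMap.toSpanSingletonCLE (𝕜 := ℝ) (E := ℝ)).continuous.continuousAt.comp this)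
    (by
      have : ContinuousAt (fun p : ℝ × ℝ => f₂ ⟨p.1, p.2⟩) (z.re, z.im) :=
        ContinuousAt.comp (f := fun p : ℝ × ℝ => (⟨p.1, p.2⟩ : ℂ)) (g := f₂)
          (c2.continuousAt (hU.mem_nhds hz)) hm
      exact (ContinuousLinearMap.toSpanSingletonCLE (𝕜 := ℝ) (E := ℝ)).continuous.continuousAt.comp this)
  have h3 := key.hasFDerivAt.comp z (Complex.equivRealProdCLM.hasFDerivAt (x := z))
  refine h3.congr_fderiv ?_
  ext w
  simp [Function.HasUncurry.uncurry, mul_comm]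

/-- The primitive of `f` along horizontal lines. -/
noncomputable def hprim (x₀ : ℝ) (f : ℂ → ℝ) (w : ℂ) : ℝ := ∫ s in x₀..w.re, f ⟨s, w.im⟩

lemma continuous_hprim (x₀ : ℝ) {f : ℂ → ℝ} (hf : Continuous f) : Continuous (hprim x₀ f) := by
  unfold hprim
  refine intervalIntegral.continuous_parametric_intervalIntegral_of_continuous
    (μ := volume) (f := fun w s => f ⟨s, w.im⟩) ?_ Complex.continuous_re
  exact hf.comp (continuous_mk.comp (continuous_snd.prodMk (Complex.continuous_im.comp continuous_fst)))

lemma hasFDerivAt_hprim (x₀ : ℝ) {f : ℂ → ℝ} (hf : ContDiff ℝ 1 f) (z : ℂ) :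
    HasFDerivAt (hprim x₀ f) (lin (f z) (hprim x₀ (fun w => fderiv ℝ f w Complex.I) z)) z := by
  have hf' : Continuous (fun w => fderiv ℝ f w Complex.I) :=
    (hf.continuous_fderiv (by simp)).clm_apply continuous_const
  have hrow : ∀ y : ℝ, Continuous fun s : ℝ => (⟨s, y⟩ : ℂ) := fun y =>
    continuous_mk.comp (continuous_id.prodMk continuous_const)
  refine hasFDerivAt_of_partials (U := univ) isOpen_univ ?_ ?_ hf.continuous.continuousOn
    (continuous_hprim x₀ hf').continuousOn (mem_univ z)
  · intro z _
    exact intervalIntegral.integral_hasDerivAt_right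
      ((hf.continuous.comp (hrow z.im)).intervalIntegrable _ _)
      ((hf.continuous.comp (hrow z.im)).stronglyMeasurable.stronglyMeasurableAtFilter)
      (hf.continuous.comp (hrow z.im)).continuousAt
  · intro z _
    have hK : IsCompact (uIcc x₀ z.re ×ℂ Icc (z.im - 1) (z.im + 1)) :=
      isCompact_uIcc.reProdIm isCompact_Icc
    obtain ⟨M, hM⟩ := hK.exists_bound_of_continuousOn hf'.continuousOn
    refine (intervalIntegral.hasDerivAt_integral_of_dominated_loc_of_deriv_le
      (F := fun y s => f ⟨s, y⟩) (F' := fun y s => fderiv ℝ f ⟨s, y⟩ Complex.I)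
      (bound := fun _ => M) (s := Icc (z.im - 1) (z.im + 1))
      (Icc_mem_nhds (by linarith) (by linarith)) ?_ ?_ ?_ ?_ (by simp) ?_).2
    · exact Eventually.of_forall fun y => (hf.continuous.comp (hrow y)).aestronglyMeasurable
    · exact (hf.continuous.comp (hrow _)).intervalIntegrable _ _
    · exact (hf'.comp (hrow _)).aestronglyMeasurable
    · refine Eventually.of_forall fun s hs y hy => hM _ ⟨uIoc_subset_uIcc hs, hy⟩
    · refine Eventually.of_forall fun s hs y hy => ?_
      exact HasFDerivAt.right_slice ((hf.differentiable (by simp)) _).hasFDerivAt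

lemma contDiff_hprim (x₀ : ℝ) {f : ℂ → ℝ} (hf : ContDiff ℝ ∞ f) : ContDiff ℝ ∞ (hprim x₀ f) := by
  rw [contDiff_infty]
  intro n
  induction n generalizing f with
  | zero => exact contDiff_zero.2 (continuous_hprim x₀ hf.continuous)
  | succ n ih =>
    have hf' : ContDiff ℝ ∞ (fun w => fderiv ℝ f w Complex.I) :=
      (hf.fderiv_right (by simp)).clm_apply contDiff_const
    have h1 := fun z => hasFDerivAt_hprim x₀ (hf.of_le (by simp)) z
    rw [show ((n + 1 : ℕ) : WithTop ℕ∞) = (n : WithTop ℕ∞) + 1 by simp, contDiff_succ_iff_fderiv]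
    refine ⟨fun z => (h1 z).differentiableAt, by simp, ?_⟩
    rw [funext fun z => (h1 z).fderiv]
    unfold lin
    exact ((hf.of_le (by exact_mod_cast le_top)).smul contDiff_const).add ((ih hf').smul contDiff_const)

end

section

/-- A convex function lies above its tangent plane. -/
lemma tangent_le {v : ℂ → ℝ} {O : Set ℂ} {L : ℂ →L[ℝ] ℝ} {w w' : ℂ} (hv : ConvexOn ℝ O v)
    (hw : w ∈ O) (hw' : w' ∈ O) (h : HasFDerivAt v L w) : v w + L (w' - w) ≤ v w' := by
  have hl : HasDerivAt (fun t : ℝ => v (w + t • (w' - w))) (L (w' - w)) 0 := by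
    have h1 : HasDerivAt (fun t : ℝ => w + t • (w' - w)) (w' - w) 0 := by
      have := ((hasDerivAt_id (0 : ℝ)).smul_const (w' - w)).const_add w
      simpa using this
    exact HasFDerivAt.comp_hasDerivAt 0 (by simpa using h) h1
  have hlim := hl.tendsto_slope_zero_right
  refine le_sub_iff_add_le'.1 (le_of_tendsto hlim ?_)
  filter_upwards [Ioc_mem_nhdsGT (zero_lt_one' ℝ)] with t ht
  have h2 := hv.2 hw hw' (sub_nonneg.2 ht.2) ht.1.le (by ring : (1 - t) + t = 1)
  have h3 : (1 - t) • w + t • w' = w + t • (w' - w) := by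
    simp only [smul_sub, sub_smul, one_smul]; ring
  rw [h3] at h2
  simp only [zero_add, zero_smul, add_zero, smul_eq_mul] at h2 ⊢
  rw [inv_mul_le_iff₀ ht.1]
  linarith

lemma tangent_lt {v : ℂ → ℝ} {O : Set ℂ} {L : ℂ →L[ℝ] ℝ} {w w' : ℂ} (hv : StrictConvexOn ℝ O v)
    (hw : w ∈ O) (hw' : w' ∈ O) (hne : w ≠ w') (h : HasFDerivAt v L w) : v w + L (w' - w) < v w' := by
  set m : ℂ := (1 / 2 : ℝ) • w + (1 / 2 : ℝ) • w' with hm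
  have h1 := hv.2 hw hw' hne (by norm_num : (0 : ℝ) < 1 / 2) (by norm_num : (0 : ℝ) < 1 / 2) (by norm_num)
  have hmO : m ∈ O := hv.1 hw hw' (by norm_num) (by norm_num) (by norm_num)
  have h2 := tangent_le hv.convexOn hw hmO h
  have h3 : m - w = (1 / 2 : ℝ) • (w' - w) := by
    rw [hm, smul_sub]
    have : w = (1 / 2 : ℝ) • w + (1 / 2 : ℝ) • w := by rw [← add_smul]; norm_num
    nth_rewrite 2 [this]
    ring
  rw [h3, map_smul] at h2
  rw [← hm] at h1
  simp only [smul_eq_mul] at h1 h2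
  linarith

/-- Strict monotonicity of the gradient of a strictly convex function. -/
lemma gradient_strictMono {v : ℂ → ℝ} {O : Set ℂ} {L L' : ℂ →L[ℝ] ℝ} {w w' : ℂ}
    (hv : StrictConvexOn ℝ O v) (hw : w ∈ O) (hw' : w' ∈ O) (hne : w ≠ w')
    (h : HasFDerivAt v L w) (h' : HasFDerivAt v L' w') : L (w' - w) < L' (w' - w) := by
  have h1 := tangent_lt hv hw hw' hne h
  have h2 := tangent_lt hv hw' hw hne.symm h'
  have h3 : L' (w - w') = - L' (w' - w) := by rw [← map_neg, neg_sub]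
  linarith

/-- A strictly convex `C¹` function `v` with gradient `g` solving the Monge–Ampère equation
with density `f` in the measure theoretic sense. -/
structure GenSol (v f : ℂ → ℝ) (g : ℂ → ℂ) (O : Set ℂ) : Prop where
  isOpen : IsOpen O
  strict : StrictConvexOn ℝ O v
  grad : ∀ w ∈ O, HasFDerivAt v (lin (g w).re (g w).im) w
  cont : ContinuousOn g O
  smooth : ContDiffOn ℝ ∞ f O
  pos : ∀ w ∈ O, 0 < f w
  vol : ∀ U ⊆ O, IsOpen U → volume (g '' U) = ∫⁻ w in U, ENNReal.ofReal (f w)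

variable {v f : ℂ → ℝ} {g : ℂ → ℂ} {O : Set ℂ}

lemma GenSol.re_lt (h : GenSol v f g O) {x x' y : ℝ} (h1 : (⟨x, y⟩ : ℂ) ∈ O)
    (h2 : (⟨x', y⟩ : ℂ) ∈ O) (hx : x < x') : (g ⟨x, y⟩).re < (g ⟨x', y⟩).re := by
  have := gradient_strictMono h.strict h1 h2 (by simp [hx.ne]) (h.grad _ h1) (h.grad _ h2)
  simpa [hx] using this

lemma GenSol.injOn (h : GenSol v f g O) : InjOn g O := by
  intro w hw w' hw' he
  by_contra hne
  have := gradient_strictMono h.strict hw hw' hne (h.grad _ hw) (h.grad _ hw')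
  rw [he] at this
  exact lt_irrefl _ this

lemma GenSol.strictFDeriv (h : GenSol v f g O) {w : ℂ} (hw : w ∈ O) :
    HasStrictFDerivAt v (lin (g w).re (g w).im) w := by
  refine hasStrictFDerivAt_of_hasFDerivAt_of_continuousAt
    (by filter_upwards [h.isOpen.mem_nhds hw] with y hy using h.grad y hy) ?_
  exact (continuousOn_lin (Complex.continuous_re.comp_continuousOn h.cont)
    (Complex.continuous_im.comp_continuousOn h.cont)).continuousAt (h.isOpen.mem_nhds hw)

/-- A coordinate box on which the partial Legendre transform is defined by the function `X`:
for `z = p + i y` the point `X z + i y` is the one where the `x`-derivative of `v` is `p`. -/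
structure LegBox (g : ℂ → ℂ) (O : Set ℂ) (X : ℂ → ℝ) (x₁ x₂ p₁ p₂ y₁ y₂ : ℝ) : Prop where
  sub : ∀ x ∈ Icc x₁ x₂, ∀ y ∈ Ioo y₁ y₂, (⟨x, y⟩ : ℂ) ∈ O
  mem : ∀ z ∈ Ioo p₁ p₂ ×ℂ Ioo y₁ y₂, X z ∈ Ioo x₁ x₂
  eq : ∀ z ∈ Ioo p₁ p₂ ×ℂ Ioo y₁ y₂, (g (graphMap X z)).re = z.re

lemma GenSol.exists_legBox (h : GenSol v f g O) {w : ℂ} (hw : w ∈ O) {ε : ℝ} (hε : 0 < ε) :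
    ∃ (X : ℂ → ℝ) (x₁ x₂ p₁ p₂ y₁ y₂ : ℝ), LegBox g O X x₁ x₂ p₁ p₂ y₁ y₂ ∧
      w.re ∈ Ioo x₁ x₂ ∧ (g w).re ∈ Ioo p₁ p₂ ∧ w.im ∈ Ioo y₁ y₂ ∧
      Icc x₁ x₂ ×ℂ Ioo y₁ y₂ ⊆ ball w ε := by
  obtain ⟨r, hr, hrO⟩ := Metric.isOpen_iff.1 h.isOpen w hw
  set a := min r ε / 3 with ha
  have hm : 0 < min r ε := lt_min hr hε
  have ha0 : 0 < a := by positivity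
  have hbox : ∀ x ∈ Icc (w.re - a) (w.re + a), ∀ y ∈ Ioo (w.im - a) (w.im + a),
      (⟨x, y⟩ : ℂ) ∈ ball w (min r ε) := by
    intro x hx y hy
    rw [mem_ball, dist_eq_norm]
    have h1 := Complex.norm_le_abs_re_add_abs_im ((⟨x, y⟩ : ℂ) - w)
    simp only [Complex.sub_re, Complex.sub_im] at h1
    have h2 : |x - w.re| ≤ a := abs_le.2 ⟨by linarith [hx.1], by linarith [hx.2]⟩
    have h3 : |y - w.im| ≤ a := abs_le.2 ⟨by linarith [hy.1], by linarith [hy.2]⟩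
    have : a = min r ε / 3 := ha
    linarith
  have hboxO : ∀ x ∈ Icc (w.re - a) (w.re + a), ∀ y ∈ Ioo (w.im - a) (w.im + a),
      (⟨x, y⟩ : ℂ) ∈ O := fun x hx y hy => hrO (ball_subset_ball (min_le_left _ _) (hbox x hx y hy))
  have hy0 : w.im ∈ Ioo (w.im - a) (w.im + a) := ⟨by linarith, by linarith⟩
  have hl := h.re_lt (hboxO (w.re - a) ⟨le_rfl, by linarith⟩ _ hy0) hw (by linarith)
  have hr' := h.re_lt hw (hboxO (w.re + a) ⟨by linarith, le_rfl⟩ _ hy0) (by linarith)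
  obtain ⟨p₁, hp1, hp1'⟩ := exists_between hl
  obtain ⟨p₂, hp2, hp2'⟩ := exists_between hr'
  have hc : ∀ x ∈ Icc (w.re - a) (w.re + a),
      ContinuousAt (fun y : ℝ => (g ⟨x, y⟩).re) w.im := by
    intro x hx
    have h1 : ContinuousAt (fun z => (g z).re) (⟨x, w.im⟩ : ℂ) :=
      (Complex.continuous_re.comp_continuousOn h.cont).continuousAt
        (h.isOpen.mem_nhds (hboxO x hx _ hy0))
    exact ContinuousAt.comp (f := fun y : ℝ => (⟨x, y⟩ : ℂ)) (g := fun z => (g z).re) h1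
      (hasDerivAt_mk_right x w.im).continuousAt
  have e1 := (hc (w.re - a) ⟨le_rfl, by linarith⟩).eventually (gt_mem_nhds hp1)
  have e2 := (hc (w.re + a) ⟨by linarith, le_rfl⟩).eventually (lt_mem_nhds hp2')
  obtain ⟨b, hb, hball⟩ := Metric.eventually_nhds_iff_ball.1 (e1.and e2)
  set c := min a b
  have hc0 : 0 < c := lt_min ha0 hb
  have hca : c ≤ a := min_le_left _ _
  have hIoo : ∀ y ∈ Ioo (w.im - c) (w.im + c), y ∈ Ioo (w.im - a) (w.im + a) ∧ y ∈ ball w.im b := by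
    intro y hy
    refine ⟨⟨by linarith [hy.1], by linarith [hy.2]⟩, ?_⟩
    rw [Real.ball_eq_Ioo]
    have : c ≤ b := min_le_right _ _
    exact ⟨by linarith [hy.1], by linarith [hy.2]⟩
  have hex : ∀ z : ℂ, ∃ X : ℝ, z ∈ Ioo p₁ p₂ ×ℂ Ioo (w.im - c) (w.im + c) →
      X ∈ Ioo (w.re - a) (w.re + a) ∧ (g ⟨X, z.im⟩).re = z.re := by
    intro z
    by_cases hz : z ∈ Ioo p₁ p₂ ×ℂ Ioo (w.im - c) (w.im + c)
    · obtain ⟨hy, hyb⟩ := hIoo _ hz.2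
      have hcont : ContinuousOn (fun x : ℝ => (g ⟨x, z.im⟩).re) (Icc (w.re - a) (w.re + a)) := by
        refine (Complex.continuous_re.comp_continuousOn h.cont).comp
          (f := fun x : ℝ => (⟨x, z.im⟩ : ℂ)) ?_ (fun x hx => hboxO x hx _ hy)
        exact fun x _ => (hasDerivAt_mk_left x z.im).continuousAt.continuousWithinAt
      have hpz := hball _ hyb
      have := intermediate_value_Ioo (by linarith) hcont
      obtain ⟨x, hx, hxe⟩ := this (show z.re ∈ Ioo _ _ from ⟨hpz.1.trans hz.1.1, hz.1.2.trans hpz.2⟩)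
      exact ⟨x, fun _ => ⟨hx, hxe⟩⟩
    · exact ⟨0, fun h => absurd h hz⟩
  choose X hX using hex
  refine ⟨X, w.re - a, w.re + a, p₁, p₂, w.im - c, w.im + c,
    ⟨fun x hx y hy => hboxO x hx y (hIoo y hy).1, fun z hz => (hX z hz).1, fun z hz => (hX z hz).2⟩,
    ⟨by linarith, by linarith⟩, ⟨hp1', hp2⟩, ⟨by linarith, by linarith⟩, ?_⟩
  intro z hz
  exact ball_subset_ball (min_le_right _ _) (hbox z.re hz.1 z.im (hIoo _ hz.2).1)

end

section

variable {v f : ℂ → ℝ} {g : ℂ → ℂ} {O : Set ℂ} {X : ℂ → ℝ} {x₁ x₂ p₁ p₂ y₁ y₂ : ℝ}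

lemma isOpen_box (a b c d : ℝ) : IsOpen (Ioo a b ×ℂ Ioo c d) := isOpen_Ioo.reProdIm isOpen_Ioo

lemma LegBox.mem_O (hB : LegBox g O X x₁ x₂ p₁ p₂ y₁ y₂) {z : ℂ}
    (hz : z ∈ Ioo p₁ p₂ ×ℂ Ioo y₁ y₂) : graphMap X z ∈ O :=
  hB.sub _ (Ioo_subset_Icc_self (hB.mem z hz)) _ hz.2

lemma LegBox.lt_iff (hB : LegBox g O X x₁ x₂ p₁ p₂ y₁ y₂) (h : GenSol v f g O) {z : ℂ}
    (hz : z ∈ Ioo p₁ p₂ ×ℂ Ioo y₁ y₂) {x : ℝ} (hx : x ∈ Icc x₁ x₂) :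
    X z < x ↔ z.re < (g ⟨x, z.im⟩).re := by
  have hO := hB.sub x hx _ hz.2
  have he : (g ⟨X z, z.im⟩).re = z.re := hB.eq z hz
  constructor
  · intro hlt
    have := h.re_lt (hB.mem_O hz) hO hlt
    rwa [he] at this
  · intro hlt
    by_contra hge
    rcases (not_lt.1 hge).eq_or_lt with h1 | h1
    · rw [h1, he] at hlt; exact lt_irrefl _ hlt
    · have := h.re_lt hO (hB.mem_O hz) h1
      rw [he] at this; exact lt_asymm hlt this

lemma LegBox.gt_iff (hB : LegBox g O X x₁ x₂ p₁ p₂ y₁ y₂) (h : GenSol v f g O) {z : ℂ}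
    (hz : z ∈ Ioo p₁ p₂ ×ℂ Ioo y₁ y₂) {x : ℝ} (hx : x ∈ Icc x₁ x₂) :
    x < X z ↔ (g ⟨x, z.im⟩).re < z.re := by
  have hO := hB.sub x hx _ hz.2
  have he : (g ⟨X z, z.im⟩).re = z.re := hB.eq z hz
  constructor
  · intro hlt
    have := h.re_lt hO (hB.mem_O hz) hlt
    rwa [he] at this
  · intro hlt
    by_contra hge
    rcases (not_lt.1 hge).eq_or_lt with h1 | h1
    · rw [← h1, he] at hlt; exact lt_irrefl _ hlt
    · have := h.re_lt (hB.mem_O hz) hO h1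
      rw [he] at this; exact lt_asymm hlt this

lemma LegBox.unique (hB : LegBox g O X x₁ x₂ p₁ p₂ y₁ y₂) (h : GenSol v f g O) {z : ℂ}
    (hz : z ∈ Ioo p₁ p₂ ×ℂ Ioo y₁ y₂) {x : ℝ} (hx : x ∈ Icc x₁ x₂)
    (he : (g ⟨x, z.im⟩).re = z.re) : X z = x :=
  le_antisymm (not_lt.1 fun hl => by rw [hB.gt_iff h hz hx, he] at hl; exact lt_irrefl _ hl)
    (not_lt.1 fun hl => by rw [hB.lt_iff h hz hx, he] at hl; exact lt_irrefl _ hl)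

lemma LegBox.continuousOn (hB : LegBox g O X x₁ x₂ p₁ p₂ y₁ y₂) (h : GenSol v f g O) :
    ContinuousOn X (Ioo p₁ p₂ ×ℂ Ioo y₁ y₂) := by
  intro z hz
  refine ContinuousAt.continuousWithinAt ?_
  have hn := (isOpen_box p₁ p₂ y₁ y₂).mem_nhds hz
  have hc : ∀ x ∈ Icc x₁ x₂, ContinuousAt (fun z : ℂ => (g ⟨x, z.im⟩).re) z := by
    intro x hx
    have h1 : ContinuousAt (fun z => (g z).re) (⟨x, z.im⟩ : ℂ) :=
      (Complex.continuous_re.comp_continuousOn h.cont).continuousAt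
        (h.isOpen.mem_nhds (hB.sub x hx _ hz.2))
    exact ContinuousAt.comp (f := fun z : ℂ => (⟨x, z.im⟩ : ℂ)) (g := fun z => (g z).re) h1
      (continuous_mk.comp (continuous_const.prodMk Complex.continuous_im)).continuousAt
  refine tendsto_order.2 ⟨fun a ha => ?_, fun a ha => ?_⟩
  · rcases lt_or_ge a x₁ with hl | hl
    · filter_upwards [hn] with z' hz' using hl.trans (hB.mem z' hz').1
    · have hx : a ∈ Icc x₁ x₂ := ⟨hl, (ha.trans (hB.mem z hz).2).le⟩
      have := (hB.gt_iff h hz hx).1 ha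
      filter_upwards [hn, (hc a hx).eventually_lt Complex.continuous_re.continuousAt this] with z' hz' hlt
      exact (hB.gt_iff h hz' hx).2 hlt
  · rcases lt_or_ge x₂ a with hl | hl
    · filter_upwards [hn] with z' hz' using (hB.mem z' hz').2.trans hl
    · have hx : a ∈ Icc x₁ x₂ := ⟨((hB.mem z hz).1.trans ha).le, hl⟩
      have := (hB.lt_iff h hz hx).1 ha
      filter_upwards [hn, Complex.continuous_re.continuousAt.eventually_lt (hc a hx) this] with z' hz' hlt
      exact (hB.lt_iff h hz' hx).2 hlt

lemma LegBox.continuousOn_graphMap (hB : LegBox g O X x₁ x₂ p₁ p₂ y₁ y₂) (h : GenSol v f g O) :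
    ContinuousOn (graphMap X) (Ioo p₁ p₂ ×ℂ Ioo y₁ y₂) :=
  continuous_mk.comp_continuousOn ((hB.continuousOn h).prodMk Complex.continuous_im.continuousOn)

lemma LegBox.continuousOn_im (hB : LegBox g O X x₁ x₂ p₁ p₂ y₁ y₂) (h : GenSol v f g O) :
    ContinuousOn (fun z => (g (graphMap X z)).im) (Ioo p₁ p₂ ×ℂ Ioo y₁ y₂) :=
  Complex.continuous_im.comp_continuousOn
    (h.cont.comp (hB.continuousOn_graphMap h) fun _ hz => hB.mem_O hz)

/-- The gradient of the partial Legendre transform. -/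
lemma LegBox.hasFDerivAt (hB : LegBox g O X x₁ x₂ p₁ p₂ y₁ y₂) (h : GenSol v f g O) {z : ℂ}
    (hz : z ∈ Ioo p₁ p₂ ×ℂ Ioo y₁ y₂) :
    HasFDerivAt (fun z => z.re * X z - v (graphMap X z))
      (lin (X z) (-(g (graphMap X z)).im)) z := by
  have hn := (isOpen_box p₁ p₂ y₁ y₂).mem_nhds hz
  have hXc := (hB.continuousOn h).continuousAt hn
  have hmax : ∀ z' ∈ Ioo p₁ p₂ ×ℂ Ioo y₁ y₂, ∀ x ∈ Icc x₁ x₂,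
      z'.re * x - v ⟨x, z'.im⟩ ≤ z'.re * X z' - v ⟨X z', z'.im⟩ := by
    intro z' hz' x hx
    have := tangent_le h.strict.convexOn (hB.mem_O hz') (hB.sub x hx _ hz'.2) (h.grad _ (hB.mem_O hz'))
    simp only [graphMap, lin_apply, Complex.sub_re, Complex.sub_im, sub_self, mul_zero, add_zero] at this
    have he : (g ⟨X z', z'.im⟩).re = z'.re := hB.eq z' hz'
    rw [he] at this
    linarith
  have hs := h.strictFDeriv (hB.mem_O hz)
  set q := (g (graphMap X z)).im with hq
  rw [hasFDerivAt_iff_isLittleO, Asymptotics.isLittleO_iff]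
  intro ε hε
  have hs' := (Asymptotics.isLittleO_iff.1 hs.isLittleO) (half_pos hε)
  have ht1 : Tendsto (fun z' : ℂ => ((⟨X z', z'.im⟩ : ℂ), (⟨X z', z.im⟩ : ℂ))) (𝓝 z)
      (𝓝 (graphMap X z, graphMap X z)) := by
    refine Tendsto.prodMk_nhds ?_ ?_
    · exact continuous_mk.continuousAt.tendsto.comp (hXc.tendsto.prodMk_nhds Complex.continuous_im.continuousAt.tendsto)
    · exact continuous_mk.continuousAt.tendsto.comp (hXc.tendsto.prodMk_nhds tendsto_const_nhds)
  have ht2 : Tendsto (fun z' : ℂ => ((⟨X z, z'.im⟩ : ℂ), (⟨X z, z.im⟩ : ℂ))) (𝓝 z)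
      (𝓝 (graphMap X z, graphMap X z)) := by
    refine Tendsto.prodMk_nhds ?_ ?_
    · exact continuous_mk.continuousAt.tendsto.comp
        (tendsto_const_nhds.prodMk_nhds Complex.continuous_im.continuousAt.tendsto)
    · exact tendsto_const_nhds
  have hX' : ∀ᶠ z' in 𝓝 z, |X z' - X z| ≤ ε / 2 := by
    have := (Metric.tendsto_nhds.1 hXc.tendsto) (ε / 2) (half_pos hε)
    filter_upwards [this] with z' hz'
    rw [Real.dist_eq] at hz'; exact hz'.le
  filter_upwards [hn, ht1.eventually hs', ht2.eventually hs', hX'] with z' hz' e1 e2 e3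
  have him : ∀ a : ℝ, ‖(⟨a, z'.im⟩ : ℂ) - ⟨a, z.im⟩‖ ≤ ‖z' - z‖ := by
    intro a
    have : (⟨a, z'.im⟩ : ℂ) - ⟨a, z.im⟩ = ((z' - z).im : ℂ) * Complex.I := by
      apply Complex.ext <;> simp
    rw [this, norm_mul, Complex.norm_I, mul_one, Complex.norm_real]
    exact Complex.abs_im_le_norm _
  have hre : |z'.re - z.re| ≤ ‖z' - z‖ := by
    rw [← Complex.sub_re]; exact Complex.abs_re_le_norm _
  replace e1 := e1.trans (mul_le_mul_of_nonneg_left (him _) (half_pos hε).le)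
  replace e2 := e2.trans (mul_le_mul_of_nonneg_left (him _) (half_pos hε).le)
  simp only [lin_apply, Complex.sub_re, Complex.sub_im, sub_self, mul_zero, zero_add, Real.norm_eq_abs
    ] at e1 e2
  have m1 := hmax z' hz' (X z) (Ioo_subset_Icc_self (hB.mem z hz))
  have m2 := hmax z hz (X z') (Ioo_subset_Icc_self (hB.mem z' hz'))
  have e4 : |(z'.re - z.re) * (X z' - X z)| ≤ ε / 2 * ‖z' - z‖ := by
    rw [abs_mul, mul_comm]
    exact mul_le_mul e3 hre (abs_nonneg _) (half_pos hε).le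
  simp only [lin_apply, Complex.sub_re, Complex.sub_im, Real.norm_eq_abs, graphMap]
  rw [abs_le] at e1 e2 e4 ⊢
  constructor <;> nlinarith [norm_nonneg (z' - z)]

end

section

lemma volume_between {a b : ℝ → ℝ} {s : Set ℝ} (hs : MeasurableSet s) (ha : IntegrableOn a s)
    (hb : IntegrableOn b s) (hab : ∀ t ∈ s, a t ≤ b t) :
    volume {w : ℂ | w.re ∈ s ∧ w.im ∈ Ioo (a w.re) (b w.re)} =
      ENNReal.ofReal (∫ t in s, (b t - a t)) := by
  have h1 := volume_regionBetween_eq_integral (μ := volume) ha hb hs hab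
  have h2 := Complex.volume_preserving_equiv_real_prod.measure_preimage_equiv (regionBetween a b s)
  rw [Measure.volume_eq_prod, h1] at h2
  exact h2

lemma lintegral_between {a b : ℝ → ℝ} {y y' : ℝ} {R : Set ℂ} (hR : MeasurableSet R)
    (hRe : ∀ w, w ∈ R ↔ w.im ∈ Ioo y y' ∧ w.re ∈ Ioo (a w.im) (b w.im)) {k : ℂ → ℝ}
    (hk : Continuous k) (hpos : ∀ w ∈ R, 0 ≤ k w) (hab : ∀ t ∈ Ioo y y', a t ≤ b t)
    (hint : IntegrableOn (fun t => ∫ x in a t..b t, k ⟨x, t⟩) (Ioo y y')) :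
    ∫⁻ w in R, ENNReal.ofReal (k w) =
      ENNReal.ofReal (∫ t in Ioo y y', ∫ x in a t..b t, k ⟨x, t⟩) := by
  have hrow : ∀ t : ℝ, Continuous fun s : ℝ => k ⟨s, t⟩ := fun t =>
    hk.comp (continuous_mk.comp (continuous_id.prodMk continuous_const))
  have hslice : ∀ t ∈ Ioo y y', ∫⁻ x in Ioo (a t) (b t), ENNReal.ofReal (k ⟨x, t⟩) =
      ENNReal.ofReal (∫ x in a t..b t, k ⟨x, t⟩) := by
    intro t ht
    rw [intervalIntegral.integral_of_le (hab t ht), integral_Ioc_eq_integral_Ioo,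
      ofReal_integral_eq_lintegral_ofReal]
    · exact ((hrow t).integrableOn_Icc).mono_set Ioo_subset_Icc_self
    · filter_upwards [ae_restrict_mem measurableSet_Ioo] with x hx
      exact hpos _ ((hRe ⟨x, t⟩).2 ⟨ht, hx⟩)
  rw [ofReal_integral_eq_lintegral_ofReal hint, ← lintegral_indicator hR]
  · have hmeas : Measurable (R.indicator fun w => ENNReal.ofReal (k w)) :=
      (ENNReal.measurable_ofReal.comp hk.measurable).indicator hR
    have h1 := Complex.volume_preserving_equiv_real_prod.symm.lintegral_comp hmeas
    rw [← h1, Measure.volume_eq_prod, lintegral_prod_symm']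
    swap
    · exact hmeas.comp Complex.measurableEquivRealProd.symm.measurable
    rw [← lintegral_indicator measurableSet_Ioo]
    refine lintegral_congr fun t => ?_
    by_cases ht : t ∈ Ioo y y'
    · rw [indicator_of_mem ht, ← hslice t ht, ← lintegral_indicator measurableSet_Ioo]
      refine lintegral_congr fun x => ?_
      change R.indicator (fun w => ENNReal.ofReal (k w)) ⟨x, t⟩ = _
      by_cases hx : x ∈ Ioo (a t) (b t)
      · rw [indicator_of_mem hx, indicator_of_mem ((hRe ⟨x, t⟩).2 ⟨ht, hx⟩)]
      · rw [indicator_of_notMem hx, indicator_of_notMem fun h => hx ((hRe ⟨x, t⟩).1 h).2]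
    · rw [indicator_of_notMem ht]
      refine (lintegral_congr fun x => ?_).trans lintegral_zero
      change R.indicator (fun w => ENNReal.ofReal (k w)) ⟨x, t⟩ = _
      rw [indicator_of_notMem fun h => ht ((hRe ⟨x, t⟩).1 h).1]
  · filter_upwards [ae_restrict_mem measurableSet_Ioo] with t ht
    refine intervalIntegral.integral_nonneg_of_ae_restrict (hab t ht) ?_
    rw [restrict_Ioo_eq_restrict_Icc.symm]
    filter_upwards [ae_restrict_mem measurableSet_Ioo] with x hx
    exact hpos _ ((hRe ⟨x, t⟩).2 ⟨ht, hx⟩)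

variable {v f : ℂ → ℝ} {g : ℂ → ℂ} {O : Set ℂ} {X : ℂ → ℝ} {x₁ x₂ p₁ p₂ y₁ y₂ : ℝ}

lemma LegBox.im_strictMono (hB : LegBox g O X x₁ x₂ p₁ p₂ y₁ y₂) (h : GenSol v f g O) {p y y' : ℝ}
    (hp : p ∈ Ioo p₁ p₂) (hy : y ∈ Ioo y₁ y₂) (hy' : y' ∈ Ioo y₁ y₂) (hlt : y < y') :
    (g (graphMap X ⟨p, y⟩)).im < (g (graphMap X ⟨p, y'⟩)).im := by
  have h1 : (⟨p, y⟩ : ℂ) ∈ Ioo p₁ p₂ ×ℂ Ioo y₁ y₂ := ⟨hp, hy⟩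
  have h2 : (⟨p, y'⟩ : ℂ) ∈ Ioo p₁ p₂ ×ℂ Ioo y₁ y₂ := ⟨hp, hy'⟩
  have hne : graphMap X ⟨p, y⟩ ≠ graphMap X ⟨p, y'⟩ := fun he =>
    hlt.ne (congrArg Complex.im he)
  have := gradient_strictMono h.strict (hB.mem_O h1) (hB.mem_O h2) hne
    (h.grad _ (hB.mem_O h1)) (h.grad _ (hB.mem_O h2))
  rw [lin_apply, lin_apply, hB.eq _ h1, hB.eq _ h2] at this
  simp only [Complex.sub_im] at this
  have e1 : (graphMap X ⟨p, y⟩).im = y := rfl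
  have e2 : (graphMap X ⟨p, y'⟩).im = y' := rfl
  rw [e1, e2] at this
  have h3 : 0 < y' - y := sub_pos.2 hlt
  exact lt_of_mul_lt_mul_right (by linarith) h3.le

/-- The part of the domain corresponding to a rectangle in the `(p, y)` plane. -/
def legRect (g : ℂ → ℂ) (x₁ x₂ p p' y y' : ℝ) : Set ℂ :=
  {w | w ∈ Ioo x₁ x₂ ×ℂ Ioo y y' ∧ (g w).re ∈ Ioo p p'}

lemma LegBox.mem_legRect (hB : LegBox g O X x₁ x₂ p₁ p₂ y₁ y₂) (h : GenSol v f g O)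
    {p p' y y' : ℝ} (hp : p ∈ Ioo p₁ p₂) (hp' : p' ∈ Ioo p₁ p₂) (hy : y ∈ Ioo y₁ y₂)
    (hy' : y' ∈ Ioo y₁ y₂) (w : ℂ) : w ∈ legRect g x₁ x₂ p p' y y' ↔
      w.im ∈ Ioo y y' ∧ w.re ∈ Ioo (X ⟨p, w.im⟩) (X ⟨p', w.im⟩) := by
  have hsub : Ioo y y' ⊆ Ioo y₁ y₂ := Ioo_subset_Ioo hy.1.le hy'.2.le
  constructor
  · rintro ⟨⟨h1, h2⟩, h3⟩
    have hx := Ioo_subset_Icc_self h1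
    exact ⟨h2, (hB.lt_iff h (z := ⟨p, w.im⟩) ⟨hp, hsub h2⟩ hx).2 h3.1,
      (hB.gt_iff h (z := ⟨p', w.im⟩) ⟨hp', hsub h2⟩ hx).2 h3.2⟩
  · rintro ⟨h2, h3⟩
    have m1 := hB.mem ⟨p, w.im⟩ ⟨hp, hsub h2⟩
    have m2 := hB.mem ⟨p', w.im⟩ ⟨hp', hsub h2⟩
    have h1 : w.re ∈ Ioo x₁ x₂ := ⟨m1.1.trans h3.1, h3.2.trans m2.2⟩
    have hx := Ioo_subset_Icc_self h1
    exact ⟨⟨h1, h2⟩, (hB.lt_iff h (z := ⟨p, w.im⟩) ⟨hp, hsub h2⟩ hx).1 h3.1,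
      (hB.gt_iff h (z := ⟨p', w.im⟩) ⟨hp', hsub h2⟩ hx).1 h3.2⟩

lemma LegBox.legRect_subset (hB : LegBox g O X x₁ x₂ p₁ p₂ y₁ y₂) {p p' y y' : ℝ}
    (hy : y ∈ Ioo y₁ y₂) (hy' : y' ∈ Ioo y₁ y₂) :
    legRect g x₁ x₂ p p' y y' ⊆ O := fun w hw =>
  hB.sub w.re (Ioo_subset_Icc_self hw.1.1) w.im (Ioo_subset_Ioo hy.1.le hy'.2.le hw.1.2)

lemma LegBox.isOpen_legRect (hB : LegBox g O X x₁ x₂ p₁ p₂ y₁ y₂) (h : GenSol v f g O)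
    {p p' y y' : ℝ} (hy : y ∈ Ioo y₁ y₂) (hy' : y' ∈ Ioo y₁ y₂) :
    IsOpen (legRect g x₁ x₂ p p' y y') := by
  have hc : ContinuousOn (fun w => (g w).re) (Ioo x₁ x₂ ×ℂ Ioo y y') :=
    (Complex.continuous_re.comp_continuousOn h.cont).mono fun w hw =>
      hB.sub w.re (Ioo_subset_Icc_self hw.1) w.im (Ioo_subset_Ioo hy.1.le hy'.2.le hw.2)
  exact hc.isOpen_inter_preimage (isOpen_box _ _ _ _) isOpen_Ioo

lemma LegBox.image_legRect (hB : LegBox g O X x₁ x₂ p₁ p₂ y₁ y₂) (h : GenSol v f g O)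
    {p p' y y' : ℝ} (hp : p ∈ Ioo p₁ p₂) (hp' : p' ∈ Ioo p₁ p₂) (hy : y ∈ Ioo y₁ y₂)
    (hy' : y' ∈ Ioo y₁ y₂) (hyy : y < y') : g '' legRect g x₁ x₂ p p' y y' =
      {w | w.re ∈ Ioo p p' ∧ w.im ∈ Ioo (g (graphMap X ⟨w.re, y⟩)).im (g (graphMap X ⟨w.re, y'⟩)).im} := by
  have hsub : Ioo y y' ⊆ Ioo y₁ y₂ := Ioo_subset_Ioo hy.1.le hy'.2.le
  have hsubp : Ioo p p' ⊆ Ioo p₁ p₂ := Ioo_subset_Ioo hp.1.le hp'.2.le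
  ext ζ
  constructor
  · rintro ⟨w, ⟨⟨h1, h2⟩, h3⟩, rfl⟩
    have hu : X ⟨(g w).re, w.im⟩ = w.re :=
      hB.unique h (z := ⟨(g w).re, w.im⟩) ⟨hsubp h3, hsub h2⟩ (Ioo_subset_Icc_self h1) rfl
    have he : graphMap X ⟨(g w).re, w.im⟩ = w := Complex.ext hu rfl
    refine ⟨h3, ?_, ?_⟩
    · have := hB.im_strictMono h (hsubp h3) hy (hsub h2) h2.1
      rwa [he] at this
    · have := hB.im_strictMono h (hsubp h3) (hsub h2) hy' h2.2
      rwa [he] at this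
  · rintro ⟨h1, h2⟩
    have hcont : ContinuousOn (fun t : ℝ => (g (graphMap X ⟨ζ.re, t⟩)).im) (Icc y y') := by
      refine (hB.continuousOn_im h).comp (f := fun t : ℝ => (⟨ζ.re, t⟩ : ℂ)) ?_
        (fun t ht => ⟨hsubp h1, hy.1.trans_le ht.1, ht.2.trans_lt hy'.2⟩)
      exact fun x _ => (hasDerivAt_mk_right _ _).continuousAt.continuousWithinAt
    obtain ⟨t, ht, hte⟩ := intermediate_value_Ioo hyy.le hcont h2
    have hz : (⟨ζ.re, t⟩ : ℂ) ∈ Ioo p₁ p₂ ×ℂ Ioo y₁ y₂ := ⟨hsubp h1, hsub ht⟩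
    refine ⟨graphMap X ⟨ζ.re, t⟩, ⟨⟨hB.mem _ hz, ht⟩, ?_⟩, ?_⟩
    · rw [hB.eq _ hz]; exact h1
    · exact Complex.ext (hB.eq _ hz) hte

lemma hprim_sub (x₀ : ℝ) {k : ℂ → ℝ} (hk : Continuous k) (a b t : ℝ) :
    hprim x₀ k ⟨b, t⟩ - hprim x₀ k ⟨a, t⟩ = ∫ x in a..b, k ⟨x, t⟩ := by
  have hrow : Continuous fun s : ℝ => k ⟨s, t⟩ :=
    hk.comp (continuous_mk.comp (continuous_id.prodMk continuous_const))
  exact intervalIntegral.integral_interval_sub_left (hrow.intervalIntegrable _ _)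
    (hrow.intervalIntegrable _ _)

lemma LegBox.rect_identity (hB : LegBox g O X x₁ x₂ p₁ p₂ y₁ y₂) (h : GenSol v f g O)
    {k : ℂ → ℝ} (hk : Continuous k) (hkf : ∀ w ∈ Ioo x₁ x₂ ×ℂ Ioo y₁ y₂, f w = k w) (x₀ : ℝ)
    {p p' y y' : ℝ} (hp : p ∈ Ioo p₁ p₂) (hp' : p' ∈ Ioo p₁ p₂) (hy : y ∈ Ioo y₁ y₂)
    (hy' : y' ∈ Ioo y₁ y₂) (hpp : p < p') (hyy : y < y') :
    ∫ s in p..p', ((g (graphMap X ⟨s, y'⟩)).im - (g (graphMap X ⟨s, y⟩)).im) =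
      ∫ t in y..y', (hprim x₀ k (graphMap X ⟨p', t⟩) - hprim x₀ k (graphMap X ⟨p, t⟩)) := by
  have hsub : Icc y y' ⊆ Ioo y₁ y₂ := fun t ht => ⟨hy.1.trans_le ht.1, ht.2.trans_lt hy'.2⟩
  have hsubp : Icc p p' ⊆ Ioo p₁ p₂ := fun t ht => ⟨hp.1.trans_le ht.1, ht.2.trans_lt hp'.2⟩
  have hQi : ∀ y ∈ Ioo y₁ y₂, IntegrableOn (fun s => (g (graphMap X ⟨s, y⟩)).im) (Ioo p p') := by
    intro y hy
    refine IntegrableOn.mono_set (ContinuousOn.integrableOn_Icc ?_) Ioo_subset_Icc_self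
    exact (hB.continuousOn_im h).comp (f := fun t : ℝ => (⟨t, y⟩ : ℂ))
      (fun x _ => (hasDerivAt_mk_left _ _).continuousAt.continuousWithinAt)
      (fun t ht => ⟨hsubp ht, hy⟩)
  have hGi : ∀ p ∈ Ioo p₁ p₂, IntegrableOn (fun t => hprim x₀ k (graphMap X ⟨p, t⟩)) (Ioo y y') := by
    intro p hp
    refine IntegrableOn.mono_set (ContinuousOn.integrableOn_Icc ?_) Ioo_subset_Icc_self
    exact ((continuous_hprim x₀ hk).comp_continuousOn (hB.continuousOn_graphMap h)).comp
      (f := fun t : ℝ => (⟨p, t⟩ : ℂ))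
      (fun x _ => (hasDerivAt_mk_right _ _).continuousAt.continuousWithinAt)
      (fun t ht => ⟨hp, hsub ht⟩)
  have hG : ∀ t, ∫ x in X ⟨p, t⟩..X ⟨p', t⟩, k ⟨x, t⟩ =
      hprim x₀ k (graphMap X ⟨p', t⟩) - hprim x₀ k (graphMap X ⟨p, t⟩) :=
    fun t => (hprim_sub x₀ hk _ _ t).symm
  have hmono : ∀ t ∈ Ioo y y', X ⟨p, t⟩ ≤ X ⟨p', t⟩ := by
    intro t ht
    have hz : (⟨p, t⟩ : ℂ) ∈ Ioo p₁ p₂ ×ℂ Ioo y₁ y₂ := ⟨hp, hsub (Ioo_subset_Icc_self ht)⟩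
    have hz' : (⟨p', t⟩ : ℂ) ∈ Ioo p₁ p₂ ×ℂ Ioo y₁ y₂ := ⟨hp', hsub (Ioo_subset_Icc_self ht)⟩
    refine ((hB.lt_iff h hz (Ioo_subset_Icc_self (hB.mem _ hz'))).2 ?_).le
    have : (g ⟨X ⟨p', t⟩, t⟩).re = p' := hB.eq _ hz'
    change p < (g ⟨X ⟨p', t⟩, t⟩).re
    rwa [this]
  have hRO := hB.legRect_subset (p := p) (p' := p') hy hy'
  have hRm : ∀ w ∈ legRect g x₁ x₂ p p' y y', f w = k w := fun w hw =>
    hkf w ⟨hw.1.1, hsub (Ioo_subset_Icc_self hw.1.2)⟩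
  have hopen := hB.isOpen_legRect h (p := p) (p' := p') hy hy'
  have h1 := h.vol _ hRO hopen
  rw [hB.image_legRect h hp hp' hy hy' hyy,
    volume_between measurableSet_Ioo (hQi y hy) (hQi y' hy')
      (fun t ht => (hB.im_strictMono h (hsubp (Ioo_subset_Icc_self ht)) hy hy' hyy).le),
    setLIntegral_congr_fun hopen.measurableSet (fun w hw => by rw [hRm w hw]),
    lintegral_between hopen.measurableSet (hB.mem_legRect h hp hp' hy hy') hk
      (fun w hw => by rw [← hRm w hw]; exact (h.pos w (hRO hw)).le) hmono
      (by simp_rw [hG]; exact (hGi p' hp').sub (hGi p hp))] at h1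
  simp_rw [hG] at h1
  rw [intervalIntegral.integral_of_le hpp.le, intervalIntegral.integral_of_le hyy.le,
    integral_Ioc_eq_integral_Ioo, integral_Ioc_eq_integral_Ioo]
  refine (ENNReal.ofReal_eq_ofReal_iff ?_ ?_).1 h1
  · exact setIntegral_nonneg measurableSet_Ioo fun t ht => sub_nonneg.2
      (hB.im_strictMono h (hsubp (Ioo_subset_Icc_self ht)) hy hy' hyy).le
  · refine setIntegral_nonneg measurableSet_Ioo fun t ht => ?_
    rw [← hG]
    refine intervalIntegral.integral_nonneg_of_ae_restrict (hmono t ht) ?_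
    rw [restrict_Ioo_eq_restrict_Icc.symm]
    filter_upwards [ae_restrict_mem measurableSet_Ioo] with x hx
    have hw := (hB.mem_legRect h hp hp' hy hy' ⟨x, t⟩).2 ⟨ht, hx⟩
    rw [← hRm _ hw]
    exact (h.pos _ (hRO hw)).le

end

section

/-- Existence of a potential from the rectangle identity. -/
lemma exists_potential {Q G : ℂ → ℝ} {p₁ p₂ y₁ y₂ : ℝ} (hQ : ContinuousOn Q (Ioo p₁ p₂ ×ℂ Ioo y₁ y₂))
    (hG : ContinuousOn G (Ioo p₁ p₂ ×ℂ Ioo y₁ y₂))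
    (hrect : ∀ p ∈ Ioo p₁ p₂, ∀ p' ∈ Ioo p₁ p₂, ∀ y ∈ Ioo y₁ y₂, ∀ y' ∈ Ioo y₁ y₂, p < p' → y < y' →
      ∫ s in p..p', (Q ⟨s, y'⟩ - Q ⟨s, y⟩) = ∫ t in y..y', (G ⟨p', t⟩ - G ⟨p, t⟩)) :
    ∃ B : ℂ → ℝ, ∀ z ∈ Ioo p₁ p₂ ×ℂ Ioo y₁ y₂, HasFDerivAt B (lin (Q z) (G z)) z := by
  rcases (Ioo p₁ p₂ ×ℂ Ioo y₁ y₂).eq_empty_or_nonempty with he | ⟨c, hc⟩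
  · exact ⟨0, by simp [he]⟩
  have hQs : ∀ y ∈ Ioo y₁ y₂, ContinuousOn (fun s : ℝ => Q ⟨s, y⟩) (Ioo p₁ p₂) := fun y hy =>
    hQ.comp (f := fun t : ℝ => (⟨t, y⟩ : ℂ))
      (fun x _ => (hasDerivAt_mk_left _ _).continuousAt.continuousWithinAt) (fun t ht => ⟨ht, hy⟩)
  have hGs : ∀ p ∈ Ioo p₁ p₂, ContinuousOn (fun t : ℝ => G ⟨p, t⟩) (Ioo y₁ y₂) := fun p hp =>
    hG.comp (f := fun t : ℝ => (⟨p, t⟩ : ℂ))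
      (fun x _ => (hasDerivAt_mk_right _ _).continuousAt.continuousWithinAt) (fun t ht => ⟨hp, ht⟩)
  have hu : ∀ {a b x y : ℝ}, x ∈ Ioo a b → y ∈ Ioo a b → uIcc x y ⊆ Ioo a b := fun hx hy =>
    (ordConnected_Ioo).uIcc_subset hx hy
  have hQi : ∀ y ∈ Ioo y₁ y₂, ∀ p ∈ Ioo p₁ p₂, ∀ p' ∈ Ioo p₁ p₂,
      IntervalIntegrable (fun s : ℝ => Q ⟨s, y⟩) volume p p' := fun y hy p hp p' hp' =>
    ((hQs y hy).mono (hu hp hp')).intervalIntegrable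
  have hGi : ∀ p ∈ Ioo p₁ p₂, ∀ y ∈ Ioo y₁ y₂, ∀ y' ∈ Ioo y₁ y₂,
      IntervalIntegrable (fun t : ℝ => G ⟨p, t⟩) volume y y' := fun p hp y hy y' hy' =>
    ((hGs p hp).mono (hu hy hy')).intervalIntegrable
  have hpos : ∀ p ∈ Ioo p₁ p₂, ∀ p' ∈ Ioo p₁ p₂, ∀ y ∈ Ioo y₁ y₂, ∀ y' ∈ Ioo y₁ y₂, p < p' →
      ∫ s in p..p', (Q ⟨s, y'⟩ - Q ⟨s, y⟩) = ∫ t in y..y', (G ⟨p', t⟩ - G ⟨p, t⟩) := by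
    intro p hp p' hp' y hy y' hy' hpp
    rcases lt_trichotomy y y' with hl | rfl | hl
    · exact hrect p hp p' hp' y hy y' hy' hpp hl
    · simp
    · have := hrect p hp p' hp' y' hy' y hy hpp hl
      rw [intervalIntegral.integral_symm y', ← this, ← intervalIntegral.integral_neg]
      simp only [neg_sub]
  have hall : ∀ p ∈ Ioo p₁ p₂, ∀ p' ∈ Ioo p₁ p₂, ∀ y ∈ Ioo y₁ y₂, ∀ y' ∈ Ioo y₁ y₂,
      ∫ s in p..p', (Q ⟨s, y'⟩ - Q ⟨s, y⟩) = ∫ t in y..y', (G ⟨p', t⟩ - G ⟨p, t⟩) := by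
    intro p hp p' hp' y hy y' hy'
    rcases lt_trichotomy p p' with hl | rfl | hl
    · exact hpos p hp p' hp' y hy y' hy' hl
    · simp
    · have := hpos p' hp' p hp y hy y' hy' hl
      rw [intervalIntegral.integral_symm p', this, ← intervalIntegral.integral_neg]
      simp only [neg_sub]
  refine ⟨fun z => (∫ s in c.re..z.re, Q ⟨s, c.im⟩) + ∫ t in c.im..z.im, G ⟨z.re, t⟩, fun z hz => ?_⟩
  refine hasFDerivAt_of_partials (isOpen_box p₁ p₂ y₁ y₂) ?_ ?_ hQ hG hz
  · intro z hz
    have hd : HasDerivAt (fun p => (∫ s in c.re..p, Q ⟨s, z.im⟩) + ∫ t in c.im..z.im, G ⟨c.re, t⟩)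
        (Q z) z.re := by
      refine HasDerivAt.add_const _ ?_
      exact intervalIntegral.integral_hasDerivAt_right (hQi _ hz.2 _ hc.1 _ hz.1)
        ((hQs _ hz.2).stronglyMeasurableAtFilter isOpen_Ioo _ hz.1)
        ((hQs _ hz.2).continuousAt (isOpen_Ioo.mem_nhds hz.1))
    refine hd.congr_of_eventuallyEq ?_
    filter_upwards [isOpen_Ioo.mem_nhds hz.1] with p hp
    have := hall c.re hc.1 p hp c.im hc.2 z.im hz.2
    rw [intervalIntegral.integral_sub (hQi _ hz.2 _ hc.1 _ hp) (hQi _ hc.2 _ hc.1 _ hp),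
      intervalIntegral.integral_sub (hGi _ hp _ hc.2 _ hz.2) (hGi _ hc.1 _ hc.2 _ hz.2)] at this
    linarith
  · intro z hz
    refine HasDerivAt.const_add (∫ s in c.re..z.re, Q ⟨s, c.im⟩) ?_
    exact intervalIntegral.integral_hasDerivAt_right (hGi _ hz.1 _ hc.2 _ hz.2)
      ((hGs _ hz.1).stronglyMeasurableAtFilter isOpen_Ioo _ hz.2)
      ((hGs _ hz.1).continuousAt (isOpen_Ioo.mem_nhds hz.2))

variable {v f : ℂ → ℝ} {g : ℂ → ℂ} {O : Set ℂ}

/-- Smoothness of the partial Legendre transform. -/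
lemma GenSol.exists_smooth_legBox (h : GenSol v f g O) {w : ℂ} (hw : w ∈ O) :
    ∃ (X : ℂ → ℝ) (x₁ x₂ p₁ p₂ y₁ y₂ : ℝ), LegBox g O X x₁ x₂ p₁ p₂ y₁ y₂ ∧
      w.re ∈ Ioo x₁ x₂ ∧ (g w).re ∈ Ioo p₁ p₂ ∧ w.im ∈ Ioo y₁ y₂ ∧
      ContDiffOn ℝ ∞ X (Ioo p₁ p₂ ×ℂ Ioo y₁ y₂) ∧
      ContDiffOn ℝ ∞ (fun z => (g (graphMap X z)).im) (Ioo p₁ p₂ ×ℂ Ioo y₁ y₂) := by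
  obtain ⟨r, hr, hrO⟩ := Metric.isOpen_iff.1 h.isOpen w hw
  let χ : ContDiffBump w := ⟨r / 3, r / 2, by positivity, by linarith⟩
  set k : ℂ → ℝ := fun z => χ z * f z with hkdef
  have hk : ContDiff ℝ ∞ k := by
    rw [contDiff_iff_contDiffAt]
    intro z
    by_cases hz : z ∈ ball w r
    · exact χ.contDiff.contDiffAt.mul (h.smooth.contDiffAt (h.isOpen.mem_nhds (hrO hz)))
    · have hz' : z ∉ closedBall w (r / 2) := fun h => hz (closedBall_subset_ball (by linarith) h)
      have hk0 : k =ᶠ[𝓝 z] fun _ => 0 := by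
        filter_upwards [isClosed_closedBall.isOpen_compl.mem_nhds hz'] with y hy
        have : χ y = 0 := χ.zero_of_le_dist (by
          have := not_le.1 (fun h => hy (mem_closedBall.2 h)); exact this.le)
        simp [hkdef, this]
      exact contDiffAt_const.congr_of_eventuallyEq hk0
  obtain ⟨X, x₁, x₂, p₁, p₂, y₁, y₂, hB, hx, hp, hy, hsub⟩ :=
    h.exists_legBox hw (ε := r / 3) (by positivity)
  refine ⟨X, x₁, x₂, p₁, p₂, y₁, y₂, hB, hx, hp, hy, ?_⟩
  have hkf : ∀ z ∈ Ioo x₁ x₂ ×ℂ Ioo y₁ y₂, f z = k z := by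
    intro z hz
    have : z ∈ ball w (r / 3) := hsub ⟨Ioo_subset_Icc_self hz.1, hz.2⟩
    have h1 : χ z = 1 := χ.one_of_mem_closedBall (ball_subset_closedBall this)
    simp [hkdef, h1]
  obtain ⟨B, hBd⟩ := exists_potential (hB.continuousOn_im h)
    ((continuous_hprim 0 hk.continuous).comp_continuousOn (hB.continuousOn_graphMap h))
    (fun p hp p' hp' y hy y' hy' hpp hyy =>
      hB.rect_identity h hk.continuous hkf 0 hp hp' hy hy' hpp hyy)
  have hS : Sys _ B X (fun z => (g (graphMap X z)).im)
      (hprim 0 k ∘ graphMap X) (Ioo p₁ p₂ ×ℂ Ioo y₁ y₂) :=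
    ⟨isOpen_box _ _ _ _, fun z hz => hB.hasFDerivAt h hz, hBd, hB.continuousOn h,
      hB.continuousOn_im h,
      (continuous_hprim 0 hk.continuous).comp_continuousOn (hB.continuousOn_graphMap h)⟩
  refine hS.contDiffOn (isOpen_box x₁ x₂ y₁ y₂) (contDiff_hprim 0 hk).contDiffOn
    (fun z hz => ⟨hB.mem z hz, hz.2⟩) (fun z hz => rfl) (fun z hz => ?_)
  rw [(hasFDerivAt_hprim 0 (hk.of_le (by simp)) z).fderiv, lin_apply]
  simp only [Complex.one_re, Complex.one_im, mul_one, mul_zero, add_zero]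
  rw [← hkf z hz]
  exact h.pos z (hB.sub z.re (Ioo_subset_Icc_self hz.1) z.im hz.2)

end

section

/-- The linear map `s + i t ↦ (κ s + t) + i s`. -/
noncomputable def shear (κ : ℝ) : ℂ →L[ℝ] ℂ :=
  LinearMap.toContinuousLinearMap (Matrix.toLin Complex.basisOneI Complex.basisOneI !![κ, 1; 1, 0])

@[simp] lemma shear_apply (κ : ℝ) (z : ℂ) : shear κ z = ⟨κ * z.re + z.im, z.re⟩ := by
  rw [shear, LinearMap.coe_toContinuousLinearMap', Matrix.toLin_apply]
  apply Complex.ext <;> simp [Matrix.mulVec, dotProduct, Fin.sum_univ_two]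

lemma abs_det_shear (κ : ℝ) : |(shear κ).det| = 1 := by
  have : (shear κ).det = -1 := by
    rw [ContinuousLinearMap.det, shear, LinearMap.coe_toContinuousLinearMap, LinearMap.det_toLin]
    simp
  rw [this]; simp

lemma shear_injective (κ : ℝ) : Function.Injective (shear κ) := by
  intro z w h
  have h1 := congrArg Complex.im h
  have h2 := congrArg Complex.re h
  simp only [shear_apply] at h1 h2
  exact Complex.ext h1 (by rw [h1] at h2; linarith)

lemma volume_shear_image (κ : ℝ) (s : Set ℂ) : volume (shear κ '' s) = volume s := by
  have := Measure.addHaar_image_continuousLinearMap volume (shear κ) s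
  rw [this, abs_det_shear]; simp

lemma lintegral_shear_image (κ : ℝ) {s : Set ℂ} (hs : MeasurableSet s) (k : ℂ → ENNReal) :
    ∫⁻ z in shear κ '' s, k z = ∫⁻ z in s, k (shear κ z) := by
  rw [lintegral_image_eq_lintegral_abs_det_fderiv_mul volume hs
    (fun z _ => (shear κ).hasFDerivAt.hasFDerivWithinAt) (shear_injective κ).injOn]
  simp [abs_det_shear]

variable {v f : ℂ → ℝ} {g : ℂ → ℂ} {O : Set ℂ}

lemma GenSol.shear (h : GenSol v f g O) (κ : ℝ) :
    GenSol (fun z => v (shear κ z)) (fun z => f (shear κ z)) (fun z => shear κ (g (shear κ z)))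
      (shear κ ⁻¹' O) where
  isOpen := h.isOpen.preimage (MA.shear κ).continuous
  strict := by
    refine ⟨h.strict.1.linear_preimage (MA.shear κ).toLinearMap, ?_⟩
    intro x hx y hy hxy a b ha hb hab
    beta_reduce
    rw [map_add, map_smul, map_smul]
    exact h.strict.2 hx hy (fun he => hxy (shear_injective κ he)) ha hb hab
  grad := by
    intro z hz
    refine ((h.grad _ hz).comp z (MA.shear κ).hasFDerivAt).congr_fderiv ?_
    ext w
    simp
    ring
  cont := (MA.shear κ).continuous.comp_continuousOn
    (h.cont.comp (MA.shear κ).continuous.continuousOn fun _ hz => hz)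
  smooth := h.smooth.comp (MA.shear κ).contDiff.contDiffOn fun _ hz => hz
  pos := fun z hz => h.pos _ hz
  vol := by
    intro U hU hUo
    have hsurj : Function.Surjective (MA.shear κ) := by
      intro w
      refine ⟨⟨w.im, w.re - κ * w.im⟩, ?_⟩
      apply Complex.ext <;> simp
    have hopen : IsOpen (MA.shear κ '' U) := (MA.shear κ).isOpenMap hsurj _ hUo
    have h1 := h.vol (MA.shear κ '' U) (by rintro _ ⟨z, hz, rfl⟩; exact hU hz) hopen
    rw [lintegral_shear_image κ hUo.measurableSet] at h1
    rw [← h1, ← volume_shear_image κ (g '' _)]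
    congr 1
    rw [image_image, image_image]

lemma LegBox.left_inv {X : ℂ → ℝ} {x₁ x₂ p₁ p₂ y₁ y₂ : ℝ} (hB : LegBox g O X x₁ x₂ p₁ p₂ y₁ y₂)
    (h : GenSol v f g O) {w : ℂ} (hx : w.re ∈ Icc x₁ x₂) (hp : (g w).re ∈ Ioo p₁ p₂)
    (hy : w.im ∈ Ioo y₁ y₂) : graphMap X ⟨(g w).re, w.im⟩ = w :=
  Complex.ext (hB.unique h (z := ⟨(g w).re, w.im⟩) ⟨hp, hy⟩ hx rfl) rfl

/-- The partial Legendre transform is nondegenerate. -/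
lemma LegBox.deriv_ne_zero {X : ℂ → ℝ} {x₁ x₂ p₁ p₂ y₁ y₂ : ℝ}
    (hB : LegBox g O X x₁ x₂ p₁ p₂ y₁ y₂) (h : GenSol v f g O) {z₀ : ℂ}
    (hz : z₀ ∈ Ioo p₁ p₂ ×ℂ Ioo y₁ y₂) (hX : ContDiffOn ℝ ∞ X (Ioo p₁ p₂ ×ℂ Ioo y₁ y₂))
    (hQ : ContDiffOn ℝ ∞ (fun z => (g (graphMap X z)).im) (Ioo p₁ p₂ ×ℂ Ioo y₁ y₂)) :
    fderiv ℝ X z₀ 1 ≠ 0 := by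
  intro h0
  have hPo := isOpen_box p₁ p₂ y₁ y₂
  have hXd := ((hX.contDiffAt (hPo.mem_nhds hz)).differentiableAt (by simp)).hasFDerivAt
  have hQd := ((hQ.contDiffAt (hPo.mem_nhds hz)).differentiableAt (by simp)).hasFDerivAt
  set κ := fderiv ℝ X z₀ Complex.I with hκ
  set Q : ℂ → ℝ := fun z => (g (graphMap X z)).im with hQdef
  have hQ1 : fderiv ℝ Q z₀ 1 = -κ := by
    have hX' := hXd
    rw [exists_eq_lin (fderiv ℝ X z₀)] at hX'
    have hQ' := hQd.fun_neg
    rw [exists_eq_lin (-fderiv ℝ Q z₀)] at hQ'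
    have := mixed_eq hPo (fun z hz => hB.hasFDerivAt h hz) hz hX' hQ'
    simp only [_root_.neg_apply] at this
    linarith
  have hs := h.shear κ
  set w := graphMap X z₀ with hw
  have hwO : w ∈ O := hB.mem_O hz
  set ζ : ℝ → ℂ := fun p => ⟨z₀.im, X ⟨p, z₀.im⟩ - κ * z₀.im⟩ with hζ
  have hSζ : ∀ p, MA.shear κ (ζ p) = graphMap X ⟨p, z₀.im⟩ := by
    intro p
    apply Complex.ext <;> simp [hζ, graphMap]
  have hζO : ζ z₀.re ∈ MA.shear κ ⁻¹' O := by
    rw [mem_preimage, hSζ]; exact hwO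
  obtain ⟨X', x₁', x₂', p₁', p₂', y₁', y₂', hB', hx', hp', hy', hX's, hQ's⟩ :=
    hs.exists_smooth_legBox hζO
  set g' : ℂ → ℂ := fun z => MA.shear κ (g (MA.shear κ z)) with hg'
  have hslice : HasDerivAt (fun p : ℝ => X ⟨p, z₀.im⟩) 0 z₀.re := by
    have := HasFDerivAt.left_slice (x := z₀.re) (y := z₀.im) hXd
    rwa [h0] at this
  have hsliceQ : HasDerivAt (fun p : ℝ => Q ⟨p, z₀.im⟩) (-κ) z₀.re := by
    have := HasFDerivAt.left_slice (x := z₀.re) (y := z₀.im) hQd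
    rwa [hQ1] at this
  set ξ : ℝ → ℂ := fun p => ⟨κ * p + Q ⟨p, z₀.im⟩, X ⟨p, z₀.im⟩ - κ * z₀.im⟩ with hξ
  have hξd : HasDerivAt ξ 0 z₀.re := by
    have h1 : HasDerivAt (fun p : ℝ => κ * p + Q ⟨p, z₀.im⟩) 0 z₀.re := by
      have := ((hasDerivAt_id z₀.re).const_mul κ).add hsliceQ
      exact this.congr_deriv (by ring)
    have h2 := hslice.sub_const (κ * z₀.im)
    have h3 := (Complex.ofRealCLM.hasFDerivAt.comp_hasDerivAt _ h1).add
      ((Complex.ofRealCLM.hasFDerivAt.comp_hasDerivAt _ h2).mul_const Complex.I)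
    refine (h3.congr_of_eventuallyEq (Eventually.of_forall fun p => ?_)).congr_deriv (by simp)
    apply Complex.ext <;> simp [hξ]
  have hslicemem : ∀ᶠ p in 𝓝 z₀.re, (⟨p, z₀.im⟩ : ℂ) ∈ Ioo p₁ p₂ ×ℂ Ioo y₁ y₂ := by
    filter_upwards [isOpen_Ioo.mem_nhds hz.1] with p hp using ⟨hp, hz.2⟩
  have hgζ : ∀ᶠ p in 𝓝 z₀.re, g' (ζ p) = ⟨(ξ p).re, p⟩ := by
    filter_upwards [hslicemem] with p hp
    rw [hg']
    beta_reduce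
    rw [hSζ, shear_apply, hB.eq _ hp]
  have hξ0 : ξ z₀.re ∈ Ioo p₁' p₂' ×ℂ Ioo y₁' y₂' := by
    refine ⟨?_, hy'⟩
    have := hgζ.self_of_nhds
    have hp'' : (g' (ζ z₀.re)).re ∈ Ioo p₁' p₂' := hp'
    rwa [this] at hp''
  have hev : ∀ᶠ p in 𝓝 z₀.re, (g' (graphMap X' (ξ p))).im = p := by
    filter_upwards [hgζ, hξd.continuousAt.eventually ((isOpen_box p₁' p₂' y₁' y₂').mem_nhds hξ0)] with p hp hm
    have hr : (g' (ζ p)).re = (ξ p).re := by rw [hp]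
    have := hB'.left_inv hs (w := ζ p) (Ioo_subset_Icc_self hx') (by
      rw [hr]; exact hm.1) hm.2
    have h5 : (⟨(g' (ζ p)).re, (ζ p).im⟩ : ℂ) = ξ p := Complex.ext hr rfl
    change graphMap X' ⟨(g' (ζ p)).re, (ζ p).im⟩ = _ at this
    rw [h5] at this
    rw [this, hp]
  have hQ'd := ((hQ's.contDiffAt ((isOpen_box p₁' p₂' y₁' y₂').mem_nhds hξ0)).differentiableAt
    (by simp)).hasFDerivAt
  have hc := hQ'd.comp_hasDerivAt _ hξd
  have hid := (hasDerivAt_id z₀.re).congr_of_eventuallyEq hev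
  have := hc.unique hid
  simp at this

end

section

lemma le_of_lintegral_eq {a b : ℂ → ℝ} {O : Set ℂ} (hO : IsOpen O) (ha : ContinuousOn a O)
    (hb : ContinuousOn b O) (hb0 : ∀ z ∈ O, 0 ≤ b z)
    (h : ∀ U ⊆ O, IsOpen U → ∫⁻ z in U, ENNReal.ofReal (a z) = ∫⁻ z in U, ENNReal.ofReal (b z))
    {z : ℂ} (hz : z ∈ O) : a z ≤ b z := by
  by_contra hlt
  push Not at hlt
  obtain ⟨c, hc1, hc⟩ := exists_between hlt
  obtain ⟨d, hd1, hd⟩ := exists_between hc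
  have e1 := (hb.continuousAt (hO.mem_nhds hz)).eventually (gt_mem_nhds hc1)
  have e2 := (ha.continuousAt (hO.mem_nhds hz)).eventually (lt_mem_nhds hd)
  obtain ⟨r, hr, hball⟩ := Metric.eventually_nhds_iff_ball.1
    ((e1.and e2).and (hO.mem_nhds hz))
  have h1 := h (ball z r) (fun y hy => (hball y hy).2) isOpen_ball
  have h2 : ENNReal.ofReal d * volume (ball z r) ≤ ∫⁻ z in ball z r, ENNReal.ofReal (a z) := by
    rw [← setLIntegral_const]
    exact setLIntegral_mono' measurableSet_ball fun y hy => ENNReal.ofReal_le_ofReal (hball y hy).1.2.le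
  have h3 : ∫⁻ z in ball z r, ENNReal.ofReal (b z) ≤ ENNReal.ofReal c * volume (ball z r) := by
    rw [← setLIntegral_const]
    exact setLIntegral_mono' measurableSet_ball fun y hy => ENNReal.ofReal_le_ofReal (hball y hy).1.1.le
  have h4 := (h2.trans h1.le).trans h3
  have hv0 : volume (ball z r) ≠ 0 := (measure_ball_pos volume z hr).ne'
  have hvt : volume (ball z r) ≠ ⊤ := measure_ball_lt_top.ne
  rw [ENNReal.mul_le_mul_iff_left hv0 hvt] at h4
  have hc0 : 0 ≤ c := (hb0 z hz).trans hc1.le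
  have := (ENNReal.ofReal_le_ofReal_iff hc0).1 h4
  linarith

variable {v f : ℂ → ℝ} {g : ℂ → ℂ} {O : Set ℂ}

lemma GenSol.contDiffAt_gradient (h : GenSol v f g O) {w : ℂ} (hw : w ∈ O) :
    ContDiffAt ℝ ∞ g w := by
  obtain ⟨X, x₁, x₂, p₁, p₂, y₁, y₂, hB, hx, hp, hy, hX, hQ⟩ := h.exists_smooth_legBox hw
  set z₀ : ℂ := ⟨(g w).re, w.im⟩ with hz₀
  have hz : z₀ ∈ Ioo p₁ p₂ ×ℂ Ioo y₁ y₂ := ⟨hp, hy⟩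
  have hPo := isOpen_box p₁ p₂ y₁ y₂
  have hne := hB.deriv_ne_zero h hz hX hQ
  have hXat := hX.contDiffAt (hPo.mem_nhds hz)
  have hXd := (hXat.differentiableAt (by simp)).hasFDerivAt
  have hgm : ContDiffAt ℝ ∞ (graphMap X) z₀ := by
    have h1 : ContDiffAt ℝ ∞ (fun z => (X z : ℂ) + (z.im : ℂ) * Complex.I) z₀ :=
      (Complex.ofRealCLM.contDiff.contDiffAt.comp z₀ hXat).add
        ((Complex.ofRealCLM.contDiff.comp Complex.imCLM.contDiff).contDiffAt.mul contDiffAt_const)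
    refine h1.congr_of_eventuallyEq (Eventually.of_forall fun z => ?_)
    apply Complex.ext <;> simp [graphMap]
  set L := fderiv ℝ (graphMap X) z₀ with hL
  have hgd : HasFDerivAt (graphMap X) L z₀ := (hgm.differentiableAt (by simp)).hasFDerivAt
  have hLa : ∀ ζ : ℂ, L ζ = ⟨fderiv ℝ X z₀ ζ, ζ.im⟩ := by
    intro ζ
    have h1 := (Complex.reCLM.hasFDerivAt.comp z₀ hgd).unique hXd
    have h2 := (Complex.imCLM.hasFDerivAt.comp z₀ hgd).unique Complex.imCLM.hasFDerivAt
    have h1' := congrArg (fun M : ℂ →L[ℝ] ℝ => M ζ) h1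
    have h2' := congrArg (fun M : ℂ →L[ℝ] ℝ => M ζ) h2
    exact Complex.ext h1' h2'
  have hinj : Function.Injective L := by
    rw [injective_iff_map_eq_zero]
    intro ζ hζ
    rw [hLa] at hζ
    have h2 : ζ.im = 0 := congrArg Complex.im hζ
    have h1 : fderiv ℝ X z₀ ζ = 0 := congrArg Complex.re hζ
    rw [exists_eq_lin (fderiv ℝ X z₀), lin_apply, h2, mul_zero, add_zero] at h1
    exact Complex.ext ((mul_eq_zero.1 h1).resolve_left hne) h2
  let e : ℂ ≃L[ℝ] ℂ := (LinearEquiv.ofInjectiveEndo (L : ℂ →ₗ[ℝ] ℂ) hinj).toContinuousLinearEquiv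
  have he : HasFDerivAt (graphMap X) (e : ℂ →L[ℝ] ℂ) z₀ := by
    refine hgd.congr_fderiv ?_
    ext ζ; rfl
  have hgw : graphMap X z₀ = w := hB.left_inv h (Ioo_subset_Icc_self hx) hp hy
  have hinv := hgm.to_localInverse he (by simp)
  have hstrict : HasStrictFDerivAt (graphMap X) (e : ℂ →L[ℝ] ℂ) z₀ := by
    have := hgm.hasStrictFDerivAt (by simp)
    rwa [← hL, hgd.unique he] at this
  have hleft := hstrict.eventually_left_inverse
  set Θ : ℂ → ℂ := fun w => ⟨(g w).re, w.im⟩ with hΘ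
  have hgc := h.cont.continuousAt (h.isOpen.mem_nhds hw)
  have hΘc : ContinuousAt Θ w :=
    continuous_mk.continuousAt.comp ((Complex.continuous_re.continuousAt.comp hgc).prodMk
      Complex.continuous_im.continuousAt)
  have hloc : ∀ᶠ w' in 𝓝 w, Θ w' ∈ Ioo p₁ p₂ ×ℂ Ioo y₁ y₂ ∧ graphMap X (Θ w') = w' := by
    filter_upwards [hΘc.eventually (hPo.mem_nhds hz),
      Complex.continuous_re.continuousAt.eventually (isOpen_Ioo.mem_nhds hx)] with w' h1 h2
    exact ⟨h1, hB.left_inv h (Ioo_subset_Icc_self h2) h1.1 h1.2⟩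
  have hΘs : ContDiffAt ℝ ∞ Θ w := by
    rw [hgw] at hinv
    refine hinv.congr_of_eventuallyEq ?_
    filter_upwards [hloc, hΘc.eventually hleft] with w' h1 h2
    rw [h1.2] at h2
    exact h2.symm
  have hfin : ContDiffAt ℝ ∞ (fun w' => ((Θ w').re : ℂ) + ((g (graphMap X (Θ w'))).im : ℂ) * Complex.I) w := by
    refine ContDiffAt.add ?_ (ContDiffAt.mul ?_ contDiffAt_const)
    · exact ContDiffAt.comp (g := fun z : ℂ => ((z.re : ℝ) : ℂ)) (f := Θ) w
        (Complex.ofRealCLM.contDiff.comp Complex.reCLM.contDiff).contDiffAt hΘs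
    · exact Complex.ofRealCLM.contDiff.contDiffAt.comp w
        (ContDiffAt.comp (g := fun z => (g (graphMap X z)).im) (f := Θ) w
          (hQ.contDiffAt (hPo.mem_nhds hz)) hΘs)
  refine hfin.congr_of_eventuallyEq ?_
  filter_upwards [hloc] with w' h1
  rw [h1.2]
  apply Complex.ext <;> simp [hΘ]

lemma det_clm (L : ℂ →L[ℝ] ℂ) : L.det = (L 1).re * (L Complex.I).im - (L Complex.I).re * (L 1).im := by
  rw [ContinuousLinearMap.det, ← LinearMap.det_toMatrix Complex.basisOneI, Matrix.det_fin_two]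
  simp [LinearMap.toMatrix_apply]

lemma GenSol.det_nonneg (h : GenSol v f g O) {w : ℂ} (hw : w ∈ O) : 0 ≤ (fderiv ℝ g w).det := by
  have hgd := ((h.contDiffAt_gradient hw).differentiableAt (by simp)).hasFDerivAt
  set L := fderiv ℝ g w
  have h1 := Complex.reCLM.hasFDerivAt.comp w hgd
  have h2 := Complex.imCLM.hasFDerivAt.comp w hgd
  rw [exists_eq_lin (Complex.reCLM.comp L)] at h1
  rw [exists_eq_lin (Complex.imCLM.comp L)] at h2
  have hsym : (L Complex.I).re = (L 1).im := by
    have := mixed_eq h.isOpen (a₁ := fun z => (g z).re) (a₂ := fun z => (g z).im) h.grad hw h1 h2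
    simpa using this
  have hpos : ∀ ζ : ℂ, 0 ≤ (L ζ).re * ζ.re + (L ζ).im * ζ.im := by
    intro ζ
    have hl : HasDerivAt (fun t : ℝ => w + t • ζ) ζ 0 := by
      have := ((hasDerivAt_id (0 : ℝ)).smul_const ζ).const_add w
      simpa using this
    have hc : HasDerivAt (fun t : ℝ => g (w + t • ζ)) (L ζ) 0 :=
      HasFDerivAt.comp_hasDerivAt 0 (by simpa using hgd) hl
    have hcr := Complex.reCLM.hasFDerivAt.comp_hasDerivAt _ hc
    have hci := Complex.imCLM.hasFDerivAt.comp_hasDerivAt _ hc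
    have hd := ((hcr.mul_const ζ.re).add (hci.mul_const ζ.im)).tendsto_slope_zero_right
    refine ge_of_tendsto hd ?_
    have hO : ∀ᶠ t in 𝓝 (0 : ℝ), w + t • ζ ∈ O :=
      hl.continuousAt.eventually (h.isOpen.mem_nhds (by simpa using hw))
    filter_upwards [self_mem_nhdsWithin, nhdsWithin_le_nhds hO] with t ht htO
    rw [mem_Ioi] at ht
    have m1 := tangent_le h.strict.convexOn hw htO (h.grad w hw)
    have m2 := tangent_le h.strict.convexOn htO hw (h.grad _ htO)
    simp only [lin_apply, add_sub_cancel_left, sub_add_cancel_left, Complex.neg_re, Complex.neg_im,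
      Complex.smul_re, Complex.smul_im, smul_eq_mul] at m1 m2
    have m3 : 0 ≤ t * (((g (w + t • ζ)).re * ζ.re + (g (w + t • ζ)).im * ζ.im)
      - ((g w).re * ζ.re + (g w).im * ζ.im)) := by nlinarith
    simp only [zero_add, zero_smul, add_zero, smul_eq_mul, Pi.add_apply, Function.comp,
      Complex.reCLM_apply, Complex.imCLM_apply]
    exact mul_nonneg (inv_nonneg.2 ht.le) (by nlinarith)
  rw [det_clm, hsym]
  set a := (L 1).re
  set b := (L 1).im
  set c := (L Complex.I).im
  have hq : ∀ s t : ℝ, 0 ≤ a * s ^ 2 + 2 * b * s * t + c * t ^ 2 := by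
    intro s t
    have := hpos (s • (1 : ℂ) + t • Complex.I)
    rw [map_add, map_smul, map_smul] at this
    simp [hsym] at this
    nlinarith
  have ha := hq 1 0
  have hc := hq 0 1
  rcases eq_or_lt_of_le (show 0 ≤ a by nlinarith) with h0 | h0
  · have := hq (-(c + 1) * b) (b ^ 2 / 1)
    have h4 := hq (-(c + 1)) b
    rw [← h0] at h4 ⊢
    nlinarith [sq_nonneg b]
  · have := hq (-b) a
    have h5 : 0 ≤ a * (a * c - b * b) := by nlinarith
    exact nonneg_of_mul_nonneg_right h5 h0

/-- Regularity of strictly convex `C¹` generalised solutions. -/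
theorem GenSol.regularity (h : GenSol v f g O) :
    ContDiffOn ℝ ∞ v O ∧ ContDiffOn ℝ ∞ g O ∧ ∀ w ∈ O, (fderiv ℝ g w).det = f w := by
  have hg : ContDiffOn ℝ ∞ g O := fun w hw => (h.contDiffAt_gradient hw).contDiffWithinAt
  have hdc : ContinuousOn (fun w => (fderiv ℝ g w).det) O :=
    ContinuousLinearMap.continuous_det.comp_continuousOn (hg.continuousOn_fderiv_of_isOpen h.isOpen (by simp))
  have hint : ∀ U ⊆ O, IsOpen U →
      ∫⁻ z in U, ENNReal.ofReal ((fderiv ℝ g z).det) = ∫⁻ z in U, ENNReal.ofReal (f z) := by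
    intro U hU hUo
    rw [← h.vol U hU hUo, ← lintegral_abs_det_fderiv_eq_addHaar_image volume hUo.measurableSet
      (fun z hz => ((h.contDiffAt_gradient (hU hz)).differentiableAt
        (by simp)).hasFDerivAt.hasFDerivWithinAt) (h.injOn.mono hU)]
    exact setLIntegral_congr_fun hUo.measurableSet fun z hz => by
      rw [abs_of_nonneg (h.det_nonneg (hU hz))]
  refine ⟨?_, hg, fun w hw => le_antisymm ?_ ?_⟩
  · rw [contDiffOn_infty_iff_fderiv_of_isOpen h.isOpen]
    refine ⟨fun z hz => (h.grad z hz).differentiableAt.differentiableWithinAt, ?_⟩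
    have : ContDiffOn ℝ ∞ (fun z => lin (g z).re (g z).im) O := by
      unfold lin
      exact ((Complex.reCLM.contDiff.comp_contDiffOn hg).smul contDiffOn_const).add
        ((Complex.imCLM.contDiff.comp_contDiffOn hg).smul contDiffOn_const)
    exact this.congr fun z hz => (h.grad z hz).fderiv
  · exact le_of_lintegral_eq h.isOpen hdc h.smooth.continuousOn (fun z hz => (h.pos z hz).le) hint hw
  · exact le_of_lintegral_eq h.isOpen h.smooth.continuousOn hdc (fun z hz => h.det_nonneg hz)
      (fun U hU hUo => (hint U hU hUo).symm) hw

end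

section

/-- `y` is a subgradient of `u` at `x`. -/
def SubAt (u : ℂ → ℝ) (x y : ℂ) : Prop := ∀ z, u x + inner ℝ y (z - x) ≤ u z

/-- Every point has a subgradient of norm at most one. -/
def Sub1 (u : ℂ → ℝ) : Prop := ∀ x, ∃ y ∈ closedBall (0 : ℂ) 1, SubAt u x y

/-- `h` is the support function of the graph of `φ` over the unit circle. -/
structure IsSupport (φ h : ℂ → ℝ) : Prop where
  le : ∀ x, ∀ y ∈ sphere (0 : ℂ) 1, inner ℝ y x - φ y ≤ h x
  attained : ∀ x, ∃ y ∈ sphere (0 : ℂ) 1, h x = inner ℝ y x - φ y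

lemma exists_isSupport {φ : ℂ → ℝ} (hφ : Continuous φ) : ∃ h, IsSupport φ h := by
  have key : ∀ x : ℂ, ∃ y ∈ sphere (0 : ℂ) 1, IsMaxOn (fun y => inner ℝ y x - φ y) (sphere 0 1) y :=
    fun x => (isCompact_sphere 0 1).exists_isMaxOn ⟨1, by simp⟩ (by fun_prop)
  choose y hy hmax using key
  exact ⟨fun x => inner ℝ (y x) x - φ (y x), fun x z hz => hmax x hz, fun x => ⟨y x, hy x, rfl⟩⟩

variable {u φ h : ℂ → ℝ} {x y : ℂ} {M : ℝ}

lemma inner_le_norm_of_mem (hy : y ∈ closedBall (0 : ℂ) 1) (x : ℂ) : inner ℝ y x ≤ ‖x‖ := by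
  refine (real_inner_le_norm _ _).trans ?_
  have := mem_closedBall_zero_iff.1 hy
  nlinarith [norm_nonneg x]

lemma exists_inner_eq_norm (x : ℂ) : ∃ y ∈ sphere (0 : ℂ) 1, inner ℝ y x = ‖x‖ := by
  rcases eq_or_ne x 0 with rfl | hx
  · exact ⟨1, by simp, by simp⟩
  · have hn : ‖x‖ ≠ 0 := norm_ne_zero_iff.2 hx
    refine ⟨(‖x‖⁻¹ : ℝ) • x, by simp [hn], ?_⟩
    rw [real_inner_smul_left, real_inner_self_eq_norm_sq]
    field_simp

lemma IsSupport.lower (H : IsSupport φ h) (hM : ∀ y ∈ sphere (0 : ℂ) 1, |φ y| ≤ M) (x : ℂ) :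
    ‖x‖ - M ≤ h x := by
  obtain ⟨y, hy, h1⟩ := exists_inner_eq_norm x
  have := H.le x y hy
  have := (abs_le.1 (hM y hy)).2
  linarith

lemma IsSupport.upper (H : IsSupport φ h) (hM : ∀ y ∈ sphere (0 : ℂ) 1, |φ y| ≤ M) (x : ℂ) :
    h x ≤ ‖x‖ + M := by
  obtain ⟨y, hy, h1⟩ := H.attained x
  have := inner_le_norm_of_mem (sphere_subset_closedBall hy) x
  have := (abs_le.1 (hM y hy)).1
  linarith

lemma IsSupport.sub1 (H : IsSupport φ h) : Sub1 h := by
  intro x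
  obtain ⟨y, hy, h1⟩ := H.attained x
  refine ⟨y, sphere_subset_closedBall hy, fun x' => ?_⟩
  have := H.le x' y hy
  rw [inner_sub_right]; linarith

lemma Sub1.lipschitz (hu : Sub1 u) : LipschitzWith 1 u := by
  refine LipschitzWith.of_le_add fun x x' => ?_
  obtain ⟨y, hy, h1⟩ := hu x
  have h2 := h1 x'
  have h3 := inner_le_norm_of_mem hy (x - x')
  rw [← neg_sub, inner_neg_right] at h2
  rw [dist_eq_norm]; linarith

lemma Sub1.ae_differentiableAt (hu : Sub1 u) : ∀ᵐ x, DifferentiableAt ℝ u x :=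
  hu.lipschitz.ae_differentiableAt

lemma SubAt.eq_gradient (hy : SubAt u x y) (hd : DifferentiableAt ℝ u x) : y = gradient u x := by
  have h1 : HasFDerivAt (fun x' => u x' - inner ℝ y x') (fderiv ℝ u x - innerSL ℝ y) x :=
    hd.hasFDerivAt.sub (innerSL ℝ y).hasFDerivAt
  have h2 : IsLocalMin (fun x' => u x' - inner ℝ y x') x := by
    refine Eventually.of_forall fun x' => ?_
    have := hy x'
    rw [inner_sub_right] at this
    linarith
  have h3 := sub_eq_zero.1 (h2.hasFDerivAt_eq_zero h1)
  rw [gradient, h3]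
  exact ((InnerProductSpace.toDual ℝ ℂ).symm_apply_apply y).symm

lemma Sub1.subAt_gradient (hu : Sub1 u) (hd : DifferentiableAt ℝ u x) :
    SubAt u x (gradient u x) ∧ gradient u x ∈ closedBall (0 : ℂ) 1 := by
  obtain ⟨y, hy, h1⟩ := hu x
  rw [← h1.eq_gradient hd]
  exact ⟨h1, hy⟩

lemma measurable_gradient (u : ℂ → ℝ) : Measurable (gradient u) :=
  (InnerProductSpace.toDual ℝ ℂ).symm.continuous.measurable.comp (measurable_fderiv ℝ u)

section limits

variable {U : ℕ → ℂ → ℝ}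

lemma exists_subseq_tendsto (hU : ∀ k, Sub1 (U k)) {C : ℝ} (hC : ∀ k, |U k 0| ≤ C) :
    ∃ θ : ℕ → ℕ, StrictMono θ ∧ ∃ u : ℂ → ℝ, ∀ x, Tendsto (fun k => U (θ k) x) atTop (𝓝 (u x)) := by
  set e := TopologicalSpace.denseSeq ℂ
  have hcomp : IsCompact (univ.pi fun n : ℕ => Icc (-(‖e n‖ + C)) (‖e n‖ + C)) :=
    isCompact_univ_pi fun _ => isCompact_Icc
  have hmem : ∀ k, (fun n => U k (e n)) ∈ univ.pi fun n : ℕ => Icc (-(‖e n‖ + C)) (‖e n‖ + C) := by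
    intro k n _
    have h1 := (hU k).lipschitz.dist_le_mul (e n) 0
    simp only [Real.dist_eq, NNReal.coe_one, one_mul, dist_zero_right] at h1
    have := abs_le.1 h1
    have := abs_le.1 (hC k)
    constructor <;> linarith
  obtain ⟨a, -, θ, hθ, hlim⟩ := hcomp.tendsto_subseq hmem
  refine ⟨θ, hθ, ?_⟩
  have hcau : ∀ x, ∃ l, Tendsto (fun k => U (θ k) x) atTop (𝓝 l) := by
    intro x
    refine cauchySeq_tendsto_of_complete (Metric.cauchySeq_iff'.2 fun ε hε => ?_)
    obtain ⟨n, hn⟩ := (TopologicalSpace.denseRange_denseSeq ℂ).exists_dist_lt x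
      (show 0 < ε / 3 by positivity)
    obtain ⟨N, hN⟩ := Metric.cauchySeq_iff'.1 (tendsto_pi_nhds.1 hlim n).cauchySeq (ε / 3)
      (by positivity)
    refine ⟨N, fun k hk => ?_⟩
    have h1 := (hU (θ k)).lipschitz.dist_le_mul x (e n)
    have h2 := (hU (θ N)).lipschitz.dist_le_mul (e n) x
    rw [dist_comm (e n) x] at h2
    simp only [NNReal.coe_one, one_mul] at h1 h2
    have h3 := hN k hk
    have h4 := dist_triangle4 (U (θ k) x) (U (θ k) (e n)) (U (θ N) (e n)) (U (θ N) x)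
    simp only [Function.comp] at h3
    linarith
  choose u hu using hcau
  exact ⟨u, hu⟩

lemma exists_subAt_of_tendsto (hlim : ∀ x, Tendsto (fun k => U k x) atTop (𝓝 (u x))) {Y : ℕ → ℂ} (hY : ∀ k, Y k ∈ closedBall (0 : ℂ) 1)
    (hs : ∀ k, SubAt (U k) x (Y k)) :
    ∃ y ∈ closedBall (0 : ℂ) 1, ∃ θ : ℕ → ℕ, StrictMono θ ∧ Tendsto (Y ∘ θ) atTop (𝓝 y) ∧
      SubAt u x y := by
  obtain ⟨y, hy, θ, hθ, hlimY⟩ := (isCompact_closedBall (0 : ℂ) 1).tendsto_subseq hY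
  refine ⟨y, hy, θ, hθ, hlimY, fun x' => ?_⟩
  refine le_of_tendsto_of_tendsto' (((hlim x).comp hθ.tendsto_atTop).add
    ((hlimY.inner tendsto_const_nhds))) ((hlim x').comp hθ.tendsto_atTop) fun k => hs (θ k) x'

variable (hU : ∀ k, Sub1 (U k)) (hlim : ∀ x, Tendsto (fun k => U k x) atTop (𝓝 (u x)))
include hU hlim

lemma Sub1.of_tendsto : Sub1 u := by
  intro x
  choose Y hY hs using fun k => hU k x
  obtain ⟨y, hy, -, -, -, h⟩ := exists_subAt_of_tendsto hlim hY hs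
  exact ⟨y, hy, h⟩

lemma tendsto_gradient (hd : ∀ k, DifferentiableAt ℝ (U k) x) (hd' : DifferentiableAt ℝ u x) :
    Tendsto (fun k => gradient (U k) x) atTop (𝓝 (gradient u x)) := by
  refine tendsto_of_subseq_tendsto fun ns hns => ?_
  obtain ⟨y, -, θ, -, h1, h2⟩ := exists_subAt_of_tendsto (u := u) (U := fun k => U (ns k)) (x := x)
    (fun x' => (hlim x').comp hns)
    (fun k => ((hU (ns k)).subAt_gradient (hd _)).2) (fun k => ((hU (ns k)).subAt_gradient (hd _)).1)
  exact ⟨θ, by rw [← h2.eq_gradient hd']; exact h1⟩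

end limits

/-- Nonnegative continuous functions vanishing near and outside the unit circle. -/
structure IsTest (ψ : ℂ → ℝ) : Prop where
  cont : Continuous ψ
  nonneg : ∀ y, 0 ≤ ψ y
  zero : ∃ r < 1, ∀ y, r ≤ ‖y‖ → ψ y = 0

lemma IsTest.exists_bound {ψ : ℂ → ℝ} (hψ : IsTest ψ) : ∃ C, ∀ y, ψ y ≤ C := by
  obtain ⟨C, hC⟩ := (isCompact_closedBall (0 : ℂ) 1).exists_bound_of_continuousOn hψ.cont.continuousOn
  obtain ⟨r, hr, h0⟩ := hψ.zero
  refine ⟨max C 0, fun y => ?_⟩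
  by_cases hy : ‖y‖ ≤ 1
  · exact (le_abs_self _).trans ((hC y (by simpa using hy)).trans (le_max_left _ _))
  · rw [h0 y (by linarith)]; exact le_max_right _ _

/-- `T` pushes Lebesgue measure to `ν` inside the unit disc. -/
def Push (T : ℂ → ℂ) (ν : Measure ℂ) : Prop :=
  ∀ ψ, IsTest ψ → ∫⁻ x, ENNReal.ofReal (ψ (T x)) = ∫⁻ y, ENNReal.ofReal (ψ y) ∂ν

lemma Push.of_tendsto {U : ℕ → ℂ → ℝ} {ν : ℕ → Measure ℂ} {ν' : Measure ℂ} {A : ℝ}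
    (hU : ∀ k, Sub1 (U k)) (hlim : ∀ x, Tendsto (fun k => U k x) atTop (𝓝 (u x)))
    (hlow : ∀ k x, ‖x‖ - M ≤ U k x) (hA : ∀ k, U k 0 ≤ A) (hP : ∀ k, Push (gradient (U k)) (ν k))
    (hν : ∀ ψ, IsTest ψ → Tendsto (fun k => ∫⁻ y, ENNReal.ofReal (ψ y) ∂(ν k)) atTop
      (𝓝 (∫⁻ y, ENNReal.ofReal (ψ y) ∂ν'))) : Push (gradient u) ν' := by
  intro ψ hψ
  have hu : Sub1 u := Sub1.of_tendsto hU hlim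
  obtain ⟨C, hC⟩ := hψ.exists_bound
  obtain ⟨r, hr, h0⟩ := hψ.zero
  refine tendsto_nhds_unique ?_ (hν ψ hψ)
  simp_rw [← fun k => hP k ψ hψ]
  have hae : ∀ᵐ x, (∀ k, DifferentiableAt ℝ (U k) x) ∧ DifferentiableAt ℝ u x :=
    (ae_all_iff.2 fun k => (hU k).ae_differentiableAt).and hu.ae_differentiableAt
  refine tendsto_lintegral_of_dominated_convergence
    ((closedBall (0 : ℂ) ((A + M) / (1 - r))).indicator fun _ => ENNReal.ofReal C)
    (fun k => (hψ.cont.measurable.comp (measurable_gradient _)).ennreal_ofReal) (fun k => ?_) ?_ ?_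
  · filter_upwards [hae] with x hx
    by_cases hxB : x ∈ closedBall (0 : ℂ) ((A + M) / (1 - r))
    · rw [indicator_of_mem hxB]; exact ENNReal.ofReal_le_ofReal (hC _)
    · rw [indicator_of_notMem hxB, h0, ENNReal.ofReal_zero]
      by_contra! hlt
      refine hxB ?_
      rw [mem_closedBall_zero_iff, le_div_iff₀ (by linarith)]
      have h1 := ((hU k).subAt_gradient (hx.1 k)).1 0
      rw [zero_sub, inner_neg_right] at h1
      have h2 := real_inner_le_norm (gradient (U k) x) x
      have h3 := hlow k x
      have h4 := hA k
      nlinarith [norm_nonneg x]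
  · rw [lintegral_indicator measurableSet_closedBall, setLIntegral_const]
    exact ENNReal.mul_ne_top ENNReal.ofReal_ne_top measure_closedBall_lt_top.ne
  · filter_upwards [hae] with x hx
    exact (ENNReal.continuous_ofReal.comp hψ.cont).continuousAt.tendsto.comp
      (tendsto_gradient hU hlim hx.1 hx.2)

lemma Push.volume_preimage {T : ℂ → ℂ} {ν : Measure ℂ} (hT : Measurable T) (hP : Push T ν) {O : Set ℂ}
    (hO : IsOpen O) (hO1 : O ⊆ ball 0 1) : volume (T ⁻¹' O) = ν O := by
  have hne : (Oᶜ).Nonempty := ⟨1, fun h => by simpa using hO1 h⟩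
  let ψ : ℕ → ℂ → ℝ := fun n y => min 1 ((n : ℝ) * max 0 (infDist y Oᶜ - 1 / (n + 1)))
  have hψ : ∀ n, IsTest (ψ n) := by
    intro n
    refine ⟨by have := continuous_infDist_pt (Oᶜ); fun_prop, fun y => by positivity,
      1 - 1 / (n + 1), by have : (0 : ℝ) < 1 / (n + 1) := by positivity
                          linarith, fun y hy => ?_⟩
    have : infDist y Oᶜ ≤ 1 / (n + 1) := by
      by_cases hy1 : ‖y‖ < 1
      · obtain ⟨z, hz, hzy⟩ : ∃ z ∈ sphere (0 : ℂ) 1, dist y z ≤ 1 - ‖y‖ := by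
          rcases eq_or_ne y 0 with rfl | h0
          · exact ⟨1, by simp, by simp⟩
          · have hn : ‖y‖ ≠ 0 := norm_ne_zero_iff.2 h0
            refine ⟨(‖y‖⁻¹ : ℝ) • y, by simp [hn], ?_⟩
            rw [dist_eq_norm, show y - (‖y‖⁻¹ : ℝ) • y = (1 - ‖y‖⁻¹) • y by rw [sub_smul, one_smul],
              norm_smul, Real.norm_eq_abs, abs_of_nonpos (by
                rw [sub_nonpos]; exact (one_le_inv₀ (by positivity)).2 hy1.le)]
            field_simp; linarith
        refine (infDist_le_dist_of_mem (y := z) fun hzO => ?_).trans (by linarith)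
        have := hO1 hzO
        rw [mem_ball_zero_iff] at this
        rw [mem_sphere_zero_iff_norm] at hz
        linarith
      · rw [infDist_zero_of_mem (show y ∈ Oᶜ from fun hyO => hy1 (by simpa using hO1 hyO))]
        positivity
    simp only [ψ, max_eq_left (sub_nonpos.2 this), mul_zero, min_eq_right zero_le_one]
  have hmono : ∀ y, Monotone fun n => ENNReal.ofReal (ψ n y) := by
    intro y n m hnm
    refine ENNReal.ofReal_le_ofReal (min_le_min le_rfl ?_)
    have : (n : ℝ) ≤ m := by exact_mod_cast hnm
    gcongr
  have hlim : ∀ y, Tendsto (fun n => ENNReal.ofReal (ψ n y)) atTop (𝓝 (O.indicator 1 y)) := by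
    intro y
    by_cases hy : y ∈ O
    · rw [indicator_of_mem hy, Pi.one_apply, ← ENNReal.ofReal_one]
      refine (ENNReal.continuous_ofReal.tendsto _).comp ?_
      have hd : 0 < infDist y Oᶜ := (hO.isClosed_compl.notMem_iff_infDist_pos hne).1 (by simpa using hy)
      refine tendsto_const_nhds.congr' ?_
      have e1 := (tendsto_one_div_add_atTop_nhds_zero_nat (𝕜 := ℝ)).eventually
        (gt_mem_nhds (show (0 : ℝ) < infDist y Oᶜ / 2 by positivity))
      have e2 := tendsto_natCast_atTop_atTop.eventually (eventually_ge_atTop (2 / infDist y Oᶜ))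
      filter_upwards [e1, e2] with n h1 h2
      rw [div_le_iff₀ hd] at h2
      refine (min_eq_left ?_).symm
      have h3 : infDist y Oᶜ / 2 ≤ max 0 (infDist y Oᶜ - 1 / (n + 1)) := le_max_of_le_right (by linarith)
      have h4 := mul_le_mul_of_nonneg_left h3 (Nat.cast_nonneg (α := ℝ) n)
      linarith
    · rw [indicator_of_notMem hy]
      refine tendsto_const_nhds.congr fun n => ?_
      simp only [ψ]
      rw [infDist_zero_of_mem (show y ∈ Oᶜ from hy), max_eq_left (by simp; positivity)]
      simp
  have hmeas : ∀ n, Measurable fun y => ENNReal.ofReal (ψ n y) :=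
    fun n => (hψ n).cont.measurable.ennreal_ofReal
  have h1 := lintegral_tendsto_of_tendsto_of_monotone (μ := volume)
    (fun n => ((hmeas n).comp hT).aemeasurable) (Eventually.of_forall fun x => hmono (T x))
    (Eventually.of_forall fun x => hlim (T x))
  have h2 := lintegral_tendsto_of_tendsto_of_monotone (μ := ν)
    (fun n => (hmeas n).aemeasurable) (Eventually.of_forall hmono) (Eventually.of_forall hlim)
  have h3 := tendsto_nhds_unique (h1.congr fun n => hP (ψ n) (hψ n)) h2
  rw [lintegral_indicator_one hO.measurableSet] at h3
  rw [← h3, ← lintegral_indicator_one (hT hO.measurableSet)]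
  rfl

end

section

section discrete

variable {ι : Type*} [Fintype ι] {φ h : ℂ → ℝ} {p : ι → ℂ} {c c' : ι → ℝ} {x : ℂ} {M ρ A R : ℝ}

/-- The affine functions `⟪p i, ·⟫ - c i` together with `h`. -/
noncomputable def slot (h : ℂ → ℝ) (p : ι → ℂ) (c : ι → ℝ) (x : ℂ) : Option ι → ℝ
  | none => h x
  | some i => inner ℝ (p i) x - c i

/-- The maximum of `h` and of the affine functions `⟪p i, ·⟫ - c i`. -/
noncomputable def env (h : ℂ → ℝ) (p : ι → ℂ) (c : ι → ℝ) (x : ℂ) : ℝ :=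
  Finset.univ.sup' Finset.univ_nonempty (slot h p c x)

lemma slot_le_env (o : Option ι) : slot h p c x o ≤ env h p c x :=
  Finset.le_sup' _ (Finset.mem_univ o)

lemma le_env : h x ≤ env h p c x := slot_le_env (p := p) (c := c) none

lemma exists_env_eq (h : ℂ → ℝ) (p : ι → ℂ) (c : ι → ℝ) (x : ℂ) :
    ∃ o, env h p c x = slot h p c x o := by
  obtain ⟨o, -, ho⟩ := Finset.exists_mem_eq_sup' Finset.univ_nonempty (slot h p c x)
  exact ⟨o, ho⟩

lemma env_le_iff {r : ℝ} : env h p c x ≤ r ↔ h x ≤ r ∧ ∀ i, inner ℝ (p i) x - c i ≤ r := by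
  simp only [env, Finset.sup'_le_iff, Finset.mem_univ, true_imp_iff]
  exact ⟨fun H => ⟨H none, fun i => H (some i)⟩, fun H o => by cases o; exacts [H.1, H.2 _]⟩

omit [Fintype ι] in
lemma inner_le_mul_norm (hp : ∀ i, ‖p i‖ ≤ ρ) (i : ι) (x : ℂ) : inner ℝ (p i) x ≤ ρ * ‖x‖ :=
  (real_inner_le_norm _ _).trans (mul_le_mul_of_nonneg_right (hp i) (norm_nonneg _))

lemma env_le_max (hp : ∀ i, ‖p i‖ ≤ ρ) (hc : ∀ i, -A ≤ c i) :
    env h p c x ≤ max (h x) (ρ * ‖x‖ + A) := by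
  refine env_le_iff.2 ⟨le_max_left _ _, fun i => le_max_of_le_right ?_⟩
  have := inner_le_mul_norm hp i x
  have := hc i
  linarith

lemma env_eq_of_far (hl : ∀ x, ‖x‖ - M ≤ h x) (hp : ∀ i, ‖p i‖ ≤ ρ) (hc : ∀ i, -A ≤ c i)
    (hx : A + M ≤ (1 - ρ) * ‖x‖) : env h p c x = h x := by
  refine le_antisymm ((env_le_max hp hc).trans (max_le le_rfl ?_)) le_env
  have := hl x
  nlinarith

lemma env_min (hl : ∀ x, ‖x‖ - M ≤ h x) (hp : ∀ i, ‖p i‖ ≤ 1) :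
    env h p (fun i => min (c i) M) x = env h p c x := by
  refine le_antisymm (env_le_iff.2 ⟨le_env, fun i => ?_⟩) (env_le_iff.2 ⟨le_env, fun i => ?_⟩)
  · rcases min_choice (c i) M with h1 | h1
    · rw [h1]; exact slot_le_env (some i)
    · rw [h1]
      have := inner_le_mul_norm hp i x
      refine le_trans ?_ ((hl x).trans le_env)
      linarith
  · have h1 := slot_le_env (h := h) (p := p) (c := fun i => min (c i) M) (x := x) (some i)
    have := min_le_left (c i) M
    simp only [slot] at h1
    linarith

lemma env_lipschitz (h : ℂ → ℝ) (p : ι → ℂ) (x : ℂ) : LipschitzWith 1 fun c => env h p c x := by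
  refine LipschitzWith.of_le_add fun c c' => env_le_iff.2
    ⟨le_env.trans (le_add_of_nonneg_right dist_nonneg), fun i => ?_⟩
  have h1 := slot_le_env (h := h) (p := p) (c := c') (x := x) (some i)
  have h2 := abs_le.1 ((Real.dist_eq (c i) (c' i)).symm.le.trans (dist_le_pi_dist c c' i))
  simp only [slot] at h1
  linarith

lemma env_sub1 (H : IsSupport φ h) (hp : ∀ i, ‖p i‖ ≤ 1) : Sub1 (env h p c) := by
  intro x
  obtain ⟨o, ho⟩ := exists_env_eq h p c x
  cases o with
  | none =>
    obtain ⟨y, hy, h1⟩ := H.attained x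
    refine ⟨y, sphere_subset_closedBall hy, fun x' => ?_⟩
    rw [ho, slot, h1, inner_sub_right]
    have := H.le x' y hy
    have := le_env (h := h) (p := p) (c := c) (x := x')
    linarith
  | some i =>
    refine ⟨p i, by simpa using hp i, fun x' => ?_⟩
    rw [ho, slot, inner_sub_right]
    have := slot_le_env (h := h) (p := p) (c := c) (x := x') (some i)
    simp only [slot] at this
    linarith

/-- At a point of differentiability, the gradient of the envelope determines the active slot. -/
lemma env_active (H : IsSupport φ h) (hd : DifferentiableAt ℝ (env h p c) x) {o : Option ι}
    (ho : env h p c x = slot h p c x o) :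
    (o = none ∧ gradient (env h p c) x ∈ sphere (0 : ℂ) 1) ∨
      ∃ i, o = some i ∧ gradient (env h p c) x = p i := by
  cases o with
  | none =>
    obtain ⟨y, hy, h1⟩ := H.attained x
    refine Or.inl ⟨rfl, ?_⟩
    rw [← SubAt.eq_gradient (y := y) (fun x' => ?_) hd]
    · exact hy
    rw [ho, slot, h1, inner_sub_right]
    have := H.le x' y hy
    have := le_env (h := h) (p := p) (c := c) (x := x')
    linarith
  | some i =>
    refine Or.inr ⟨i, rfl, (SubAt.eq_gradient (y := p i) (fun x' => ?_) hd).symm⟩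
    rw [ho, slot, inner_sub_right]
    have := slot_le_env (h := h) (p := p) (c := c) (x := x') (some i)
    simp only [slot] at this
    linarith

/-- The functional minimised in the discrete problem. -/
noncomputable def cost (h : ℂ → ℝ) (p : ι → ℂ) (m : ι → ℝ) (R : ℝ) (c : ι → ℝ) : ℝ :=
  (∫ x in closedBall (0 : ℂ) R, (env h p c x - h x)) + ∑ i, m i * c i

lemma integrableOn_env_sub (H : IsSupport φ h) (hp : ∀ i, ‖p i‖ ≤ 1) :
    IntegrableOn (fun x => env h p c x - h x) (closedBall 0 R) :=
  ((env_sub1 H hp).lipschitz.continuous.sub H.sub1.lipschitz.continuous).continuousOn.integrableOn_compact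
    (isCompact_closedBall 0 R)

lemma continuous_cost (H : IsSupport φ h) (hp : ∀ i, ‖p i‖ ≤ 1) (m : ι → ℝ) :
    Continuous (cost h p m R) := by
  refine Continuous.add ?_ (by fun_prop)
  refine LipschitzWith.continuous (K := (volume.real (closedBall (0 : ℂ) R)).toNNReal)
    (LipschitzWith.of_dist_le_mul fun c c' => ?_)
  rw [dist_eq_norm, ← integral_sub (integrableOn_env_sub H hp) (integrableOn_env_sub H hp),
    Real.coe_toNNReal _ measureReal_nonneg, mul_comm]
  refine norm_setIntegral_le_of_norm_le_const measure_closedBall_lt_top fun x _ => ?_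
  have := (env_lipschitz h p x).dist_le_mul c c'
  rw [NNReal.coe_one, one_mul, Real.dist_eq] at this
  rw [Real.norm_eq_abs]
  simpa using this

lemma exists_minimizer (H : IsSupport φ h) (hM : ∀ y ∈ sphere (0 : ℂ) 1, |φ y| ≤ M)
    (hp : ∀ i, ‖p i‖ ≤ 1) {m : ι → ℝ} (hm : ∀ i, 0 ≤ m i) {b : ℝ}
    (hb : b = 1 + 11 * (2 * M + 1) * ∑ i, m i) (hR : b / 4 ≤ R) :
    ∃ c : ι → ℝ, (∀ i, -(M + b) < c i) ∧
      ∀ d : ι → ℝ, ∀ᶠ t in 𝓝 (0 : ℝ), cost h p m R c ≤ cost h p m R (c + t • d) := by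
  have hM0 : 0 ≤ M := (abs_nonneg _).trans (hM 1 (by simp))
  set F := ∑ i, m i with hF
  have hF0 : 0 ≤ F := Finset.sum_nonneg fun i _ => hm i
  have hb1 : 1 ≤ b := by rw [hb]; nlinarith
  have hl := H.lower hM
  obtain ⟨c, hc, hmin⟩ := (isCompact_Icc (a := fun _ : ι => -(M + b)) (b := fun _ => M)).exists_isMinOn
    ⟨fun _ => M, fun _ => by simp only; linarith, le_rfl⟩ (continuous_cost (R := R) H hp m).continuousOn
  have hcM : cost h p m R c ≤ M * F := by
    refine (hmin (show (fun _ => M) ∈ Icc (fun _ : ι => -(M + b)) (fun _ => M) from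
      ⟨fun _ => by simp only; linarith, le_rfl⟩)).trans_eq ?_
    have : ∀ x, env h p (fun _ => M) x = h x := fun x =>
      le_antisymm (env_le_iff.2 ⟨le_rfl, fun i => by
        have := inner_le_mul_norm hp i x
        have := hl x
        linarith⟩) le_env
    simp only [cost, this, sub_self, integral_zero, zero_add, ← Finset.sum_mul]
    rw [mul_comm]
  have hlow : ∀ i, -(M + b) < c i := by
    intro i
    refine lt_of_le_of_ne (hc.1 i) fun hi => ?_
    have h1 : -(M + b) * F ≤ ∑ i, m i * c i := by
      rw [hF, Finset.mul_sum]
      refine Finset.sum_le_sum fun j _ => ?_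
      rw [mul_comm]
      exact mul_le_mul_of_nonneg_left (hc.1 j) (hm j)
    have h2 : b / 2 * (π * (b / 4) ^ 2) ≤ ∫ x in closedBall (0 : ℂ) R, (env h p c x - h x) := by
      calc b / 2 * (π * (b / 4) ^ 2) = ∫ _x in closedBall (0 : ℂ) (b / 4), b / 2 := by
            rw [setIntegral_const, smul_eq_mul]
            simp [Measure.real, Complex.volume_closedBall, show 0 ≤ b / 4 by linarith]
            ring
        _ ≤ ∫ x in closedBall (0 : ℂ) (b / 4), (env h p c x - h x) := by
            refine setIntegral_mono_on (integrableOn_const measure_closedBall_lt_top.ne)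
              (integrableOn_env_sub H hp)
              measurableSet_closedBall fun x hx => ?_
            rw [mem_closedBall_zero_iff] at hx
            have h3 := slot_le_env (h := h) (p := p) (c := c) (x := x) (some i)
            have h4 := H.upper hM x
            have h5 := inner_le_mul_norm hp i (-x)
            rw [inner_neg_right, norm_neg] at h5
            simp only [slot, ← hi] at h3
            linarith
        _ ≤ _ := setIntegral_mono_set (integrableOn_env_sub H hp)
            (ae_of_all _ fun x => sub_nonneg.2 le_env) (closedBall_subset_closedBall hR).eventuallyLE
    have h3 : b / 2 * (π * (b / 4) ^ 2) ≤ (2 * M + b) * F := by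
      simp only [cost] at hcM
      nlinarith
    have h4 : b * b * b * 3 / 32 ≤ b / 2 * (π * (b / 4) ^ 2) := by
      nlinarith [pi_gt_three, show 0 ≤ b * b * b by positivity]
    have h5 : (2 * M + b) * F ≤ (2 * M + 1) * F * b := by nlinarith [mul_nonneg hM0 hF0]
    have h6 : (2 * M + 1) * F = (b - 1) / 11 := by rw [hb]; ring
    rw [h6] at h5
    nlinarith [mul_nonneg (show 0 ≤ b by linarith) (show 0 ≤ b by linarith),
      mul_nonneg (mul_nonneg (show 0 ≤ b by linarith) (show 0 ≤ b by linarith)) (sub_nonneg.2 hb1)]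
  refine ⟨c, hlow, fun d => ?_⟩
  have hev : ∀ᶠ t in 𝓝 (0 : ℝ), ∀ i, -(M + b) < (c + t • d) i := by
    refine eventually_all.2 fun i => ?_
    have : ContinuousAt (fun t : ℝ => (c + t • d) i) 0 := by
      simp only [Pi.add_apply, Pi.smul_apply]; fun_prop
    exact this.eventually (lt_mem_nhds (by simpa using hlow i))
  filter_upwards [hev] with t ht
  have h1 := hmin (show (fun i => min ((c + t • d) i) M) ∈ Icc (fun _ : ι => -(M + b)) (fun _ => M) from
    ⟨fun i => le_min (ht i).le (by linarith), fun i => min_le_right _ _⟩)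
  refine h1.trans ?_
  simp only [cost, env_min hl hp]
  gcongr with i
  · exact hm i
  · exact min_le_left _ _

lemma sum_eq_integral_of_min (H : IsSupport φ h) (hp : ∀ i, ‖p i‖ ≤ 1) (hinj : Function.Injective p)
    {m : ι → ℝ} (hmin : ∀ d : ι → ℝ, ∀ᶠ t in 𝓝 (0 : ℝ), cost h p m R c ≤ cost h p m R (c + t • d))
    (hp1 : ∀ i, p i ∉ sphere (0 : ℂ) 1)
    {ψ : ℂ → ℝ} (hψ : IsTest ψ) :
    IntegrableOn (fun x => ψ (gradient (env h p c) x)) (closedBall 0 R) ∧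
    ∫ x in closedBall (0 : ℂ) R, ψ (gradient (env h p c) x) = ∑ i, m i * ψ (p i) := by
  set d : ι → ℝ := fun i => ψ (p i) with hd
  have hψ1 : ∀ y ∈ sphere (0 : ℂ) 1, ψ y = 0 := by
    obtain ⟨r, hr, h0⟩ := hψ.zero
    intro y hy
    exact h0 y (by rw [mem_sphere_zero_iff_norm.1 hy]; exact hr.le)
  have hder : ∀ᵐ x, HasDerivAt (fun t : ℝ => env h p (c + t • d) x - h x)
      (-ψ (gradient (env h p c) x)) 0 := by
    filter_upwards [(env_sub1 (c := c) H hp).ae_differentiableAt] with x hx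
    obtain ⟨o, ho⟩ := exists_env_eq h p c x
    have huniq : ∀ o', env h p c x = slot h p c x o' → o' = o := by
      intro o' ho'
      rcases env_active H hx ho with ⟨h1, h2⟩ | ⟨i, h1, h2⟩ <;>
        rcases env_active H hx ho' with ⟨h3, h4⟩ | ⟨j, h3, h4⟩
      · rw [h1, h3]
      · exact absurd (h4 ▸ h2) (hp1 j)
      · exact absurd (h2 ▸ h4) (hp1 i)
      · rw [h1, h3, hinj (h4.symm.trans h2)]
    have hslot : ∀ o', Continuous fun t : ℝ => slot h p (c + t • d) x o' := by
      intro o'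
      cases o' <;> simp only [slot, Pi.add_apply, Pi.smul_apply] <;> fun_prop
    have hev : ∀ᶠ t in 𝓝 (0 : ℝ), env h p (c + t • d) x = slot h p (c + t • d) x o := by
      have : ∀ᶠ t in 𝓝 (0 : ℝ), ∀ o', o' ≠ o → slot h p (c + t • d) x o' < slot h p (c + t • d) x o := by
        refine eventually_all.2 fun o' => eventually_imp_distrib_left.2 fun hne => ?_
        refine (hslot o').continuousAt.eventually_lt (hslot o).continuousAt ?_
        simp only [zero_smul, add_zero]
        exact ho ▸ lt_of_le_of_ne (slot_le_env o') fun h1 => hne (huniq o' h1.symm)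
      filter_upwards [this] with t ht
      obtain ⟨o', ho'⟩ := exists_env_eq h p (c + t • d) x
      by_cases hne : o' = o
      · rw [ho', hne]
      · exact absurd (slot_le_env o) (not_le.2 (ho' ▸ ht o' hne))
    have hslotd : HasDerivAt (fun t : ℝ => slot h p (c + t • d) x o - h x)
        (-ψ (gradient (env h p c) x)) 0 := by
      rcases env_active H hx ho with ⟨h1, h2⟩ | ⟨i, h1, h2⟩
      · subst h1
        rw [hψ1 _ h2, neg_zero]
        exact hasDerivAt_const (0 : ℝ) (h x - h x)
      · subst h1
        rw [h2]
        have : HasDerivAt (fun t : ℝ => inner ℝ (p i) x - (c i + t * d i) - h x) (-(1 * d i)) 0 :=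
          ((((hasDerivAt_id (0 : ℝ)).mul_const (d i)).const_add (c i)).const_sub
            (inner ℝ (p i) x)).sub_const (h x)
        rw [one_mul] at this
        exact this
    refine hslotd.congr_of_eventuallyEq ?_
    filter_upwards [hev] with t ht
    rw [ht]
  obtain ⟨hint, hD⟩ := hasDerivAt_integral_of_dominated_loc_of_lip
    (μ := volume.restrict (closedBall (0 : ℂ) R)) (F := fun t x => env h p (c + t • d) x - h x)
    (F' := fun x => -ψ (gradient (env h p c) x)) (x₀ := (0 : ℝ)) (s := univ) (bound := fun _ => ‖d‖)
    univ_mem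
    (Eventually.of_forall fun t => (integrableOn_env_sub H hp).aestronglyMeasurable)
    (integrableOn_env_sub H hp)
    ((hψ.cont.measurable.comp (measurable_gradient _)).neg.aestronglyMeasurable)
    (ae_of_all _ fun x => by
      refine LipschitzOnWith.of_dist_le_mul fun t _ t' _ => ?_
      have h1 := (env_lipschitz h p x).dist_le_mul (c + t • d) (c + t' • d)
      rw [NNReal.coe_one, one_mul] at h1
      rw [dist_sub_right]
      refine h1.trans ?_
      rw [dist_add_left, dist_eq_norm, ← sub_smul, norm_smul, mul_comm, dist_eq_norm,
        Real.coe_nnabs, abs_of_nonneg (norm_nonneg d)])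
    (integrableOn_const measure_closedBall_lt_top.ne) (ae_restrict_of_ae hder)
  refine ⟨by simpa [IntegrableOn] using hint.neg, ?_⟩
  have hD2 : HasDerivAt (fun t : ℝ => ∑ i, m i * (c + t • d) i) (∑ i, m i * d i) 0 := by
    refine HasDerivAt.fun_sum fun i _ => ?_
    have : HasDerivAt (fun t : ℝ => m i * (c i + t * d i)) (m i * (1 * d i)) 0 :=
      (((hasDerivAt_id (0 : ℝ)).mul_const (d i)).const_add (c i)).const_mul _
    rw [one_mul] at this
    exact this
  have hloc : IsLocalMin (fun t : ℝ => cost h p m R (c + t • d)) 0 := by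
    filter_upwards [hmin d] with t ht
    simpa using ht
  have h0 := hloc.hasDerivAt_eq_zero (hD.add hD2)
  rw [integral_neg] at h0
  linarith

/-- The discrete problem: prescribed masses `m i` for the gradients `p i`. -/
lemma exists_discrete (H : IsSupport φ h) (hM : ∀ y ∈ sphere (0 : ℂ) 1, |φ y| ≤ M)
    (hinj : Function.Injective p) (hρ : ρ < 1) (hp : ∀ i, ‖p i‖ ≤ ρ) {m : ι → ℝ} (hm : ∀ i, 0 ≤ m i)
    (hA : A = M + (1 + 11 * (2 * M + 1) * ∑ i, m i)) :
    ∃ u, Sub1 u ∧ (∀ x, h x ≤ u x) ∧ (∀ x, u x ≤ max (h x) (ρ * ‖x‖ + A)) ∧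
      ∀ ψ, IsTest ψ → ∫⁻ x, ENNReal.ofReal (ψ (gradient u x)) = ENNReal.ofReal (∑ i, m i * ψ (p i)) := by
  have hp1 : ∀ i, ‖p i‖ ≤ 1 := fun i => (hp i).trans hρ.le
  set b := 1 + 11 * (2 * M + 1) * ∑ i, m i with hb
  set R := max (b / 4) ((A + M) / (1 - ρ))
  obtain ⟨c, hc, hmin⟩ := exists_minimizer (R := R) H hM hp1 hm hb (le_max_left _ _)
  have hcA : ∀ i, -A ≤ c i := fun i => by rw [hA]; exact (hc i).le
  refine ⟨env h p c, env_sub1 H hp1, fun x => le_env, fun x => env_le_max hp hcA, fun ψ hψ => ?_⟩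
  obtain ⟨h1, h2⟩ := sum_eq_integral_of_min H hp1 hinj hmin
    (fun i hi => by have := hp i; rw [mem_sphere_zero_iff_norm.1 hi] at this; linarith) hψ
  rw [← h2, ofReal_integral_eq_lintegral_ofReal h1 (ae_of_all _ fun x => hψ.nonneg _)]
  rw [← lintegral_indicator measurableSet_closedBall]
  refine lintegral_congr_ae ?_
  filter_upwards [(env_sub1 (c := c) H hp1).ae_differentiableAt] with x hx
  by_cases hxR : x ∈ closedBall (0 : ℂ) R
  · rw [indicator_of_mem hxR]
  rw [indicator_of_notMem hxR]
  rw [mem_closedBall_zero_iff, not_le] at hxR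
  have hfar := (le_max_right _ _).trans hxR.le
  rw [div_le_iff₀ (by linarith), mul_comm] at hfar
  obtain ⟨r, hr, h0⟩ := hψ.zero
  rcases env_active (o := none) H hx (env_eq_of_far (H.lower hM) hp hcA hfar) with ⟨-, h3⟩ | ⟨i, h3, -⟩
  · rw [h0 _ (by rw [mem_sphere_zero_iff_norm.1 h3]; exact hr.le), ENNReal.ofReal_zero]
  · cases h3

end discrete

end

section

variable {u φ h : ℂ → ℝ} {M ρ A : ℝ}

lemma exists_push_of_finite (H : IsSupport φ h) (hM : ∀ y ∈ sphere (0 : ℂ) 1, |φ y| ≤ M)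
    (hρ0 : 0 ≤ ρ) (hρ : ρ < 1) (ν : Measure ℂ) [IsFiniteMeasure ν] (hν : ν (closedBall 0 ρ)ᶜ = 0) :
    ∃ u A, Sub1 u ∧ (∀ x, h x ≤ u x) ∧ (∀ x, u x ≤ max (h x) (ρ * ‖x‖ + A)) ∧
      Push (gradient u) ν := by
  let s : ℕ → SimpleFunc ℂ ℂ :=
    SimpleFunc.approxOn id measurable_id (closedBall 0 ρ) 0 (by simpa using hρ0)
  have hs : ∀ N y, s N y ∈ closedBall (0 : ℂ) ρ := fun N y => SimpleFunc.approxOn_mem _ _ N y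
  set A := M + (1 + 11 * (2 * M + 1) * ν.real univ) with hA
  have key : ∀ N, ∃ u, Sub1 u ∧ (∀ x, h x ≤ u x) ∧ (∀ x, u x ≤ max (h x) (ρ * ‖x‖ + A)) ∧
      Push (gradient u) (ν.map (s N)) := by
    intro N
    obtain ⟨u, h1, h2, h3, h4⟩ := exists_discrete (p := fun i : (s N).range => (i : ℂ)) (A := A)
      (m := fun i => ν.real (s N ⁻¹' {(i : ℂ)})) H hM Subtype.val_injective hρ
      (fun i => by
        obtain ⟨y, hy⟩ := SimpleFunc.mem_range.1 i.2
        rw [← hy]; simpa using hs N y) (fun i => measureReal_nonneg) (by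
        rw [hA, Finset.sum_coe_sort (s N).range fun i => ν.real (s N ⁻¹' {i})]
        simp only [Measure.real]
        rw [← ENNReal.toReal_sum fun i _ => measure_ne_top _ _,
          SimpleFunc.sum_range_measure_preimage_singleton])
    refine ⟨u, h1, h2, h3, fun ψ hψ => ?_⟩
    rw [h4 ψ hψ, lintegral_map hψ.cont.measurable.ennreal_ofReal (s N).measurable,
      Finset.sum_coe_sort (s N).range fun i => ν.real (s N ⁻¹' {i}) * ψ i,
      ENNReal.ofReal_sum_of_nonneg fun i _ => mul_nonneg measureReal_nonneg (hψ.nonneg _)]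
    have h5 := SimpleFunc.lintegral_eq_lintegral ((s N).map fun y => ENNReal.ofReal (ψ y)) ν
    rw [SimpleFunc.map_lintegral] at h5
    refine Eq.trans (Finset.sum_congr rfl fun i _ => ?_) h5.symm
    rw [ENNReal.ofReal_mul measureReal_nonneg, ofReal_measureReal, mul_comm]
  choose U hU1 hUh hUA hUP using key
  have hl := H.lower hM
  have h00 : h 0 ≤ M := by simpa using H.upper hM 0
  have hM0 : 0 ≤ M := (abs_nonneg _).trans (hM 1 (by simp))
  have hMA : M ≤ A := by
    have : 0 ≤ ν.real univ := measureReal_nonneg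
    rw [hA]; nlinarith [mul_nonneg hM0 this]
  have hU0 : ∀ k, U k 0 ≤ A := fun k => (hUA k 0).trans (max_le (h00.trans hMA) (by simp))
  obtain ⟨θ, hθ, u, hlim⟩ := exists_subseq_tendsto (C := A) hU1 fun k => abs_le.2
    ⟨by have := (hl 0).trans (hUh k 0); rw [norm_zero] at this; linarith, hU0 k⟩
  refine ⟨u, A, Sub1.of_tendsto (fun k => hU1 (θ k)) hlim,
    fun x => ge_of_tendsto' (hlim x) fun k => hUh _ x,
    fun x => le_of_tendsto' (hlim x) fun k => hUA _ x,
    Push.of_tendsto (fun k => hU1 (θ k)) hlim (fun k x => (hl x).trans (hUh _ x)) (fun k => hU0 _)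
      (fun k => hUP (θ k)) fun ψ hψ => ?_⟩
  refine Tendsto.comp (g := fun N => ∫⁻ y, ENNReal.ofReal (ψ y) ∂ν.map (s N)) ?_ hθ.tendsto_atTop
  simp_rw [fun N => lintegral_map (μ := ν) hψ.cont.measurable.ennreal_ofReal (s N).measurable]
  obtain ⟨C, hC⟩ := hψ.exists_bound
  refine tendsto_lintegral_of_dominated_convergence (fun _ => ENNReal.ofReal C)
    (fun N => hψ.cont.measurable.ennreal_ofReal.comp (s N).measurable)
    (fun N => ae_of_all _ fun y => ENNReal.ofReal_le_ofReal (hC _)) ?_ ?_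
  · rw [lintegral_const]
    exact ENNReal.mul_ne_top ENNReal.ofReal_ne_top (measure_ne_top _ _)
  · have : ∀ᵐ y ∂ν, y ∈ closedBall (0 : ℂ) ρ := hν
    filter_upwards [this] with y hy
    exact ((ENNReal.continuous_ofReal.comp hψ.cont).tendsto y).comp
      (SimpleFunc.tendsto_approxOn measurable_id _ (subset_closure hy))

/-- If `p` is a subgradient of `g` at a point where the test function `W` lies below `g`, then `p` is
attained by the gradient of `W` on that set. -/
lemma exists_grad_eq {E : Type*} [NormedAddCommGroup E] [InnerProductSpace ℝ E] {g W : E → ℝ} {G : E → E}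
    {K U : Set E} (hK : IsCompact K) (hW : ContinuousOn W K) (hUK : U ⊆ interior K)
    (hout : ∀ z ∈ K, z ∉ U → g z ≤ W z) (hin : ∀ z ∈ U, W z < g z)
    (hG : ∀ z ∈ U, HasFDerivAt W (innerSL ℝ (G z)) z) {y p : E} (hy : y ∈ U)
    (hp : ∀ z ∈ K, g y + inner ℝ p (z - y) ≤ g z) : ∃ z ∈ U, G z = p := by
  obtain ⟨z, hz, hmin⟩ := hK.exists_isMinOn ⟨y, interior_subset (hUK hy)⟩
    (hW.sub (continuous_const.inner continuous_id : Continuous fun z => inner ℝ p z).continuousOn)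
  have hzU : z ∈ U := by
    by_contra hzU
    have h1 := hmin (interior_subset (hUK hy))
    have h2 := hp z hz
    have h3 := hout z hz hzU
    have h4 := hin y hy
    rw [inner_sub_right] at h2
    simp only [mem_ofPred_eq, Pi.sub_apply] at h1
    linarith
  refine ⟨z, hzU, ?_⟩
  have h1 := (hmin.isLocalMin (mem_interior_iff_mem_nhds.1 (hUK hzU))).hasFDerivAt_eq_zero
    ((hG z hzU).sub (innerSL ℝ p).hasFDerivAt)
  exact (innerSL_inj (𝕜 := ℝ)).1 (sub_eq_zero.1 h1)

section barrier

variable {a : ℝ} {z y : ℂ}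

/-- The radius `√(a² + |z|²)`. -/
noncomputable def rad (a : ℝ) (z : ℂ) : ℝ := √(a ^ 2 + ‖z‖ ^ 2)

lemma rad_sq : rad a z ^ 2 = a ^ 2 + ‖z‖ ^ 2 := Real.sq_sqrt (by positivity)

lemma rad_pos (ha : 0 < a) : 0 < rad a z := Real.sqrt_pos.2 (by positivity)

lemma norm_le_rad : ‖z‖ ≤ rad a z := Real.le_sqrt_of_sq_le (by nlinarith [sq_nonneg a])

lemma hasFDerivAt_rad (ha : 0 < a) (z : ℂ) :
    HasFDerivAt (rad a) (innerSL ℝ ((rad a z)⁻¹ • z)) z := by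
  have h1 : HasFDerivAt (fun z : ℂ => a ^ 2 + ‖z‖ ^ 2) (2 • innerSL ℝ z) z :=
    (hasStrictFDerivAt_norm_sq z).hasFDerivAt.const_add _
  refine (h1.sqrt (by positivity)).congr_fderiv ?_
  have := (rad_pos (z := z) ha).ne'
  ext; simp [rad]; ring

lemma hasFDerivAt_grad_rad (ha : 0 < a) (z : ℂ) :
    ∃ L : ℂ →L[ℝ] ℂ, HasFDerivAt (fun z => (rad a z)⁻¹ • z) L z ∧ L.det = a ^ 2 / rad a z ^ 4 := by
  have hR := (rad_pos (z := z) ha).ne'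
  have h1 := ((hasDerivAt_inv hR).comp_hasFDerivAt z (hasFDerivAt_rad ha z)).smul (hasFDerivAt_id z)
  refine ⟨_, h1, ?_⟩
  rw [det_clm]
  have h2 := rad_sq (a := a) (z := z)
  rw [Complex.sq_norm, Complex.normSq_apply] at h2
  simp [Complex.inner]
  field_simp
  simp only [← Complex.ofReal_pow, Complex.ofReal_re, Complex.ofReal_im]
  linear_combination rad a z ^ 6 * h2

lemma one_sub_norm_grad_rad (ha : 0 < a) (z : ℂ) :
    1 - ‖(rad a z)⁻¹ • z‖ ^ 2 = (a / rad a z) ^ 2 := by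
  have hR := rad_pos (z := z) ha
  rw [norm_smul, Real.norm_eq_abs, abs_of_pos (by positivity), mul_pow, div_pow]
  field_simp
  rw [rad_sq]; ring

/-- The inverse of `z ↦ z / rad a z`. -/
noncomputable def radInv (a : ℝ) (y : ℂ) : ℂ := (a / √(1 - ‖y‖ ^ 2)) • y

lemma radInv_grad_rad (ha : 0 < a) (z : ℂ) : radInv a ((rad a z)⁻¹ • z) = z := by
  have hR := rad_pos (z := z) ha
  rw [radInv, one_sub_norm_grad_rad ha, Real.sqrt_sq (by positivity), smul_smul]
  field_simp
  exact one_smul _ _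

lemma one_sub_sq_pos (hy : y ∈ ball (0 : ℂ) 1) : 0 < 1 - ‖y‖ ^ 2 := by
  have := mem_ball_zero_iff.1 hy
  nlinarith [norm_nonneg y]

lemma rad_radInv (ha : 0 < a) (hy : y ∈ ball (0 : ℂ) 1) : rad a (radInv a y) = a / √(1 - ‖y‖ ^ 2) := by
  have h1 := one_sub_sq_pos hy
  have h2 := Real.sqrt_pos.2 h1
  rw [rad, Real.sqrt_eq_iff_eq_sq (by positivity) (by positivity), radInv, norm_smul, Real.norm_eq_abs,
    abs_of_pos (by positivity), mul_pow, div_pow, Real.sq_sqrt h1.le]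
  field_simp
  ring

lemma grad_rad_radInv (ha : 0 < a) (hy : y ∈ ball (0 : ℂ) 1) :
    (rad a (radInv a y))⁻¹ • radInv a y = y := by
  have h2 := Real.sqrt_pos.2 (one_sub_sq_pos hy)
  rw [rad_radInv ha hy, radInv, smul_smul]
  field_simp
  exact one_smul _ _

variable {q : ℂ} {β : ℝ}

lemma grad_rad_mem (ha : 0 < a) (z : ℂ) : (rad a z)⁻¹ • z ∈ ball (0 : ℂ) 1 := by
  have h1 := one_sub_norm_grad_rad ha z
  have h2 : 0 < (a / rad a z) ^ 2 := by have := rad_pos (z := z) ha; positivity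
  rw [mem_ball_zero_iff]
  nlinarith [norm_nonneg ((rad a z)⁻¹ • z)]

lemma image_grad_rad (ha : 0 < a) (X : Set ℂ) :
    (fun z => (rad a (z - q))⁻¹ • (z - q)) '' X = ball 0 1 ∩ (fun y => radInv a y + q) ⁻¹' X := by
  ext y
  constructor
  · rintro ⟨z, hz, rfl⟩
    refine ⟨grad_rad_mem ha _, ?_⟩
    simpa only [mem_preimage, radInv_grad_rad ha, sub_add_cancel] using hz
  · rintro ⟨hy, hX⟩
    refine ⟨_, hX, ?_⟩
    simp only [add_sub_cancel_right]
    exact grad_rad_radInv ha hy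

lemma isOpen_image_grad_rad (ha : 0 < a) {X : Set ℂ} (hX : IsOpen X) :
    IsOpen ((fun z => (rad a (z - q))⁻¹ • (z - q)) '' X) := by
  rw [image_grad_rad ha]
  refine ContinuousOn.isOpen_inter_preimage ?_ isOpen_ball hX
  have hc : Continuous fun y : ℂ => √(1 - ‖y‖ ^ 2) := by fun_prop
  refine ContinuousOn.add (ContinuousOn.smul (ContinuousOn.div continuousOn_const hc.continuousOn
    fun y hy => ?_) continuousOn_id) continuousOn_const
  exact (Real.sqrt_pos.2 (one_sub_sq_pos hy)).ne'

lemma lintegral_image_grad_rad (ha : 0 < a) {X : Set ℂ} (hX : IsOpen X) :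
    ∫⁻ y in (fun z => (rad a (z - q))⁻¹ • (z - q)) '' X, ENNReal.ofReal (a ^ 2 / (1 - ‖y‖ ^ 2) ^ 2)
      = volume X := by
  choose L hL hdet using fun z => hasFDerivAt_grad_rad (a := a) ha z
  have hd : ∀ z ∈ X, HasFDerivWithinAt (fun z => (rad a (z - q))⁻¹ • (z - q)) (L (z - q)) X z := by
    intro z _
    have := HasFDerivAt.comp z (hL (z - q)) ((hasFDerivAt_id z).sub_const q)
    rw [ContinuousLinearMap.comp_id] at this
    exact this.hasFDerivWithinAt
  rw [lintegral_image_eq_lintegral_abs_det_fderiv_mul volume hX.measurableSet hd fun z _ z' _ h => by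
    have := congrArg (radInv a) h
    simpa only [radInv_grad_rad ha, sub_left_inj] using this]
  rw [← setLIntegral_one]
  refine lintegral_congr fun z => ?_
  have hR := rad_pos (z := z - q) ha
  rw [one_sub_norm_grad_rad ha, hdet, abs_of_pos (by positivity), ← ENNReal.ofReal_mul (by positivity),
    ← ENNReal.ofReal_one]
  congr 1
  field_simp

/-- Comparison with the dual barrier `√(a² + |x - q|²) + β`. -/
lemma le_dual_barrier (ha : 0 < a) {ν : Measure ℂ} (hu : Sub1 u) (hP : Push (gradient u) ν)
    (hν : ∀ O ⊆ ball (0 : ℂ) 1, IsOpen O →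
      2 * ν O ≤ ∫⁻ y in O, ENNReal.ofReal (a ^ 2 / (1 - ‖y‖ ^ 2) ^ 2))
    {R : ℝ} (hR : ∀ x, R ≤ ‖x‖ → u x ≤ rad a (x - q) + β) (x : ℂ) : u x ≤ rad a (x - q) + β := by
  set X := {x | rad a (x - q) + β < u x} with hX
  have hcE : Continuous fun x => rad a (x - q) + β := by unfold rad; fun_prop
  have hXo : IsOpen X := isOpen_lt hcE hu.lipschitz.continuous
  have hXR : X ⊆ ball 0 R := fun x hx => by
    by_contra h
    rw [mem_ball_zero_iff, not_lt] at h
    exact absurd (hR x h) (not_le.2 hx)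
  have hXfin : volume X ≠ ⊤ := ((measure_mono hXR).trans_lt measure_ball_lt_top).ne
  set G : ℂ → ℂ := fun z => (rad a (z - q))⁻¹ • (z - q)
  have hsub : ∀ᵐ x, x ∈ X → x ∈ gradient u ⁻¹' (G '' X) := by
    filter_upwards [hu.ae_differentiableAt] with x hx hxX
    obtain ⟨z, hz, h⟩ := exists_grad_eq (G := G) (p := gradient u x) (isCompact_closedBall (0 : ℂ) R)
      hcE.continuousOn (interior_maximal (hXR.trans ball_subset_closedBall) hXo |> fun h => h)
      (fun z _ hz => not_lt.1 hz) (fun z hz => hz) (fun z _ => by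
        have := HasFDerivAt.comp z (hasFDerivAt_rad ha (z - q)) ((hasFDerivAt_id z).sub_const q)
        rw [ContinuousLinearMap.comp_id] at this
        exact this.add_const β) hxX
      fun z _ => (hu.subAt_gradient hx).1 z
    exact ⟨z, hz, h⟩
  have hGX : G '' X ⊆ ball 0 1 := by rintro _ ⟨z, -, rfl⟩; exact grad_rad_mem ha _
  have h1 := hν _ hGX (isOpen_image_grad_rad ha hXo)
  rw [lintegral_image_grad_rad ha hXo,
    ← hP.volume_preimage (measurable_gradient u) (isOpen_image_grad_rad ha hXo) hGX] at h1
  have h2 : 2 * volume X ≤ volume X := (mul_le_mul_right (measure_mono_ae hsub) 2).trans h1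
  have h3 : volume X = 0 := by
    by_contra h0
    rw [two_mul] at h2
    exact absurd h2 (not_le.2 (ENNReal.lt_add_right hXfin h0))
  by_contra hx
  exact (hXo.measure_pos volume ⟨x, not_le.1 hx⟩).ne' h3

end barrier

/-- Weak solution of the Minkowski problem together with the dual barriers giving its boundary
values. -/
theorem exists_weak_solution {K : NNReal} (hφ : LipschitzWith K φ) (H : IsSupport φ h)
    (hM : ∀ y ∈ sphere (0 : ℂ) 1, |φ y| ≤ M) {a : ℝ} (ha : 0 < a) {ν : Measure ℂ}
    (hν : ∀ O ⊆ ball (0 : ℂ) 1, MeasurableSet O →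
      2 * ν O ≤ ∫⁻ y in O, ENNReal.ofReal (a ^ 2 / (1 - ‖y‖ ^ 2) ^ 2)) :
    ∃ u, Sub1 u ∧ (∀ x, h x ≤ u x) ∧ Push (gradient u) ν ∧
      ∀ y₀ ∈ sphere (0 : ℂ) 1, ∀ ε : ℝ, 0 < ε → ∃ N : ℝ, ∀ x,
        u x ≤ rad a (x - N • y₀) + (N + ε - φ y₀) := by
  have key : ∀ k : ℕ, ∃ u, Sub1 u ∧ (∀ x, h x ≤ u x) ∧
      Push (gradient u) (ν.restrict (closedBall 0 (1 - 1 / (k + 1)))) ∧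
      ∀ y₀ ∈ sphere (0 : ℂ) 1, ∀ ε : ℝ, 0 < ε → ∀ x,
        u x ≤ rad a (x - ((K : ℝ) ^ 2 / (2 * ε)) • y₀) + ((K : ℝ) ^ 2 / (2 * ε) + ε - φ y₀) := by
    intro k
    set ρ : ℝ := 1 - 1 / (k + 1)
    have hk : (0 : ℝ) < 1 / (k + 1) := by positivity
    have hρ1 : ρ < 1 := by simp only [ρ]; linarith
    have hρ0 : 0 ≤ ρ := sub_nonneg.2 (by rw [div_le_one (by positivity)]; linarith [(k.cast_nonneg : (0 : ℝ) ≤ k)])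
    have hsub : closedBall (0 : ℂ) ρ ⊆ ball 0 1 := closedBall_subset_ball hρ1
    have : IsFiniteMeasure (ν.restrict (closedBall 0 ρ)) := by
      refine ⟨?_⟩
      rw [Measure.restrict_apply_univ]
      have h1 := hν _ hsub measurableSet_closedBall
      have h2 : ∫⁻ y in closedBall (0 : ℂ) ρ, ENNReal.ofReal (a ^ 2 / (1 - ‖y‖ ^ 2) ^ 2) < ⊤ := by
        refine (setLIntegral_mono measurable_const (g := fun _ => ENNReal.ofReal (a ^ 2 / (1 - ρ ^ 2) ^ 2))
          fun y hy => ENNReal.ofReal_le_ofReal ?_).trans_lt ?_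
        · rw [mem_closedBall_zero_iff] at hy
          have h3 : 0 < 1 - ρ ^ 2 := by nlinarith
          have h4 : 1 - ρ ^ 2 ≤ 1 - ‖y‖ ^ 2 := by nlinarith [norm_nonneg y]
          gcongr
        · rw [setLIntegral_const]
          exact ENNReal.mul_lt_top ENNReal.ofReal_lt_top measure_closedBall_lt_top
      refine lt_of_le_of_lt ?_ (h1.trans_lt h2)
      rw [two_mul]; exact le_self_add
    obtain ⟨u, A, h1, h2, h3, h4⟩ := exists_push_of_finite H hM hρ0 hρ1
      (ν.restrict (closedBall 0 ρ)) (by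
        rw [Measure.restrict_apply measurableSet_closedBall.compl, compl_inter_self, measure_empty])
    refine ⟨u, h1, h2, h4, fun y₀ hy₀ ε hε => ?_⟩
    set N : ℝ := K ^ 2 / (2 * ε) with hN
    have hn0 := mem_sphere_zero_iff_norm.1 hy₀
    have hN0 : 0 ≤ N := by positivity
    refine le_dual_barrier ha h1 h4 (fun O hO hOo => ?_) (R := (A - ε + φ y₀) / (1 - ρ)) fun x hx => ?_
    · refine le_trans ?_ (hν O hO hOo.measurableSet)
      gcongr
      exact Measure.restrict_le_self
    · refine (h3 x).trans (max_le ?_ ?_)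
      · obtain ⟨y, hy, hyx⟩ := H.attained x
        have h5 := inner_le_norm_of_mem (sphere_subset_closedBall hy) (x - N • y₀)
        rw [inner_sub_right, real_inner_smul_right] at h5
        have h6 := norm_le_rad (a := a) (z := x - N • y₀)
        have h7 := hφ.dist_le_mul y₀ y
        rw [Real.dist_eq] at h7
        have h8 := (le_abs_self _).trans h7
        have h9 : dist y₀ y ^ 2 = 2 - 2 * inner ℝ y y₀ := by
          rw [dist_comm, dist_eq_norm, norm_sub_sq_real, mem_sphere_zero_iff_norm.1 hy, hn0]; ring
        have h10 : K * dist y₀ y ≤ ε + N * (1 - inner ℝ y y₀) := by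
          have : N * (1 - inner ℝ y y₀) = K ^ 2 * dist y₀ y ^ 2 / (4 * ε) := by
            rw [h9, hN]; field_simp; ring
          rw [this, ← sub_nonneg]
          have : ε + K ^ 2 * dist y₀ y ^ 2 / (4 * ε) - K * dist y₀ y
              = (2 * ε - K * dist y₀ y) ^ 2 / (4 * ε) := by field_simp; ring
          rw [this]; positivity
        linarith
      · rw [div_le_iff₀ (by linarith)] at hx
        have h6 := norm_le_rad (a := a) (z := x - N • y₀)
        have h7 := norm_sub_norm_le x (N • y₀)
        rw [norm_smul, hn0, Real.norm_eq_abs, abs_of_nonneg hN0, mul_one] at h7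
        linarith
  choose U hU1 hUh hUP hUB using key
  have hl := H.lower hM
  set A := rad a (0 - ((K : ℝ) ^ 2 / (2 * 1)) • (1 : ℂ)) + ((K : ℝ) ^ 2 / (2 * 1) + 1 - φ 1)
  have hU0 : ∀ k, U k 0 ≤ A := fun k => hUB k 1 (by simp) 1 one_pos 0
  obtain ⟨θ, hθ, u, hlim⟩ := exists_subseq_tendsto (C := max A M) hU1 fun k => abs_le.2
    ⟨by have := (hl 0).trans (hUh k 0); rw [norm_zero] at this; linarith [le_max_right A M],
      (hU0 k).trans (le_max_left _ _)⟩
  refine ⟨u, Sub1.of_tendsto (fun k => hU1 (θ k)) hlim,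
    fun x => ge_of_tendsto' (hlim x) fun k => hUh _ x,
    Push.of_tendsto (fun k => hU1 (θ k)) hlim (fun k x => (hl x).trans (hUh _ x)) (fun k => hU0 _)
      (fun k => hUP (θ k)) fun ψ hψ => ?_,
    fun y₀ hy₀ ε hε => ⟨(K : ℝ) ^ 2 / (2 * ε), fun x => le_of_tendsto' (hlim x) fun k => hUB _ y₀ hy₀ ε hε x⟩⟩
  obtain ⟨r, hr, h0⟩ := hψ.zero
  refine tendsto_const_nhds.congr' ?_
  have e1 := (tendsto_one_div_add_atTop_nhds_zero_nat (𝕜 := ℝ)).eventually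
    (gt_mem_nhds (show (0 : ℝ) < 1 - r by linarith))
  filter_upwards [hθ.tendsto_atTop.eventually e1] with k hk
  refine (setLIntegral_eq_of_support_subset fun y hy => ?_).symm
  rw [mem_closedBall_zero_iff]
  by_contra! hlt
  exact hy (by beta_reduce; rw [h0 y (by linarith), ENNReal.ofReal_zero])

end

section

/-- Comparison principle: a function whose Monge–Ampère measure is at least `f` lies below a function
whose Hessian determinant is at most `θ f`, `θ < 1`, if it does so near the boundary. -/
theorem le_of_det_le {E : Type*} [NormedAddCommGroup E] [InnerProductSpace ℝ E] [FiniteDimensional ℝ E]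
    [MeasurableSpace E] [BorelSpace E] {μ : Measure E} [μ.IsAddHaarMeasure] {g W f : E → ℝ} {G : E → E}
    {G' : E → E →L[ℝ] E} {K : Set E} {θ : ℝ} (hK : IsCompact K) (hg : ContinuousOn g K)
    (hW : ContinuousOn W K) (hbd : ∀ z ∈ K, z ∉ interior K → g z < W z)
    (hG : ∀ z ∈ interior K, W z < g z → HasFDerivAt W (innerSL ℝ (G z)) z)
    (hG' : ∀ z ∈ interior K, W z < g z → HasFDerivAt G (G' z) z)
    (hf : ContinuousOn f (interior K)) (hf0 : ∀ z ∈ interior K, 0 < f z) (hθ0 : 0 ≤ θ) (hθ : θ < 1)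
    (hdet : ∀ z ∈ interior K, W z < g z → |(G' z).det| ≤ θ * f z)
    (hvol : ∀ U ⊆ interior K, IsOpen U → ∫⁻ z in U, ENNReal.ofReal (f z) ∂μ ≤
      μ {p | ∃ y ∈ U, ∀ z ∈ K, g y + inner ℝ p (z - y) ≤ g z}) :
    ∀ z ∈ K, g z ≤ W z := by
  set U := interior K ∩ {z | W z < g z} with hU
  set Z := {z ∈ K | W z ≤ g z} with hZ
  have hUo : IsOpen U := by
    have := ((hg.sub hW).mono interior_subset).isOpen_inter_preimage isOpen_interior (isOpen_Ioi (a := 0))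
    convert this using 2
    ext z; simp
  have hZc : IsCompact Z := by
    refine hK.of_isClosed_subset ?_ (sep_subset _ _)
    have := (hg.sub hW).preimage_isClosed_of_isClosed hK.isClosed (isClosed_Ici (a := 0))
    convert this using 1
    ext z; simp [hZ]
  have hZK : Z ⊆ interior K := fun z hz => by
    by_contra h
    exact absurd (hbd z hz.1 h) (not_lt.2 hz.2)
  have hUZ : U ⊆ Z := fun z hz => ⟨interior_subset hz.1, le_of_lt hz.2⟩
  suffices hU0 : U = ∅ by
    intro z hz
    by_contra! hlt
    have : z ∈ U := ⟨hZK ⟨hz, hlt.le⟩, hlt⟩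
    rwa [hU0] at this
  have hsub : {p | ∃ y ∈ U, ∀ z ∈ K, g y + inner ℝ p (z - y) ≤ g z} ⊆ G '' U := by
    rintro p ⟨y, hy, hp⟩
    exact exists_grad_eq hK hW inter_subset_left
      (fun z hz hzU => by
        by_contra! hlt
        exact hzU ⟨hZK ⟨hz, hlt.le⟩, hlt⟩) (fun z hz => hz.2) (fun z hz => hG z hz.1 hz.2) hy hp
  have h1 : ∫⁻ z in U, ENNReal.ofReal (f z) ∂μ ≤
      ENNReal.ofReal θ * ∫⁻ z in U, ENNReal.ofReal (f z) ∂μ := by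
    refine (hvol U inter_subset_left hUo).trans ((measure_mono hsub).trans
      ((addHaar_image_le_lintegral_abs_det_fderiv μ hUo.measurableSet
        fun z hz => (hG' z hz.1 hz.2).hasFDerivWithinAt).trans ?_))
    rw [← lintegral_const_mul' _ _ ENNReal.ofReal_ne_top]
    refine setLIntegral_mono' hUo.measurableSet fun z hz => ?_
    rw [← ENNReal.ofReal_mul hθ0]
    exact ENNReal.ofReal_le_ofReal (hdet z hz.1 hz.2)
  by_contra hne
  obtain ⟨z₀, hz₀⟩ := nonempty_iff_ne_empty.2 hne
  obtain ⟨z₁, hz₁, hmin⟩ := hZc.exists_isMinOn ⟨z₀, hUZ hz₀⟩ (hf.mono hZK)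
  obtain ⟨z₂, hz₂, hmax⟩ := hZc.exists_isMaxOn ⟨z₀, hUZ hz₀⟩ (hf.mono hZK)
  have hfin : ∫⁻ z in U, ENNReal.ofReal (f z) ∂μ ≠ ⊤ := by
    refine ne_top_of_le_ne_top (b := ENNReal.ofReal (f z₂) * μ U) ?_ ?_
    · exact ENNReal.mul_ne_top ENNReal.ofReal_ne_top
        ((measure_mono hUZ).trans_lt hZc.measure_lt_top).ne
    · rw [← setLIntegral_const]
      exact setLIntegral_mono' hUo.measurableSet fun z hz => ENNReal.ofReal_le_ofReal (hmax (hUZ hz))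
  have hpos : 0 < ∫⁻ z in U, ENNReal.ofReal (f z) ∂μ := by
    refine lt_of_lt_of_le (b := ENNReal.ofReal (f z₁) * μ U) ?_ ?_
    · exact ENNReal.mul_pos (ENNReal.ofReal_pos.2 (hf0 _ (hZK hz₁))).ne'
        (hUo.measure_pos μ ⟨z₀, hz₀⟩).ne'
    · rw [← setLIntegral_const]
      exact setLIntegral_mono' hUo.measurableSet fun z hz => ENNReal.ofReal_le_ofReal (hmin (hUZ hz))
  refine absurd h1 (not_le.2 ?_)
  calc ENNReal.ofReal θ * ∫⁻ z in U, ENNReal.ofReal (f z) ∂μ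
      < 1 * ∫⁻ z in U, ENNReal.ofReal (f z) ∂μ :=
        ENNReal.mul_lt_mul_left hpos.ne' hfin (by rwa [ENNReal.ofReal_lt_one])
    _ = _ := one_mul _

section dual

variable {u φ h : ℂ → ℝ} {M : ℝ} {x y : ℂ}

/-- The Legendre transform `y ↦ sup_x (⟨y, x⟩ - u x)`. -/
noncomputable def conj (u : ℂ → ℝ) (y : ℂ) : ℝ := ⨆ x, (inner ℝ y x - u x)

lemma bddAbove_conj (hl : ∀ x, ‖x‖ - M ≤ u x) (hy : y ∈ closedBall (0 : ℂ) 1) :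
    BddAbove (range fun x => inner ℝ y x - u x) := by
  refine ⟨M, ?_⟩
  rintro _ ⟨x, rfl⟩
  have h1 := inner_le_norm_of_mem hy x
  have h2 := hl x
  beta_reduce
  linarith

lemma le_conj (hl : ∀ x, ‖x‖ - M ≤ u x) (hy : y ∈ closedBall (0 : ℂ) 1) (x : ℂ) :
    inner ℝ y x - u x ≤ conj u y :=
  le_ciSup (bddAbove_conj hl hy) x

lemma convexOn_conj (hl : ∀ x, ‖x‖ - M ≤ u x) : ConvexOn ℝ (closedBall (0 : ℂ) 1) (conj u) := by
  refine ⟨convex_closedBall _ _, fun y hy y' hy' a b ha hb hab => ciSup_le fun x => ?_⟩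
  have h1 := mul_le_mul_of_nonneg_left (le_conj hl hy x) ha
  have h2 := mul_le_mul_of_nonneg_left (le_conj hl hy' x) hb
  rw [inner_add_left, real_inner_smul_left, real_inner_smul_left, smul_eq_mul, smul_eq_mul]
  have h3 : u x = a * u x + b * u x := by rw [← add_mul, hab, one_mul]
  linarith

lemma SubAt.conj_eq (hl : ∀ x, ‖x‖ - M ≤ u x) (hy : y ∈ closedBall (0 : ℂ) 1) (hs : SubAt u x y) :
    conj u y = inner ℝ y x - u x := by
  refine le_antisymm (ciSup_le fun x' => ?_) (le_conj hl hy x)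
  have := hs x'
  rw [inner_sub_right] at this
  linarith

lemma SubAt.dual (hl : ∀ x, ‖x‖ - M ≤ u x) (hy : y ∈ closedBall (0 : ℂ) 1) (hs : SubAt u x y) :
    ∀ z ∈ closedBall (0 : ℂ) 1, conj u y + inner ℝ x (z - y) ≤ conj u z := by
  intro z hz
  have := le_conj hl hz x
  rw [hs.conj_eq hl hy, inner_sub_right, real_inner_comm z x, real_inner_comm y x]
  linarith

lemma conj_le_of_mem_sphere (H : IsSupport φ h) (hh : ∀ x, h x ≤ u x) (hy : y ∈ sphere (0 : ℂ) 1) :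
    conj u y ≤ φ y := by
  refine ciSup_le fun x => ?_
  have h1 := H.le x y hy
  have h2 := hh x
  linarith

lemma conj_eq_of_mem_sphere (H : IsSupport φ h) (hl : ∀ x, ‖x‖ - M ≤ u x) (hh : ∀ x, h x ≤ u x)
    {a : ℝ} (hB : ∀ y₀ ∈ sphere (0 : ℂ) 1, ∀ ε : ℝ, 0 < ε → ∃ N : ℝ, ∀ x,
      u x ≤ rad a (x - N • y₀) + (N + ε - φ y₀)) (hy : y ∈ sphere (0 : ℂ) 1) : conj u y = φ y := by
  refine le_antisymm (conj_le_of_mem_sphere H hh hy) (le_of_forall_pos_le_add fun ε hε => ?_)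
  obtain ⟨N, hN⟩ := hB y hy (ε / 2) (half_pos hε)
  have hn := mem_sphere_zero_iff_norm.1 hy
  set s : ℝ := a ^ 2 / ε + 1
  have hs : 0 < s := by positivity
  have h1 := hN ((N + s) • y)
  have h2 := le_conj hl (sphere_subset_closedBall hy) ((N + s) • y)
  rw [real_inner_smul_right, real_inner_self_eq_norm_sq, hn] at h2
  have h3 : rad a ((N + s) • y - N • y) ≤ s + ε / 2 := by
    rw [← sub_smul, add_sub_cancel_left, rad, norm_smul, hn, Real.norm_eq_abs, abs_of_pos hs,
      Real.sqrt_le_left (by positivity)]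
    have : a ^ 2 = (s - 1) * ε := by simp only [s]; field_simp; ring
    nlinarith [sq_nonneg ε]
  linarith

lemma continuousOn_conj {K : NNReal} (hφ : LipschitzWith K φ) (hM : ∀ y ∈ sphere (0 : ℂ) 1, |φ y| ≤ M)
    (hl : ∀ x, ‖x‖ - M ≤ u x) (hv : ∀ y ∈ sphere (0 : ℂ) 1, conj u y = φ y) :
    ContinuousOn (conj u) (closedBall 0 1) := by
  have hM0 : 0 ≤ M := (abs_nonneg _).trans (hM 1 (by simp))
  intro y₀ hy₀
  rcases (mem_closedBall_zero_iff.1 hy₀).lt_or_eq with hlt | heq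
  · exact ((((convexOn_conj hl).subset ball_subset_closedBall (convex_ball _ _)).continuousOn
      isOpen_ball).continuousAt (isOpen_ball.mem_nhds (mem_ball_zero_iff.2 hlt))).continuousWithinAt
  have hs₀ := mem_sphere_zero_iff_norm.2 heq
  have hup : ∀ y ∈ closedBall (0 : ℂ) 1, conj u y ≤ φ y₀ + (2 * K + M) * ‖y - y₀‖ := by
    intro y hy
    have hr1 := mem_closedBall_zero_iff.1 hy
    set r := ‖y‖
    obtain ⟨ζ, hζ, hyζ⟩ : ∃ ζ : ℂ, ‖ζ‖ = 1 ∧ y = r • ζ := by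
      rcases eq_or_ne y 0 with rfl | h0
      · exact ⟨1, by simp, by simp [r]⟩
      · refine ⟨r⁻¹ • y, ?_, ?_⟩
        · rw [norm_smul, norm_inv, norm_norm, inv_mul_cancel₀ (norm_ne_zero_iff.2 h0)]
        · rw [smul_smul, mul_inv_cancel₀ (norm_ne_zero_iff.2 h0), one_smul]
    have hζs := mem_sphere_zero_iff_norm.2 hζ
    have hζs' : -ζ ∈ sphere (0 : ℂ) 1 := by rw [mem_sphere_zero_iff_norm, norm_neg, hζ]
    have h1 := (convexOn_conj hl).2 (sphere_subset_closedBall hζs) (sphere_subset_closedBall hζs')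
      (show 0 ≤ (1 + r) / 2 by have := norm_nonneg y; positivity) (show 0 ≤ (1 - r) / 2 by linarith) (by ring)
    have e1 : ((1 + r) / 2) • ζ + ((1 - r) / 2) • -ζ = y := by
      rw [hyζ, smul_neg, ← sub_eq_add_neg, ← sub_smul]; congr 1; ring
    rw [e1, hv _ hζs, hv _ hζs', smul_eq_mul, smul_eq_mul] at h1
    have h2 := (abs_le.1 (hM _ hζs')).2
    have h3 := (abs_le.1 (hM _ hζs)).1
    have h4 : 1 - r ≤ ‖y - y₀‖ := by
      have := norm_sub_norm_le y₀ y
      rwa [heq, norm_sub_rev] at this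
    have h5 : ‖ζ - y₀‖ ≤ 2 * ‖y - y₀‖ := by
      have h6 : ‖ζ - y‖ = 1 - r := by
        rw [show ζ - y = (1 - r) • ζ by rw [sub_smul, one_smul, ← hyζ], norm_smul, hζ, Real.norm_eq_abs,
          abs_of_nonneg (by linarith), mul_one]
      have := norm_sub_le_norm_sub_add_norm_sub ζ y y₀
      linarith
    have h7 := hφ.dist_le_mul ζ y₀
    rw [Real.dist_eq, dist_eq_norm] at h7
    have h8 := (le_abs_self _).trans h7
    have h9 := mul_le_mul_of_nonneg_left h5 K.coe_nonneg
    nlinarith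
  refine Metric.continuousWithinAt_iff'.2 fun ε hε => ?_
  obtain ⟨x, hx⟩ := exists_lt_of_lt_ciSup (show conj u y₀ - ε / 2 < ⨆ x, (inner ℝ y₀ x - u x) from by
    change _ < conj u y₀; linarith)
  have c1 : Continuous fun y : ℂ => inner ℝ y x - u x :=
    (continuous_id.inner continuous_const).sub continuous_const
  have c2 : Continuous fun y : ℂ => φ y₀ + (2 * K + M) * ‖y - y₀‖ := by fun_prop
  have e1 := c1.continuousAt.eventually (lt_mem_nhds hx)
  have e2 := (c2.tendsto y₀).eventually (gt_mem_nhds (show _ < φ y₀ + ε by simpa using hε))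
  filter_upwards [self_mem_nhdsWithin, mem_nhdsWithin_of_mem_nhds e1, mem_nhdsWithin_of_mem_nhds e2]
    with y hy h1 h2
  have h3 := hup y hy
  have h4 := le_conj hl hy x
  have h5 := hv y₀ hs₀
  rw [Real.dist_eq, abs_lt]
  constructor <;> linarith

lemma lintegral_le_volume_subgradient {ν : Measure ℂ} (hu : Sub1 u) (hl : ∀ x, ‖x‖ - M ≤ u x)
    (hP : Push (gradient u) ν) {U : Set ℂ} (hU : IsOpen U) (hU1 : U ⊆ ball 0 1) :
    ν U ≤ volume {p | ∃ y ∈ U, ∀ z ∈ closedBall 0 1, conj u y + inner ℝ p (z - y) ≤ conj u z} := by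
  rw [← hP.volume_preimage (measurable_gradient u) hU hU1]
  refine measure_mono_ae ?_
  filter_upwards [hu.ae_differentiableAt] with x hx hxU
  obtain ⟨h1, h2⟩ := hu.subAt_gradient hx
  exact ⟨_, hxU, h1.dual hl h2⟩

end dual

end

section

/-- The barrier `τ t arsinh (τ t / σ) - √(σ² + τ² t²)`. -/
noncomputable def bar (τ σ t : ℝ) : ℝ := τ * t * arsinh (τ * t / σ) - √(σ ^ 2 + (τ * t) ^ 2)

lemma cosh_tangent (A B : ℝ) : cosh A + (B - A) * sinh A ≤ cosh B := by
  have e1 : exp B = exp A * exp (B - A) := by rw [← exp_add]; ring_nf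
  have e2 : exp (-B) = exp (-A) * exp (-(B - A)) := by rw [← exp_add]; ring_nf
  have h1 := mul_le_mul_of_nonneg_left (add_one_le_exp (B - A)) (exp_pos A).le
  have h2 := mul_le_mul_of_nonneg_left (add_one_le_exp (-(B - A))) (exp_pos (-A)).le
  rw [cosh_eq, cosh_eq, sinh_eq]
  linarith

lemma bar_ge {τ σ : ℝ} (hτ : 0 < τ) (hσ : 0 < σ) (q t : ℝ) :
    q * t - σ * cosh (q / τ) ≤ bar τ σ t := by
  set A := arsinh (τ * t / σ) with hA
  have h1 : sinh A = τ * t / σ := sinh_arsinh _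
  have h2 : √(σ ^ 2 + (τ * t) ^ 2) = σ * cosh A := by
    rw [Real.sqrt_eq_iff_eq_sq (by positivity) (mul_nonneg hσ.le (cosh_pos A).le), mul_pow σ, cosh_sq, h1]
    field_simp; ring
  have h3 := mul_le_mul_of_nonneg_left (cosh_tangent A (q / τ)) hσ.le
  have h4 : σ * (cosh A + (q / τ - A) * sinh A) = σ * cosh A + (q * t - τ * t * A) := by
    rw [h1]; field_simp
  rw [bar, h2]
  linarith

lemma bar_zero_right {τ σ : ℝ} (hσ : 0 ≤ σ) : bar τ σ 0 = -σ := by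
  simp [bar, Real.sqrt_sq hσ]

lemma bar_neg (τ σ t : ℝ) : bar τ σ (-t) = bar τ σ t := by
  simp [bar, neg_div]

lemma bar_ge_abs {τ σ : ℝ} (hτ : 0 < τ) (hσ : 0 < σ) (q t : ℝ) :
    q * |t| - σ * cosh (q / τ) ≤ bar τ σ t := by
  rcases abs_choice t with h | h
  · rw [h]; exact bar_ge hτ hσ q t
  · rw [h, ← bar_neg]; exact bar_ge hτ hσ q (-t)

lemma det_frame {e : ℂ} (he : ‖e‖ = 1) (α β γ : ℝ) :
    ((α • innerSL ℝ (Complex.I * e) + β • innerSL ℝ e).smulRight (Complex.I * e) +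
      (β • innerSL ℝ (Complex.I * e) + γ • innerSL ℝ e).smulRight e : ℂ →L[ℝ] ℂ).det
      = α * γ - β ^ 2 := by
  have h1 : e.re ^ 2 + e.im ^ 2 = 1 := by
    rw [← one_pow 2, ← he, Complex.sq_norm, Complex.normSq_apply]; ring
  rw [det_clm]
  simp [Complex.inner]
  linear_combination (α * γ - β ^ 2) * (e.re ^ 2 + e.im ^ 2 + 1) * h1

section

variable {τ : ℝ} {σ σ₁ : ℝ → ℝ} {σ₂ : ℝ} {e b z : ℂ}

/-- The gradient of `z ↦ bar τ (σ s) t` in the frame `s = ⟨e, z - b⟩`, `t = ⟨I e, z - b⟩`. -/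
noncomputable def gradBar (τ : ℝ) (σ σ₁ : ℝ → ℝ) (e b z : ℂ) : ℂ :=
  (τ * arsinh (τ * inner ℝ (Complex.I * e) (z - b) / σ (inner ℝ e (z - b)))) • (Complex.I * e) +
    (-(σ₁ (inner ℝ e (z - b)) / σ (inner ℝ e (z - b)) *
      √(σ (inner ℝ e (z - b)) ^ 2 + (τ * inner ℝ (Complex.I * e) (z - b)) ^ 2))) • e

lemma hasFDerivAt_inner_sub (e b z : ℂ) :
    HasFDerivAt (fun z => inner ℝ e (z - b)) (innerSL ℝ e) z := by
  have := ((innerSL ℝ e).hasFDerivAt (x := z - b)).comp z ((hasFDerivAt_id z).sub_const b)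
  rwa [ContinuousLinearMap.comp_id] at this

lemma hasFDerivAt_bar_sqrt (hσ : 0 < σ (inner ℝ e (z - b)))
    (h1 : HasDerivAt σ (σ₁ (inner ℝ e (z - b))) (inner ℝ e (z - b))) :
    HasFDerivAt (fun z => √(σ (inner ℝ e (z - b)) ^ 2 + (τ * inner ℝ (Complex.I * e) (z - b)) ^ 2))
      ((√(σ (inner ℝ e (z - b)) ^ 2 + (τ * inner ℝ (Complex.I * e) (z - b)) ^ 2))⁻¹ •
        ((σ (inner ℝ e (z - b)) * σ₁ (inner ℝ e (z - b))) • innerSL ℝ e +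
          (τ ^ 2 * inner ℝ (Complex.I * e) (z - b)) • innerSL ℝ (Complex.I * e))) z := by
  have hs := h1.comp_hasFDerivAt z (hasFDerivAt_inner_sub e b z)
  have ht := (hasFDerivAt_inner_sub (Complex.I * e) b z).const_mul τ
  refine (((hs.pow 2).fun_add (ht.pow 2)).sqrt ?_).congr_fderiv ?_
  · simp only [Function.comp_apply]; positivity
  · simp only [Function.comp_apply]
    set R := √(σ (inner ℝ e (z - b)) ^ 2 + (τ * inner ℝ (Complex.I * e) (z - b)) ^ 2) with hR
    have hR0 : R ≠ 0 := (Real.sqrt_pos.2 (by positivity)).ne'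
    rw [ContinuousLinearMap.ext_iff]
    intro w
    simp only [smul_apply, add_apply, smul_eq_mul]
    field_simp
    simp
    ring

lemma hasFDerivAt_bar_arsinh (hσ : 0 < σ (inner ℝ e (z - b)))
    (h1 : HasDerivAt σ (σ₁ (inner ℝ e (z - b))) (inner ℝ e (z - b))) :
    HasFDerivAt (fun z => arsinh (τ * inner ℝ (Complex.I * e) (z - b) / σ (inner ℝ e (z - b))))
      ((√(σ (inner ℝ e (z - b)) ^ 2 + (τ * inner ℝ (Complex.I * e) (z - b)) ^ 2))⁻¹ •
        (τ • innerSL ℝ (Complex.I * e) -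
          (τ * inner ℝ (Complex.I * e) (z - b) * σ₁ (inner ℝ e (z - b)) / σ (inner ℝ e (z - b))) •
            innerSL ℝ e)) z := by
  have hs := h1.comp_hasFDerivAt z (hasFDerivAt_inner_sub e b z)
  have ht := (hasFDerivAt_inner_sub (Complex.I * e) b z).const_mul τ
  have hq := (ht.fun_mul ((hasDerivAt_inv hσ.ne').comp_hasFDerivAt z hs)).arsinh
  simp only [Function.comp_apply, ← div_eq_mul_inv] at hq
  refine hq.congr_fderiv ?_
  set R := √(σ (inner ℝ e (z - b)) ^ 2 + (τ * inner ℝ (Complex.I * e) (z - b)) ^ 2) with hR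
  have hR0 : 0 < R := Real.sqrt_pos.2 (by positivity)
  have hR1 : √(1 + (τ * inner ℝ (Complex.I * e) (z - b) / σ (inner ℝ e (z - b))) ^ 2)
      = R / σ (inner ℝ e (z - b)) := by
    rw [Real.sqrt_eq_iff_eq_sq (by positivity) (by positivity), div_pow R, hR, Real.sq_sqrt (by positivity)]
    field_simp
  rw [hR1, ContinuousLinearMap.ext_iff]
  intro w
  simp only [smul_apply, add_apply,
    sub_apply, smul_eq_mul]
  field_simp
  ring

lemma hasFDerivAt_bar (hσ : 0 < σ (inner ℝ e (z - b)))
    (h1 : HasDerivAt σ (σ₁ (inner ℝ e (z - b))) (inner ℝ e (z - b))) :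
    HasFDerivAt (fun z => bar τ (σ (inner ℝ e (z - b))) (inner ℝ (Complex.I * e) (z - b)))
      (innerSL ℝ (gradBar τ σ σ₁ e b z)) z := by
  have ht := (hasFDerivAt_inner_sub (Complex.I * e) b z).const_mul τ
  refine ((ht.fun_mul (hasFDerivAt_bar_arsinh (τ := τ) hσ h1)).fun_sub
    (hasFDerivAt_bar_sqrt (τ := τ) hσ h1)).congr_fderiv ?_
  rw [gradBar]
  set R := √(σ (inner ℝ e (z - b)) ^ 2 + (τ * inner ℝ (Complex.I * e) (z - b)) ^ 2) with hR
  have hR0 : 0 < R := Real.sqrt_pos.2 (by positivity)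
  have hR2 : R ^ 2 = σ (inner ℝ e (z - b)) ^ 2 + (τ * inner ℝ (Complex.I * e) (z - b)) ^ 2 :=
    Real.sq_sqrt (by positivity)
  rw [ContinuousLinearMap.ext_iff]
  intro w
  simp only [smul_apply, add_apply,
    sub_apply, smul_eq_mul, innerSL_apply_apply, inner_add_left, real_inner_smul_left]
  generalize inner ℝ e w = p1
  generalize inner ℝ (Complex.I * e) w = p2
  field_simp
  linear_combination σ₁ (inner ℝ e (z - b)) * p1 * hR2

lemma hasFDerivAt_gradBar (he : ‖e‖ = 1) (hσ : 0 < σ (inner ℝ e (z - b)))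
    (h1 : HasDerivAt σ (σ₁ (inner ℝ e (z - b))) (inner ℝ e (z - b)))
    (h2 : HasDerivAt σ₁ σ₂ (inner ℝ e (z - b))) :
    ∃ L : ℂ →L[ℝ] ℂ, HasFDerivAt (gradBar τ σ σ₁ e b) L z ∧
      L.det = -(τ ^ 2 * σ₂ / σ (inner ℝ e (z - b))) := by
  have hR' := hasFDerivAt_bar_sqrt (τ := τ) hσ h1
  have hA' := (hasFDerivAt_bar_arsinh (τ := τ) hσ h1).const_mul τ
  have hs := h1.comp_hasFDerivAt z (hasFDerivAt_inner_sub e b z)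
  have hs2 := h2.comp_hasFDerivAt z (hasFDerivAt_inner_sub e b z)
  have hq := ((hs2.fun_mul ((hasDerivAt_inv hσ.ne').comp_hasFDerivAt z hs)).fun_mul hR').fun_neg
  simp only [Function.comp_apply, ← div_eq_mul_inv] at hq
  set S := σ (inner ℝ e (z - b)) with hS
  set S1 := σ₁ (inner ℝ e (z - b)) with hS1
  set t := inner ℝ (Complex.I * e) (z - b) with ht
  set R := √(S ^ 2 + (τ * t) ^ 2) with hR
  have hR0 : 0 < R := Real.sqrt_pos.2 (by positivity)
  have hR2 : R ^ 2 = S ^ 2 + (τ * t) ^ 2 := Real.sq_sqrt (by positivity)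
  have hA2 := hA'.congr_fderiv (g' := (τ ^ 2 / R) • innerSL ℝ (Complex.I * e) +
      (-(τ ^ 2 * t * S1 / (S * R))) • innerSL ℝ e) (by
    rw [ContinuousLinearMap.ext_iff]
    intro w
    simp only [smul_apply, add_apply,
      sub_apply, smul_eq_mul]
    field_simp
    ring)
  have hq2 := hq.congr_fderiv (g' := (-(τ ^ 2 * t * S1 / (S * R))) • innerSL ℝ (Complex.I * e) +
      (-(σ₂ / S * R) + S1 ^ 2 / S ^ 2 * (τ * t) ^ 2 / R) • innerSL ℝ e) (by
    rw [ContinuousLinearMap.ext_iff]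
    intro w
    simp only [smul_apply, add_apply, neg_add,
      neg_apply, smul_eq_mul]
    field_simp
    rw [hR2]
    ring)
  refine ⟨_, (hA2.smul_const (Complex.I * e)).fun_add (hq2.smul_const e), ?_⟩
  rw [det_frame he]
  field_simp
  ring

end

end

section

lemma bar_le {τ σ : ℝ} (hσ : 0 < σ) (t : ℝ) : bar τ σ t ≤ (τ * t) ^ 2 / σ := by
  set A := arsinh (τ * t / σ) with hA
  have h1 : τ * t = σ * sinh A := by rw [hA, sinh_arsinh]; field_simp
  have h2 : sinh A * A ≤ sinh A ^ 2 := by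
    rw [sq]
    rcases le_total 0 A with h | h
    · exact mul_le_mul_of_nonneg_left (self_le_sinh_iff.2 h) (sinh_nonneg_iff.2 h)
    · exact mul_le_mul_of_nonpos_left (sinh_le_self_iff.2 h) (sinh_nonpos_iff.2 h)
  have h3 : (τ * t) ^ 2 / σ = σ * sinh A ^ 2 := by rw [h1]; field_simp
  have h4 := mul_le_mul_of_nonneg_left h2 hσ.le
  have h5 := Real.sqrt_nonneg (σ ^ 2 + (τ * t) ^ 2)
  rw [bar, h3, ← hA]
  have h6 : τ * t * A = σ * (sinh A * A) := by rw [h1]; ring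
  linarith

lemma frame_sq {e : ℂ} (he : ‖e‖ = 1) (w : ℂ) :
    inner ℝ e w ^ 2 + inner ℝ (Complex.I * e) w ^ 2 = ‖w‖ ^ 2 := by
  have h1 : e.re ^ 2 + e.im ^ 2 = 1 := by
    rw [← one_pow 2, ← he, Complex.sq_norm, Complex.normSq_apply]; ring
  rw [Complex.sq_norm, Complex.normSq_apply]
  simp [Complex.inner]
  linear_combination (w.re ^ 2 + w.im ^ 2) * h1

lemma frame_expand {e : ℂ} (he : ‖e‖ = 1) (w : ℂ) :
    w - (inner ℝ e w : ℝ) • e = (inner ℝ (Complex.I * e) w : ℝ) • (Complex.I * e) := by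
  have h1 : e.re ^ 2 + e.im ^ 2 = 1 := by
    rw [← one_pow 2, ← he, Complex.sq_norm, Complex.normSq_apply]; ring
  apply Complex.ext
  · simp [Complex.inner]; linear_combination -w.re * h1
  · simp [Complex.inner]; linear_combination -w.im * h1

/-- A convex function on the plane with Monge–Ampère measure bounded below is strictly convex. -/
theorem strictConvexOn_of_volume {g : ℂ → ℝ} {O C : Set ℂ} {c : ℝ} (hO : IsOpen O) (hOC : O ⊆ C)
    (hg : ConvexOn ℝ O g) (hc : 0 < c)
    (hvol : ∀ U ⊆ O, IsOpen U → ENNReal.ofReal c * volume U ≤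
      volume {p | ∃ y ∈ U, ∀ z ∈ C, g y + inner ℝ p (z - y) ≤ g z}) : StrictConvexOn ℝ O g := by
  refine ⟨hg.1, fun x hx y hy hxy α β hα hβ hαβ => ?_⟩
  by_contra! hle
  rw [smul_eq_mul, smul_eq_mul] at hle
  set m := α • x + β • y with hm
  have hmO : m ∈ O := hg.1 hx hy hα.le hβ.le hαβ
  have hd : 0 < ‖y - x‖ := norm_pos_iff.2 (sub_ne_zero.2 hxy.symm)
  set d := ‖y - x‖ with hd'
  set e : ℂ := d⁻¹ • (y - x) with he'
  have he : ‖e‖ = 1 := by rw [he', norm_smul, norm_inv, norm_norm, inv_mul_cancel₀ hd.ne']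
  have hde : d • e = y - x := by rw [he', smul_smul, mul_inv_cancel₀ hd.ne', one_smul]
  clear_value e
  obtain ⟨L, N, hN, hL⟩ := hg.locallyLipschitzOn hO hmO
  rw [hO.nhdsWithin_eq hmO] at hN
  obtain ⟨r, hr, hrN⟩ := Metric.mem_nhds_iff.1 (inter_mem hN (hO.mem_nhds hmO))
  set s₀ := min (r / 2) (min (d * α) (d * β)) with hs₀
  have hs0 : 0 < s₀ := by positivity
  have hsr : s₀ ≤ r / 2 := min_le_left _ _
  have hsα : s₀ ≤ d * α := (min_le_right _ _).trans (min_le_left _ _)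
  have hsβ : s₀ ≤ d * β := (min_le_right _ _).trans (min_le_right _ _)
  set S : ℂ → ℝ := fun z => inner ℝ e (z - m) with hS
  set T : ℂ → ℝ := fun z => inner ℝ (Complex.I * e) (z - m) with hT
  have hSc : Continuous S := continuous_const.inner (continuous_id.sub continuous_const)
  have hTc : Continuous T := continuous_const.inner (continuous_id.sub continuous_const)
  set K : Set ℂ := {z | |S z| ≤ s₀ ∧ |T z| ≤ s₀} with hK
  have hKr : K ⊆ ball m r := by
    rintro z ⟨h1, h2⟩
    rw [mem_ball, dist_eq_norm]
    have h3 := frame_sq he (z - m)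
    have h4 := sq_le_sq' (abs_le.1 h1).1 (abs_le.1 h1).2
    have h5 := sq_le_sq' (abs_le.1 h2).1 (abs_le.1 h2).2
    simp only [hS, hT] at h4 h5
    nlinarith [norm_nonneg (z - m)]
  have hKO : K ⊆ O := fun z hz => (hrN (hKr hz)).2
  have hKc : IsCompact K := by
    refine isCompact_of_isClosed_isBounded ?_ (isBounded_ball.subset hKr)
    exact (isClosed_le hSc.abs continuous_const).inter (isClosed_le hTc.abs continuous_const)
  have hKi : {z | |S z| < s₀ ∧ |T z| < s₀} ⊆ interior K := by
    refine interior_maximal (fun z hz => ⟨hz.1.le, hz.2.le⟩) ?_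
    exact (isOpen_lt hSc.abs continuous_const).inter (isOpen_lt hTc.abs continuous_const)
  set k := (g y - g x) / d with hk
  have hkd : k * d = g y - g x := by rw [hk]; field_simp
  have hub : ∀ z ∈ K, g z ≤ α * g x + β * g y + k * S z + L * |T z| := by
    intro z hz
    obtain ⟨h1, h2⟩ := abs_le.1 hz.1
    have h3 : m + S z • e = (α - S z / d) • x + (β + S z / d) • y := by
      rw [hm, he', show y - x = (1 : ℝ) • y - (1 : ℝ) • x by simp, smul_sub, smul_sub, smul_smul, smul_smul,
        smul_smul, smul_smul, sub_smul, add_smul, div_eq_mul_inv, mul_one]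
      ring
    have h4 : S z / d ≤ α := by rw [div_le_iff₀ hd]; linarith
    have h5 : -β ≤ S z / d := by rw [le_div_iff₀ hd]; linarith
    have h6 := hg.2 hx hy (sub_nonneg.2 h4) (show 0 ≤ β + S z / d by linarith) (by linarith)
    rw [← h3, smul_eq_mul, smul_eq_mul] at h6
    have hz' : m + S z • e ∈ K := by
      have e1 : S (m + S z • e) = S z := by
        simp only [hS]
        rw [add_sub_cancel_left, real_inner_smul_right, real_inner_self_eq_norm_sq, he]; ring
      have e2 : T (m + S z • e) = 0 := by
        simp only [hT]
        rw [add_sub_cancel_left, real_inner_smul_right]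
        simp [Complex.inner]
        right; ring
      exact ⟨by rw [e1]; exact hz.1, by rw [e2, abs_zero]; exact hs0.le⟩
    have h7 := hL.dist_le_mul z (hrN (hKr hz)).1 _ (hrN (hKr hz')).1
    have h8 : z - (m + S z • e) = T z • (Complex.I * e) := by
      rw [← sub_sub]; exact frame_expand he (z - m)
    rw [Real.dist_eq, dist_eq_norm, h8, norm_smul, norm_mul, Complex.norm_I, he, one_mul, mul_one,
      Real.norm_eq_abs] at h7
    have h9 := (le_abs_self _).trans h7
    have h10 : (α - S z / d) * g x + (β + S z / d) * g y = α * g x + β * g y + k * S z := by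
      rw [hk]; field_simp; ring
    linarith
  have hτ : 0 < √(c / 2) * s₀ / (π / 2) := by positivity
  set τ := √(c / 2) * s₀ / (π / 2) with hτ'
  set Q := cosh (L / τ) with hQ
  have hQ1 : 1 ≤ Q := one_le_cosh _
  set θ := arccos (1 / (2 * Q)) with hθ
  have hcos : cos θ = 1 / (2 * Q) := by
    refine cos_arccos ?_ ?_
    · have : 0 ≤ 1 / (2 * Q) := by positivity
      linarith
    · rw [div_le_one (by positivity)]; linarith
  have hθ0 : 0 ≤ θ := arccos_nonneg _
  have hθ1 : θ < π / 2 := arccos_lt_pi_div_two.2 (by positivity)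
  set a := s₀ / cosh ((L + 1) / τ) with ha
  have ha0 : 0 < a := by have := cosh_pos ((L + 1) / τ); positivity
  set w := θ / s₀ with hw
  have hws : w * s₀ = θ := by rw [hw]; field_simp
  have hw0 : 0 ≤ w := by positivity
  set σ : ℝ → ℝ := fun s => a * cos (w * s) with hσ
  have hσpos : ∀ z ∈ K, 0 < σ (S z) := by
    intro z hz
    obtain ⟨h1, h2⟩ := abs_le.1 hz.1
    refine mul_pos ha0 (cos_pos_of_mem_Ioo ⟨?_, ?_⟩)
    · have := mul_le_mul_of_nonneg_left h1 hw0
      rw [mul_neg, hws] at this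
      linarith
    · have := mul_le_mul_of_nonneg_left h2 hw0
      rw [hws] at this
      linarith
  have hd1 : ∀ s, HasDerivAt σ (-(a * w) * sin (w * s)) s := fun s => by
    have := ((hasDerivAt_id s).const_mul w).cos.const_mul a
    refine this.congr_deriv ?_
    simp; ring
  have hd2 : ∀ s, HasDerivAt (fun s => -(a * w) * sin (w * s)) (-(w ^ 2) * σ s) s := fun s => by
    have := ((hasDerivAt_id s).const_mul w).sin.const_mul (-(a * w))
    refine this.congr_deriv ?_
    simp [hσ]; ring
  have hdetτ : τ ^ 2 * w ^ 2 ≤ c / 2 := by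
    have h1 : τ * w = √(c / 2) * (θ / (π / 2)) := by rw [hτ', hw]; field_simp
    have h2 : θ / (π / 2) ≤ 1 := by rw [div_le_one (by positivity)]; exact hθ1.le
    have h3 : (θ / (π / 2)) ^ 2 ≤ 1 := pow_le_one₀ (by positivity) h2
    rw [← mul_pow, h1, mul_pow, Real.sq_sqrt (by positivity)]
    nlinarith
  set W : ℂ → ℝ := fun z => bar τ (σ (S z)) (T z) + (α * g x + β * g y + 3 * a / 4 + k * S z) with hW
  have hder : ∀ z ∈ K, HasFDerivAt W
      (innerSL ℝ (gradBar τ σ (fun s => -(a * w) * sin (w * s)) e m z + k • e)) z := by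
    intro z hz
    refine ((hasFDerivAt_bar (τ := τ) (σ₁ := fun s => -(a * w) * sin (w * s)) (hσpos z hz) (hd1 _)).fun_add
      (((hasFDerivAt_inner_sub e m z).const_mul k).const_add _)).congr_fderiv ?_
    rw [map_add, map_smul]
  have hL2 : ∀ z, ∃ L : ℂ →L[ℝ] ℂ, z ∈ K →
      HasFDerivAt (fun z => gradBar τ σ (fun s => -(a * w) * sin (w * s)) e m z + k • e) L z ∧
        L.det = τ ^ 2 * w ^ 2 := by
    intro z
    by_cases hz : z ∈ K
    · obtain ⟨L, h1, h2⟩ := hasFDerivAt_gradBar (τ := τ)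
        (σ₁ := fun s => -(a * w) * sin (w * s)) he (hσpos z hz) (hd1 _) (hd2 _)
      refine ⟨L, fun _ => ⟨h1.add_const _, ?_⟩⟩
      rw [h2]
      have := (hσpos z hz).ne'
      simp only [hS] at this
      field_simp
    · exact ⟨0, fun h => absurd h hz⟩
  choose G' hG' using hL2
  have hfin := le_of_det_le (μ := volume) (g := g) (W := W) (f := fun _ => c) (θ := 1 / 2) hKc
    ((hg.continuousOn hO).mono hKO) (fun z hz => (hder z hz).continuousAt.continuousWithinAt)
    (fun z hz hzi => by
      have h1 := hub z hz
      have h2 : s₀ ≤ |S z| ∨ s₀ ≤ |T z| := by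
        by_contra! h
        exact hzi (hKi h)
      simp only [hW]
      rcases h2 with h2 | h2
      · have h3 := bar_ge_abs hτ (hσpos z hz) L (T z)
        have h4 : |S z| = s₀ := le_antisymm hz.1 h2
        have h5 : σ (S z) = a / (2 * Q) := by
          simp only [hσ]
          rw [← cos_abs, abs_mul, h4, abs_of_nonneg hw0, hws, hcos]; ring
        have h6 : a / (2 * Q) * Q = a / 2 := by field_simp
        rw [h5, ← hQ, h6] at h3
        rw [h5]
        linarith
      · have h3 := bar_ge_abs hτ (hσpos z hz) (L + 1) (T z)
        have h4 : |T z| = s₀ := le_antisymm hz.2 h2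
        have h5 : σ (S z) * cosh ((L + 1) / τ) ≤ s₀ := by
          have h6 : a * cosh ((L + 1) / τ) = s₀ := by
            rw [ha, div_mul_cancel₀ _ (cosh_pos _).ne']
          rw [← h6]
          refine mul_le_mul_of_nonneg_right ?_ (cosh_pos _).le
          simp only [hσ]
          nlinarith [cos_le_one (w * S z)]
        rw [h4] at h1 h3
        linarith)
    (fun z hz _ => hder z (interior_subset hz)) (fun z hz _ => (hG' z (interior_subset hz)).1)
    continuousOn_const (fun _ _ => hc) (by norm_num) (by norm_num)
    (fun z hz _ => by
      rw [(hG' z (interior_subset hz)).2, abs_of_nonneg (by positivity)]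
      linarith)
    (fun U hU hUo => by
      rw [setLIntegral_const]
      refine (hvol U (hU.trans (interior_subset.trans hKO)) hUo).trans (measure_mono ?_)
      rintro p ⟨y, hy, hp⟩
      exact ⟨y, hy, fun z hz => hp z (hOC (hKO hz))⟩)
    m (by
      refine ⟨?_, ?_⟩ <;> simp [hS, hT, hs0.le])
  have e1 : S m = 0 := by simp [hS]
  have e2 : T m = 0 := by simp [hT]
  have e3 : σ 0 = a := by simp [hσ]
  simp only [hW] at hfin
  rw [e1, e2, e3, bar_zero_right ha0.le] at hfin
  linarith

end

section

set_option maxHeartbeats 1000000 in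
/-- At a boundary point, a function whose Monge–Ampère measure blows up like the inverse square of the
distance to the circle has infinite slope. -/
theorem exists_boundary_slope {v φ f : ℂ → ℝ} {K : NNReal} {m : ℝ} (hφ : LipschitzWith K φ)
    (hv : ContinuousOn v (closedBall 0 1)) (hvφ : ∀ y ∈ sphere (0 : ℂ) 1, v y = φ y)
    (hf : ContinuousOn f (ball 0 1)) (hm : 0 < m)
    (hfm : ∀ z ∈ ball (0 : ℂ) 1, m / (1 - ‖z‖ ^ 2) ^ 2 ≤ f z)
    (hvol : ∀ U ⊆ ball (0 : ℂ) 1, IsOpen U → ∫⁻ z in U, ENNReal.ofReal (f z) ≤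
      volume {p | ∃ y ∈ U, ∀ z ∈ closedBall 0 1, v y + inner ℝ p (z - y) ≤ v z})
    {y₀ : ℂ} (hy₀ : y₀ ∈ sphere (0 : ℂ) 1) :
    ∃ a B : ℝ, 0 < a ∧ ∀ s ∈ Ioc (0 : ℝ) 1, v ((1 - s) • y₀) ≤ v y₀ + B * s - a * √s := by
  have hy1 := mem_sphere_zero_iff_norm.1 hy₀
  set e := -y₀ with he'
  have he : ‖e‖ = 1 := by rw [he', norm_neg, hy1]
  clear_value e
  have hy0e : y₀ = -e := by rw [he', neg_neg]
  set τ := √(m / 2) with hτ'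
  have hτ : 0 < τ := Real.sqrt_pos.2 (by positivity)
  have hτ2 : τ ^ 2 = m / 2 := Real.sq_sqrt (by positivity)
  set q : ℝ := 2 * K + 1 with hq
  set a := 1 / cosh (q / τ) with ha
  have ha0 : 0 < a := one_div_pos.2 (cosh_pos _)
  have ha1 : a ≤ 1 := by rw [ha, div_le_one (cosh_pos _)]; exact one_le_cosh _
  have haq : a * cosh (q / τ) = 1 := by rw [ha, div_mul_cancel₀ _ (cosh_pos _).ne']
  clear_value a
  set B : ℝ := 2 * K + 2 with hB
  set S : ℂ → ℝ := fun z => inner ℝ e (z - y₀) with hS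
  set T : ℂ → ℝ := fun z => inner ℝ (Complex.I * e) (z - y₀) with hT
  have hSc : Continuous S := continuous_const.inner (continuous_id.sub continuous_const)
  have hTc : Continuous T := continuous_const.inner (continuous_id.sub continuous_const)
  have hee : inner ℝ e e = (1 : ℝ) := by rw [real_inner_self_eq_norm_sq, he]; norm_num
  have hIe : inner ℝ (Complex.I * e) e = (0 : ℝ) := by simp [Complex.inner]; ring
  have hS1 : ∀ z, S z = 1 + inner ℝ e z := fun z => by
    simp only [hS, hy0e]
    rw [sub_neg_eq_add, inner_add_right, hee, add_comm]
  have hST : ∀ z, T z ^ 2 = ‖z‖ ^ 2 - (1 - S z) ^ 2 := fun z => by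
    have h1 := frame_sq he z
    have h2 : T z = inner ℝ (Complex.I * e) z := by
      simp only [hT, hy0e]
      rw [sub_neg_eq_add, inner_add_right, hIe, add_zero]
    rw [h2, hS1]; linarith
  have hSz : ∀ z, 1 - ‖z‖ ≤ S z := fun z => by
    have h1 := abs_le.1 (abs_real_inner_le_norm e z)
    rw [he, one_mul] at h1
    rw [hS1]; linarith
  have hS0 : ∀ z ∈ closedBall (0 : ℂ) 1, 0 ≤ S z := fun z hz => by
    have := mem_closedBall_zero_iff.1 hz
    linarith [hSz z]
  have hT2 : ∀ z ∈ closedBall (0 : ℂ) 1, T z ^ 2 ≤ 2 * S z := fun z hz => by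
    have := mem_closedBall_zero_iff.1 hz
    rw [hST]
    nlinarith [norm_nonneg z, sq_nonneg (S z)]
  have hT0 : ∀ z ∈ closedBall (0 : ℂ) 1, S z = 0 → T z = 0 := fun z hz h => by
    have := hT2 z hz
    rw [h, mul_zero] at this
    exact pow_eq_zero_iff two_ne_zero |>.1 (le_antisymm this (sq_nonneg _))
  set σ : ℝ → ℝ := fun s => a * √s with hσ
  have hσp : ∀ {s}, 0 < s → 0 < σ s := fun hs => mul_pos ha0 (Real.sqrt_pos.2 hs)
  have hd1 : ∀ s, 0 < s → HasDerivAt σ (a / (2 * √s)) s := fun s hs => by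
    refine ((Real.hasDerivAt_sqrt hs.ne').const_mul a).congr_deriv ?_
    ring
  have hd2 : ∀ s, 0 < s → HasDerivAt (fun s => a / (2 * √s)) (-(σ s) / (4 * s ^ 2)) s := fun s hs => by
    have h1 := ((Real.hasDerivAt_sqrt hs.ne').const_mul 2)
    have h2 := (Real.sqrt_pos.2 hs).ne'
    refine ((hasDerivAt_const s a).fun_div h1 (by positivity)).congr_deriv ?_
    have h3 : √s ^ 2 = s := Real.sq_sqrt hs.le
    simp only [hσ]
    rw [show (4 : ℝ) * s ^ 2 = 4 * (√s ^ 2) ^ 2 by rw [h3]]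
    field_simp
    ring
  have hbz : ∀ z ∈ closedBall (0 : ℂ) 1, S z = 0 → bar τ (σ (S z)) (T z) = 0 := fun z hz h => by
    rw [hT0 z hz h, h]
    simp [hσ, bar]
  have hbc : ContinuousOn (fun z => bar τ (σ (S z)) (T z)) (closedBall 0 1) := by
    intro z hz
    rcases (hS0 z hz).lt_or_eq with h | h
    · exact (hasFDerivAt_bar (τ := τ) (σ₁ := fun s => a / (2 * √s)) (hσp h)
        (hd1 _ h)).continuousAt.continuousWithinAt
    · rw [ContinuousWithinAt, hbz z hz h.symm]
      have hc : Continuous fun z => √(S z) := hSc.sqrt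
      have t1 : Tendsto (fun z => -(a * √(S z))) (𝓝[closedBall 0 1] z) (𝓝 0) := by
        have h1 : Continuous fun z => -(a * √(S z)) := (continuous_const.mul hc).neg
        exact (h1.tendsto' z 0 (by rw [← h]; simp)).mono_left nhdsWithin_le_nhds
      have t2 : Tendsto (fun z => 2 * τ ^ 2 / a * √(S z)) (𝓝[closedBall 0 1] z) (𝓝 0) := by
        have h1 : Continuous fun z => 2 * τ ^ 2 / a * √(S z) := continuous_const.mul hc
        exact (h1.tendsto' z 0 (by rw [← h]; simp)).mono_left nhdsWithin_le_nhds
      refine tendsto_of_tendsto_of_tendsto_of_le_of_le' t1 t2 ?_ ?_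
      · filter_upwards [self_mem_nhdsWithin] with x hx
        rcases (hS0 x hx).lt_or_eq with h1 | h1
        · have := bar_ge hτ (hσp h1) 0 (T x)
          simpa [hσ] using this
        · rw [hbz x hx h1.symm, ← h1]; simp
      · filter_upwards [self_mem_nhdsWithin] with x hx
        rcases (hS0 x hx).lt_or_eq with h1 | h1
        · refine (bar_le (hσp h1) (T x)).trans ?_
          have h2 := Real.sqrt_pos.2 h1
          have h3 := Real.sq_sqrt h1.le
          simp only [hσ]
          rw [div_le_iff₀ (by positivity),
            show 2 * τ ^ 2 / a * √(S x) * (a * √(S x)) = τ ^ 2 * (2 * √(S x) ^ 2) by field_simp, h3, mul_pow]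
          exact mul_le_mul_of_nonneg_left (hT2 x hx) (sq_nonneg _)
        · rw [hbz x hx h1.symm, ← h1]; simp
  have hi : interior (closedBall (0 : ℂ) 1) = ball 0 1 := interior_closedBall _ one_ne_zero
  have hSb : ∀ z ∈ ball (0 : ℂ) 1, 0 < S z := fun z hz => by
    have := mem_ball_zero_iff.1 hz
    linarith [hSz z]
  have hmain : ∀ ε : ℝ, 0 < ε → ∀ z ∈ closedBall (0 : ℂ) 1,
      v z ≤ bar τ (σ (S z)) (T z) + (φ y₀ + ε + B * S z) := by
    intro ε hε
    have hL2 : ∀ z, ∃ L : ℂ →L[ℝ] ℂ, z ∈ ball (0 : ℂ) 1 →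
        HasFDerivAt (fun z => gradBar τ σ (fun s => a / (2 * √s)) e y₀ z + B • e) L z ∧
          L.det = τ ^ 2 / (4 * S z ^ 2) := by
      intro z
      by_cases hz : z ∈ ball (0 : ℂ) 1
      · obtain ⟨L, h1, h2⟩ := hasFDerivAt_gradBar (τ := τ) (σ₁ := fun s => a / (2 * √s)) he
          (hσp (hSb z hz)) (hd1 _ (hSb z hz)) (hd2 _ (hSb z hz))
        refine ⟨L, fun _ => ⟨h1.add_const _, ?_⟩⟩
        rw [h2]
        have h3 := (hσp (hSb z hz)).ne'
        have h4 := (hSb z hz).ne'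
        simp only [hS] at h3 h4 ⊢
        field_simp
      · exact ⟨0, fun h => absurd h hz⟩
    choose G' hG' using hL2
    refine le_of_det_le (μ := volume) (f := f) (θ := 1 / 2) (isCompact_closedBall 0 1) hv
      (hbc.add (by fun_prop)) ?_ (G := fun z => gradBar τ σ (fun s => a / (2 * √s)) e y₀ z + B • e)
      (G' := G') ?_ ?_ ?_ ?_ (by norm_num) (by norm_num) ?_ ?_
    · intro z hz hzi
      rw [hi, mem_ball_zero_iff, not_lt] at hzi
      have hz1 : ‖z‖ = 1 := le_antisymm (mem_closedBall_zero_iff.1 hz) hzi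
      rw [hvφ z (mem_sphere_zero_iff_norm.2 hz1)]
      have h0 := hS0 z hz
      have h1 := hφ.dist_le_mul z y₀
      have h2 : dist z y₀ ^ 2 = 2 * S z := by
        rw [dist_eq_norm, norm_sub_sq_real, hz1, hy1, hS1, hy0e, inner_neg_right, real_inner_comm]; ring
      have hT' := hST z
      rw [hz1] at hT'
      rw [Real.dist_eq] at h1
      have h3 := (le_abs_self _).trans h1
      have hd0 : 0 ≤ dist z y₀ := dist_nonneg
      have hK := K.coe_nonneg
      rcases h0.lt_or_eq with hp | hp
      · have hr := Real.sqrt_pos.2 hp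
        have hr2 := Real.sq_sqrt hp.le
        rcases le_total (S z) 1 with hle | hle
        · have h4 := bar_ge_abs hτ (hσp hp) q (T z)
          rw [show σ (S z) * cosh (q / τ) = a * cosh (q / τ) * √(S z) by simp only [hσ]; ring, haq,
            one_mul] at h4
          have h5 : √(S z) ≤ |T z| := Real.sqrt_le_iff.2 ⟨abs_nonneg _, by rw [sq_abs, hT']; nlinarith⟩
          have h6 : dist z y₀ ≤ 2 * √(S z) := by
            refine abs_le_of_sq_le_sq' ?_ (by positivity) |>.2
            rw [h2, mul_pow, hr2]; linarith
          have h7 : q * √(S z) ≤ q * |T z| := mul_le_mul_of_nonneg_left h5 (by positivity)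
          have h8 := mul_le_mul_of_nonneg_left h6 hK
          have h9 : 0 ≤ B * S z := by positivity
          have h10 : q * √(S z) - √(S z) = K * (2 * √(S z)) := by rw [hq]; ring
          linarith
        · have h4 := bar_ge hτ (hσp hp) 0 (T z)
          rw [zero_mul, zero_div, cosh_zero, mul_one] at h4
          have hS2 : S z ≤ 2 := by nlinarith [sq_nonneg (T z)]
          have h5 : σ (S z) ≤ 2 := by
            simp only [hσ]
            have : √(S z) ≤ 2 := Real.sqrt_le_iff.2 ⟨by norm_num, by linarith⟩
            nlinarith
          have h6 : dist z y₀ ≤ 2 := abs_le_of_sq_le_sq' (by rw [h2]; linarith) (by norm_num) |>.2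
          have h7 : B ≤ B * S z := by nlinarith
          have h8 := mul_le_mul_of_nonneg_left h6 hK
          linarith
      · rw [hbz z hz hp.symm, ← hp]
        rw [← hp, mul_zero] at h2
        rw [pow_eq_zero_iff two_ne_zero] at h2
        rw [h2] at h3
        linarith
    · intro z hz _
      rw [hi] at hz
      refine ((hasFDerivAt_bar (τ := τ) (σ₁ := fun s => a / (2 * √s)) (hσp (hSb z hz))
        (hd1 _ (hSb z hz))).fun_add
        (((hasFDerivAt_inner_sub e y₀ z).const_mul B).const_add _)).congr_fderiv ?_
      rw [map_add, map_smul]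
    · intro z hz _
      rw [hi] at hz
      exact (hG' z hz).1
    · rwa [hi]
    · intro z hz
      rw [hi] at hz
      have := one_sub_sq_pos hz
      exact lt_of_lt_of_le (by positivity) (hfm z hz)
    · intro z hz _
      rw [hi] at hz
      have hp := hSb z hz
      have h1 := one_sub_sq_pos hz
      rw [(hG' z hz).2, abs_of_nonneg (by positivity), hτ2]
      have h2 : 1 - ‖z‖ ^ 2 ≤ 2 * S z := by nlinarith [hSz z, norm_nonneg z, mem_ball_zero_iff.1 hz]
      have h3 : m / (2 * S z) ^ 2 ≤ m / (1 - ‖z‖ ^ 2) ^ 2 := by gcongr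
      have h4 := hfm z hz
      have h5 : m / 2 / (4 * S z ^ 2) = 1 / 2 * (m / (2 * S z) ^ 2) := by field_simp; norm_num
      rw [h5]
      linarith
    · rwa [hi]
  refine ⟨a, B, ha0, fun s hs => le_of_forall_pos_le_add fun ε hε => ?_⟩
  have h1 := hmain ε hε ((1 - s) • y₀) (by
    rw [mem_closedBall_zero_iff, norm_smul, hy1, mul_one, Real.norm_eq_abs, abs_of_nonneg (by linarith [hs.2])]
    linarith [hs.1])
  have e0 : (1 - s) • y₀ - y₀ = s • e := by
    rw [hy0e, sub_smul, one_smul]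
    simp
  have e1 : S ((1 - s) • y₀) = s := by
    simp only [hS]
    rw [e0, real_inner_smul_right, hee, mul_one]
  have e2 : T ((1 - s) • y₀) = 0 := by
    simp only [hT]
    rw [e0, real_inner_smul_right, hIe, mul_zero]
  rw [e1, e2, bar_zero_right (hσp hs.1).le] at h1
  rw [hvφ y₀ hy₀]
  simp only [hσ] at h1
  linarith

/-- Hence the function has no subgradient at boundary points. -/
lemma not_subgradient_of_slope {v : ℂ → ℝ} {y₀ p : ℂ} (hy₀ : y₀ ∈ sphere (0 : ℂ) 1)
    (h : ∃ a B : ℝ, 0 < a ∧ ∀ s ∈ Ioc (0 : ℝ) 1, v ((1 - s) • y₀) ≤ v y₀ + B * s - a * √s) :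
    ¬ ∀ z ∈ closedBall (0 : ℂ) 1, v y₀ + inner ℝ p (z - y₀) ≤ v z := by
  intro hp
  obtain ⟨a, B, ha, hs⟩ := h
  have hy1 := mem_sphere_zero_iff_norm.1 hy₀
  set D := B + inner ℝ p y₀ with hD
  set r := a / (a + |D| + 1) with hr
  have hden : 0 < a + |D| + 1 := by positivity
  have hr0 : 0 < r := by positivity
  have hr1 : r ≤ 1 := by rw [hr, div_le_one hden]; linarith [abs_nonneg D]
  have hra : r * (a + |D| + 1) = a := by rw [hr]; field_simp
  have hmem : r ^ 2 ∈ Ioc (0 : ℝ) 1 := ⟨by positivity, pow_le_one₀ hr0.le hr1⟩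
  have h1 := hs _ hmem
  rw [Real.sqrt_sq hr0.le] at h1
  have h2 := hp ((1 - r ^ 2) • y₀) (by
    rw [mem_closedBall_zero_iff, norm_smul, hy1, mul_one, Real.norm_eq_abs,
      abs_of_nonneg (by linarith [hmem.2])]
    linarith [hmem.1])
  rw [inner_sub_right, real_inner_smul_right] at h2
  have h3 : r * a ≤ r * (r * D) := by rw [hD]; nlinarith
  have h4 := le_of_mul_le_mul_left h3 hr0
  have h5 : r * D ≤ r * |D| := mul_le_mul_of_nonneg_left (le_abs_self D) hr0.le
  nlinarith

end

section

lemma Sub1.convexOn {u : ℂ → ℝ} (hu : Sub1 u) {O : Set ℂ} (hO : Convex ℝ O) : ConvexOn ℝ O u := by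
  refine ⟨hO, fun x _ x' _ a b ha hb hab => ?_⟩
  obtain ⟨y, -, hs⟩ := hu (a • x + b • x')
  have h1 := mul_le_mul_of_nonneg_left (hs x) ha
  have h2 := mul_le_mul_of_nonneg_left (hs x') hb
  have h3 : a * inner ℝ y (x - (a • x + b • x')) + b * inner ℝ y (x' - (a • x + b • x')) = 0 := by
    rw [← real_inner_smul_right, ← real_inner_smul_right, ← inner_add_right]
    obtain rfl : b = 1 - a := by linarith
    convert inner_zero_right y using 2
    module
  rw [smul_eq_mul, smul_eq_mul]
  have h4 : u (a • x + b • x') = a * u (a • x + b • x') + b * u (a • x + b • x') := by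
    rw [← add_mul, hab, one_mul]
  linarith

/-- A strictly convex function has a given subgradient at no more than one point. -/
lemma eq_of_subgradient {u : ℂ → ℝ} {O C : Set ℂ} {p x x' : ℂ} (hs : StrictConvexOn ℝ O u) (hOC : O ⊆ C)
    (hx : x ∈ O) (hx' : x' ∈ O) (h : ∀ z ∈ C, u x + inner ℝ p (z - x) ≤ u z)
    (h' : ∀ z ∈ C, u x' + inner ℝ p (z - x') ≤ u z) : x = x' := by
  by_contra hne
  have h2 : (0 : ℝ) < 1 / 2 := by norm_num
  have h3 : (1 / 2 + 1 / 2 : ℝ) = 1 := by norm_num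
  have h4 := hs.2 hx hx' hne h2 h2 h3
  have hm := hOC (hs.1 hx hx' h2.le h2.le h3)
  have h5 := h _ hm
  have h6 := h' _ hm
  simp only [inner_sub_right, inner_add_right, real_inner_smul_right, smul_eq_mul] at h4 h5 h6
  linarith

/-- Uniqueness of limits along a closed relation gives continuity. -/
lemma continuousAt_of_isClosed_rel {r : ℂ → ℂ → Prop} (hr : IsClosed {p : ℂ × ℂ | r p.1 p.2}) {S : ℂ → ℂ}
    {x : ℂ} {R : ℝ} (hS : ∀ᶠ x' in 𝓝 x, S x' ∈ closedBall 0 R ∧ r x' (S x'))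
    (huniq : ∀ y, r x y → y = S x) : ContinuousAt S x := by
  refine tendsto_of_subseq_tendsto fun ns hns => ?_
  obtain ⟨N, hN⟩ := eventually_atTop.1 (hns.eventually hS)
  obtain ⟨y, -, θ, hθ, hy⟩ := (isCompact_closedBall (0 : ℂ) R).tendsto_subseq
    (x := fun k => S (ns (k + N))) fun k => (hN _ (Nat.le_add_left _ _)).1
  have ht : Tendsto (fun k => θ k + N) atTop atTop := tendsto_atTop_mono (fun k => Nat.le_add_right _ _) hθ.tendsto_atTop
  have h1 : r x y := hr.mem_of_tendsto ((hns.comp ht).prodMk_nhds hy)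
    (Eventually.of_forall fun k => (hN _ (Nat.le_add_left _ _)).2)
  exact ⟨fun k => θ k + N, huniq y h1 ▸ hy⟩

lemma isClosed_subAt {u : ℂ → ℝ} (hu : Continuous u) : IsClosed {p : ℂ × ℂ | SubAt u p.1 p.2} := by
  simp only [SubAt, Set.ofPred_forall]
  exact isClosed_iInter fun x' => isClosed_le
    ((hu.comp continuous_fst).add (continuous_snd.inner (continuous_const.sub continuous_fst))) continuous_const

/-- A continuous selection of subgradients is the derivative. -/
lemma hasFDerivAt_of_subgradient {v : ℂ → ℝ} {g : ℂ → ℂ} {O : Set ℂ} {y : ℂ} (hO : O ∈ 𝓝 y)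
    (h : ∀ y ∈ O, ∀ z ∈ O, v y + inner ℝ (g y) (z - y) ≤ v z) (hg : ContinuousAt g y) :
    HasFDerivAt v (innerSL ℝ (g y)) y := by
  rw [hasFDerivAt_iff_isLittleO, Asymptotics.isLittleO_iff]
  intro c hc
  filter_upwards [hO, hg.eventually (ball_mem_nhds _ hc)] with z hz hzc
  have h1 := h y (mem_of_mem_nhds hO) z hz
  have h2 := h z hz y (mem_of_mem_nhds hO)
  have h3 := real_inner_le_norm (g z - g y) (z - y)
  have h4 := mul_le_mul_of_nonneg_right (mem_ball_iff_norm.1 hzc).le (norm_nonneg (z - y))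
  rw [← neg_sub z y, inner_neg_right] at h2
  rw [inner_sub_left] at h3
  rw [innerSL_apply_apply, Real.norm_eq_abs, abs_of_nonneg (by linarith)]
  linarith

lemma volume_le_volume_image {f : ℂ → ℝ} {S : ℂ → ℂ} {W U : Set ℂ} {c : ℝ} (hc : 0 < c) (hW : IsOpen W)
    (hf : ∀ y ∈ W, f y ≤ c) (hS : S '' U ⊆ W)
    (hP : ∀ V ⊆ W, IsOpen V → volume (S ⁻¹' V) = ∫⁻ y in V, ENNReal.ofReal (f y)) :
    ENNReal.ofReal (1 / c) * volume U ≤ volume (S '' U) := by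
  refine le_of_forall_gt fun r hr => ?_
  obtain ⟨V, hV, hVo, hVr⟩ := Set.exists_isOpen_lt_of_lt _ _ hr
  refine lt_of_le_of_lt ?_ hVr
  have h1 : volume U ≤ ENNReal.ofReal c * volume V := by
    calc volume U ≤ volume (S ⁻¹' (V ∩ W)) := measure_mono fun x hx =>
          ⟨hV (mem_image_of_mem S hx), hS (mem_image_of_mem S hx)⟩
      _ = ∫⁻ y in V ∩ W, ENNReal.ofReal (f y) := hP _ inter_subset_right (hVo.inter hW)
      _ ≤ ∫⁻ _ in V ∩ W, ENNReal.ofReal c := setLIntegral_mono measurable_const fun y hy =>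
          ENNReal.ofReal_le_ofReal (hf y hy.2)
      _ = ENNReal.ofReal c * volume (V ∩ W) := by rw [setLIntegral_const]
      _ ≤ _ := by gcongr; exact inter_subset_left
  calc ENNReal.ofReal (1 / c) * volume U ≤ ENNReal.ofReal (1 / c) * (ENNReal.ofReal c * volume V) := by gcongr
    _ = volume V := by
      rw [← mul_assoc, ← ENNReal.ofReal_mul (by positivity), one_div_mul_cancel hc.ne', ENNReal.ofReal_one,
        one_mul]

/-- The Legendre transform of a weak solution is a generalized solution. -/
theorem exists_genSol {u f : ℂ → ℝ} {M : ℝ} (hu : Sub1 u) (hl : ∀ x, ‖x‖ - M ≤ u x)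
    (hint : ∀ x, ∀ y ∈ closedBall (0 : ℂ) 1, SubAt u x y → y ∈ ball (0 : ℂ) 1)
    (hs : StrictConvexOn ℝ (ball 0 1) (conj u)) (hf : ContDiffOn ℝ ∞ f (ball 0 1))
    (hf0 : ∀ y ∈ ball (0 : ℂ) 1, 0 < f y) (hP : ∀ V ⊆ ball (0 : ℂ) 1, IsOpen V →
      volume (gradient u ⁻¹' V) = ∫⁻ y in V, ENNReal.ofReal (f y)) :
    ∃ g, GenSol (conj u) f g (ball 0 1) ∧ g '' ball 0 1 = univ := by
  have hcl := isClosed_subAt hu.lipschitz.continuous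
  choose S hS1 hS using hu
  have hSb : ∀ x, S x ∈ ball (0 : ℂ) 1 := fun x => hint x _ (hS1 x) (hS x)
  have hSu : ∀ x, ∀ y ∈ closedBall (0 : ℂ) 1, SubAt u x y → y = S x := fun x y hy h =>
    eq_of_subgradient hs ball_subset_closedBall (hint x y hy h) (hSb x) (h.dual hl hy)
      ((hS x).dual hl (hS1 x))
  have hSc : Continuous S := continuous_iff_continuousAt.2 fun x =>
    continuousAt_of_isClosed_rel (r := fun x y => y ∈ closedBall (0 : ℂ) 1 ∧ SubAt u x y)
      ((isClosed_closedBall.preimage continuous_snd).inter hcl)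
      (Eventually.of_forall fun x => ⟨hS1 x, hS1 x, hS x⟩) fun y h => hSu x y h.1 h.2
  have hgrad : gradient u = S := funext fun x => by
    have := hasFDerivAt_of_subgradient (v := u) univ_mem (fun y _ z _ => hS y z) (hSc.continuousAt (x := x))
    exact ((hS x).eq_gradient this.differentiableAt).symm
  rw [hgrad] at hP
  have hus : ∀ R : ℝ, 0 < R → StrictConvexOn ℝ (ball 0 R) u := by
    intro R hR
    obtain ⟨x₀, -, hx₀⟩ := (isCompact_closedBall (0 : ℂ) R).exists_isMaxOn ⟨0, by simp [hR.le]⟩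
      (hSc.norm).continuousOn
    obtain ⟨ρ, h1, h2⟩ := exists_between (mem_ball_zero_iff.1 (hSb x₀))
    have hρ : closedBall (0 : ℂ) ρ ⊆ ball 0 1 := closedBall_subset_ball h2
    obtain ⟨c, hc⟩ := (isCompact_closedBall (0 : ℂ) ρ).exists_bound_of_continuousOn (hf.continuousOn.mono hρ)
    have hc0 : 0 < max c 1 := by positivity
    refine strictConvexOn_of_volume (c := 1 / max c 1) isOpen_ball (subset_univ _)
      (Sub1.convexOn (fun x => ⟨S x, hS1 x, hS x⟩) (convex_ball _ _)) (by positivity) fun U hU _ => ?_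
    refine (volume_le_volume_image (f := f) (S := S) (W := ball 0 ρ) hc0 isOpen_ball (fun y hy =>
      (le_abs_self _).trans ((hc y (ball_subset_closedBall hy)).trans (le_max_left _ _))) ?_ fun V hV =>
        hP V (hV.trans (ball_subset_closedBall.trans hρ))).trans (measure_mono ?_)
    · rintro _ ⟨x, hx, rfl⟩
      exact mem_ball_zero_iff.2 ((hx₀ (ball_subset_closedBall (hU hx))).trans_lt h1)
    · rintro _ ⟨x, hx, rfl⟩
      exact ⟨x, hx, fun z _ => hS x z⟩
  have huniq : ∀ x x' y, SubAt u x y → SubAt u x' y → x = x' := fun x x' y h h' =>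
    eq_of_subgradient (hus (max ‖x‖ ‖x'‖ + 1) (by positivity)) (subset_univ _)
      (mem_ball_zero_iff.2 (by linarith [le_max_left ‖x‖ ‖x'‖]))
      (mem_ball_zero_iff.2 (by linarith [le_max_right ‖x‖ ‖x'‖])) (fun z _ => h z) fun z _ => h' z
  have huc : Continuous u := (Sub1.lipschitz fun x => ⟨S x, hS1 x, hS x⟩).continuous
  have hex : ∀ y, ∃ x, y ∈ ball (0 : ℂ) 1 → SubAt u x y := by
    intro y
    by_cases hy : y ∈ ball (0 : ℂ) 1
    · have hy' := mem_ball_zero_iff.1 hy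
      obtain ⟨x, hx⟩ := (huc.sub (continuous_const.inner continuous_id :
          Continuous fun x => inner ℝ y x)).exists_forall_le (tendsto_atTop_mono
          (f := fun x => (1 - ‖y‖) * ‖x‖ + -M) (fun x => by
            have h1 := real_inner_le_norm y x
            have h2 := hl x
            simp only [Pi.sub_apply]
            linarith)
          (tendsto_atTop_add_const_right _ _
            (tendsto_norm_cocompact_atTop.const_mul_atTop (by linarith : 0 < 1 - ‖y‖))))
      refine ⟨x, fun _ x' => ?_⟩
      have := hx x'
      simp only [Pi.sub_apply] at this
      rw [inner_sub_right]
      linarith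
    · exact ⟨0, fun h => absurd h hy⟩
  choose g hg using hex
  have hgS : ∀ x, g (S x) = x := fun x => huniq _ _ _ (hg _ (hSb x)) (hS x)
  have hSg : ∀ y ∈ ball (0 : ℂ) 1, S (g y) = y := fun y hy => (hSu _ _ (ball_subset_closedBall hy) (hg y hy)).symm
  have himg : ∀ U ⊆ ball (0 : ℂ) 1, g '' U = S ⁻¹' U := by
    intro U hU
    ext x
    constructor
    · rintro ⟨y, hy, rfl⟩
      rwa [mem_preimage, hSg y (hU hy)]
    · exact fun hx => ⟨S x, hx, hgS x⟩
  have hgc : ∀ y ∈ ball (0 : ℂ) 1, ContinuousAt g y := by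
    intro y hy
    obtain ⟨ρ, h1, h2⟩ := exists_between (mem_ball_zero_iff.1 hy)
    refine continuousAt_of_isClosed_rel (r := fun y x => SubAt u x y) (R := (M + u 0) / (1 - ρ))
      (hcl.preimage continuous_swap) ?_ fun x hx => huniq _ _ _ hx (hg y hy)
    filter_upwards [isOpen_ball.mem_nhds (mem_ball_zero_iff.2 h1)] with z hz
    have hz1 := mem_ball_zero_iff.1 hz
    have h3 := hg z (mem_ball_zero_iff.2 (hz1.trans h2))
    refine ⟨?_, h3⟩
    have h4 := h3 0
    have h5 := real_inner_le_norm z (g z)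
    have h6 := mul_le_mul_of_nonneg_right hz1.le (norm_nonneg (g z))
    rw [zero_sub, inner_neg_right] at h4
    rw [mem_closedBall_zero_iff, le_div_iff₀ (by linarith)]
    linarith [hl (g z)]
  refine ⟨g, ⟨isOpen_ball, hs, fun y hy => ?_, fun y hy => (hgc y hy).continuousWithinAt, hf, hf0,
    fun U hU hUo => ?_⟩, ?_⟩
  · refine (hasFDerivAt_of_subgradient (isOpen_ball.mem_nhds hy) (fun y hy z hz =>
      (hg y hy).dual hl (ball_subset_closedBall hy) z (ball_subset_closedBall hz)) (hgc y hy)).congr_fderiv ?_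
    ext z
    simp [lin_apply, Complex.inner, mul_comm]
  · rw [himg U hU, hP U hU hUo]
  · rw [himg _ subset_rfl]
    exact eq_univ_of_forall hSb

end

section

/-- The boundary value problem on the unit ball of an inner product space. -/
structure IsBallSolution {E : Type*} [NormedAddCommGroup E] [InnerProductSpace ℝ E] [CompleteSpace E]
    (η φ v : E → ℝ) : Prop where
  cont : ContinuousOn v (closedBall 0 1)
  smooth : ContDiffOn ℝ ∞ v (ball 0 1)
  strict : StrictConvexOn ℝ (ball 0 1) v
  det : ∀ y ∈ ball (0 : E) 1, (fderiv ℝ (gradient v) y).det = 1 / (η y * (1 - ‖y‖ ^ 2) ^ 2)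
  boundary : ∀ y ∈ sphere (0 : E) 1, v y = φ y
  surj : gradient v '' ball 0 1 = univ

/-- Existence on the complex unit disc. -/
theorem exists_solution {η φ : ℂ → ℝ} {K : NNReal} (hφ : LipschitzWith K φ)
    (hηc : ContinuousOn η (closedBall 0 1)) (hη0 : ∀ y ∈ closedBall (0 : ℂ) 1, 0 < η y)
    (hηs : ContDiffOn ℝ ∞ η (ball 0 1)) :
    ∃ v, IsBallSolution η φ v := by
  have hne : (closedBall (0 : ℂ) 1).Nonempty := ⟨0, by simp⟩
  obtain ⟨z₁, hz₁, hmin⟩ := (isCompact_closedBall (0 : ℂ) 1).exists_isMinOn hne hηc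
  obtain ⟨z₂, hz₂, hmax⟩ := (isCompact_closedBall (0 : ℂ) 1).exists_isMaxOn hne hηc
  have hb := hη0 z₁ hz₁
  have hB := hη0 z₂ hz₂
  obtain ⟨M, hM⟩ := (isCompact_sphere (0 : ℂ) 1).exists_bound_of_continuousOn hφ.continuous.continuousOn
  obtain ⟨h, H⟩ := exists_isSupport hφ.continuous
  set f : ℂ → ℝ := fun y => 1 / (η y * (1 - ‖y‖ ^ 2) ^ 2) with hf
  have hd : ∀ y ∈ ball (0 : ℂ) 1, 0 < η y * (1 - ‖y‖ ^ 2) ^ 2 := fun y hy => by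
    have h1 := one_sub_sq_pos hy
    have h2 := hη0 y (ball_subset_closedBall hy)
    positivity
  have hf0 : ∀ y ∈ ball (0 : ℂ) 1, 0 < f y := fun y hy => one_div_pos.2 (hd y hy)
  have hfs : ContDiffOn ℝ ∞ f (ball 0 1) := contDiffOn_const.div
    (hηs.mul (((contDiff_const.sub (contDiff_norm_sq ℝ)).pow 2).contDiffOn)) fun y hy => (hd y hy).ne'
  have hfB : ∀ y ∈ ball (0 : ℂ) 1, 1 / η z₂ / (1 - ‖y‖ ^ 2) ^ 2 ≤ f y := fun y hy => by
    have h1 := one_sub_sq_pos hy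
    rw [div_div]
    exact one_div_le_one_div_of_le (hd y hy)
      (mul_le_mul_of_nonneg_right (hmax (ball_subset_closedBall hy)) (by positivity))
  set ν : Measure ℂ := (volume.restrict (ball 0 1)).withDensity fun y => ENNReal.ofReal (f y) with hν
  have hνO : ∀ O ⊆ ball (0 : ℂ) 1, MeasurableSet O → ν O = ∫⁻ y in O, ENNReal.ofReal (f y) :=
    fun O hO hOm => by rw [hν, withDensity_apply _ hOm, Measure.restrict_restrict hOm, inter_eq_left.2 hO]
  obtain ⟨u, hu, hh, hP, hbar⟩ := exists_weak_solution (a := √(2 / η z₁)) (ν := ν) hφ H hM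
    (Real.sqrt_pos.2 (by positivity)) fun O hO hOm => by
      rw [hνO O hO hOm, Real.sq_sqrt (by positivity),
        ← lintegral_const_mul' _ _ ENNReal.ofNat_ne_top]
      refine setLIntegral_mono' hOm fun y hy => ?_
      have h1 := one_sub_sq_pos (hO hy)
      rw [show (2 : ENNReal) = ENNReal.ofReal 2 by simp, ← ENNReal.ofReal_mul (by norm_num)]
      refine ENNReal.ofReal_le_ofReal ?_
      rw [div_div, ← mul_one_div 2 (_ * _)]
      refine mul_le_mul_of_nonneg_left (one_div_le_one_div_of_le (by positivity)
        (mul_le_mul_of_nonneg_right (hmin (ball_subset_closedBall (hO hy))) (by positivity))) (by norm_num)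
  have hl : ∀ x, ‖x‖ - M ≤ u x := fun x => (H.lower hM x).trans (hh x)
  have hvφ : ∀ y ∈ sphere (0 : ℂ) 1, conj u y = φ y := fun y hy => conj_eq_of_mem_sphere H hl hh hbar hy
  have hvc := continuousOn_conj hφ hM hl hvφ
  have hvol : ∀ U ⊆ ball (0 : ℂ) 1, IsOpen U → ∫⁻ y in U, ENNReal.ofReal (f y) ≤
      volume {p | ∃ y ∈ U, ∀ z ∈ closedBall 0 1, conj u y + inner ℝ p (z - y) ≤ conj u z} :=
    fun U hU hUo => by
      rw [← hνO U hU hUo.measurableSet]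
      exact lintegral_le_volume_subgradient hu hl hP hUo hU
  have hint : ∀ x, ∀ y ∈ closedBall (0 : ℂ) 1, SubAt u x y → y ∈ ball (0 : ℂ) 1 := by
    intro x y hy hxy
    by_contra hyb
    have hys : y ∈ sphere (0 : ℂ) 1 := by
      rw [← closedBall_sdiff_ball]
      exact ⟨hy, hyb⟩
    exact not_subgradient_of_slope hys (exists_boundary_slope hφ hvc hvφ hfs.continuousOn
      (one_div_pos.2 hB) hfB hvol hys) (hxy.dual hl hy)
  have hs : StrictConvexOn ℝ (ball 0 1) (conj u) := by
    refine strictConvexOn_of_volume (c := 1 / η z₂) isOpen_ball ball_subset_closedBall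
      ((convexOn_conj hl).subset ball_subset_closedBall (convex_ball _ _)) (one_div_pos.2 hB)
      fun U hU hUo => le_trans ?_ (hvol U hU hUo)
    rw [← setLIntegral_const]
    refine setLIntegral_mono' hUo.measurableSet fun y hy => ENNReal.ofReal_le_ofReal ?_
    refine le_trans ?_ (hfB y (hU hy))
    have h1 := one_sub_sq_pos (hU hy)
    rw [le_div_iff₀ (by positivity)]
    refine mul_le_of_le_one_right (by positivity) (pow_le_one₀ h1.le ?_)
    linarith [sq_nonneg ‖y‖]
  obtain ⟨g, hg, hgu⟩ := exists_genSol hu hl hint hs hfs hf0 fun V hV hVo => by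
    rw [hP.volume_preimage (measurable_gradient u) hVo hV, hνO V hV hVo.measurableSet]
  have hgrad : ∀ y ∈ ball (0 : ℂ) 1, gradient (conj u) y = g y := by
    intro y hy
    rw [gradient, (hg.grad y hy).fderiv, LinearIsometryEquiv.symm_apply_eq]
    ext z
    simp [lin_apply, Complex.inner, mul_comm]
  obtain ⟨h1, -, h3⟩ := hg.regularity
  refine ⟨conj u, hvc, h1, hs, fun y hy => ?_, hvφ, by rw [image_congr hgrad, hgu]⟩
  rw [EventuallyEq.fderiv_eq (f := g) (eventually_of_mem (isOpen_ball.mem_nhds hy) hgrad), h3 y hy]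

end

section

lemma hasFDerivAt_innerSL_gradient {E : Type*} [NormedAddCommGroup E] [InnerProductSpace ℝ E]
    [CompleteSpace E] {v : E → ℝ} {y : E} (hd : DifferentiableAt ℝ v y) :
    HasFDerivAt v (innerSL ℝ (gradient v y)) y := by
  have := hd.hasGradientAt.hasFDerivAt
  exact this

lemma IsBallSolution.differentiableAt {η φ v : ℂ → ℝ} (h : IsBallSolution η φ v) {y : ℂ}
    (hy : y ∈ ball (0 : ℂ) 1) : DifferentiableAt ℝ v y ∧ DifferentiableAt ℝ (gradient v) y := by
  have h1 := h.smooth.contDiffAt (isOpen_ball.mem_nhds hy)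
  have h2 : DifferentiableAt ℝ (fderiv ℝ v) y :=
    (h1.fderiv_right (m := 1) (by norm_cast)).differentiableAt one_ne_zero
  exact ⟨h1.differentiableAt (by simp),
    (InnerProductSpace.toDual ℝ ℂ).symm.toContinuousLinearEquiv.differentiableAt.comp y h2⟩

lemma IsBallSolution.lintegral_le {η φ v : ℂ → ℝ} (h : IsBallSolution η φ v)
    (hη0 : ∀ y ∈ closedBall (0 : ℂ) 1, 0 < η y) {U : Set ℂ} (hU : U ⊆ ball 0 1) (hUo : IsOpen U) :
    ∫⁻ y in U, ENNReal.ofReal (1 / (η y * (1 - ‖y‖ ^ 2) ^ 2)) ≤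
      volume {p | ∃ y ∈ U, ∀ z ∈ closedBall 0 1, v y + inner ℝ p (z - y) ≤ v z} := by
  have hg : ∀ y ∈ ball (0 : ℂ) 1, HasFDerivAt v (innerSL ℝ (gradient v y)) y :=
    fun y hy => hasFDerivAt_innerSL_gradient (h.differentiableAt hy).1
  have hinj : InjOn (gradient v) U := by
    intro y hy z hz hyz
    by_contra hne
    have := gradient_strictMono h.strict (hU hy) (hU hz) hne (hg y (hU hy)) (hg z (hU hz))
    rw [hyz] at this
    exact lt_irrefl _ this
  have h1 := lintegral_abs_det_fderiv_eq_addHaar_image volume hUo.measurableSet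
    (fun y hy => (h.differentiableAt (hU hy)).2.hasFDerivAt.hasFDerivWithinAt) hinj
  have h2 : ∫⁻ y in U, ENNReal.ofReal (1 / (η y * (1 - ‖y‖ ^ 2) ^ 2)) = volume (gradient v '' U) := by
    rw [← h1]
    refine setLIntegral_congr_fun hUo.measurableSet fun y hy => ?_
    have h3 := hη0 y (ball_subset_closedBall (hU hy))
    rw [h.det y (hU hy), abs_of_nonneg (by positivity)]
  rw [h2]
  refine measure_mono ?_
  rintro _ ⟨y, hy, rfl⟩
  refine ⟨y, hy, ?_⟩
  have hcl : closure (ball (0 : ℂ) 1) = closedBall 0 1 := closure_ball _ one_ne_zero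
  rw [← hcl]
  refine le_on_closure (fun z hz => tangent_le h.strict.convexOn (hU hy) hz (hg y (hU hy))) ?_ ?_
  · fun_prop
  · rw [hcl]; exact h.cont

lemma IsBallSolution.le {η φ v w : ℂ → ℝ} (hηc : ContinuousOn η (closedBall 0 1))
    (hη0 : ∀ y ∈ closedBall (0 : ℂ) 1, 0 < η y) (hv : IsBallSolution η φ v) (hw : IsBallSolution η φ w) :
    ∀ z ∈ closedBall (0 : ℂ) 1, v z ≤ w z := by
  intro z hz
  obtain ⟨M, hM⟩ := (isCompact_closedBall (0 : ℂ) 1).exists_bound_of_continuousOn hv.cont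
  have hi : interior (closedBall (0 : ℂ) 1) = ball 0 1 := interior_closedBall _ one_ne_zero
  have hd : ∀ y ∈ ball (0 : ℂ) 1, 0 < η y * (1 - ‖y‖ ^ 2) ^ 2 := fun y hy => by
    have h1 := one_sub_sq_pos hy
    have h2 := hη0 y (ball_subset_closedBall hy)
    positivity
  have key : ∀ ε ∈ Ioo (0 : ℝ) 1, v z ≤ (1 - ε) * w z + ε * (M + 1) := by
    rintro ε ⟨hε0, hε1⟩
    refine le_of_det_le (μ := volume) (f := fun y => 1 / (η y * (1 - ‖y‖ ^ 2) ^ 2)) (θ := (1 - ε) ^ 2)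
      (g := v) (W := fun z => (1 - ε) * w z + ε * (M + 1)) (G := fun z => (1 - ε) • gradient w z)
      (G' := fun z => (1 - ε) • fderiv ℝ (gradient w) z) (isCompact_closedBall 0 1) hv.cont
      ((continuousOn_const.mul hw.cont).add continuousOn_const) ?_ ?_ ?_ ?_ ?_ (by positivity) (by nlinarith)
      ?_ ?_ z hz
    · intro y hy hyi
      have hys : y ∈ sphere (0 : ℂ) 1 := by
        rw [← closedBall_sdiff_ball, ← hi]
        exact ⟨hy, hyi⟩
      have h1 := (le_abs_self _).trans (hM y hy)
      rw [hv.boundary y hys] at h1 ⊢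
      rw [hw.boundary y hys]
      nlinarith
    · intro y hy _
      rw [hi] at hy
      refine (((hasFDerivAt_innerSL_gradient (hw.differentiableAt hy).1).const_mul (1 - ε)).add_const
        (ε * (M + 1))).congr_fderiv ?_
      rw [map_smul]
    · intro y hy _
      rw [hi] at hy
      exact (hw.differentiableAt hy).2.hasFDerivAt.fun_const_smul (1 - ε)
    · rw [hi]
      exact continuousOn_const.div ((hηc.mono ball_subset_closedBall).mul (by fun_prop))
        fun y hy => (hd y hy).ne'
    · intro y hy
      rw [hi] at hy
      exact one_div_pos.2 (hd y hy)
    · intro y hy _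
      rw [hi] at hy
      have h1 : ((1 - ε) • fderiv ℝ (gradient w) y).det = (1 - ε) ^ 2 * (fderiv ℝ (gradient w) y).det := by
        rw [det_clm, det_clm]
        simp
        ring
      have h2 := one_div_pos.2 (hd y hy)
      rw [h1, hw.det y hy, abs_of_nonneg (by positivity)]
    · rw [hi]
      exact fun U hU hUo => hv.lintegral_le hη0 hU hUo
  have hlim : Tendsto (fun ε : ℝ => (1 - ε) * w z + ε * (M + 1)) (𝓝[>] 0) (𝓝 (w z)) := by
    have h1 : Continuous fun ε : ℝ => (1 - ε) * w z + ε * (M + 1) := by fun_prop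
    exact (h1.tendsto' 0 (w z) (by simp)).mono_left nhdsWithin_le_nhds
  exact ge_of_tendsto hlim (eventually_of_mem (Ioo_mem_nhdsGT one_pos) key)

lemma gradient_comp_linearIsometryEquiv {E F : Type*} [NormedAddCommGroup E] [InnerProductSpace ℝ E]
    [CompleteSpace E] [NormedAddCommGroup F] [InnerProductSpace ℝ F] [CompleteSpace F] (L : E ≃ₗᵢ[ℝ] F)
    (v : F → ℝ) : gradient (v ∘ L) = L.symm ∘ gradient v ∘ L := by
  funext y
  have h1 : fderiv ℝ (v ∘ L) y = (fderiv ℝ v (L y)).comp (L : E →L[ℝ] F) :=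
    L.toContinuousLinearEquiv.comp_right_fderiv
  rw [gradient, LinearIsometryEquiv.symm_apply_eq, h1]
  ext x
  simp only [ContinuousLinearMap.comp_apply, Function.comp_apply, InnerProductSpace.toDual_apply_apply]
  rw [← LinearIsometryEquiv.inner_map_map L (L.symm _) x, LinearIsometryEquiv.apply_symm_apply,
    gradient, InnerProductSpace.toDual_symm_apply]
  rfl

/-- Solutions are transported by linear isometries. -/
lemma IsBallSolution.comp_linearIsometryEquiv {E F : Type*} [NormedAddCommGroup E] [InnerProductSpace ℝ E]
    [CompleteSpace E] [NormedAddCommGroup F] [InnerProductSpace ℝ F] [CompleteSpace F] (L : E ≃ₗᵢ[ℝ] F)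
    {η φ v : F → ℝ} (h : IsBallSolution η φ v) : IsBallSolution (η ∘ L) (φ ∘ L) (v ∘ L) := by
  have hb : ∀ y ∈ ball (0 : E) 1, L y ∈ ball (0 : F) 1 := fun y hy => by simpa using hy
  refine ⟨h.cont.comp L.continuous.continuousOn fun y hy => by simpa using hy,
    h.smooth.comp L.contDiff.contDiffOn hb, ⟨convex_ball _ _, fun x hx y hy hne a b ha hb' hab => ?_⟩,
    fun y hy => ?_, fun y hy => h.boundary _ (by simpa using hy), ?_⟩
  · simpa using h.strict.2 (hb x hx) (hb y hy) (L.injective.ne hne) ha hb' hab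
  · have h1 : fderiv ℝ (gradient (v ∘ L)) y =
        (L.symm : F →L[ℝ] E).comp ((fderiv ℝ (gradient v) (L y)).comp (L : E →L[ℝ] F)) := by
      rw [gradient_comp_linearIsometryEquiv]
      exact (L.symm.toContinuousLinearEquiv.comp_fderiv).trans
        (congrArg _ L.toContinuousLinearEquiv.comp_right_fderiv)
    rw [h1, Function.comp_apply, ← L.norm_map y, ← h.det _ (hb y hy)]
    exact LinearMap.det_conj _ L.symm.toLinearEquiv
  · rw [gradient_comp_linearIsometryEquiv, image_comp, image_comp]
    have h1 : L '' ball 0 1 = ball 0 1 := by simp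
    rw [h1, h.surj, image_univ, L.symm.surjective.range_eq]

lemma IsBallSolution.congr_boundary {η φ φ' v : ℂ → ℝ} (h : IsBallSolution η φ v)
    (hφ : ∀ y ∈ sphere (0 : ℂ) 1, φ y = φ' y) : IsBallSolution η φ' v :=
  ⟨h.cont, h.smooth, h.strict, h.det, fun y hy => (h.boundary y hy).trans (hφ y hy), h.surj⟩

lemma isMinkowskiSolution2_iff {η φ v : EuclideanSpace ℝ (Fin 2) → ℝ} :
    IsMinkowskiSolution2 (ball 0 1) η φ v ↔ IsBallSolution η φ v := by
  rw [IsMinkowskiSolution2, closure_ball _ one_ne_zero, frontier_ball _ one_ne_zero]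
  exact ⟨fun ⟨h1, h2, h3, h4, h5, h6⟩ => ⟨h1, h2, h3, h4, h5, h6⟩,
    fun ⟨h1, h2, h3, h4, h5, h6⟩ => ⟨h1, h2, h3, h4, h5, h6⟩⟩

end

end MA

/-- the Minkowski-type problem on the unit disk `Ω = B₁(0) ⊆ ℝ²`
with Lipschitz boundary data: given `η` positive, continuous on `closure Ω` and
smooth on `Ω`, and `φ` Lipschitz on `∂Ω`, there is exactly one function (on
`closure Ω`) which is continuous on `closure Ω`, smooth and strictly convex on
`Ω`, solves `det D²v = 1/(η (1-|y|²)²)` in `Ω`, equals `φ` on `∂Ω`, and whose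
gradient image `∇v(Ω)` is all of `ℝ²`. -/
theorem stmt_19 (Ω : Set (EuclideanSpace ℝ (Fin 2)))
    (hΩ : Ω = Metric.ball (0 : EuclideanSpace ℝ (Fin 2)) 1)
    (η φ : EuclideanSpace ℝ (Fin 2) → ℝ)
    (hηc : ContinuousOn η (closure Ω)) (hηpos : ∀ y ∈ closure Ω, 0 < η y)
    (hηsm : ContDiffOn ℝ (⊤ : ℕ∞) η Ω)
    (hφ : ∃ K : NNReal, LipschitzOnWith K φ (frontier Ω)) :
    ∃ v : EuclideanSpace ℝ (Fin 2) → ℝ, IsMinkowskiSolution2 Ω η φ v ∧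
      ∀ w : EuclideanSpace ℝ (Fin 2) → ℝ, IsMinkowskiSolution2 Ω η φ w →
        ∀ y ∈ closure Ω, w y = v y := by
  subst hΩ
  rw [closure_ball _ one_ne_zero] at hηc hηpos ⊢
  rw [frontier_ball _ one_ne_zero] at hφ
  obtain ⟨K, hK⟩ := hφ
  obtain ⟨ψ, hψ, hφψ⟩ := hK.extend_real
  have key := fun w => MA.isMinkowskiSolution2_iff (η := η) (φ := φ) (v := w)
  set L := Complex.orthonormalBasisOneI.repr
  have hL : ∀ y ∈ Metric.closedBall (0 : ℂ) 1, L y ∈ Metric.closedBall (0 : EuclideanSpace ℝ (Fin 2)) 1 :=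
    fun y hy => by simpa using hy
  have hc := hηc.comp L.continuous.continuousOn hL
  have hp : ∀ y ∈ Metric.closedBall (0 : ℂ) 1, 0 < (η ∘ L) y := fun y hy => hηpos _ (hL y hy)
  obtain ⟨v, hv⟩ := MA.exists_solution (hψ.comp L.lipschitz) hc hp
    (hηsm.comp L.contDiff.contDiffOn fun y hy => by simpa using hy)
  have hv' := hv.congr_boundary (φ' := φ ∘ L) fun y hy => (hφψ (by simpa using hy)).symm
  have hvE := hv'.comp_linearIsometryEquiv L.symm
  have e : ∀ f : EuclideanSpace ℝ (Fin 2) → ℝ, (f ∘ L) ∘ L.symm = f := fun f => by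
    funext y
    simp
  rw [e, e] at hvE
  refine ⟨_, (key _).2 hvE, fun w hw y hy => ?_⟩
  have hwC := ((key w).1 hw).comp_linearIsometryEquiv L
  have hy' : L.symm y ∈ Metric.closedBall (0 : ℂ) 1 := by simpa using hy
  have h1 := hwC.le hc hp hv' _ hy'
  have h2 := hv'.le hc hp hwC _ hy'
  rw [Function.comp_apply, L.apply_symm_apply] at h1 h2
  exact le_antisymm h1 h2
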